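/- Let k_2/k_1 be a finite extension of p-adic fields with residual degree f, with uniformizers π_2 of k_2 and π_1 of k_1. Then Nr_{k_2/k_1}(π_2) = π_1^f if and only if the Lubin-Tate extension k_{1,π_1} of k_1 associated with π_1 is contained in the Lubin-Tate extension k_{2,π_2} of k_2 associated with π_2. -/

import Mathlib

/-- Residue field cardinality of a `p`-adic field. -/
noncomputable def resCard (p : ℕ) [Fact p.Prime] (k : Type*) [Field k] [Algebra ℤ_[p] k] : ℕ :=
  Nat.card ((integralClosure ℤ_[p] k) ⧸ ((⊥ : Ideal (integralClosure ℤ_[p] k)).jacobson))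

/-- `π` is a uniformizer of the `p`-adic field `k`. -/
def IsUniformizer (p : ℕ) [Fact p.Prime] (k : Type*) [Field k] [Algebra ℤ_[p] k] (π : k) :
    Prop :=
  ∃ h : π ∈ integralClosure ℤ_[p] k, Irreducible (⟨π, h⟩ : integralClosure ℤ_[p] k)

/-- The Lubin-Tate extension `k_π` of a `p`-adic field `k` associated with a uniformizer
`π`, inside a fixed algebraic closure `Ω`.  By local class field theory (Artin map with
arithmetic normalization) it is the union of all finite abelian extensions `L/k` (inside
`Ω`) such that `π` is a norm from `L`; equivalently, the fixed field of `Art_k(π)` in the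
maximal abelian extension of `k`. -/
noncomputable def lubinTateExt (k Ω : Type*) [Field k] [Field Ω] [Algebra k Ω] (π : k) :
    IntermediateField k Ω :=
  ⨆ L ∈ {L : IntermediateField k Ω | FiniteDimensional k L ∧ IsGalois k L ∧
      (∀ σ τ : L ≃ₐ[k] L, σ * τ = τ * σ) ∧ ∃ x : L, Algebra.norm k x = π}, L

/-! ### Part 1 : a group acting on a normed field, relative norms -/

namespace LT

/-- The action preserves the norm. -/
class NInv (Γ Ω : Type*) [Group Γ] [NormedField Ω] [MulSemiringAction Γ Ω] : Prop where
  norm_act : ∀ (γ : Γ) (x : Ω), ‖γ • x‖ = ‖x‖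

section basic

variable {Γ Ω : Type*} [Group Γ] [NormedField Ω] [MulSemiringAction Γ Ω]

@[simp] lemma norm_act [NInv Γ Ω] (γ : Γ) (x : Ω) : ‖γ • x‖ = ‖x‖ := NInv.norm_act γ x

variable (Ω) in
/-- Fixed field of a subgroup. -/
def FF (H : Subgroup Γ) : Subfield Ω := FixedPoints.subfield H Ω

lemma mem_FF {H : Subgroup Γ} {x : Ω} : x ∈ FF Ω H ↔ ∀ γ ∈ H, γ • x = x := by
  constructor
  · intro h γ hγ
    exact h ⟨γ, hγ⟩
  · intro h γ
    exact h γ.1 γ.2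

lemma FF_anti {H H' : Subgroup Γ} (h : H ≤ H') : FF Ω H' ≤ FF Ω H := by
  intro x hx
  rw [mem_FF] at hx ⊢
  exact fun γ hγ => hx γ (h hγ)

lemma smul_mem_FF {H : Subgroup Γ} {x : Ω} (hx : x ∈ FF Ω H) {γ : Γ}
    (hγ : ∀ h ∈ H, γ⁻¹ * h * γ ∈ H) : γ • x ∈ FF Ω H := by
  rw [mem_FF] at hx ⊢
  intro h hh
  have := hx _ (hγ h hh)
  calc h • γ • x = γ • ((γ⁻¹ * h * γ) • x) := by simp [← mul_smul, ← mul_assoc]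
    _ = γ • x := by rw [this]

lemma smul_eq_of_FF {H : Subgroup Γ} {x : Ω} (hx : x ∈ FF Ω H) {a b : Γ}
    (h : a⁻¹ * b ∈ H) : b • x = a • x := by
  have := mem_FF.1 hx _ h
  rw [mul_smul, inv_smul_eq_iff] at this
  exact this

/-- `f` is a left transversal of `A / B`. -/
def Trv {ι : Type*} (A B : Subgroup Γ) (f : ι → Γ) : Prop :=
  (∀ i, f i ∈ A) ∧ ∀ a ∈ A, ∃! i, (f i)⁻¹ * a ∈ B

/-- The canonical bijection attached to a transversal. -/
lemma Trv.bij {ι : Type*} {A B : Subgroup Γ} {f : ι → Γ} (h : Trv A B f) :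
    Function.Bijective (fun i => (QuotientGroup.mk ⟨f i, h.1 i⟩ : A ⧸ B.subgroupOf A)) := by
  constructor
  · intro i j hij
    simp only [QuotientGroup.eq, Subgroup.mem_subgroupOf] at hij
    obtain ⟨k, _, hk⟩ := h.2 (f j) (h.1 j)
    rw [hk i (by simpa using hij), hk j (by simp)]
  · intro q
    obtain ⟨a, rfl⟩ := QuotientGroup.mk_surjective q
    obtain ⟨i, hi, _⟩ := h.2 a.1 a.2
    refine ⟨i, ?_⟩
    simp only [QuotientGroup.eq, Subgroup.mem_subgroupOf]
    simpa using hi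

lemma Trv.card {ι : Type*} {A B : Subgroup Γ} {f : ι → Γ} (h : Trv A B f) :
    Nat.card ι = B.relIndex A := by
  rw [Subgroup.relIndex, Subgroup.index]
  exact Nat.card_congr (Equiv.ofBijective _ h.bij)

lemma exists_Trv (A B : Subgroup Γ) : ∃ f : (A ⧸ B.subgroupOf A) → Γ, Trv A B f := by
  refine ⟨fun q => (q.out : A), fun i => i.out.2, fun a ha => ?_⟩
  refine ⟨QuotientGroup.mk ⟨a, ha⟩, ?_, ?_⟩
  · have : (QuotientGroup.mk (Quotient.out (QuotientGroup.mk ⟨a, ha⟩ : A ⧸ B.subgroupOf A)) :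
      A ⧸ B.subgroupOf A) = QuotientGroup.mk ⟨a, ha⟩ := QuotientGroup.out_eq' _
    rw [QuotientGroup.eq, Subgroup.mem_subgroupOf] at this
    simpa using this
  · intro q hq
    have : (QuotientGroup.mk (q.out) : A ⧸ B.subgroupOf A) = QuotientGroup.mk ⟨a, ha⟩ := by
      rw [QuotientGroup.eq, Subgroup.mem_subgroupOf]
      simpa using hq
    rw [← this]
    exact (QuotientGroup.out_eq' q).symm

/-- Relative norm. -/
noncomputable def rN (A B : Subgroup Γ) (x : Ω) : Ω :=
  ∏ᶠ q : A ⧸ B.subgroupOf A, ((exists_Trv A B).choose q) • x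

lemma rN_eq {ι : Type*} {A B : Subgroup Γ} {f : ι → Γ} (h : Trv A B f) {x : Ω}
    (hx : x ∈ FF Ω B) : rN A B x = ∏ᶠ i, f i • x := by
  have h0 := (exists_Trv A B).choose_spec
  set g := (exists_Trv A B).choose with hg
  unfold rN
  rw [← hg]
  -- the map sending i to the unique q
  let e := (Equiv.ofBijective _ h.bij).trans (Equiv.ofBijective _ h0.bij).symm
  refine (finprod_eq_of_bijective e e.bijective ?_).symm
  intro i
  apply smul_eq_of_FF hx
  have : (Equiv.ofBijective _ h0.bij) (e i) = (Equiv.ofBijective _ h.bij) i := by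
    simp [e]
  simp only [Equiv.ofBijective_apply, QuotientGroup.eq, Subgroup.mem_subgroupOf] at this
  simpa using this

lemma rN_eq_prod {ι : Type*} [Fintype ι] {A B : Subgroup Γ} {f : ι → Γ} (h : Trv A B f) {x : Ω}
    (hx : x ∈ FF Ω B) : rN A B x = ∏ i, f i • x := by
  rw [rN_eq h hx, finprod_eq_prod_of_fintype]

lemma exists_Trv_fin {A B : Subgroup Γ} (h : B.relIndex A ≠ 0) :
    ∃ f : Fin (B.relIndex A) → Γ, Trv A B f := by
  obtain ⟨g, hg⟩ := exists_Trv A B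
  have hc : Nat.card (A ⧸ B.subgroupOf A) = B.relIndex A := hg.card
  have : Finite (A ⧸ B.subgroupOf A) := Nat.finite_of_card_ne_zero (by rw [hc]; exact h)
  let e : Fin (B.relIndex A) ≃ (A ⧸ B.subgroupOf A) := (Finite.equivFinOfCardEq hc).symm
  refine ⟨g ∘ e, fun i => hg.1 _, fun a ha => ?_⟩
  obtain ⟨q, hq, hu⟩ := hg.2 a ha
  refine ⟨e.symm q, by simpa using hq, fun j hj => ?_⟩
  rw [← hu (e j) hj]; simp

lemma Trv.mul {ι κ : Type*} {A H B : Subgroup Γ} {f : ι → Γ} {g : κ → Γ}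
    (hf : Trv A H f) (hg : Trv H B g) (hHA : H ≤ A) (hBH : B ≤ H) :
    Trv A B (fun t : ι × κ => f t.1 * g t.2) := by
  refine ⟨fun t => A.mul_mem (hf.1 _) (hHA (hg.1 _)), fun a ha => ?_⟩
  obtain ⟨i, hi, hiu⟩ := hf.2 a ha
  obtain ⟨j, hj, hju⟩ := hg.2 _ hi
  refine ⟨(i, j), by simpa [mul_assoc] using hj, ?_⟩
  rintro ⟨i', j'⟩ h'
  simp only [mul_inv_rev] at h'
  have h1 : (f i')⁻¹ * a ∈ H := by
    have := H.mul_mem (hg.1 j') (hBH h')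
    simpa [← mul_assoc] using this
  obtain rfl := hiu _ h1
  obtain rfl := hju j' (by simpa [mul_assoc] using h')
  rfl

lemma rN_tower {A H B : Subgroup Γ} (hHA : H ≤ A) (hBH : B ≤ H)
    (h1 : H.relIndex A ≠ 0) (h2 : B.relIndex H ≠ 0) {x : Ω} (hx : x ∈ FF Ω B)
    (hN : rN H B x ∈ FF Ω H) : rN A B x = rN A H (rN H B x) := by
  obtain ⟨f, hf⟩ := exists_Trv_fin h1
  obtain ⟨g, hg⟩ := exists_Trv_fin h2
  rw [rN_eq_prod hf hN, rN_eq_prod (hf.mul hg hHA hBH) hx, rN_eq_prod hg hx,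
    Fintype.prod_prod_type]
  refine Finset.prod_congr rfl fun i _ => ?_
  rw [Finset.smul_prod']
  simp [mul_smul]

lemma Trv.left {ι : Type*} {A B : Subgroup Γ} {f : ι → Γ} (hf : Trv A B f) {a : Γ} (ha : a ∈ A) :
    Trv A B (fun i => a * f i) := by
  refine ⟨fun i => A.mul_mem ha (hf.1 i), fun b hb => ?_⟩
  obtain ⟨i, hi, hu⟩ := hf.2 (a⁻¹ * b) (A.mul_mem (A.inv_mem ha) hb)
  refine ⟨i, by simpa [mul_assoc] using hi, fun j hj => hu j (by simpa [mul_assoc] using hj)⟩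

lemma rN_mem {A B : Subgroup Γ} (h : B.relIndex A ≠ 0) {x : Ω} (hx : x ∈ FF Ω B) :
    rN A B x ∈ FF Ω A := by
  rw [mem_FF]
  intro a ha
  obtain ⟨f, hf⟩ := exists_Trv_fin h
  rw [rN_eq_prod hf hx, Finset.smul_prod']
  conv_rhs => rw [← rN_eq_prod hf hx, rN_eq_prod (hf.left ha) hx]
  simp [mul_smul]

lemma rN_tower' {A H B : Subgroup Γ} (hHA : H ≤ A) (hBH : B ≤ H)
    (h1 : H.relIndex A ≠ 0) (h2 : B.relIndex H ≠ 0) {x : Ω} (hx : x ∈ FF Ω B) :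
    rN A B x = rN A H (rN H B x) :=
  rN_tower hHA hBH h1 h2 hx (rN_mem h2 hx)

lemma rN_mul {A B : Subgroup Γ} (h : B.relIndex A ≠ 0) {x y : Ω} (hx : x ∈ FF Ω B)
    (hy : y ∈ FF Ω B) : rN A B (x * y) = rN A B x * rN A B y := by
  obtain ⟨f, hf⟩ := exists_Trv_fin h
  rw [rN_eq_prod hf hx, rN_eq_prod hf hy, rN_eq_prod hf (mul_mem hx hy), ← Finset.prod_mul_distrib]
  simp [smul_mul']

lemma rN_inv {A B : Subgroup Γ} (h : B.relIndex A ≠ 0) {x : Ω} (hx : x ∈ FF Ω B) :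
    rN A B (x⁻¹) = (rN A B x)⁻¹ := by
  obtain ⟨f, hf⟩ := exists_Trv_fin h
  rw [rN_eq_prod hf hx, rN_eq_prod hf (inv_mem hx), ← Finset.prod_inv_distrib]
  simp [smul_inv'']

lemma rN_one {A B : Subgroup Γ} (h : B.relIndex A ≠ 0) : rN A B (1 : Ω) = 1 := by
  obtain ⟨f, hf⟩ := exists_Trv_fin h
  rw [rN_eq_prod hf (one_mem _)]
  simp

lemma rN_div {A B : Subgroup Γ} (h : B.relIndex A ≠ 0) {x y : Ω} (hx : x ∈ FF Ω B)
    (hy : y ∈ FF Ω B) : rN A B (x / y) = rN A B x / rN A B y := by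
  rw [div_eq_mul_inv, rN_mul h hx (inv_mem hy), rN_inv h hy, div_eq_mul_inv]

lemma rN_zpow {A B : Subgroup Γ} (h : B.relIndex A ≠ 0) {x : Ω} (hx : x ∈ FF Ω B) (i : ℤ) :
    rN A B (x ^ i) = (rN A B x) ^ i := by
  obtain ⟨f, hf⟩ := exists_Trv_fin h
  rw [rN_eq_prod hf hx, rN_eq_prod hf (zpow_mem hx i), ← Finset.prod_zpow]
  refine Finset.prod_congr rfl fun j _ => ?_
  exact map_zpow₀ (MulSemiringAction.toRingHom Γ Ω (f j)) x i

lemma rN_of_mem {A B : Subgroup Γ} (h : B.relIndex A ≠ 0) (hBA : B ≤ A) {x : Ω}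
    (hx : x ∈ FF Ω A) : rN A B x = x ^ (B.relIndex A) := by
  obtain ⟨f, hf⟩ := exists_Trv_fin h
  rw [rN_eq_prod hf (FF_anti hBA hx)]
  rw [Finset.prod_congr rfl (fun i _ => mem_FF.1 hx _ (hf.1 i))]
  simp

lemma norm_rN [NInv Γ Ω] {A B : Subgroup Γ} (h : B.relIndex A ≠ 0) {x : Ω} (hx : x ∈ FF Ω B) :
    ‖rN A B x‖ = ‖x‖ ^ (B.relIndex A) := by
  obtain ⟨f, hf⟩ := exists_Trv_fin h
  rw [rN_eq_prod hf hx, norm_prod]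
  simp

lemma rN_ne_zero {A B : Subgroup Γ} (h : B.relIndex A ≠ 0) {x : Ω} (hx : x ∈ FF Ω B)
    (h0 : x ≠ 0) : rN A B x ≠ 0 := by
  obtain ⟨f, hf⟩ := exists_Trv_fin h
  rw [rN_eq_prod hf hx, Finset.prod_ne_zero_iff]
  intro i _
  have h2 : MulSemiringAction.toRingHom Γ Ω (f i) x ≠ 0 := by
    rw [Ne, map_eq_zero]; exact h0
  exact h2

/-- `φ` normalizes `H`. -/
def Nz (φ : Γ) (H : Subgroup Γ) : Prop := ∀ h, h ∈ H ↔ φ⁻¹ * h * φ ∈ H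

lemma Nz.smul_mem {φ : Γ} {H : Subgroup Γ} (h : Nz φ H) {x : Ω} (hx : x ∈ FF Ω H) :
    φ • x ∈ FF Ω H := smul_mem_FF hx (fun y hy => (h y).1 hy)

lemma Nz.inv {φ : Γ} {H : Subgroup Γ} (h : Nz φ H) : Nz φ⁻¹ H := by
  intro y
  rw [h (φ⁻¹⁻¹ * y * φ⁻¹)]
  simp [mul_assoc]

lemma Nz.one {H : Subgroup Γ} : Nz 1 H := by
  intro y; simp

lemma Nz.mul {φ ψ : Γ} {H : Subgroup Γ} (h : Nz φ H) (h' : Nz ψ H) : Nz (φ * ψ) H := by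
  intro y
  rw [h y, h' _]
  simp [mul_assoc]

lemma Nz.pow {φ : Γ} {H : Subgroup Γ} (h : Nz φ H) (n : ℕ) : Nz (φ ^ n) H := by
  induction n with
  | zero => simpa using Nz.one
  | succ n ih => rw [pow_succ]; exact ih.mul h

lemma Nz.of_mem {φ : Γ} {H : Subgroup Γ} (h : φ ∈ H) : Nz φ H := by
  intro y
  constructor
  · intro hy
    exact H.mul_mem (H.mul_mem (H.inv_mem h) hy) h
  · intro hy
    have := H.mul_mem (H.mul_mem h hy) (H.inv_mem h)
    simpa [mul_assoc] using this

lemma Nz.inf {φ : Γ} {H H' : Subgroup Γ} (h : Nz φ H) (h' : Nz φ H') : Nz φ (H ⊓ H') := by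
  intro y
  rw [Subgroup.mem_inf, Subgroup.mem_inf, ← h y, ← h' y]

lemma Trv.conj {ι : Type*} {A B : Subgroup Γ} {f : ι → Γ} (hf : Trv A B f) {φ : Γ} (hA : Nz φ A)
    (hB : Nz φ B) : Trv A B (fun i => φ * f i * φ⁻¹) := by
  refine ⟨fun i => ?_, fun a ha => ?_⟩
  · rw [hA]; simpa [mul_assoc] using hf.1 i
  · obtain ⟨i, hi, hu⟩ := hf.2 _ ((hA a).1 ha)
    refine ⟨i, ?_, fun j hj => ?_⟩
    · beta_reduce; rw [hB]; simpa [mul_assoc] using hi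
    · apply hu; beta_reduce at hj; rw [hB] at hj; simpa [mul_assoc] using hj

lemma rN_smul {A B : Subgroup Γ} (h : B.relIndex A ≠ 0) {φ : Γ} (hA : Nz φ A)
    (hB : Nz φ B) {x : Ω} (hx : x ∈ FF Ω B) : rN A B (φ • x) = φ • rN A B x := by
  obtain ⟨f, hf⟩ := exists_Trv_fin h
  rw [rN_eq_prod hf hx, rN_eq_prod (hf.conj hA hB) (hB.smul_mem hx), Finset.smul_prod']
  simp [mul_smul]

lemma rN_self {A : Subgroup Γ} {x : Ω} (hx : x ∈ FF Ω A) : rN A A x = x := by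
  rw [rN_of_mem (by simp) le_rfl hx]; simp

/-- the norm can be computed from a subgroup surjecting on the quotient -/
lemma Trv.of_sub {ι : Type*} {A B I : Subgroup Γ} {f : ι → Γ} (hIA : I ≤ A)
    (hf : Trv I (B ⊓ I) f) (hs : ∀ a ∈ A, ∃ i ∈ I, i⁻¹ * a ∈ B) : Trv A B f := by
  refine ⟨fun i => hIA (hf.1 i), fun a ha => ?_⟩
  obtain ⟨c, hc, hca⟩ := hs a ha
  obtain ⟨i, hi, hu⟩ := hf.2 c hc
  refine ⟨i, ?_, fun j hj => hu j ⟨?_, I.mul_mem (I.inv_mem (hf.1 j)) hc⟩⟩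
  · have := B.mul_mem hi.1 hca
    simpa [mul_assoc] using this
  · have := B.mul_mem hj (B.inv_mem hca)
    simpa [mul_assoc] using this

lemma rN_of_sub {A B I : Subgroup Γ} (hIA : I ≤ A) 
    (hs : ∀ a ∈ A, ∃ i ∈ I, i⁻¹ * a ∈ B) {x : Ω} (hx : x ∈ FF Ω B) :
    rN A B x = rN I (B ⊓ I) x := by
  obtain ⟨f, hf⟩ := exists_Trv I (B ⊓ I)
  rw [rN_eq hf (FF_anti inf_le_left hx), rN_eq (hf.of_sub hIA hs) hx]

/-- transversal for a cyclic step -/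
lemma Trv.cyc {A B : Subgroup Γ} {s : Γ} {l : ℕ} (hl : 0 < l) (hs : s ∈ A) (hsl : s ^ l ∈ B)
    (hmin : ∀ i, 0 < i → i < l → s ^ i ∉ B) (hgen : ∀ a ∈ A, ∃ i : ℕ, (s ^ i)⁻¹ * a ∈ B)  :
    Trv A B (fun i : Fin l => s ^ (i : ℕ)) := by
  refine ⟨fun i => A.pow_mem hs _, fun a ha => ?_⟩
  obtain ⟨i, hi⟩ := hgen a ha
  have key : (s ^ (i % l))⁻¹ * a ∈ B := by
    have h1 : (s ^ l) ^ (i / l) * ((s ^ i)⁻¹ * a) ∈ B := B.mul_mem (B.pow_mem hsl _) hi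
    convert h1 using 1
    rw [← mul_assoc, ← pow_mul]
    congr 1
    have : s ^ i = s ^ (l * (i / l)) * s ^ (i % l) := by
      rw [← pow_add, Nat.div_add_mod]
    have h2 : s ^ i = s ^ (i % l) * s ^ (l * (i / l)) := by
      rw [← pow_add, Nat.mod_add_div]
    rw [h2]; simp
  refine ⟨⟨i % l, Nat.mod_lt _ hl⟩, key, ?_⟩
  rintro ⟨j, hj⟩ hja
  simp only at hja
  have h3 : (s ^ j)⁻¹ * s ^ (i % l) ∈ B := by
    have := B.mul_mem hja (B.inv_mem key)
    simpa [mul_assoc] using this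
  have hi' := Nat.mod_lt i hl
  rw [Fin.mk.injEq]
  rcases lt_trichotomy j (i % l) with h | h | h
  · exfalso
    apply hmin (i % l - j) (by omega) (by omega)
    have : s ^ (i % l) = s ^ j * s ^ (i % l - j) := by
      rw [← pow_add]; congr 1; omega
    rw [this] at h3
    simpa using h3
  · exact h
  · exfalso
    apply hmin (j - i % l) (by omega) (by omega)
    have : s ^ j = s ^ (i % l) * s ^ (j - i % l) := by
      rw [← pow_add]; congr 1; omega
    rw [this] at h3
    simpa using h3

end basic

end LT

/-! ### Part 2 : ultrametric estimates, roots, Teichmueller representatives -/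

namespace LT

set_option linter.unusedSectionVars false

section ultra

variable {Ω : Type*} [NormedField Ω] [IsUltrametricDist Ω]

lemma u_add {a b : Ω} {r : ℝ} (ha : ‖a‖ ≤ r) (hb : ‖b‖ ≤ r) : ‖a + b‖ ≤ r :=
  (IsUltrametricDist.norm_add_le_max a b).trans (max_le ha hb)

lemma u_sub {a b : Ω} {r : ℝ} (ha : ‖a‖ ≤ r) (hb : ‖b‖ ≤ r) : ‖a - b‖ ≤ r := by
  rw [sub_eq_add_neg]; exact u_add ha (by rwa [norm_neg])

lemma u_add_lt {a b : Ω} {r : ℝ} (ha : ‖a‖ < r) (hb : ‖b‖ < r) : ‖a + b‖ < r :=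
  (IsUltrametricDist.norm_add_le_max a b).trans_lt (max_lt ha hb)

lemma u_sub_lt {a b : Ω} {r : ℝ} (ha : ‖a‖ < r) (hb : ‖b‖ < r) : ‖a - b‖ < r := by
  rw [sub_eq_add_neg]; exact u_add_lt ha (by rwa [norm_neg])

lemma u_trans {a b c : Ω} {r : ℝ} (ha : ‖a - b‖ ≤ r) (hb : ‖b - c‖ ≤ r) : ‖a - c‖ ≤ r := by
  have := u_add ha hb
  rwa [sub_add_sub_cancel] at this

lemma u_trans_lt {a b c : Ω} {r : ℝ} (ha : ‖a - b‖ < r) (hb : ‖b - c‖ < r) : ‖a - c‖ < r := by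
  have := u_add_lt ha hb
  rwa [sub_add_sub_cancel] at this

lemma u_sum {ι : Type*} (s : Finset ι) {f : ι → Ω} {r : ℝ} (hr : 0 ≤ r)
    (h : ∀ i ∈ s, ‖f i‖ ≤ r) : ‖∑ i ∈ s, f i‖ ≤ r :=
  IsUltrametricDist.norm_sum_le_of_forall_le_of_nonneg hr h

lemma u_sum_lt {ι : Type*} (s : Finset ι) {f : ι → Ω} {r : ℝ} (hr : 0 < r)
    (h : ∀ i ∈ s, ‖f i‖ < r) : ‖∑ i ∈ s, f i‖ < r := by
  classical
  induction s using Finset.induction_on with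
  | empty => simpa using hr
  | insert a s ha ih =>
    rw [Finset.sum_insert ha]
    exact u_add_lt (h a (by simp)) (ih fun i hi => h i (by simp [hi]))

lemma u_eq {a b : Ω} (h : ‖a - b‖ < ‖a‖) : ‖b‖ = ‖a‖ := by
  have hb : b = a + (b - a) := by ring
  rw [norm_sub_rev] at h
  apply le_antisymm
  · rw [hb]; exact u_add le_rfl h.le
  · by_contra hlt
    push Not at hlt
    have : ‖b - (b - a)‖ < ‖a‖ := u_sub_lt hlt h
    simp at this

lemma u_one {a : Ω} (h : ‖a - 1‖ < 1) : ‖a‖ = 1 := by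
  have : ‖(1 : Ω) - a‖ < ‖(1 : Ω)‖ := by rw [norm_sub_rev]; simpa using h
  rw [u_eq this]; simp

lemma u_mul_sub {a b c d : Ω} {r : ℝ} (ha : ‖a‖ ≤ 1) (hd : ‖d‖ ≤ 1)
    (h1 : ‖a - b‖ ≤ r) (h2 : ‖c - d‖ ≤ r) : ‖a * c - b * d‖ ≤ r := by
  have hr : 0 ≤ r := (norm_nonneg _).trans h1
  have : a * c - b * d = a * (c - d) + (a - b) * d := by ring
  rw [this]
  apply u_add
  · rw [norm_mul]; exact (mul_le_of_le_one_left (norm_nonneg _) ha).trans h2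
  · rw [norm_mul]; exact (mul_le_of_le_one_right (norm_nonneg _) hd).trans h1

lemma u_pow_sub {a b : Ω} (ha : ‖a‖ ≤ 1) (hb : ‖b‖ ≤ 1) (n : ℕ) :
    ‖a ^ n - b ^ n‖ ≤ ‖a - b‖ := by
  induction n with
  | zero => simp
  | succ n ih =>
    rw [pow_succ, pow_succ]
    exact u_mul_sub (by rw [norm_pow]; exact pow_le_one₀ (norm_nonneg _) ha) hb ih le_rfl

lemma u_prod_sub {ι : Type*} (s : Finset ι) {f g : ι → Ω} {r : ℝ} (hr : 0 ≤ r)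
    (hf : ∀ i ∈ s, ‖f i‖ ≤ 1) (hg : ∀ i ∈ s, ‖g i‖ ≤ 1)
    (h : ∀ i ∈ s, ‖f i - g i‖ ≤ r) : ‖∏ i ∈ s, f i - ∏ i ∈ s, g i‖ ≤ r := by
  classical
  induction s using Finset.induction_on with
  | empty => simpa using hr
  | insert a s ha ih =>
    rw [Finset.prod_insert ha, Finset.prod_insert ha]
    refine u_mul_sub (hf a (by simp)) ?_ (h a (by simp))
      (ih (fun i hi => hf i (by simp [hi])) (fun i hi => hg i (by simp [hi]))
        (fun i hi => h i (by simp [hi])))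
    rw [norm_prod]
    exact Finset.prod_le_one (fun _ _ => norm_nonneg _) (fun i hi => hg i (by simp [hi]))

lemma u_nat (n : ℕ) : ‖(n : Ω)‖ ≤ 1 := IsUltrametricDist.norm_natCast_le_one Ω n
lemma u_int (n : ℤ) : ‖(n : Ω)‖ ≤ 1 := IsUltrametricDist.norm_intCast_le_one Ω n

lemma u_coprime {m p : ℕ} (h : m.Coprime p) (hp : ‖(p : Ω)‖ < 1) : ‖(m : Ω)‖ = 1 := by
  have hb := Nat.gcd_eq_gcd_ab m p
  rw [h] at hb
  have hb' : (1 : Ω) = m * (m.gcdA p : ℤ) + p * (m.gcdB p : ℤ) := by exact_mod_cast congrArg (Int.cast (R := Ω)) hb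
  have h1 : ‖(m : Ω) * (m.gcdA p : ℤ) - 1‖ < 1 := by
    have : (m : Ω) * (m.gcdA p : ℤ) - 1 = - (p * (m.gcdB p : ℤ)) := by rw [hb']; ring
    rw [this, norm_neg, norm_mul]
    exact (mul_le_of_le_one_right (norm_nonneg _) (u_int _)).trans_lt hp
  have h2 := u_one h1
  rw [norm_mul] at h2
  apply le_antisymm (u_nat m)
  rw [← h2]
  exact mul_le_of_le_one_right (norm_nonneg _) (u_int _)

lemma norm_rootOne {Ω : Type*} [NormedField Ω] {n : ℕ} (hn : n ≠ 0) {z : Ω} (hz : z ^ n = 1) : ‖z‖ = 1 := by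
  have := congrArg norm hz
  rw [norm_pow, norm_one] at this
  exact (pow_eq_one_iff_of_nonneg (norm_nonneg _) hn).1 this

lemma rootOne_dist {n : ℕ} (hn : ‖(n : Ω)‖ = 1) {z : Ω} (hz : z ^ n = 1) (h1 : z ≠ 1) :
    1 ≤ ‖z - 1‖ := by
  by_contra h
  push Not at h
  have hz1 := u_one h
  have hs : ∑ i ∈ Finset.range n, z ^ i = 0 := by
    have := mul_geom_sum z n
    rw [hz, sub_self] at this
    exact (mul_eq_zero.1 this).resolve_left (sub_ne_zero.2 h1)
  have h2 : ‖∑ i ∈ Finset.range n, (z ^ i - 1)‖ < 1 := by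
    apply u_sum_lt _ one_pos
    intro i _
    refine lt_of_le_of_lt ?_ h
    simpa using u_pow_sub hz1.le (b := 1) (by simp) i
  rw [Finset.sum_sub_distrib, hs] at h2
  simp [hn] at h2

lemma exists_dist [CharZero Ω] {n : ℕ} (hn : n ≠ 0) :
    ∃ d : ℝ, 0 < d ∧ d ≤ 1 ∧ ∀ z : Ω, z ^ n = 1 → z ≠ 1 → d ≤ ‖z - 1‖ := by
  classical
  let S : Finset ℝ := insert 1 (((Polynomial.nthRootsFinset n (1 : Ω)).erase 1).image
    fun z => ‖z - 1‖)
  have hS : S.Nonempty := ⟨1, by simp [S]⟩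
  refine ⟨S.min' hS, ?_, S.min'_le _ (by simp [S]), ?_⟩
  · rw [Finset.lt_min'_iff]
    intro y hy
    simp only [S, Finset.mem_insert, Finset.mem_image, Finset.mem_erase] at hy
    rcases hy with rfl | ⟨z, ⟨hz, _⟩, rfl⟩
    · exact one_pos
    · exact norm_pos_iff.2 (sub_ne_zero.2 hz)
  · intro z hz hz1
    apply S.min'_le
    simp only [S, Finset.mem_insert, Finset.mem_image, Finset.mem_erase]
    right
    exact ⟨z, ⟨hz1, (Polynomial.mem_nthRootsFinset (Nat.pos_of_ne_zero hn) _).2 hz⟩, rfl⟩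

variable {Γ : Type*} [Group Γ] [MulSemiringAction Γ Ω] [NInv Γ Ω]

variable (Γ) in
/-- n-th roots of elements close to one -/
lemma nroot [IsAlgClosed Ω] [CharZero Ω] {n : ℕ} (hn : n ≠ 0) {d : ℝ} (hd0 : 0 < d) (hd1 : d ≤ 1)
    (hd : ∀ z : Ω, z ^ n = 1 → z ≠ 1 → d ≤ ‖z - 1‖) {u : Ω} (hu : ‖u - 1‖ < d ^ n) :
    ∃ r : Ω, r ^ n = u ∧ ‖r - 1‖ < d ∧ ∀ γ : Γ, γ • u = u → γ • r = r := by
  obtain ⟨r0, hr0⟩ := IsAlgClosed.exists_pow_nat_eq u (Nat.pos_of_ne_zero hn)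
  have hprim : ∃ ζ : Ω, IsPrimitiveRoot ζ n := by
    have : NeZero (n : Ω) := ⟨by exact_mod_cast hn⟩
    exact (IsSepClosed.hasEnoughRootsOfUnity Ω n).prim
  obtain ⟨ζ, hζ⟩ := hprim
  have h1 : ∃ z : Ω, z ^ n = 1 ∧ ‖r0 - z‖ < d := by
    by_contra hcon
    push Not at hcon
    have hX := Polynomial.X_pow_sub_one_eq_prod (Nat.pos_of_ne_zero hn) hζ
    have := congrArg (Polynomial.eval r0) hX
    simp only [Polynomial.eval_sub, Polynomial.eval_pow, Polynomial.eval_X, Polynomial.eval_one,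
      Polynomial.eval_prod, Polynomial.eval_C] at this
    rw [hr0] at this
    rw [this, norm_prod] at hu
    have h3 : d ^ n ≤ ∏ i ∈ Polynomial.nthRootsFinset n (1 : Ω), ‖r0 - i‖ := by
      have hcard : d ^ n = ∏ _i ∈ Polynomial.nthRootsFinset n (1 : Ω), d := by
        rw [Finset.prod_const, hζ.card_nthRootsFinset]
      rw [hcard]
      apply Finset.prod_le_prod
      · intros; exact hd0.le
      · intro i hi
        exact hcon i ((Polynomial.mem_nthRootsFinset (Nat.pos_of_ne_zero hn) _).1 hi)
    linarith
  obtain ⟨z, hz, hzd⟩ := h1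
  have hz1 := norm_rootOne hn hz
  have hz0 : z ≠ 0 := by intro h; simp [h] at hz1
  have hr1 : ‖r0 / z - 1‖ < d := by
    have : r0 / z - 1 = (r0 - z) / z := by field_simp
    rw [this, norm_div, hz1, div_one]; exact hzd
  have hrn := u_one (hr1.trans_le hd1)
  have hrz : (r0 / z) ^ n = u := by rw [div_pow, hr0, hz, div_one]
  refine ⟨r0 / z, hrz, hr1, fun γ hγ => ?_⟩
  set r := r0 / z
  have hr0' : r ≠ 0 := by intro h; simp [h] at hrn
  by_contra hne
  have h4 : (γ • r / r) ^ n = 1 := by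
    rw [div_pow, ← smul_pow', hrz, hγ, div_self]
    rw [← hrz]; exact pow_ne_zero _ hr0'
  have h5 := hd _ h4 (fun h => hne ((div_eq_one_iff_eq hr0').1 h))
  have h6 : ‖γ • r - r‖ < d := by
    apply u_trans_lt (b := 1)
    · have : γ • r - 1 = γ • (r - 1) := by rw [smul_sub, smul_one]
      rw [this, norm_act]; exact hr1
    · rw [norm_sub_rev]; exact hr1
  have h7 : γ • r / r - 1 = (γ • r - r) / r := by field_simp
  rw [h7, norm_div, hrn, div_one] at h5
  linarith

/-- solve `a ^ n + c a = b` in the unit ball -/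
lemma solve_poly [IsAlgClosed Ω] {n : ℕ} (hn : 2 ≤ n) {b c : Ω} (hb : ‖b‖ ≤ 1) (hc : ‖c‖ ≤ 1) :
    ∃ a : Ω, ‖a‖ ≤ 1 ∧ a ^ n + c * a = b := by
  let P : Polynomial Ω := Polynomial.X ^ n + (Polynomial.C c * Polynomial.X - Polynomial.C b)
  have hdeg : P.degree = n := by
    suffices hlt : (Polynomial.C c * Polynomial.X - Polynomial.C b).degree <
        ((Polynomial.X : Polynomial Ω) ^ n).degree by
      rw [Polynomial.degree_add_eq_left_of_degree_lt hlt, Polynomial.degree_X_pow]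
    rw [Polynomial.degree_X_pow]
    refine lt_of_le_of_lt (Polynomial.degree_sub_le _ _) ?_
    refine max_lt ?_ ?_
    · refine (Polynomial.degree_C_mul_X_le c).trans_lt ?_
      exact_mod_cast (by omega : 1 < n)
    · refine Polynomial.degree_C_le.trans_lt ?_
      exact_mod_cast (by omega : 0 < n)
  obtain ⟨a, ha⟩ := IsAlgClosed.exists_root P (by rw [hdeg]; exact_mod_cast (by omega : n ≠ 0))
  have ha' : a ^ n + c * a = b := by
    have : a ^ n + (c * a - b) = 0 := by simpa [P, Polynomial.IsRoot] using ha
    linear_combination this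
  refine ⟨a, ?_, ha'⟩
  by_contra h
  push Not at h
  have h1 : ‖a ^ n‖ ≤ ‖a‖ := by
    have : a ^ n = b - c * a := by linear_combination ha'
    rw [this]
    apply u_sub (hb.trans h.le)
    rw [norm_mul]; exact mul_le_of_le_one_left (norm_nonneg _) hc
  rw [norm_pow] at h1
  have h2 : ‖a‖ ^ 2 ≤ ‖a‖ ^ n := pow_le_pow_right₀ h.le hn
  nlinarith

end ultra

/-- Teichmueller elements : zero and the roots of one of order prime to `p`. -/
def IsT (p : ℕ) {Ω : Type*} [Field Ω] (z : Ω) : Prop :=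
  z = 0 ∨ ∃ m : ℕ, 0 < m ∧ m.Coprime p ∧ z ^ m = 1

/-- `Ω` has Teichmueller representatives -/
class TeichP (p : outParam ℕ) (Ω : Type*) [NormedField Ω] : Prop where
  prime : p.Prime
  lt : ‖(p : Ω)‖ < 1
  ex : ∀ y : Ω, ‖y‖ ≤ 1 → ∃ z, IsT p z ∧ ‖y - z‖ < 1

lemma IsT.norm_le {p : ℕ} {Ω : Type*} [NormedField Ω] {z : Ω} (h : IsT p z) : ‖z‖ ≤ 1 := by
  rcases h with rfl | ⟨m, hm, _, hz⟩
  · simp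
  · exact (norm_rootOne hm.ne' hz).le

lemma IsT.pow {p : ℕ} {Ω : Type*} [Field Ω] {z : Ω} (h : IsT p z) {n : ℕ} (hn : n ≠ 0) : IsT p (z ^ n) := by
  rcases h with rfl | ⟨m, hm, hc, hz⟩
  · left; simp [hn]
  · right; exact ⟨m, hm, hc, by rw [← pow_mul, mul_comm, pow_mul, hz, one_pow]⟩

end LT

/-! ### Part 3 : norm surjectivity on units -/

namespace LT

set_option linter.unusedSectionVars false

section expand

variable {Ω : Type*} [NormedField Ω] [IsUltrametricDist Ω]

open Polynomial in
lemma coeff_prod_le {ι : Type*} (s : Finset ι) (c : ι → Ω) {r : ℝ} (hr : 0 ≤ r)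
    (hc : ∀ i, ‖c i‖ ≤ r) (m : ℕ) : ‖(∏ j ∈ s, (1 + C (c j) * X)).coeff m‖ ≤ r ^ m := by
  classical
  induction s using Finset.induction_on generalizing m with
  | empty =>
    rw [Finset.prod_empty, coeff_one]
    split_ifs with h
    · subst h; simp
    · simpa using pow_nonneg hr m
  | insert a s ha ih =>
    rw [Finset.prod_insert ha, add_mul, one_mul, coeff_add]
    apply u_add (ih m)
    rw [mul_assoc, coeff_C_mul]
    cases m with
    | zero => simp
    | succ m =>
      rw [coeff_X_mul, norm_mul, pow_succ']
      exact mul_le_mul (hc a) (ih m) (norm_nonneg _) hr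

lemma sum_zmod {p : ℕ} [NeZero p] {M : Type*} [AddCommMonoid M] (F : ZMod p → M) :
    ∑ i, F i = ∑ k ∈ Finset.range p, F (k : ZMod p) := by
  refine Finset.sum_nbij' (fun i => i.val) (fun k => (k : ZMod p)) ?_ ?_ ?_ ?_ ?_
  · intro i _; simpa using ZMod.val_lt i
  · intro i _; simp
  · intro i _; simp
  · intro i hi; simpa using ZMod.val_cast_of_lt (Finset.mem_range.1 hi)
  · intro i _; simp

open Polynomial in
lemma mid_est {p : ℕ} [Fact p.Prime] (c : ZMod p → Ω) (σ : Ω →+* Ω)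
    (hσ : ∀ i, σ (c i) = c (i + 1)) {r : ℝ} (hr0 : 0 ≤ r) (hr1 : r ≤ 1) (hc : ∀ i, ‖c i‖ ≤ r)
    (S : Subfield Ω) (hS : ∀ i, c i ∈ S) {t : ℝ} (ht : 0 ≤ t)
    (hT : ∀ w ∈ S, ‖w‖ ≤ r ^ 2 → ‖∑ k ∈ Finset.range p, σ^[k] w‖ ≤ t) (hp : ‖(p : Ω)‖ < 1) :
    ‖∏ i, (1 + c i) - (1 + ∑ i, c i + ∏ i, c i)‖ ≤ t := by
  classical
  have hpp : p.Prime := Fact.out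
  let P : Polynomial Ω := ∏ i, (1 + C (c i) * X)
  let R : ZMod p → Polynomial Ω := fun i => (∏ j ∈ Finset.univ.erase i, (1 + C (c j) * X))
  have hder : derivative P = ∑ i, R i * C (c i) := by
    simp [P, R, derivative_prod_finset]
  have hRm : ∀ i, (R i * C (c i)).map σ = R (i + 1) * C (c (i + 1)) := by
    intro i
    rw [Polynomial.map_mul, map_C, hσ, Polynomial.map_prod]
    congr 1
    refine Finset.prod_nbij (fun j => j + 1) ?_ ?_ ?_ ?_
    · intro j hj; simpa using hj
    · intro a _ b _ h; simpa using h
    · intro j hj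
      refine ⟨j - 1, ?_, by simp⟩
      have : j ≠ i + 1 := by simpa using hj
      simp [sub_eq_iff_eq_add, this]
    · intro j _; simp [hσ]
  have hRk : ∀ m k : ℕ, (R (k : ZMod p) * C (c (k : ZMod p))).coeff m =
      σ^[k] ((R 0 * C (c 0)).coeff m) := by
    intro m k
    induction k with
    | zero => simp
    | succ k ih =>
      rw [Function.iterate_succ_apply', ← ih, ← coeff_map, hRm, Nat.cast_succ]
  have hco : ∀ m : ℕ, P.coeff (m + 1) * ((m : Ω) + 1) =
      ∑ k ∈ Finset.range p, σ^[k] ((R 0 * C (c 0)).coeff m) := by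
    intro m
    rw [← coeff_derivative, hder, finsetSum_coeff, sum_zmod]
    exact Finset.sum_congr rfl fun k _ => hRk m k
  have hmem : ∀ m, (R 0 * C (c 0)).coeff m ∈ S := by
    intro m
    let c' : ZMod p → S := fun i => ⟨c i, hS i⟩
    have : R 0 * C (c 0) =
      ((∏ j ∈ Finset.univ.erase (0 : ZMod p), (1 + C (c' j) * X)) * C (c' 0)).map S.subtype := by
      rw [Polynomial.map_mul, Polynomial.map_prod]
      simp [R, c']
    rw [this, coeff_map]
    exact Subtype.property _
  have hnm : ∀ m, ‖(R 0 * C (c 0)).coeff m‖ ≤ r ^ (m + 1) := by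
    intro m
    rw [coeff_mul_C, norm_mul, pow_succ]
    exact mul_le_mul (coeff_prod_le _ c hr0 hc m) (hc 0) (norm_nonneg _) (by positivity)
  have hmid : ∀ m, 1 ≤ m → m + 1 < p → ‖P.coeff (m + 1)‖ ≤ t := by
    intro m h1 h2
    have h3 : ‖((m : Ω) + 1)‖ = 1 := by
      have : ((m : Ω) + 1) = ((m + 1 : ℕ) : Ω) := by push_cast; ring
      rw [this]
      apply u_coprime _ hp
      exact (Nat.coprime_of_lt_prime (by omega) h2 hpp).symm
    have h4 := congrArg norm (hco m)
    rw [norm_mul, h3, mul_one] at h4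
    rw [h4]
    apply hT _ (hmem m)
    exact (hnm m).trans (pow_le_pow_of_le_one hr0 hr1 (by omega))
  have h0 : P.coeff 0 = 1 := by
    simp only [P, coeff_zero_eq_eval_zero, eval_prod]; simp
  have h1 : P.coeff 1 = ∑ i, c i := by
    have := hco 0
    rw [sum_zmod]
    simp only [Nat.cast_zero, zero_add, mul_one] at this
    rw [this]
    refine Finset.sum_congr rfl fun k _ => ?_
    rw [← hRk]
    rw [coeff_mul_C]
    have : (R k).coeff 0 = 1 := by
      simp only [R, coeff_zero_eq_eval_zero, eval_prod]; simp
    rw [this, one_mul]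
  have hdeg : ∀ i, (1 + C (c i) * X).natDegree ≤ 1 := fun i =>
    (natDegree_add_le _ _).trans (by simpa using (natDegree_C_mul_le (c i) X).trans natDegree_X_le)
  have hlast : P.coeff p = ∏ i, c i := by
    have := coeff_prod_of_natDegree_le (s := Finset.univ) (fun i => 1 + C (c i) * X) 1
      (fun i _ => hdeg i)
    simp only [mul_one, Finset.card_univ, ZMod.card] at this
    rw [show P = ∏ i, (1 + C (c i) * X) from rfl, this]
    refine Finset.prod_congr rfl fun i _ => ?_
    simp [coeff_one]
  have hPdeg : P.natDegree ≤ p := by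
    refine (natDegree_prod_le _ _).trans ?_
    refine (Finset.sum_le_card_nsmul _ _ 1 (fun i _ => hdeg i)).trans ?_
    simp [ZMod.card]
  have hev : ∏ i, (1 + c i) = ∑ k ∈ Finset.range (p + 1), P.coeff k := by
    have : P.eval 1 = ∏ i, (1 + c i) := by simp [P, eval_prod]
    rw [← this, eval_eq_sum_range' (Nat.lt_succ_of_le hPdeg)]
    simp
  obtain ⟨q, rfl⟩ : ∃ q, p = q + 2 := ⟨p - 2, by have := hpp.two_le; omega⟩
  rw [hev, Finset.sum_range_succ, hlast, Finset.sum_range_succ', Finset.sum_range_succ', h0,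
    zero_add, h1]
  have : ∑ k ∈ Finset.range q, P.coeff (k + 1 + 1) + ∑ i, c i + 1 + ∏ i, c i -
      (1 + ∑ i, c i + ∏ i, c i) = ∑ k ∈ Finset.range q, P.coeff (k + 1 + 1) := by ring
  rw [this]
  apply u_sum _ ht
  intro k hk
  exact hmid (k + 1) (by omega) (by have := Finset.mem_range.1 hk; omega)

end expand

end LT

namespace LT

set_option linter.unusedSectionVars false

section tr

variable {Γ Ω : Type*} [Group Γ] [NormedField Ω] [MulSemiringAction Γ Ω] [NInv Γ Ω]

/-- a totally ramified commutative layer -/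
structure TR (p : ℕ) (A B : Subgroup Γ) (x : Ω) : Prop where
  le : B ≤ A
  comm : ∀ a ∈ A, ∀ b ∈ A, a * b * a⁻¹ * b⁻¹ ∈ B
  fin : B.relIndex A ≠ 0
  mem : x ∈ FF Ω B
  pos : 0 < ‖x‖
  lt : ‖x‖ < 1
  valB : ∀ y ∈ FF Ω B, y ≠ 0 → ∃ i : ℤ, ‖y‖ = ‖x‖ ^ i
  valA : ∀ y ∈ FF Ω A, y ≠ 0 → ∃ i : ℤ, ‖y‖ = ‖x‖ ^ ((B.relIndex A : ℤ) * i)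
  tei : ∀ a ∈ A, ∀ z : Ω, IsT p z → a • z = z

lemma Trv.sum_eq {ι κ : Type*} [Fintype ι] [Fintype κ] {A B : Subgroup Γ} {f : ι → Γ} {g : κ → Γ}
    (h : Trv A B f) (h0 : Trv A B g) {x : Ω} (hx : x ∈ FF Ω B) :
    ∑ i, f i • x = ∑ i, g i • x := by
  let e := (Equiv.ofBijective _ h.bij).trans (Equiv.ofBijective _ h0.bij).symm
  refine Fintype.sum_equiv e _ _ ?_
  intro i
  apply smul_eq_of_FF hx
  have : (Equiv.ofBijective _ h0.bij) (e i) = (Equiv.ofBijective _ h.bij) i := by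
    simp [e]
  simp only [Equiv.ofBijective_apply, QuotientGroup.eq, Subgroup.mem_subgroupOf] at this
  simpa using this

lemma Trv.sum_mem {ι : Type*} [Fintype ι] {A B : Subgroup Γ} {f : ι → Γ}
    (h : Trv A B f) {x : Ω} (hx : x ∈ FF Ω B) : ∑ i, f i • x ∈ FF Ω A := by
  rw [mem_FF]
  intro a ha
  conv_rhs => rw [h.sum_eq (h.left ha) hx]
  rw [Finset.smul_sum]
  simp [mul_smul]

lemma TR.nz {p : ℕ} {A B : Subgroup Γ} {x : Ω} (h : TR p A B x) {a : Γ} (ha : a ∈ A) : Nz a B := by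
  have key : ∀ c ∈ A, ∀ b ∈ B, c⁻¹ * b * c ∈ B := by
    intro c hc b hb
    have := B.mul_mem (h.comm _ (A.inv_mem hc) _ (h.le hb)) hb
    simpa [mul_assoc] using this
  intro b
  refine ⟨fun hb => key a ha b hb, fun hb => ?_⟩
  have := key _ (A.inv_mem ha) _ hb
  simpa [mul_assoc] using this

lemma zpow_disc {q : ℝ} (h0 : 0 < q) (h1 : q < 1) {i : ℤ} {j : ℕ} (h : q ^ i < q ^ j) :
    q ^ i ≤ q ^ (j + 1) := by
  rw [← zpow_natCast, zpow_lt_zpow_iff_right_of_lt_one₀ h0 h1] at h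
  rw [← zpow_natCast, zpow_le_zpow_iff_right_of_lt_one₀ h0 h1]
  push_cast
  omega

lemma TR.disc {p : ℕ} {A B : Subgroup Γ} {x : Ω} (h : TR p A B x) {z : Ω} (hz : z ∈ FF Ω A)
    {j : ℕ} (hj : ‖z‖ < ‖rN A B x‖ ^ j) : ‖z‖ ≤ ‖rN A B x‖ ^ (j + 1) := by
  by_cases h0 : z = 0
  · rw [h0, norm_zero]; positivity
  obtain ⟨i, hi⟩ := h.valA z hz h0
  have hx0 : x ≠ 0 := norm_pos_iff.1 h.pos
  have hlt : ‖rN A B x‖ < 1 := by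
    rw [norm_rN h.fin h.mem]; exact pow_lt_one₀ (norm_nonneg _) h.lt h.fin
  have hpos : 0 < ‖rN A B x‖ := norm_pos_iff.2 (rN_ne_zero h.fin h.mem hx0)
  have : ‖z‖ = ‖rN A B x‖ ^ i := by
    rw [hi, norm_rN h.fin h.mem, zpow_mul, zpow_natCast]
  rw [this] at hj ⊢
  exact zpow_disc hpos hlt hj

variable [IsUltrametricDist Ω] [IsAlgClosed Ω] [CharZero Ω] {p : ℕ} [TeichP p Ω]

lemma TR.T_mem {A B : Subgroup Γ} {x : Ω} (h : TR p A B x) {z : Ω} (hz : IsT p z) :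
    z ∈ FF Ω A := mem_FF.2 fun a ha => h.tei a ha z hz

/-- start of the approximation -/
lemma TR.start {A B : Subgroup Γ} {x : Ω} (h : TR p A B x) {u : Ω}
    (hu1 : ‖u‖ = 1) : ∃ z : Ω, z ∈ FF Ω A ∧ ‖z‖ = 1 ∧ ‖u - rN A B z‖ < 1 := by
  obtain ⟨y, hy⟩ := IsAlgClosed.exists_pow_nat_eq u (Nat.pos_of_ne_zero h.fin)
  have hy1 : ‖y‖ = 1 := by
    have := congrArg norm hy
    rw [norm_pow, hu1] at this
    exact (pow_eq_one_iff_of_nonneg (norm_nonneg _) h.fin).1 this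
  obtain ⟨z, hz, hyz⟩ := TeichP.ex y hy1.le
  have hz1 : ‖z‖ = 1 := by rw [← hy1]; exact u_eq (by rwa [hy1])
  refine ⟨z, h.T_mem hz, hz1, ?_⟩
  rw [rN_of_mem h.fin h.le (h.T_mem hz), ← hy]
  exact (u_pow_sub hy1.le hz1.le _).trans_lt hyz

/-- finish of the approximation -/
lemma TR.finish {A B : Subgroup Γ} {x : Ω} (h : TR p A B x) {u v : Ω} (hu : u ∈ FF Ω A)
    {d : ℝ} (hd0 : 0 < d) (hd1 : d ≤ 1)
    (hd : ∀ z : Ω, z ^ (B.relIndex A) = 1 → z ≠ 1 → d ≤ ‖z - 1‖) (hv : v ∈ FF Ω B) (hv1 : ‖v‖ = 1)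
    (huv : ‖u - rN A B v‖ < d ^ (B.relIndex A)) :
    ∃ v ∈ FF Ω B, ‖v‖ = 1 ∧ rN A B v = u := by
  have hv0 : v ≠ 0 := by intro h; simp [h] at hv1
  have hN0 := rN_ne_zero h.fin hv hv0
  have hN1 : ‖rN A B v‖ = 1 := by rw [norm_rN h.fin hv, hv1, one_pow]
  have h1 : ‖u / rN A B v - 1‖ < d ^ (B.relIndex A) := by
    have : u / rN A B v - 1 = (u - rN A B v) / rN A B v := by field_simp
    rw [this, norm_div, hN1, div_one]; exact huv
  obtain ⟨r, hr, hr1, hrf⟩ := nroot Γ h.fin hd0 hd1 hd h1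
  have hrA : r ∈ FF Ω A := mem_FF.2 fun a ha => hrf a
    (mem_FF.1 (div_mem hu (rN_mem h.fin hv)) a ha)
  refine ⟨v * r, mul_mem hv (FF_anti h.le hrA), ?_, ?_⟩
  · rw [norm_mul, hv1, u_one (hr1.trans_le hd1), one_mul]
  · rw [rN_mul h.fin hv (FF_anti h.le hrA), rN_of_mem h.fin h.le hrA, hr]
    field_simp

lemma TR.ns_tame {A B : Subgroup Γ} {x : Ω} (h : TR p A B x) (hn : (B.relIndex A).Coprime p)
    {u : Ω} (hu : u ∈ FF Ω A) (hu1 : ‖u‖ = 1) : ∃ v ∈ FF Ω B, ‖v‖ = 1 ∧ rN A B v = u := by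
  obtain ⟨z, hz, hz1, hzu⟩ := h.start hu1
  refine h.finish hu one_pos le_rfl (fun w hw hw1 => ?_) (FF_anti h.le hz) hz1 (by simpa using hzu)
  exact rootOne_dist (u_coprime hn TeichP.lt) hw hw1

/-- choice of the element `y` -/
lemma TR.choose_y {A B : Subgroup Γ} {x : Ω} (h : TR p A B x) {s : Γ}
    (hT : Trv A B (fun i : Fin p => s ^ (i : ℕ))) {j : ℕ} (hj : 1 ≤ j) :
    ∃ y ∈ FF Ω B, ‖y‖ ≤ ‖x‖ ^ j ∧ ‖∑ i : Fin p, s ^ (i : ℕ) • y‖ ≤ ‖rN A B x‖ ^ j ∧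
      (∀ w ∈ FF Ω B, ‖w‖ ≤ ‖y‖ ^ 2 → ‖∑ i : Fin p, s ^ (i : ℕ) • w‖ ≤ ‖rN A B x‖ ^ (j + 1)) ∧
      (‖y‖ = ‖x‖ ^ j ∨ ‖∑ i : Fin p, s ^ (i : ℕ) • y‖ = ‖rN A B x‖ ^ j) := by
  set q := ‖rN A B x‖ with hq
  have hqx : q = ‖x‖ ^ (B.relIndex A) := norm_rN h.fin h.mem
  have hq0 : 0 < q := by rw [hqx]; exact pow_pos h.pos _
  have hq1 : q < 1 := by rw [hqx]; exact pow_lt_one₀ (norm_nonneg _) h.lt h.fin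
  have hTn : ∀ z : Ω, ‖∑ i : Fin p, s ^ (i : ℕ) • z‖ ≤ ‖z‖ := fun z =>
    u_sum _ (norm_nonneg _) fun i _ => (norm_act _ _).le
  by_cases hcase : ∀ z ∈ FF Ω B, ‖z‖ ≤ ‖x‖ ^ j → ‖∑ i : Fin p, s ^ (i : ℕ) • z‖ ≤ q ^ (j + 1)
  · have hxj : ‖x ^ j‖ ≤ ‖x‖ ^ j := by rw [norm_pow]
    refine ⟨x ^ j, pow_mem h.mem j, hxj, ?_, ?_, Or.inl (norm_pow _ _)⟩
    · exact (hcase _ (pow_mem h.mem j) hxj).trans (pow_le_pow_of_le_one hq0.le hq1.le (by omega))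
    · intro w hw hwn
      refine hcase w hw (hwn.trans ?_)
      rw [norm_pow, ← pow_mul]
      exact pow_le_pow_of_le_one h.pos.le h.lt.le (by omega)
  · push Not at hcase
    obtain ⟨z0, hz0, hz0n, hz0T⟩ := hcase
    let S : Set ℕ := {i | j ≤ i ∧ ∃ z ∈ FF Ω B, ‖z‖ = ‖x‖ ^ i ∧
      q ^ j ≤ ‖∑ i : Fin p, s ^ (i : ℕ) • z‖}
    have hmk : ∀ z ∈ FF Ω B, ∀ m : ℕ, j ≤ m → ‖z‖ ≤ ‖x‖ ^ m →
        q ^ (j + 1) < ‖∑ i : Fin p, s ^ (i : ℕ) • z‖ →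
        ∃ i ∈ S, m ≤ i := by
      intro z hz m hjm hzm hzT
      have hzne : z ≠ 0 := by
        rintro rfl
        simp only [smul_zero, Finset.sum_const_zero, norm_zero] at hzT
        have := pow_pos hq0 (j + 1)
        linarith
      obtain ⟨i, hi⟩ := h.valB z hz hzne
      rw [hi, ← zpow_natCast, zpow_le_zpow_iff_right_of_lt_one₀ h.pos h.lt] at hzm
      obtain ⟨i, rfl⟩ := Int.eq_ofNat_of_zero_le (show 0 ≤ i by omega)
      refine ⟨i, ⟨by omega, z, hz, by simpa using hi, ?_⟩, by omega⟩
      by_contra hlt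
      push Not at hlt
      have := h.disc (hT.sum_mem hz) hlt
      linarith
    obtain ⟨i1, hi1, -⟩ := hmk z0 hz0 j le_rfl hz0n hz0T
    have hbdd : BddAbove S := by
      refine ⟨B.relIndex A * j, ?_⟩
      rintro i ⟨_, z, _, hzn, hzT⟩
      have := hzT.trans (hTn z)
      rw [hzn, hqx, ← pow_mul, pow_le_pow_iff_right_of_lt_one₀ h.pos h.lt] at this
      exact this
    have hmem := Nat.sSup_mem ⟨i1, hi1⟩ hbdd
    set i0 := sSup S
    have hmax : ∀ i ∈ S, i ≤ i0 := fun i hi => le_csSup hbdd hi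
    obtain ⟨hji, y, hy, hyn, hyT⟩ := hmem
    have hTe : ‖∑ i : Fin p, s ^ (i : ℕ) • y‖ = q ^ j := by
      apply le_antisymm _ hyT
      by_contra hlt
      push Not at hlt
      have hϖ := rN_mem h.fin h.mem
      have hTm : ∑ i : Fin p, s ^ (i : ℕ) • (rN A B x * y) =
          rN A B x * ∑ i : Fin p, s ^ (i : ℕ) • y := by
        rw [Finset.mul_sum]
        refine Finset.sum_congr rfl fun i _ => ?_
        rw [smul_mul', mem_FF.1 hϖ _ (hT.1 i)]
      obtain ⟨i, hi, him⟩ := hmk (rN A B x * y) (mul_mem (FF_anti h.le hϖ) hy) (i0 + 1) (by omega)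
        (by
          rw [norm_mul, hyn, pow_succ', ← hq, hqx]
          apply mul_le_mul_of_nonneg_right _ (by positivity)
          exact pow_le_of_le_one h.pos.le h.lt.le h.fin)
        (by
          rw [hTm, norm_mul, ← hq, pow_succ']
          exact mul_lt_mul_of_pos_left hlt hq0)
      have := hmax i hi
      omega
    refine ⟨y, hy, ?_, hTe.le, ?_, Or.inr hTe⟩
    · rw [hyn]; exact pow_le_pow_of_le_one h.pos.le h.lt.le hji
    · intro w hw hwn
      by_contra hlt
      push Not at hlt
      rw [hyn, ← pow_mul] at hwn
      obtain ⟨i, hi, him⟩ := hmk w hw (i0 * 2) (by omega) hwn hlt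
      have := hmax i hi
      omega

lemma TR.step {A B : Subgroup Γ} {x : Ω} (h : TR p A B x) {s : Γ} (hs : s ∈ A) (hsp : s ^ p ∈ B)
    (hT : Trv A B (fun i : Fin p => s ^ (i : ℕ))) {j : ℕ} (hj : 1 ≤ j) {u : Ω} (hu : u ∈ FF Ω A)
    (hu1 : ‖u - 1‖ ≤ ‖rN A B x‖ ^ j) :
    ∃ v ∈ FF Ω B, ‖v‖ = 1 ∧ ‖u - rN A B v‖ ≤ ‖rN A B x‖ ^ (j + 1) := by
  have hpp : p.Prime := TeichP.prime Ω
  have : Fact p.Prime := ⟨hpp⟩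
  have hidx : B.relIndex A = p := by rw [← hT.card]; simp
  obtain ⟨y, hy, hyj, hyT, hyw, hor⟩ := h.choose_y hT hj
  set ϖ := rN A B x with hϖ
  have hϖA : ϖ ∈ FF Ω A := rN_mem h.fin h.mem
  have hϖ0 : ϖ ≠ 0 := rN_ne_zero h.fin h.mem (norm_pos_iff.1 h.pos)
  have hqx : ‖ϖ‖ = ‖x‖ ^ p := by rw [hϖ, norm_rN h.fin h.mem, hidx]
  have hq0 : 0 < ‖ϖ‖ := norm_pos_iff.2 hϖ0
  have hqj : 0 < ‖ϖ‖ ^ j := pow_pos hq0 j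
  have hq1 : ‖ϖ‖ < 1 := by rw [hqx]; exact pow_lt_one₀ (norm_nonneg _) h.lt hpp.ne_zero
  set T := ∑ i : Fin p, s ^ (i : ℕ) • y with hTdef
  have hTA : T ∈ FF Ω A := hT.sum_mem hy
  set N := rN A B y with hN
  have hNA : N ∈ FF Ω A := rN_mem h.fin hy
  have hNn : ‖N‖ = ‖y‖ ^ p := by rw [hN, norm_rN h.fin hy, hidx]
  have hNj : ‖N‖ ≤ ‖ϖ‖ ^ j := by
    rw [hNn, hqx, ← pow_mul, mul_comm, pow_mul]
    exact pow_le_pow_left₀ (norm_nonneg _) hyj p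
  have hdiv : ∀ z : Ω, ‖z‖ ≤ ‖ϖ‖ ^ j → ‖z / ϖ ^ j‖ ≤ 1 := by
    intro z hz
    rw [norm_div, norm_pow]; exact (div_le_one hqj).2 hz
  -- the Teichmueller solution
  obtain ⟨a, ha, hsol⟩ : ∃ a : Ω, IsT p a ∧
      ‖N / ϖ ^ j * a ^ p + T / ϖ ^ j * a - (u - 1) / ϖ ^ j‖ < 1 := by
    have hb := hdiv _ hu1
    have hc := hdiv _ hyT
    have hd := hdiv _ hNj
    set b := (u - 1) / ϖ ^ j
    set c := T / ϖ ^ j with hcdef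
    set d := N / ϖ ^ j with hddef
    obtain ⟨a0, ha0, hsol0⟩ : ∃ a0 : Ω, ‖a0‖ ≤ 1 ∧ ‖d * a0 ^ p + c * a0 - b‖ < 1 := by
      rcases hd.lt_or_eq with hd1 | hd1
      · have hc1 : ‖c‖ = 1 := by
          rcases hor with h1 | h1
          · exfalso
            have : ‖d‖ = 1 := by
              rw [hddef, norm_div, norm_pow, hNn, h1, hqx, ← pow_mul, ← pow_mul, mul_comm,
                div_self (pow_ne_zero _ h.pos.ne')]
            linarith
          · rw [hcdef, norm_div, norm_pow, h1, div_self hqj.ne']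
        have hc0 : c ≠ 0 := by intro h; simp [h] at hc1
        have hbc : ‖b / c‖ ≤ 1 := by rw [norm_div, hc1, div_one]; exact hb
        refine ⟨b / c, hbc, ?_⟩
        have : d * (b / c) ^ p + c * (b / c) - b = d * (b / c) ^ p := by
          rw [mul_div_cancel₀ _ hc0]; ring
        rw [this, norm_mul]
        refine lt_of_le_of_lt (mul_le_of_le_one_right (norm_nonneg _) ?_) hd1
        rw [norm_pow]; exact pow_le_one₀ (norm_nonneg _) hbc
      · have hd0 : d ≠ 0 := by intro h; simp [h] at hd1
        obtain ⟨a, ha, he⟩ := solve_poly hpp.two_le (b := b / d) (c := c / d)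
          (by rw [norm_div, hd1, div_one]; exact hb) (by rw [norm_div, hd1, div_one]; exact hc)
        refine ⟨a, ha, ?_⟩
        have : d * a ^ p + c * a - b = 0 := by
          have := congrArg (fun t => d * t) he
          field_simp at this
          linear_combination this
        rw [this]; simp
    obtain ⟨a, ha, haa⟩ := TeichP.ex a0 ha0
    refine ⟨a, ha, ?_⟩
    have hdiff : d * a ^ p + c * a - b = (d * a0 ^ p + c * a0 - b) -
        (d * (a0 ^ p - a ^ p) + c * (a0 - a)) := by ring
    rw [hdiff]
    apply u_sub_lt hsol0
    apply u_add_lt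
    · rw [norm_mul]
      refine lt_of_le_of_lt (mul_le_of_le_one_left (norm_nonneg _) hd) ?_
      exact (u_pow_sub ha0 ha.norm_le p).trans_lt haa
    · rw [norm_mul]
      exact lt_of_le_of_lt (mul_le_of_le_one_left (norm_nonneg _) hc) haa
  have haA := h.T_mem (A := A) ha
  have hay : a * y ∈ FF Ω B := mul_mem (FF_anti h.le haA) hy
  have hayn : ‖a * y‖ ≤ ‖y‖ := by
    rw [norm_mul]; exact mul_le_of_le_one_left (norm_nonneg _) ha.norm_le
  have hy1 : ‖y‖ < 1 := hyj.trans_lt (pow_lt_one₀ h.pos.le h.lt (by omega))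
  have hvB : 1 + a * y ∈ FF Ω B := add_mem (one_mem _) hay
  have hact : ∀ k : ℕ, s ^ k • (a * y) = a * s ^ k • y := fun k => by
    rw [smul_mul', mem_FF.1 haA _ (A.pow_mem hs k)]
  refine ⟨1 + a * y, hvB, u_one (by simpa using hayn.trans_lt hy1), ?_⟩
  -- expansion of the norm
  let c : ZMod p → Ω := fun i => s ^ i.val • (a * y)
  have hsum : ∑ i, c i = a * T := by
    rw [sum_zmod, hTdef, Finset.mul_sum, ← Fin.sum_univ_eq_sum_range]
    refine Finset.sum_congr rfl fun i _ => ?_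
    simp only [c]
    rw [ZMod.val_cast_of_lt i.2, hact]
  have hTz : Trv A B (fun i : ZMod p => s ^ i.val) := by
    refine ⟨fun i => A.pow_mem hs _, fun b hb => ?_⟩
    obtain ⟨i, hi, hiu⟩ := hT.2 b hb
    refine ⟨((i : ℕ) : ZMod p), ?_, fun k hk => ?_⟩
    · simpa [ZMod.val_cast_of_lt i.2] using hi
    · have := hiu ⟨k.val, ZMod.val_lt k⟩ hk
      rw [← this]; simp
  have hprod : ∏ i, c i = a ^ p * N := by
    rw [hN, ← rN_eq_prod hTz hay, rN_mul h.fin (FF_anti h.le haA) hy,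
      rN_of_mem h.fin h.le haA, hidx]
  have hprod1 : ∏ i, (1 + c i) = rN A B (1 + a * y) := by
    rw [rN_eq_prod hTz hvB]
    refine Finset.prod_congr rfl fun i _ => ?_
    rw [smul_add, smul_one]
  have hiter : ∀ (k : ℕ) (w : Ω), (MulSemiringAction.toRingHom Γ Ω s)^[k] w = s ^ k • w := by
    intro k w
    induction k with
    | zero => simp
    | succ k ih => rw [Function.iterate_succ_apply', ih, pow_succ', mul_smul]; rfl
  have hmid := mid_est c (MulSemiringAction.toRingHom Γ Ω s) (by
      intro i
      change s • s ^ i.val • (a * y) = s ^ (i + 1).val • (a * y)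
      rw [← mul_smul, ← pow_succ']
      have h1 : i + 1 = ((i.val + 1 : ℕ) : ZMod p) := by simp
      rw [h1, ZMod.val_natCast]
      have h2 : s ^ (i.val + 1) = s ^ ((i.val + 1) % p) * (s ^ p) ^ ((i.val + 1) / p) := by
        rw [← pow_mul, ← pow_add, Nat.mod_add_div]
      rw [h2, mul_smul, mem_FF.1 hay _ (B.pow_mem hsp _)])
    (norm_nonneg y) hy1.le (fun i => by simpa [c] using hayn) (FF Ω B)
    (fun i => (h.nz (A.pow_mem hs _)).smul_mem hay) (t := ‖ϖ‖ ^ (j + 1)) (by positivity)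
    (by
      intro w hw hwn
      rw [← Fin.sum_univ_eq_sum_range]
      simp only [hiter]
      exact hyw w hw hwn) TeichP.lt
  rw [hsum, hprod, hprod1] at hmid
  have hmain : ‖(u - 1) - (a * T + a ^ p * N)‖ ≤ ‖ϖ‖ ^ (j + 1) := by
    apply h.disc
    · exact sub_mem (sub_mem hu (one_mem _)) (add_mem (mul_mem haA hTA)
        (mul_mem (pow_mem haA p) hNA))
    · have : (u - 1) - (a * T + a ^ p * N) = - ϖ ^ j *
          (N / ϖ ^ j * a ^ p + T / ϖ ^ j * a - (u - 1) / ϖ ^ j) := by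
        field_simp; ring
      rw [this, norm_mul, norm_neg, norm_pow]
      exact mul_lt_of_lt_one_right hqj hsol
  have : u - rN A B (1 + a * y) = ((u - 1) - (a * T + a ^ p * N)) -
      (rN A B (1 + a * y) - (1 + a * T + a ^ p * N)) := by ring
  rw [this]
  exact u_sub hmain hmid

lemma TR.ns_wild {A B : Subgroup Γ} {x : Ω} (h : TR p A B x) {s : Γ} (hs : s ∈ A) (hsp : s ^ p ∈ B)
    (hT : Trv A B (fun i : Fin p => s ^ (i : ℕ))) {u : Ω} (hu : u ∈ FF Ω A) (hu1 : ‖u‖ = 1) :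
    ∃ v ∈ FF Ω B, ‖v‖ = 1 ∧ rN A B v = u := by
  obtain ⟨d, hd0, hd1, hd⟩ := exists_dist (Ω := Ω) h.fin
  have hlt : ‖rN A B x‖ < 1 := by
    rw [norm_rN h.fin h.mem]; exact pow_lt_one₀ (norm_nonneg _) h.lt h.fin
  have key : ∀ j : ℕ, ∃ v ∈ FF Ω B, ‖v‖ = 1 ∧ ‖u - rN A B v‖ ≤ ‖rN A B x‖ ^ (j + 1) := by
    intro j
    induction j with
    | zero =>
      obtain ⟨z, hz, hz1, hzu⟩ := h.start hu1
      refine ⟨z, FF_anti h.le hz, hz1, h.disc (sub_mem hu (rN_mem h.fin (FF_anti h.le hz))) ?_⟩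
      simpa using hzu
    | succ j ih =>
      obtain ⟨v, hv, hv1, hvu⟩ := ih
      have hv0 : v ≠ 0 := by intro h; simp [h] at hv1
      have hN0 := rN_ne_zero h.fin hv hv0
      have hN1 : ‖rN A B v‖ = 1 := by rw [norm_rN h.fin hv, hv1, one_pow]
      obtain ⟨w, hw, hw1, hwu⟩ := h.step hs hsp hT (j := j + 1) (by omega)
        (div_mem hu (rN_mem h.fin hv)) (by
          have : u / rN A B v - 1 = (u - rN A B v) / rN A B v := by field_simp
          rw [this, norm_div, hN1, div_one]; exact hvu)
      refine ⟨v * w, mul_mem hv hw, by rw [norm_mul, hv1, hw1, one_mul], ?_⟩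
      rw [rN_mul h.fin hv hw]
      have : u - rN A B v * rN A B w = rN A B v * (u / rN A B v - rN A B w) := by field_simp
      rw [this, norm_mul, hN1, one_mul]
      exact hwu
  obtain ⟨j, hj⟩ := exists_pow_lt_of_lt_one (pow_pos hd0 (B.relIndex A)) hlt
  obtain ⟨v, hv, hv1, hvu⟩ := key j
  refine h.finish hu hd0 hd1 hd hv hv1 (hvu.trans_lt (lt_of_le_of_lt ?_ hj))
  exact pow_le_pow_of_le_one (norm_nonneg _) hlt.le (by omega)

end tr

end LT

/-! ### Part 4 : norm surjectivity, and the kernel of the norm -/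

namespace LT

set_option linter.unusedSectionVars false

section tr

variable {Γ Ω : Type*} [Group Γ] [NormedField Ω] [MulSemiringAction Γ Ω] [NInv Γ Ω]
variable {p : ℕ} {A B H : Subgroup Γ} {x : Ω}

lemma TR.idx (h : TR p A B x) (hBH : B ≤ H) (hHA : H ≤ A) :
    B.relIndex H * H.relIndex A = B.relIndex A := Subgroup.relIndex_mul_relIndex B H A hBH hHA

lemma TR.valH (h : TR p A B x) (hBH : B ≤ H) (hHA : H ≤ A) {y : Ω} (hy : y ∈ FF Ω H) (hy0 : y ≠ 0) :
    ∃ i : ℤ, ‖y‖ = ‖x‖ ^ ((B.relIndex H : ℤ) * i) := by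
  have hidx := h.idx hBH hHA
  have h1 : H.relIndex A ≠ 0 := fun h0 => h.fin (by rw [← hidx, h0, mul_zero])
  obtain ⟨i, hi⟩ := h.valB y (FF_anti hBH hy) hy0
  obtain ⟨j, hj⟩ := h.valA _ (rN_mem h1 hy) (rN_ne_zero h1 hy hy0)
  rw [norm_rN h1 hy, hi, ← zpow_natCast, ← zpow_mul] at hj
  have := zpow_right_injective₀ h.pos h.lt.ne hj
  rw [← hidx] at this
  push_cast at this
  have h2 : (H.relIndex A : ℤ) ≠ 0 := by exact_mod_cast h1
  refine ⟨j, ?_⟩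
  rw [hi]
  congr 1
  apply mul_right_cancel₀ h2
  rw [this]; ring

lemma TR.down (h : TR p A B x) (hBH : B ≤ H) (hHA : H ≤ A) : TR p H B x where
  le := hBH
  comm a ha b hb := h.comm a (hHA ha) b (hHA hb)
  fin h0 := h.fin (by rw [← h.idx hBH hHA, h0, zero_mul])
  mem := h.mem
  pos := h.pos
  lt := h.lt
  valB := h.valB
  valA y hy hy0 := h.valH hBH hHA hy hy0
  tei a ha := h.tei a (hHA ha)

lemma TR.up (h : TR p A B x) (hBH : B ≤ H) (hHA : H ≤ A) : TR p A H (rN H B x) := by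
  have h1 := h.down hBH hHA
  have hn := norm_rN h1.fin h1.mem
  refine ⟨hHA, fun a ha b hb => hBH (h.comm a ha b hb), ?_, rN_mem h1.fin h1.mem, ?_, ?_, ?_, ?_,
    h.tei⟩
  · intro h0; exact h.fin (by rw [← h.idx hBH hHA, h0, mul_zero])
  · rw [hn]; exact pow_pos h.pos _
  · rw [hn]; exact pow_lt_one₀ h.pos.le h.lt h1.fin
  · intro y hy hy0
    obtain ⟨i, hi⟩ := h1.valA y hy hy0
    exact ⟨i, by rw [hi, hn, zpow_mul, zpow_natCast]⟩
  · intro y hy hy0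
    obtain ⟨i, hi⟩ := h.valA y hy hy0
    refine ⟨i, ?_⟩
    rw [hi, hn, ← h.idx hBH hHA, ← zpow_natCast, ← zpow_mul]
    congr 1
    push_cast; ring

/-- a subgroup of prime index over the bottom -/
lemma TR.exists_prime (h : TR p A B x) (h1 : B.relIndex A ≠ 1) :
    ∃ (H : Subgroup Γ) (s : Γ) (l : ℕ), B ≤ H ∧ H ≤ A ∧ s ∈ H ∧ l.Prime ∧ s ^ l ∈ B ∧
      Trv H B (fun i : Fin l => s ^ (i : ℕ)) := by
  obtain ⟨a, ha, haB⟩ : ∃ a ∈ A, a ∉ B := by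
    by_contra hcon
    push Not at hcon
    exact h1 (Subgroup.relIndex_eq_one.2 hcon)
  have hex : ∃ n, 0 < n ∧ a ^ n ∈ B := by
    obtain ⟨n, hn, _, hm⟩ := Subgroup.exists_pow_mem_of_index_ne_zero (H := B.subgroupOf A) h.fin ⟨a, ha⟩
    exact ⟨n, hn, hm⟩
  classical
  set n := Nat.find hex with hn
  obtain ⟨hn0, hnB⟩ := Nat.find_spec hex
  have hn1 : n ≠ 1 := by
    intro h1
    rw [← hn, h1, pow_one] at hnB
    exact haB hnB
  have hl : (n.minFac).Prime := Nat.minFac_prime hn1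
  set l := n.minFac
  obtain ⟨m, hm⟩ := Nat.minFac_dvd n
  set s := a ^ m with hs
  have hsA : s ∈ A := A.pow_mem ha m
  have hsl : s ^ l ∈ B := by rw [hs, ← pow_mul, mul_comm, ← hm]; exact hnB
  have hm0 : 0 < m := by
    rcases Nat.eq_zero_or_pos m with h0 | h0
    · rw [h0, mul_zero] at hm; omega
    · exact h0
  have hmin : ∀ i, 0 < i → i < l → s ^ i ∉ B := by
    intro i hi hil hmem
    rw [hs, ← pow_mul] at hmem
    have h2 := Nat.find_min' hex ⟨Nat.mul_pos hm0 hi, hmem⟩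
    rw [← hn, hm] at h2
    have h3 : m * i < m * l := Nat.mul_lt_mul_of_pos_left hil hm0
    rw [mul_comm m l] at h3
    exact absurd (lt_of_lt_of_le h3 h2) (lt_irrefl _)
  have hnz : ∀ i : ℤ, Nz (s ^ i) B := fun i => h.nz (A.zpow_mem hsA i)
  let H : Subgroup Γ :=
    { carrier := {g | ∃ i : ℤ, s ^ i * g ∈ B}
      one_mem' := ⟨0, by simp⟩
      mul_mem' := by
        rintro g g' ⟨i, hi⟩ ⟨j, hj⟩
        refine ⟨j + i, ?_⟩
        have h1 : s ^ j * (s ^ i * g) * (s ^ j)⁻¹ ∈ B := by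
          rw [hnz j]; simpa [mul_assoc] using hi
        have := B.mul_mem h1 hj
        rw [zpow_add]
        simpa [mul_assoc] using this
      inv_mem' := by
        rintro g ⟨i, hi⟩
        refine ⟨-i, ?_⟩
        have h1 := (hnz i _).1 (B.inv_mem hi)
        simpa [mul_assoc] using h1 }
  have hBH : B ≤ H := fun b hb => ⟨0, by simpa using hb⟩
  have hHA : H ≤ A := by
    rintro g ⟨i, hi⟩
    have := A.mul_mem (A.inv_mem (A.zpow_mem hsA i)) (h.le hi)
    simpa using this
  have hsH : s ∈ H := ⟨-1, by simp⟩
  refine ⟨H, s, l, hBH, hHA, hsH, hl, hsl, Trv.cyc hl.pos hsH hsl hmin ?_⟩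
  rintro g ⟨i, hi⟩
  have hl0 : (l : ℤ) ≠ 0 := by exact_mod_cast hl.ne_zero
  refine ⟨((-i) % l).toNat, ?_⟩
  have h2 : (((-i) % l).toNat : ℤ) = (-i) % l := Int.toNat_of_nonneg (Int.emod_nonneg _ hl0)
  rw [← zpow_natCast, h2]
  have h3 := Int.emod_add_mul_ediv (-i) l
  have h4 : -((-i) % l) = l * ((-i) / l) + i := by linarith
  rw [← zpow_neg, h4, zpow_add, mul_assoc, zpow_mul, zpow_natCast]
  exact B.mul_mem (B.zpow_mem hsl _) hi

section ns
variable [IsUltrametricDist Ω] [IsAlgClosed Ω] [CharZero Ω] [TeichP p Ω]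

lemma TR.ns_prime (h : TR p A B x) {s : Γ} {l : ℕ} (hs : s ∈ A) (hl : l.Prime) (hsl : s ^ l ∈ B)
    (hT : Trv A B (fun i : Fin l => s ^ (i : ℕ))) {u : Ω} (hu : u ∈ FF Ω A) (hu1 : ‖u‖ = 1) :
    ∃ v ∈ FF Ω B, ‖v‖ = 1 ∧ rN A B v = u := by
  by_cases hlp : l = p
  · subst hlp
    exact h.ns_wild hs hsl hT hu hu1
  · have hidx : B.relIndex A = l := by rw [← hT.card]; simp
    refine h.ns_tame ?_ hu hu1
    rw [hidx]
    exact (Nat.coprime_primes hl (TeichP.prime Ω)).2 hlp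

/-- units are norms -/
theorem TR.ns (h : TR p A B x) {u : Ω} (hu : u ∈ FF Ω A) (hu1 : ‖u‖ = 1) :
    ∃ v ∈ FF Ω B, ‖v‖ = 1 ∧ rN A B v = u := by
  induction hn : B.relIndex A using Nat.strong_induction_on generalizing B x with
  | _ n ih =>
    by_cases h1 : B.relIndex A = 1
    · have hAB : A ≤ B := Subgroup.relIndex_eq_one.1 h1
      obtain rfl := le_antisymm hAB h.le
      exact ⟨u, hu, hu1, rN_self hu⟩
    · obtain ⟨H, s, l, hBH, hHA, hsH, hl, hsl, hT⟩ := h.exists_prime h1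
      have hd := h.down hBH hHA
      have hup := h.up hBH hHA
      have hidx : B.relIndex H = l := by rw [← hT.card]; simp
      have hlt : H.relIndex A < n := by
        rw [← hn, ← h.idx hBH hHA, hidx]
        have := hl.one_lt
        have := Nat.pos_of_ne_zero hup.fin
        nlinarith
      obtain ⟨v, hv, hv1, hvu⟩ := ih _ hlt hup rfl
      obtain ⟨w, hw, hw1, hwv⟩ := hd.ns_prime hsH hl hsl hT hv hv1
      refine ⟨w, hw, hw1, ?_⟩
      rw [rN_tower' hHA hBH hup.fin hd.fin hw, hwv, hvu]

end ns

/-- the subgroup generated by the `τ η / η` -/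
inductive VV (A B : Subgroup Γ) : Ω → Prop
  | one : VV A B 1
  | mul_gen {θ η : Ω} {τ : Γ} : VV A B θ → τ ∈ A → η ∈ FF Ω B → ‖η‖ = 1 → VV A B (θ * (τ • η / η))

lemma VV.gen {η : Ω} {τ : Γ} (hτ : τ ∈ A) (hη : η ∈ FF Ω B) (h1 : ‖η‖ = 1) :
    VV A B (τ • η / η) := by
  have := VV.one.mul_gen hτ hη h1
  rwa [one_mul] at this

lemma VV.mul {a b : Ω} (ha : VV A B a) (hb : VV A B b) : VV A B (a * b) := by
  induction hb with
  | one => simpa using ha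
  | mul_gen _ hτ hη h1 ih => rw [← mul_assoc]; exact ih.mul_gen hτ hη h1

lemma VV.inv {a : Ω} (ha : VV A B a) : VV A B a⁻¹ := by
  induction ha with
  | one => simpa using VV.one
  | @mul_gen θ η τ _ hτ hη h1 ih =>
    have := ih.mul_gen hτ (inv_mem hη) (by rw [norm_inv, h1, inv_one])
    convert this using 1
    rw [smul_inv'', mul_inv, inv_div, div_inv_eq_mul, div_eq_mul_inv, mul_comm η]

lemma VV.div {a b : Ω} (ha : VV A B a) (hb : VV A B b) : VV A B (a / b) := by
  rw [div_eq_mul_inv]; exact ha.mul hb.inv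

lemma VV.norm {a : Ω} (ha : VV A B a) : ‖a‖ = 1 := by
  induction ha with
  | one => simp
  | mul_gen _ hτ hη h1 ih => rw [norm_mul, norm_div, norm_act, h1, ih]; simp

lemma VV.ne_zero {a : Ω} (ha : VV A B a) : a ≠ 0 := by
  intro h; have := ha.norm; simp [h] at this

lemma VV.mem (hn : ∀ a ∈ A, Nz a B) {a : Ω} (ha : VV A B a) : a ∈ FF Ω B := by
  induction ha with
  | one => exact one_mem _
  | mul_gen _ hτ hη h1 ih => exact mul_mem ih (div_mem ((hn _ hτ).smul_mem hη) hη)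

lemma VV.rN_eq_one (hn : ∀ a ∈ A, Nz a B) (hf : B.relIndex A ≠ 0) {a : Ω} (ha : VV A B a) :
    rN A B a = 1 := by
  induction ha with
  | one => exact rN_one hf
  | @mul_gen θ η τ hθ hτ hη h1 ih =>
    have hη0 : η ≠ 0 := by intro h; simp [h] at h1
    have hs := (hn _ hτ).smul_mem hη
    rw [rN_mul hf (hθ.mem hn) (div_mem hs hη), rN_div hf hs hη, rN_smul hf (Nz.of_mem hτ) (hn _ hτ) hη,
      mem_FF.1 (rN_mem hf hη) _ hτ, div_self (rN_ne_zero hf hη hη0), ih, one_mul]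

lemma VV.smul {ψ : Γ} (hA : Nz ψ A) (hB : Nz ψ B) {a : Ω} (ha : VV A B a) : VV A B (ψ • a) := by
  induction ha with
  | one => simpa using VV.one
  | @mul_gen θ η τ hθ hτ hη h1 ih =>
    have h2 : ψ * τ * ψ⁻¹ ∈ A := by rw [hA]; simpa [mul_assoc] using hτ
    have := ih.mul_gen h2 (hB.smul_mem hη) (by rw [norm_act, h1])
    convert this using 1
    rw [smul_mul', smul_div₀']
    simp [mul_smul]

lemma VV.mono {A' : Subgroup Γ} (hA : A' ≤ A) {a : Ω} (ha : VV A' B a) : VV A B a := by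
  induction ha with
  | one => exact VV.one
  | mul_gen _ hτ hη h1 ih => exact ih.mul_gen (hA hτ) hη h1

lemma TR.x0 (h : TR p A B x) : x ≠ 0 := norm_pos_iff.1 h.pos

lemma smul_ne0 {x : Ω} (hx : x ≠ 0) (τ : Γ) : τ • x ≠ 0 := by
  intro h0
  apply hx
  rw [← inv_smul_smul τ x, h0, smul_zero]

lemma TR.gx_mem (h : TR p A B x) {τ : Γ} (hτ : τ ∈ A) : τ • x / x ∈ FF Ω B :=
  div_mem ((h.nz hτ).smul_mem h.mem) h.mem

lemma TR.gx_norm (h : TR p A B x) (τ : Γ) : ‖τ • x / x‖ = 1 := by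
  rw [norm_div, norm_act, div_self h.pos.ne']

lemma TR.hom (h : TR p A B x) {σ τ : Γ} (hσ : σ ∈ A) (hτ : τ ∈ A) :
    ∃ θ, VV A B θ ∧ (σ * τ) • x / x = (σ • x / x) * (τ • x / x) * θ := by
  refine ⟨_, VV.gen hσ (h.gx_mem hτ) (h.gx_norm τ), ?_⟩
  have hx := h.x0
  have h1 := smul_ne0 hx τ
  have h2 := smul_ne0 hx σ
  rw [smul_div₀', mul_smul]
  field_simp

lemma TR.hom_zpow (h : TR p A B x) {σ : Γ} (hσ : σ ∈ A) (i : ℤ) :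
    ∃ θ, VV A B θ ∧ (σ ^ i) • x / x = (σ • x / x) ^ i * θ := by
  have hx := h.x0
  have h2 := smul_ne0 hx σ
  induction i with
  | zero => exact ⟨1, VV.one, by simp [hx]⟩
  | succ i ih =>
    obtain ⟨θ, hθ, he⟩ := ih
    obtain ⟨θ', hθ', he'⟩ := h.hom (A.zpow_mem hσ i) hσ
    refine ⟨θ * θ', hθ.mul hθ', ?_⟩
    rw [zpow_add_one, he', he, zpow_add_one₀ (div_ne_zero h2 hx)]
    ring
  | pred i ih =>
    obtain ⟨θ, hθ, he⟩ := ih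
    obtain ⟨θ', hθ', he'⟩ := h.hom (A.zpow_mem hσ (-(i : ℤ) - 1)) hσ
    refine ⟨θ / θ', hθ.div hθ', ?_⟩
    rw [← zpow_add_one, sub_add_cancel, he] at he'
    rw [zpow_sub_one₀ (div_ne_zero h2 hx)]
    have h3 := hθ'.ne_zero
    field_simp at he' ⊢
    linear_combination -he'

end tr

end LT

namespace LT

set_option linter.unusedSectionVars false

section tr

variable {Γ Ω : Type*} [Group Γ] [NormedField Ω] [MulSemiringAction Γ Ω] [NInv Γ Ω]
variable {p : ℕ} {A B H : Subgroup Γ} {x : Ω}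

/-- Hilbert 90 for a prime cyclic step -/
lemma TR.h90 (h : TR p A B x) {s : Γ} {l : ℕ} (hs : s ∈ A) (hl : l.Prime) (hsl : s ^ l ∈ B)
    (hT : Trv A B (fun i : Fin l => s ^ (i : ℕ))) {y : Ω} (hy : y ∈ FF Ω B) (hN : rN A B y = 1) :
    ∃ c ∈ FF Ω B, c ≠ 0 ∧ y = s • c / c := by
  have hidx : B.relIndex A = l := by rw [← hT.card]; simp
  have hnzs : ∀ k : ℕ, Nz (s ^ k) B := fun k => h.nz (A.pow_mem hs k)
  -- the conjugates of x are distinct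
  have hsx : s • x ≠ x := by
    intro hfix
    have hxA : x ∈ FF Ω A := by
      rw [mem_FF]
      intro a ha
      obtain ⟨i, hi, _⟩ := hT.2 a ha
      rw [smul_eq_of_FF h.mem hi]
      change s ^ (i : ℕ) • x = x
      generalize (i : ℕ) = k
      induction k with
      | zero => simp
      | succ k ih => rw [pow_succ, mul_smul, hfix, ih]
    obtain ⟨i, hi⟩ := h.valA x hxA h.x0
    rw [hidx] at hi
    have h1 : ‖x‖ ^ (1 : ℤ) = ‖x‖ ^ ((l : ℤ) * i) := by rw [zpow_one]; exact hi
    have := zpow_right_injective₀ h.pos h.lt.ne h1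
    have h2 : (l : ℤ) ∣ 1 := ⟨i, this⟩
    have h3 := Int.eq_one_of_dvd_one (by positivity) h2
    have := hl.one_lt
    omega
  have hinj : Function.Injective (fun i : Fin l => s ^ (i : ℕ) • x) := by
    have key : ∀ i j : ℕ, i < j → j < l → s ^ i • x = s ^ j • x → False := by
      intro i j hij hjl he
      obtain ⟨m, rfl⟩ := Nat.exists_eq_add_of_lt hij
      set d := m + 1 with hd
      have hdx : s ^ d • x = x := by
        have : s ^ (i + m + 1) = s ^ i * s ^ d := by rw [← pow_add]; congr 1
        rw [this, mul_smul] at he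
        exact (smul_left_cancel _ he).symm
      have hcop : Nat.Coprime d l := (Nat.coprime_of_lt_prime (by omega) (by omega) hl).symm
      have hb := Nat.gcd_eq_gcd_ab d l
      rw [hcop] at hb
      have h1 : s = (s ^ d) ^ (d.gcdA l) * (s ^ l) ^ (d.gcdB l) := by
        rw [← zpow_natCast, ← zpow_natCast, ← zpow_mul, ← zpow_mul, ← zpow_add, ← hb]
        simp
      apply hsx
      rw [h1, mul_smul, mem_FF.1 h.mem _ (B.zpow_mem hsl _)]
      have : s ^ d ∈ MulAction.stabilizer Γ x := hdx
      exact (MulAction.stabilizer Γ x).zpow_mem this _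
    intro i j hij
    rcases lt_trichotomy (i : ℕ) j with h1 | h1 | h1
    · exact (key _ _ h1 j.2 hij).elim
    · exact Fin.ext h1
    · exact (key _ _ h1 i.2 hij.symm).elim
  let b : ℕ → Ω := fun i => ∏ k ∈ Finset.range i, s ^ k • y
  have hbl : b l = 1 := by
    rw [← hN, rN_eq_prod hT hy]
    exact (Fin.prod_univ_eq_prod_range (fun k => s ^ k • y) l).symm
  have hbs : ∀ i, y * s • b i = b (i + 1) := by
    intro i
    simp only [b]
    rw [Finset.prod_range_succ', Finset.smul_prod', mul_comm]
    simp [← mul_smul, ← pow_succ']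
  have hb_mem : ∀ i, b i ∈ FF Ω B := fun i => prod_mem fun k _ => (hnzs k).smul_mem hy
  let c : ℕ → Ω := fun k => ∑ i ∈ Finset.range l, b i * s ^ i • (x ^ k)
  have hex : ∃ k, c k ≠ 0 := by
    by_contra hcon
    push Not at hcon
    have := Matrix.eq_zero_of_forall_pow_sum_mul_pow_eq_zero
      (f := fun i : Fin l => s ^ (i : ℕ) • x) (v := fun i : Fin l => b i) hinj (by
        intro j
        have h1 := hcon j
        simp only [c] at h1
        rw [← Fin.sum_univ_eq_sum_range (fun i => b i * s ^ i • (x ^ (j : ℕ))) l] at h1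
        rw [← h1]
        refine Finset.sum_congr rfl fun i _ => ?_
        rw [smul_pow'])
    have h0 := congrFun this ⟨0, hl.pos⟩
    simp [b] at h0
  obtain ⟨k, hk⟩ := hex
  have hck : c k ∈ FF Ω B :=
    sum_mem fun i _ => mul_mem (hb_mem i) ((hnzs i).smul_mem (pow_mem h.mem k))
  have hyc : y * s • c k = c k := by
    simp only [c]
    rw [Finset.smul_sum, Finset.mul_sum]
    have h1 : ∀ i ∈ Finset.range l, y * s • (b i * s ^ i • x ^ k) =
        b (i + 1) * s ^ (i + 1) • x ^ k := by
      intro i _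
      rw [smul_mul', ← mul_assoc, hbs, pow_succ' s, mul_smul s]
    rw [Finset.sum_congr rfl h1]
    have h2 := Finset.sum_range_succ (fun i => b i * s ^ i • x ^ k) l
    have h3 := Finset.sum_range_succ' (fun i => b i * s ^ i • x ^ k) l
    rw [h3] at h2
    have h4 : b l * s ^ l • x ^ k = b 0 * s ^ 0 • x ^ k := by
      rw [hbl, mem_FF.1 (pow_mem h.mem k) _ hsl]; simp [b]
    rw [h4] at h2
    exact add_right_cancel h2
  refine ⟨(c k)⁻¹, inv_mem hck, inv_ne_zero hk, ?_⟩
  have hsc := smul_ne0 hk s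
  rw [smul_inv'']
  field_simp
  linear_combination hyc

section ns
variable [IsUltrametricDist Ω] [IsAlgClosed Ω] [CharZero Ω] [TeichP p Ω]

/-- lifting of `VV` -/
lemma TR.lift_VV (h : TR p A B x) (hBH : B ≤ H) (hHA : H ≤ A) {θ : Ω} (hθ : VV A H θ) :
    ∃ θ', VV A B θ' ∧ rN H B θ' = θ := by
  have hd := h.down hBH hHA
  have hup := h.up hBH hHA
  induction hθ with
  | one => exact ⟨1, VV.one, rN_one hd.fin⟩
  | @mul_gen θ η τ hθ hτ hη h1 ih =>
    obtain ⟨θ', hθ', he⟩ := ih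
    obtain ⟨ξ, hξ, hξ1, hξη⟩ := hd.ns hη h1
    refine ⟨_, hθ'.mul_gen hτ hξ hξ1, ?_⟩
    have hτB := h.nz hτ
    rw [rN_mul hd.fin (hθ'.mem fun a ha => h.nz ha) (div_mem (hτB.smul_mem hξ) hξ),
      rN_div hd.fin (hτB.smul_mem hξ) hξ, rN_smul hd.fin (hup.nz hτ) hτB hξ, he, hξη]

/-- elements of norm one -/
theorem TR.hm1 (h : TR p A B x) {y : Ω} (hy : y ∈ FF Ω B) (hy1 : ‖y‖ = 1) (hN : rN A B y = 1) :
    ∃ σ ∈ A, ∃ θ, VV A B θ ∧ y = (σ • x / x) * θ := by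
  induction hn : B.relIndex A using Nat.strong_induction_on generalizing B x y with
  | _ n ih =>
    by_cases h1 : B.relIndex A = 1
    · have hAB : A ≤ B := Subgroup.relIndex_eq_one.1 h1
      obtain rfl := le_antisymm hAB h.le
      refine ⟨1, A.one_mem, 1, VV.one, ?_⟩
      rw [rN_self hy] at hN
      rw [hN, one_smul, div_self h.x0, one_mul]
    · obtain ⟨H, s, l, hBH, hHA, hsH, hl, hsl, hT⟩ := h.exists_prime h1
      have hd := h.down hBH hHA
      have hup := h.up hBH hHA
      have hidx : B.relIndex H = l := by rw [← hT.card]; simp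
      have hlt : H.relIndex A < n := by
        rw [← hn, ← h.idx hBH hHA, hidx]
        have := hl.one_lt
        have := Nat.pos_of_ne_zero hup.fin
        nlinarith
      have hy0 : y ≠ 0 := by intro h; simp [h] at hy1
      obtain ⟨σ, hσ, θ, hθ, he⟩ := ih _ hlt hup (rN_mem hd.fin hy)
        (by rw [norm_rN hd.fin hy, hy1, one_pow])
        (by rw [← rN_tower' hHA hBH hup.fin hd.fin hy, hN]) rfl
      obtain ⟨θ', hθ', hθe⟩ := h.lift_VV hBH hHA hθ
      have hσB := h.nz hσ
      have hθB : θ' ∈ FF Ω B := hθ'.mem fun a ha => h.nz ha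
      have hgB := h.gx_mem hσ
      have hg0 : σ • x / x ≠ 0 := div_ne_zero (smul_ne0 h.x0 σ) h.x0
      have hNg : rN H B (σ • x / x * θ') = rN H B y := by
        rw [rN_mul hd.fin hgB hθB, rN_div hd.fin (hσB.smul_mem h.mem) h.mem,
          rN_smul hd.fin (hup.nz hσ) hσB h.mem, hθe, he]
      obtain ⟨c, hc, hc0, hyc⟩ := hd.h90 hsH hl hsl hT (y := y / (σ • x / x * θ'))
        (div_mem hy (mul_mem hgB hθB)) (by
          rw [rN_div hd.fin hy (mul_mem hgB hθB), hNg, div_self (rN_ne_zero hd.fin hy hy0)])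
      obtain ⟨i, hi⟩ := h.valB c hc hc0
      -- c = x ^ i * η
      have hη1 : ‖c / x ^ i‖ = 1 := by
        rw [norm_div, norm_zpow, hi, div_self (zpow_ne_zero _ h.pos.ne')]
      have hηB : c / x ^ i ∈ FF Ω B := div_mem hc (zpow_mem h.mem i)
      obtain ⟨θ1, hθ1, he1⟩ := h.hom_zpow (hHA hsH) i
      obtain ⟨θ2, hθ2, he2⟩ := h.hom hσ (A.zpow_mem (hHA hsH) i)
      have hθ3 : VV A B (s • (c / x ^ i) / (c / x ^ i)) := VV.gen (hHA hsH) hηB hη1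
      refine ⟨σ * s ^ i, A.mul_mem hσ (A.zpow_mem (hHA hsH) i),
        θ' * (s • (c / x ^ i) / (c / x ^ i)) / (θ1 * θ2), (hθ'.mul hθ3).div (hθ1.mul hθ2), ?_⟩
      rw [he2, he1]
      have e1 : y = (σ • x / x * θ') * (s • c / c) := by
        rw [← hyc]
        exact (mul_div_cancel₀ _ (mul_ne_zero hg0 hθ'.ne_zero)).symm
      have hx0 := h.x0
      have e2 : s • (c / x ^ i) / (c / x ^ i) * (s • x / x) ^ i = s • c / c := by
        have hsx := smul_ne0 hx0 s
        have : s • (x ^ i) = (s • x) ^ i :=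
          map_zpow₀ (MulSemiringAction.toRingHom Γ Ω s) x i
        rw [smul_div₀', this, div_zpow]
        have h5 := zpow_ne_zero i hsx
        have h6 := zpow_ne_zero i hx0
        field_simp
      rw [e1, ← e2]
      have h3 := hθ1.ne_zero
      have h4 := hθ2.ne_zero
      field_simp

end ns

/-- for a cyclic quotient all elements of `VV` are `g η / η` -/
lemma VV.cyc {g : Γ} (hg : g ∈ A) (hnz : ∀ a ∈ A, Nz a H) (hgen : ∀ a ∈ A, ∃ i : ℕ, (g ^ i)⁻¹ * a ∈ H)
    {θ : Ω} (hθ : VV A H θ) : ∃ η ∈ FF Ω H, ‖η‖ = 1 ∧ θ = g • η / η := by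
  induction hθ with
  | one => exact ⟨1, one_mem _, by simp, by simp⟩
  | @mul_gen θ η τ hθ hτ hη h1 ih =>
    obtain ⟨η', hη', hη1, he⟩ := ih
    obtain ⟨i, hi⟩ := hgen τ hτ
    refine ⟨η' * ∏ k ∈ Finset.range i, g ^ k • η, mul_mem hη' (prod_mem fun k _ =>
      (hnz _ (A.pow_mem hg k)).smul_mem hη), ?_, ?_⟩
    · rw [norm_mul, hη1, norm_prod]; simp [h1]
    · have hη0 : η ≠ 0 := by intro h; simp [h] at h1
      rw [he, smul_eq_of_FF hη hi, smul_mul', Finset.smul_prod', mul_div_mul_comm]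
      congr 1
      have hp : (∏ k ∈ Finset.range i, g ^ k • η) ≠ 0 :=
        Finset.prod_ne_zero_iff.2 fun k _ => smul_ne0 hη0 _
      rw [div_eq_div_iff hη0 hp]
      have h2 := Finset.prod_range_succ (fun k => g ^ k • η) i
      rw [Finset.prod_range_succ'] at h2
      simp only [pow_zero, one_smul, pow_succ' g, mul_smul g] at h2
      rw [h2]; ring

theorem TR.inj (h : TR p A B x) {σ : Γ} (hσ : σ ∈ A) (hV : VV A B (σ • x / x)) : σ ∈ B := by
  by_contra hσB
  -- the quotient group
  have hnorm : (B.subgroupOf A).Normal := by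
    refine ⟨fun n hn g => ?_⟩
    have := (h.nz (A.inv_mem g.2) n.1).1 hn
    simpa [Subgroup.mem_subgroupOf] using this
  let Q := A ⧸ B.subgroupOf A
  letI : CommGroup Q :=
    { (inferInstance : Group Q) with
      mul_comm := by
        intro a b
        obtain ⟨a, rfl⟩ := QuotientGroup.mk_surjective a
        obtain ⟨b, rfl⟩ := QuotientGroup.mk_surjective b
        change (QuotientGroup.mk (a * b) : Q) = QuotientGroup.mk (b * a)
        rw [QuotientGroup.eq, Subgroup.mem_subgroupOf]
        have := h.comm _ (A.inv_mem b.2) _ (A.inv_mem a.2)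
        simpa [mul_assoc] using this }
  have : Finite Q := Nat.finite_of_card_ne_zero h.fin
  have hne : (QuotientGroup.mk ⟨σ, hσ⟩ : Q) ≠ 1 := by
    intro h0
    apply hσB
    have := (QuotientGroup.eq_one_iff _).1 h0
    simpa [Subgroup.mem_subgroupOf] using this
  obtain ⟨χ, hχ⟩ := CommGroup.exists_apply_ne_one_of_hasEnoughRootsOfUnity Q ℂ hne
  let ψ : A →* ℂˣ := χ.comp (QuotientGroup.mk' (B.subgroupOf A))
  let H : Subgroup Γ := ψ.ker.map A.subtype
  have hH : ∀ a (ha : a ∈ A), a ∈ H ↔ ψ ⟨a, ha⟩ = 1 := by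
    intro a ha
    simp only [H, Subgroup.mem_map, MonoidHom.mem_ker]
    constructor
    · rintro ⟨b, hb, rfl⟩; exact hb
    · intro h1; exact ⟨⟨a, ha⟩, h1, rfl⟩
  have hBH : B ≤ H := by
    intro b hb
    rw [hH b (h.le hb)]
    have : (QuotientGroup.mk' (B.subgroupOf A)) ⟨b, h.le hb⟩ = 1 := by
      rw [QuotientGroup.mk'_apply, QuotientGroup.eq_one_iff]
      exact hb
    simp only [ψ, MonoidHom.comp_apply, this]
    exact map_one χ
  have hHA : H ≤ A := by
    rintro _ ⟨b, _, rfl⟩; exact b.2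
  have hσH : σ ∉ H := by
    rw [hH σ hσ]; exact hχ
  -- cyclic range
  have hfin : Finite ψ.range := by
    have : (ψ.range : Set ℂˣ) ⊆ Set.range χ := by
      rintro _ ⟨a, rfl⟩; exact ⟨_, rfl⟩
    exact (Set.finite_range χ).subset this
  obtain ⟨⟨_, ⟨⟨g, hg⟩, rfl⟩⟩, hgg⟩ := (inferInstance : IsCyclic ψ.range).exists_generator
  have hgen : ∀ a ∈ A, ∃ i : ℕ, (g ^ i)⁻¹ * a ∈ H := by
    intro a ha
    have h1 := hgg ⟨ψ ⟨a, ha⟩, ⟨_, rfl⟩⟩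
    rw [← mem_powers_iff_mem_zpowers] at h1
    obtain ⟨i, hi⟩ := h1
    refine ⟨i, ?_⟩
    have hm : (g ^ i)⁻¹ * a ∈ A := A.mul_mem (A.inv_mem (A.pow_mem hg i)) ha
    rw [hH _ hm]
    have h2 : (⟨(g ^ i)⁻¹ * a, hm⟩ : A) = (⟨g, hg⟩ ^ i)⁻¹ * ⟨a, ha⟩ := rfl
    have h3 : ψ ⟨g, hg⟩ ^ i = ψ ⟨a, ha⟩ := by simpa using congrArg Subtype.val hi
    rw [h2, map_mul, map_inv, map_pow, h3, inv_mul_cancel]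
  have hd := h.down hBH hHA
  have hup := h.up hBH hHA
  set xH := rN H B x with hxH
  -- push down
  have hpush : ∀ θ : Ω, VV A B θ → VV A H (rN H B θ) := by
    intro θ hθ
    induction hθ with
    | one => rw [rN_one hd.fin]; exact VV.one
    | @mul_gen θ η τ hθ hτ hη h1 ih =>
      have hτB := h.nz hτ
      rw [rN_mul hd.fin (hθ.mem fun a ha => h.nz ha) (div_mem (hτB.smul_mem hη) hη),
        rN_div hd.fin (hτB.smul_mem hη) hη, rN_smul hd.fin (hup.nz hτ) hτB hη]
      exact ih.mul_gen hτ (rN_mem hd.fin hη) (by rw [norm_rN hd.fin hη, h1, one_pow])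
  have hVH : VV A H (σ • xH / xH) := by
    have := hpush _ hV
    rwa [rN_div hd.fin ((h.nz hσ).smul_mem h.mem) h.mem, rN_smul hd.fin (hup.nz hσ) (h.nz hσ) h.mem]
      at this
  obtain ⟨η, hη, hη1, he⟩ := hVH.cyc hg (fun a ha => hup.nz ha) hgen
  obtain ⟨i, hi⟩ := hgen σ hσ
  have hη0 : η ≠ 0 := by intro h; simp [h] at hη1
  have hxH0 := hup.x0
  let z : Ω := ∏ k ∈ Finset.range i, g ^ k • xH
  have hz0 : z ≠ 0 := Finset.prod_ne_zero_iff.2 fun k _ => smul_ne0 hxH0 _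
  have hzH : z ∈ FF Ω H := prod_mem fun k _ => (hup.nz (A.pow_mem hg k)).smul_mem hup.mem
  have hgz : g • z / z = σ • xH / xH := by
    rw [smul_eq_of_FF hup.mem hi, div_eq_div_iff hz0 hxH0]
    have h2 := Finset.prod_range_succ (fun k => g ^ k • xH) i
    rw [Finset.prod_range_succ'] at h2
    simp only [pow_zero, one_smul, pow_succ' g, mul_smul g] at h2
    simp only [z]
    rw [Finset.smul_prod', h2]; ring
  have hfix : z / η ∈ FF Ω A := by
    rw [mem_FF]
    have hg1 : g • (z / η) = z / η := by
      rw [smul_div₀', div_eq_div_iff (smul_ne0 hη0 g) hη0]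
      rw [← hgz, div_eq_div_iff hz0 hη0] at he
      linear_combination he
    intro a ha
    obtain ⟨j, hj⟩ := hgen a ha
    rw [smul_eq_of_FF (div_mem hzH hη) hj]
    have : g ∈ MulAction.stabilizer Γ (z / η) := hg1
    exact (MulAction.stabilizer Γ (z / η)).pow_mem this j
  obtain ⟨j, hj⟩ := hup.valA _ hfix (div_ne_zero hz0 hη0)
  have hzn : ‖z / η‖ = ‖xH‖ ^ (i : ℤ) := by
    rw [norm_div, hη1, div_one, norm_prod]; simp
  rw [hzn] at hj
  have hij := zpow_right_injective₀ hup.pos hup.lt.ne hj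
  -- g ^ i ∈ H
  apply hσH
  have hdvd : H.relIndex A ∣ i := by
    have : (H.relIndex A : ℤ) ∣ i := ⟨j, hij⟩
    exact_mod_cast this
  have hgi : g ^ i ∈ H := by
    obtain ⟨m, rfl⟩ := hdvd
    have hnH : (H.subgroupOf A).Normal := by
      refine ⟨fun n hn g => ?_⟩
      have := (hup.nz (A.inv_mem g.2) n.1).1 hn
      simpa [Subgroup.mem_subgroupOf] using this
    have := Subgroup.pow_index_mem (H.subgroupOf A) ⟨g, hg⟩
    rw [pow_mul]
    exact H.pow_mem this m
  have := H.mul_mem hgi hi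
  simpa using this

end tr

end LT

namespace LT

set_option linter.unusedSectionVars false

section frob

variable {Γ Ω : Type*} [Group Γ] [NormedField Ω] [MulSemiringAction Γ Ω] [NInv Γ Ω]
variable {p : ℕ} {A B H : Subgroup Γ} {x : Ω}

/-- `φ` acts as the `q`-Frobenius on Teichmueller representatives -/
def IsFrob (p : ℕ) (Ω : Type*) [NormedField Ω] [MulSemiringAction Γ Ω] (q : ℕ) (φ : Γ) : Prop :=
  (∃ r : ℕ, r ≠ 0 ∧ q = p ^ r) ∧ ∀ z : Ω, IsT p z → φ • z = z ^ q

lemma IsFrob.ne_zero {q : ℕ} {φ : Γ} (h : IsFrob p Ω q φ) (hp : p.Prime) : q ≠ 0 := by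
  obtain ⟨⟨r, hr, rfl⟩, _⟩ := h
  exact pow_ne_zero _ hp.ne_zero

lemma IsFrob.two_le {q : ℕ} {φ : Γ} (h : IsFrob p Ω q φ) (hp : p.Prime) : 2 ≤ q := by
  obtain ⟨⟨r, hr, rfl⟩, _⟩ := h
  exact hp.two_le.trans (Nat.le_self_pow hr p)

lemma IsFrob.pow_smul {q : ℕ} {φ : Γ} (h : IsFrob p Ω q φ) (hp : p.Prime) {z : Ω} (hz : IsT p z)
    (i : ℕ) : φ ^ i • z = z ^ (q ^ i) := by
  induction i with
  | zero => simp
  | succ i ih =>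
    rw [pow_succ', mul_smul, ih, h.2 _ (hz.pow (pow_ne_zero i (h.ne_zero hp))), ← pow_mul, pow_succ]

lemma IsFrob.mul_left {q : ℕ} {φ σ : Γ} (h : IsFrob p Ω q φ) (hp : p.Prime)
    (hσ : ∀ z : Ω, IsT p z → σ • z = z) : IsFrob p Ω q (σ * φ) := by
  refine ⟨h.1, fun z hz => ?_⟩
  rw [mul_smul, h.2 z hz, hσ _ (hz.pow (h.ne_zero hp))]

section ns
variable [IsUltrametricDist Ω] [IsAlgClosed Ω] [CharZero Ω] [TeichP p Ω]

lemma coprime_pow_sub_one {p r : ℕ} (hp : p.Prime) (hr : r ≠ 0) : (p ^ r - 1).Coprime p := by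
  have h2 : 2 ≤ p ^ r := hp.two_le.trans (Nat.le_self_pow hr p)
  have h1 : (p ^ r - 1).Coprime (p ^ r) := by
    have : p ^ r = (p ^ r - 1) + 1 := by omega
    conv_rhs => rw [this]
    simp
  exact Nat.Coprime.coprime_dvd_right (dvd_pow_self p hr) h1

/-- choose a root of unity making a linearized polynomial a unit -/
lemma poly {q d : ℕ} (hq : ∃ r : ℕ, r ≠ 0 ∧ q = p ^ r) (hd : 0 < d) (b : ℕ → Ω)
    (hb : ∀ i, ‖b i‖ ≤ 1) (hb0 : ‖b 0‖ = 1) :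
    ∃ ζ : Ω, IsT p ζ ∧ ζ ^ (q ^ d) = ζ ∧ ‖∑ i ∈ Finset.range d, b i * ζ ^ (q ^ i)‖ = 1 := by
  obtain ⟨r, hr, rfl⟩ := hq
  have hpp : p.Prime := TeichP.prime Ω
  set q := p ^ r with hq
  have hq2 : 2 ≤ q := hpp.two_le.trans (Nat.le_self_pow hr p)
  have hqd : 2 ≤ q ^ d := hq2.trans (Nat.le_self_pow hd.ne' q)
  set N := q ^ d - 1 with hN
  have hN0 : N ≠ 0 := by omega
  have hcop : N.Coprime p := by
    rw [hN, hq, ← pow_mul]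
    exact coprime_pow_sub_one hpp (Nat.mul_ne_zero hr hd.ne')
  have hprim : ∃ ζ : Ω, IsPrimitiveRoot ζ N := by
    have : NeZero (N : Ω) := ⟨by exact_mod_cast hN0⟩
    exact HasEnoughRootsOfUnity.exists_primitiveRoot Ω N
  obtain ⟨ε, hε⟩ := hprim
  have hεT : ∀ j : ℕ, IsT p (ε ^ j) := fun j => Or.inr ⟨N, by omega, hcop, by
    rw [← pow_mul, mul_comm, pow_mul, hε.pow_eq_one, one_pow]⟩
  have hεn : ∀ j : ℕ, ‖ε ^ j‖ = 1 := fun j => by rw [norm_pow, norm_rootOne hN0 hε.pow_eq_one, one_pow]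
  by_contra hcon
  push Not at hcon
  let S : ℕ → Ω := fun j => ∑ i ∈ Finset.range d, b i * (ε ^ j) ^ (q ^ i)
  have hSlt : ∀ j, ‖S j‖ < 1 := by
    intro j
    refine lt_of_le_of_ne (u_sum _ zero_le_one fun i _ => ?_) (hcon (ε ^ j) (hεT j) ?_)
    · rw [norm_mul, norm_pow, hεn, one_pow, mul_one]; exact hb i
    · have : q ^ d = N + 1 := by omega
      rw [this, pow_succ, ← pow_mul, mul_comm j N, pow_mul, hε.pow_eq_one, one_pow, one_mul]
  have hsum : ∑ j ∈ Finset.range N, (ε ^ j) ^ (N - 1) * S j = N * b 0 := by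
    have h1 : ∀ j, (ε ^ j) ^ (N - 1) * S j =
        ∑ i ∈ Finset.range d, b i * (ε ^ (N - 1 + q ^ i)) ^ j := by
      intro j
      simp only [S]
      rw [Finset.mul_sum]
      refine Finset.sum_congr rfl fun i _ => ?_
      rw [← pow_mul ε (N - 1 + q ^ i), mul_comm (N - 1 + q ^ i) j, pow_mul, pow_add]
      ring
    rw [Finset.sum_congr rfl fun j _ => h1 j, Finset.sum_comm]
    rw [Finset.sum_eq_single 0]
    · rw [← Finset.mul_sum, pow_zero, Nat.sub_add_cancel (by omega), hε.pow_eq_one]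
      simp [mul_comm]
    · intro i hi hi0
      rw [← Finset.mul_sum]
      convert mul_zero _
      have hid : i < d := Finset.mem_range.1 hi
      have h2 : q ^ i < q ^ d := Nat.pow_lt_pow_right (by omega) hid
      have h3 : q ≤ q ^ i := Nat.le_self_pow hi0 q
      have hne : ε ^ (N - 1 + q ^ i) ≠ 1 := by
        intro h
        have h5 := (hε.pow_eq_one_iff_dvd _).1 h
        have h6 : N - 1 + q ^ i = N + (q ^ i - 1) := by omega
        rw [h6, Nat.dvd_add_right (dvd_refl N)] at h5
        have := Nat.le_of_dvd (by omega) h5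
        omega
      have h7 : (ε ^ (N - 1 + q ^ i)) ^ N = 1 := by
        rw [← pow_mul, mul_comm, pow_mul, hε.pow_eq_one, one_pow]
      have h8 := mul_neg_geom_sum (ε ^ (N - 1 + q ^ i)) N
      rw [h7, sub_self] at h8
      exact (mul_eq_zero.1 h8).resolve_left (sub_ne_zero.2 hne.symm)
    · intro h; exact absurd (Finset.mem_range.2 hd) h
  have hlt : ‖∑ j ∈ Finset.range N, (ε ^ j) ^ (N - 1) * S j‖ < 1 := by
    refine u_sum_lt _ one_pos fun j _ => ?_
    rw [norm_mul, norm_pow, hεn, one_pow, one_mul]; exact hSlt j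
  rw [hsum, norm_mul, hb0, u_coprime hcop TeichP.lt, mul_one] at hlt
  exact lt_irrefl _ hlt

/-- Frobenius-invariant elements of given norm -/
lemma unif {q : ℕ} {φ : Γ} (hφ : IsFrob p Ω q φ) {d : ℕ} (hd : 0 < d) {x0 : Ω} (h0 : x0 ≠ 0)
    (hx0 : φ ^ d • x0 = x0) :
    ∃ ζ : Ω, IsT p ζ ∧ φ • (∑ i ∈ Finset.range d, φ ^ i • (ζ * x0)) =
      (∑ i ∈ Finset.range d, φ ^ i • (ζ * x0)) ∧ ‖∑ i ∈ Finset.range d, φ ^ i • (ζ * x0)‖ = ‖x0‖ := by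
  have hpp : p.Prime := TeichP.prime Ω
  have hn0 : ‖x0‖ ≠ 0 := norm_ne_zero_iff.2 h0
  obtain ⟨ζ, hζ, hζd, hζ1⟩ := poly (p := p) hφ.1 hd (fun i => φ ^ i • x0 / x0)
    (fun i => by rw [norm_div, norm_act, div_self hn0]) (by simp [hn0])
  refine ⟨ζ, hζ, ?_, ?_⟩
  · rw [Finset.smul_sum]
    have h2 := Finset.sum_range_succ (fun i => φ ^ i • (ζ * x0)) d
    have h3 := Finset.sum_range_succ' (fun i => φ ^ i • (ζ * x0)) d
    rw [h3] at h2
    have h4 : φ ^ d • (ζ * x0) = φ ^ 0 • (ζ * x0) := by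
      rw [smul_mul', hx0, hφ.pow_smul hpp hζ, hζd]; simp
    rw [h4] at h2
    have := add_right_cancel h2
    rw [← this]
    refine Finset.sum_congr rfl fun i _ => ?_
    rw [pow_succ', mul_smul]
  · have : ∑ i ∈ Finset.range d, φ ^ i • (ζ * x0) =
        x0 * ∑ i ∈ Finset.range d, (φ ^ i • x0 / x0) * ζ ^ (q ^ i) := by
      rw [Finset.mul_sum]
      refine Finset.sum_congr rfl fun i _ => ?_
      rw [smul_mul', hφ.pow_smul hpp hζ]
      field_simp
    rw [this, norm_mul, hζ1, mul_one]

/-- Hilbert 90 for units -/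
lemma h90u {q : ℕ} {φ : Γ} (hφ : IsFrob p Ω q φ) {d : ℕ} (hd : 0 < d) {u : Ω} (hu1 : ‖u‖ = 1)
    (hud : φ ^ d • u = u) (hN : ∏ i ∈ Finset.range d, φ ^ i • u = 1)
    (hA : Nz φ A) (hT : ∀ z : Ω, IsT p z → z ∈ FF Ω A) (hu : u ∈ FF Ω A) :
    ∃ w ∈ FF Ω A, ‖w‖ = 1 ∧ φ ^ d • w = w ∧ u = φ • w / w := by
  have hpp : p.Prime := TeichP.prime Ω
  let c : ℕ → Ω := fun i => ∏ k ∈ Finset.range i, φ ^ k • u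
  have hcn : ∀ i, ‖c i‖ = 1 := fun i => by simp [c, norm_prod, hu1]
  have hcs : ∀ i, u * φ • c i = c (i + 1) := by
    intro i
    simp only [c]
    rw [Finset.prod_range_succ', Finset.smul_prod', mul_comm]
    simp [← mul_smul, ← pow_succ']
  have hcA : ∀ i, c i ∈ FF Ω A := fun i => prod_mem fun k _ => (hA.pow k).smul_mem hu
  have hcd : ∀ i, φ ^ d • c i = c i := by
    intro i
    simp only [c, Finset.smul_prod']
    refine Finset.prod_congr rfl fun k _ => ?_
    rw [← mul_smul, ← pow_add, add_comm, pow_add, mul_smul, hud]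
  obtain ⟨ζ, hζ, hζd, hζ1⟩ := poly (p := p) hφ.1 hd c (fun i => (hcn i).le) (hcn 0)
  set w : Ω := ∑ i ∈ Finset.range d, c i * ζ ^ (q ^ i) with hw
  have hTi : ∀ i, IsT p (ζ ^ (q ^ i)) := fun i => hζ.pow (pow_ne_zero i (hφ.ne_zero hpp))
  have hw0 : w ≠ 0 := by intro h; rw [h] at hζ1; simp at hζ1
  have hwA : w ∈ FF Ω A := sum_mem fun i _ => mul_mem (hcA i) (hT _ (hTi i))
  have hwu : u * φ • w = w := by
    rw [hw, Finset.smul_sum, Finset.mul_sum]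
    have h2 := Finset.sum_range_succ (fun i => c i * ζ ^ (q ^ i)) d
    have h3 := Finset.sum_range_succ' (fun i => c i * ζ ^ (q ^ i)) d
    rw [h3] at h2
    have h4 : c d * ζ ^ (q ^ d) = c 0 * ζ ^ (q ^ 0) := by
      rw [hζd]; simp only [c]; rw [hN]; simp
    rw [h4] at h2
    have := add_right_cancel h2
    rw [← this]
    refine Finset.sum_congr rfl fun i _ => ?_
    rw [smul_mul', ← mul_assoc, hcs, hφ.2 _ (hTi i), ← pow_mul, pow_succ]
  refine ⟨w⁻¹, inv_mem hwA, by rw [norm_inv, hζ1, inv_one], ?_, ?_⟩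
  · rw [smul_inv'', hw, Finset.smul_sum]
    congr 1
    refine Finset.sum_congr rfl fun i _ => ?_
    rw [smul_mul', hcd, hφ.pow_smul hpp (hTi i), ← pow_mul, mul_comm (q ^ i), pow_mul, hζd]
  · have := smul_ne0 hw0 φ
    rw [smul_inv'']
    field_simp
    linear_combination hwu

end ns

/-- changing the uniformizer -/
lemma TR.change (h : TR p A B x) {y : Ω} (hy : y ∈ FF Ω B) (hn : ‖y‖ = ‖x‖) : TR p A B y :=
  ⟨h.le, h.comm, h.fin, hy, by rw [hn]; exact h.pos, by rw [hn]; exact h.lt,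
    by rw [hn]; exact h.valB, by rw [hn]; exact h.valA, h.tei⟩

end frob

/-- all elements are periodic -/
class Per (Γ Ω : Type*) [Group Γ] [NormedField Ω] [MulSemiringAction Γ Ω] : Prop where
  per : ∀ (γ : Γ) (x : Ω), ∃ d : ℕ, 0 < d ∧ γ ^ d • x = x

section comm
variable {Γ : Type*} [Group Γ] {G A B : Subgroup Γ}

/-- commutators of `G` are in `B` -/
def Ab (G B : Subgroup Γ) : Prop := ∀ a ∈ G, ∀ b ∈ G, a * b * a⁻¹ * b⁻¹ ∈ B

lemma Ab.nz (h : Ab G B) (hBA : B ≤ A) (hAG : A ≤ G) {g : Γ} (hg : g ∈ G) : Nz g A := by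
  have key : ∀ c ∈ G, ∀ b ∈ A, c⁻¹ * b * c ∈ A := by
    intro c hc b hb
    have := A.mul_mem (hBA (h _ (G.inv_mem hc) _ (hAG hb))) hb
    simpa [mul_assoc] using this
  intro y
  constructor
  · exact key g hg y
  · intro hy
    have := key _ (G.inv_mem hg) _ hy
    simpa [mul_assoc] using this

lemma Ab.swap {Ω : Type*} [NormedField Ω] [MulSemiringAction Γ Ω] (h : Ab G B) {a b : Γ} (ha : a ∈ G) (hb : b ∈ G) {x : Ω} (hx : x ∈ FF Ω B) :
    a • b • x = b • a • x := by
  rw [← mul_smul, ← mul_smul]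
  refine smul_eq_of_FF hx ?_
  have := h _ (G.inv_mem ha) _ (G.inv_mem hb)
  simpa [mul_assoc] using this

end comm

end LT

namespace LT

set_option linter.unusedSectionVars false

section main

variable {Γ Ω : Type*} [Group Γ] [NormedField Ω] [MulSemiringAction Γ Ω] [NInv Γ Ω]
variable {p : ℕ} {G A B H : Subgroup Γ} {x : Ω}
variable [IsUltrametricDist Ω] [IsAlgClosed Ω] [CharZero Ω] [TeichP p Ω]

lemma IsT.norm_one {z : Ω} (h : IsT p z) (h0 : z ≠ 0) : ‖z‖ = 1 := by
  rcases h with rfl | ⟨m, hm, _, hz⟩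
  · exact absurd rfl h0
  · exact norm_rootOne hm.ne' hz

lemma TR.discB (h : TR p A B x) {z : Ω} (hz : z ∈ FF Ω B) {j : ℕ} (hj : ‖z‖ < ‖x‖ ^ j) :
    ‖z‖ ≤ ‖x‖ ^ (j + 1) := by
  by_cases h0 : z = 0
  · rw [h0, norm_zero]; exact pow_nonneg h.pos.le _
  obtain ⟨i, hi⟩ := h.valB z hz h0
  rw [hi] at hj ⊢
  exact zpow_disc h.pos h.lt hj

/-- difference of quotients of units -/
lemma div_sub_le {a b c d : Ω} (hb : ‖b‖ = 1) (hc : ‖c‖ = 1) (hd : ‖d‖ = 1) {r : ℝ}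
    (h1 : ‖a - c‖ ≤ r) (h2 : ‖b - d‖ ≤ r) : ‖a / b - c / d‖ ≤ r := by
  have hb0 : b ≠ 0 := by intro h; simp [h] at hb
  have hd0 : d ≠ 0 := by intro h; simp [h] at hd
  have : a / b - c / d = ((a - c) * d - c * (b - d)) / (b * d) := by
    field_simp; ring
  rw [this, norm_div, norm_mul, hb, hd, mul_one, div_one]
  refine u_sub ?_ ?_
  · rw [norm_mul, hd, mul_one]; exact h1
  · rw [norm_mul, hc, one_mul]; exact h2

lemma norm_one_ne {a : Ω} (ha : ‖a‖ = 1) : a ≠ 0 := by intro h; simp [h] at ha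

/-- approximate solution of `φ η / η = u` -/
lemma TR.approx (h : TR p A B x) {q : ℕ} {φ : Γ} (hφ : IsFrob p Ω q φ) (hx : φ • x = x)
    (hB : Nz φ B) {u : Ω} (hu : u ∈ FF Ω B) (hu1 : ‖u‖ = 1) (m : ℕ) :
    ∃ η ∈ FF Ω B, ‖η‖ = 1 ∧ ‖φ • η / η - u‖ ≤ ‖x‖ ^ m := by
  have hpp : p.Prime := TeichP.prime Ω
  have hq2 := hφ.two_le hpp
  have hTB : ∀ z : Ω, IsT p z → z ∈ FF Ω B := fun z hz => FF_anti h.le (h.T_mem hz)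
  -- reduction to estimate of `u * η / φ η - 1`
  have red : ∀ (v η : Ω) (r : ℝ), ‖v‖ = 1 → ‖η‖ = 1 → ‖v / (φ • η / η) - 1‖ ≤ r →
      ‖φ • η / η - v‖ ≤ r := by
    intro v η r hv hη hr
    have hη0 := norm_one_ne hη
    have hφη0 := smul_ne0 hη0 φ
    have : v - φ • η / η = (v / (φ • η / η) - 1) * (φ • η / η) := by field_simp
    rw [norm_sub_rev, this, norm_mul, norm_div (φ • η), norm_act, hη, div_one, mul_one]
    exact hr
  have red' : ∀ (v η : Ω) (r : ℝ), ‖v‖ = 1 → ‖η‖ = 1 → ‖φ • η / η - v‖ ≤ r →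
      ‖v / (φ • η / η) - 1‖ ≤ r := by
    intro v η r hv hη hr
    have hη0 := norm_one_ne hη
    have hφη0 := smul_ne0 hη0 φ
    have : v / (φ • η / η) - 1 = - (φ • η / η - v) / (φ • η / η) := by field_simp; ring
    rw [this, norm_div, norm_neg, norm_div (φ • η), norm_act, hη, div_one, div_one]
    exact hr
  rcases Nat.eq_zero_or_pos m with rfl | hm
  · refine ⟨1, one_mem _, norm_one, ?_⟩
    simp only [smul_one, div_one, pow_zero]
    exact u_sub (by simp) hu1.le
  induction m, hm using Nat.le_induction with
  | base =>
    obtain ⟨a, haT, hau⟩ := TeichP.ex u hu1.le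
    have ha0 : a ≠ 0 := by rintro rfl; rw [sub_zero, hu1] at hau; exact lt_irrefl _ hau
    have ha1 := haT.norm_one ha0
    obtain ⟨ζ, hζ⟩ := IsAlgClosed.exists_pow_nat_eq a (n := q - 1) (by omega)
    have hζ0 : ζ ≠ 0 := by
      rintro rfl; rw [zero_pow (by omega)] at hζ; exact ha0 hζ.symm
    have hζT : IsT p ζ := by
      rcases haT with h | ⟨n, hn, hcop, han⟩
      · exact absurd h ha0
      · refine Or.inr ⟨(q - 1) * n, Nat.mul_pos (by omega) hn, Nat.Coprime.mul_left ?_ hcop, by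
          rw [pow_mul, hζ, han]⟩
        obtain ⟨⟨r, hr, rfl⟩, _⟩ := hφ
        exact coprime_pow_sub_one hpp hr
    have he : φ • ζ / ζ = a := by
      rw [hφ.2 ζ hζT, ← hζ, div_eq_iff hζ0, ← pow_succ]
      congr 1; omega
    refine ⟨ζ, hTB ζ hζT, hζT.norm_one hζ0, ?_⟩
    rw [he]
    have := h.discB (z := a - u) (j := 0) (sub_mem (hTB a haT) hu) (by
      rw [norm_sub_rev]; simpa using hau)
    simpa using this
  | succ m hm ih =>
    obtain ⟨η, hη, hη1, hle⟩ := ih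
    have hη0 := norm_one_ne hη1
    set v := u / (φ • η / η) with hv
    have hvB : v ∈ FF Ω B := div_mem hu (div_mem (hB.smul_mem hη) hη)
    have hv1 : ‖v - 1‖ ≤ ‖x‖ ^ m := red' _ _ _ hu1 hη1 hle
    have hx0 := h.x0
    have hxm0 : x ^ m ≠ 0 := pow_ne_zero _ hx0
    set c := (v - 1) / x ^ m with hc
    have hcB : c ∈ FF Ω B := div_mem (sub_mem hvB (one_mem _)) (pow_mem h.mem m)
    have hc1 : ‖c‖ ≤ 1 := by
      rw [hc, norm_div, norm_pow]
      exact div_le_one_of_le₀ hv1 (by positivity)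
    have hvc : v = 1 + c * x ^ m := by rw [hc]; field_simp; ring
    obtain ⟨a', ha', hac⟩ := solve_poly (n := q) hq2 (b := c) (c := -1) hc1 (by simp)
    obtain ⟨a, haT, haa⟩ := TeichP.ex a' ha'
    have ha1 := haT.norm_le
    have hac' : ‖c - (a ^ q - a)‖ < 1 := by
      have e : c - (a ^ q - a) = (a' ^ q - a ^ q) - (a' - a) := by rw [← hac]; ring
      rw [e]
      exact u_sub_lt ((u_pow_sub ha' ha1 q).trans_lt haa) haa
    have hxlt : ‖x‖ ^ m < 1 := pow_lt_one₀ h.pos.le h.lt (by omega)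
    set ε := 1 + a * x ^ m with hε
    have hε1 : ‖ε‖ = 1 := by
      apply u_one
      rw [hε, add_sub_cancel_left, norm_mul, norm_pow]
      exact (mul_le_of_le_one_left (by positivity) ha1).trans_lt hxlt
    have hε0 := norm_one_ne hε1
    have hεB : ε ∈ FF Ω B := add_mem (one_mem _) (mul_mem (hTB a haT) (pow_mem h.mem m))
    have hφε : φ • ε = 1 + a ^ q * x ^ m := by
      rw [hε, smul_add, smul_one, smul_mul', smul_pow', hx, hφ.2 a haT]
    have hmain : ‖φ • ε / ε - v‖ < ‖x‖ ^ m := by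
      have e : φ • ε / ε - v = (((a ^ q - a) - c) - a * c * x ^ m) * x ^ m / ε := by
        rw [hφε, hvc, eq_div_iff hε0, sub_mul, div_mul_cancel₀ _ hε0, hε]; ring
      rw [e, norm_div, hε1, div_one, norm_mul, norm_pow]
      refine mul_lt_of_lt_one_left (pow_pos h.pos m) (u_sub_lt (by rw [norm_sub_rev]; exact hac') ?_)
      rw [norm_mul, norm_mul, norm_pow]
      refine lt_of_le_of_lt ?_ hxlt
      exact mul_le_of_le_one_left (by positivity) (mul_le_one₀ ha1 (norm_nonneg _) hc1)
    have hmain' := h.discB (sub_mem (div_mem (hB.smul_mem hεB) hεB) hvB) hmain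
    refine ⟨η * ε, mul_mem hη hεB, by rw [norm_mul, hη1, hε1, one_mul], ?_⟩
    have e : φ • (η * ε) / (η * ε) - u = (φ • η / η) * (φ • ε / ε - v) := by
      have hφη0 := smul_ne0 hη0 φ
      rw [smul_mul', hv]
      field_simp
    rw [e, norm_mul, norm_div, norm_act, hη1, div_one, one_mul]
    exact hmain'

lemma TR.approxV (h : TR p A B x) (hAb : Ab G B) (hAG : A ≤ G) {q : ℕ} {φ : Γ} (hφG : φ ∈ G)
    (hφ : IsFrob p Ω q φ) (hx : φ • x = x) {θ : Ω} (hθ : VV A B θ) (m : ℕ) :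
    ∃ η, VV A B η ∧ ‖φ • η / η - θ‖ ≤ ‖x‖ ^ m := by
  have hB : Nz φ B := hAb.nz le_rfl (h.le.trans hAG) hφG
  induction hθ with
  | one => exact ⟨1, VV.one, by simp only [smul_one, div_one, sub_self, norm_zero]; exact pow_nonneg h.pos.le _⟩
  | @mul_gen θ ξ τ hθ hτ hξ h1 ih =>
    obtain ⟨η, hη, hle⟩ := ih
    obtain ⟨ε, hε, hε1, hle'⟩ := h.approx hφ hx hB hξ h1 m
    refine ⟨η * (τ • ε / ε), hη.mul_gen hτ hε hε1, ?_⟩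
    have hε0 := norm_one_ne hε1
    have hη0 := hη.ne_zero
    have e : φ • (η * (τ • ε / ε)) / (η * (τ • ε / ε)) =
        (φ • η / η) * (τ • (φ • ε / ε) / (φ • ε / ε)) := by
      have h2 := smul_ne0 hε0 φ
      have h3 := smul_ne0 hε0 τ
      have h4 := smul_ne0 h2 τ
      rw [smul_mul', smul_div₀', smul_div₀', hAb.swap hφG (hAG hτ) hε]
      field_simp
    rw [e]
    have hn : ‖φ • ε / ε‖ = 1 := by rw [norm_div, norm_act, hε1, div_one]
    refine u_mul_sub ?_ ?_ hle (div_sub_le hn ?_ h1 ?_ hle')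
    · rw [norm_div, norm_act, hη.norm, div_one]
    · rw [norm_div, norm_act, h1, div_one]
    · rw [norm_act, h1]
    · rw [← smul_sub, norm_act]; exact hle'

/-- existence of the good pair -/
theorem TR.ex [Per Γ Ω] (h : TR p A B x) (hAb : Ab G B) (hAG : A ≤ G) {q : ℕ} {φ : Γ} (hφG : φ ∈ G)
    (hφ : IsFrob p Ω q φ) {π : Ω} (hπ : π ∈ FF Ω G) (hπn : ‖π‖ = ‖x‖ ^ (B.relIndex A)) :
    ∃ σ ∈ A, ∃ y ∈ FF Ω B, (σ * φ) • y = y ∧ rN A B y = π := by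
  have hpp : p.Prime := TeichP.prime Ω
  have hnzB : ∀ g ∈ G, Nz g B := fun g hg => hAb.nz le_rfl (h.le.trans hAG) hg
  have hnzA : ∀ g ∈ G, Nz g A := fun g hg => hAb.nz h.le hAG hg
  have hTB : ∀ z : Ω, IsT p z → z ∈ FF Ω B := fun z hz => FF_anti h.le (h.T_mem hz)
  have hUN : ∀ ψ ∈ G, IsFrob p Ω q ψ → ∃ y ∈ FF Ω B, ψ • y = y ∧ ‖y‖ = ‖x‖ := by
    intro ψ hψG hψ
    obtain ⟨d, hd, hdx⟩ := Per.per ψ x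
    obtain ⟨ζ, hζ, h1, h2⟩ := unif hψ hd h.x0 hdx
    exact ⟨_, sum_mem fun i _ => ((hnzB ψ hψG).pow i).smul_mem (mul_mem (hTB ζ hζ) h.mem), h1, h2⟩
  obtain ⟨x1, hx1B, hx1, hx1n⟩ := hUN φ hφG hφ
  have h1 := h.change hx1B hx1n
  have hx10 := h1.x0
  have hπ0 : π ≠ 0 := by
    rw [← norm_ne_zero_iff, hπn]; exact pow_ne_zero _ h.pos.ne'
  have hNx0 := rN_ne_zero h.fin hx1B hx10
  have hπA : π ∈ FF Ω A := FF_anti hAG hπ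
  have hNxA := rN_mem h.fin hx1B
  obtain ⟨ξ, hξ, hξ1, hNξ⟩ := h1.ns (u := π / rN A B x1) (div_mem hπA hNxA) (by
    rw [norm_div, hπn, norm_rN h.fin hx1B, hx1n, div_self (pow_ne_zero _ h.pos.ne')])
  have hξ0 := norm_one_ne hξ1
  have hφξ0 := smul_ne0 hξ0 φ
  have hNx : rN A B (x1 * ξ) = π := by
    rw [rN_mul h.fin hx1B hξ, hNξ]; field_simp
  have hφπ : ∀ g ∈ G, g • π = π := fun g hg => mem_FF.1 hπ g hg
  have hφξB := (hnzB φ hφG).smul_mem hξ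
  obtain ⟨σ, hσ, θ, hθ, he⟩ := h1.hm1 (y := φ • ξ / ξ) (div_mem hφξB hξ)
    (by rw [norm_div, norm_act, hξ1, div_one]) (by
      rw [rN_div h.fin hφξB hξ, rN_smul h.fin (hnzA φ hφG) (hnzB φ hφG) hξ, hNξ, smul_div₀',
        hφπ φ hφG, ← rN_smul h.fin (hnzA φ hφG) (hnzB φ hφG) hx1B, hx1,
        div_self (div_ne_zero hπ0 hNx0)])
  set ψ := σ⁻¹ * φ with hψd
  have hσG := hAG hσ
  have hψG : ψ ∈ G := G.mul_mem (G.inv_mem hσG) hφG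
  have hψ : IsFrob p Ω q ψ := hφ.mul_left hpp (fun z hz => h.tei _ (A.inv_mem hσ) z hz)
  have hV : VV A B (ψ • (x1 * ξ) / (x1 * ξ)) := by
    have e : ψ • (x1 * ξ) / (x1 * ξ) = (σ⁻¹ • ξ / ξ) * σ⁻¹ • θ := by
      have h2 : φ • ξ = ξ * (σ • x1 / x1) * θ := by
        rw [mul_assoc, ← he]; field_simp
      have h3 := smul_ne0 hx10 σ⁻¹
      rw [hψd, mul_smul, smul_mul', hx1, h2, smul_mul', smul_mul', smul_mul', smul_div₀', inv_smul_smul]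
      field_simp
    rw [e]
    exact (VV.gen (A.inv_mem hσ) hξ hξ1).mul
      (hθ.smul (hnzA _ (G.inv_mem hσG)) (hnzB _ (G.inv_mem hσG)))
  obtain ⟨x2, hx2B, hx2, hx2n⟩ := hUN ψ hψG hψ
  have h2 := h.change hx2B hx2n
  -- precision
  obtain ⟨δ, hδ0, hδ1, hδ⟩ := exists_dist (Ω := Ω) h.fin
  have hδn : 0 < δ ^ (B.relIndex A) := pow_pos hδ0 _
  obtain ⟨m, hm⟩ := exists_pow_lt_of_lt_one hδn h2.lt
  obtain ⟨η, hη, hηle⟩ := h2.approxV hAb hAG hψG hψ hx2 hV.inv m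
  set X := x1 * ξ * η with hX
  have hη0 := hη.ne_zero
  have hX0 : X ≠ 0 := mul_ne_zero (mul_ne_zero hx10 hξ0) hη0
  have hηB := hη.mem fun a ha => h.nz ha
  have hXB : X ∈ FF Ω B := mul_mem (mul_mem hx1B hξ) hηB
  have hNX : rN A B X = π := by
    rw [hX, rN_mul h.fin (mul_mem hx1B hξ) hηB, hNx, hη.rN_eq_one (fun a ha => h.nz ha) h.fin, mul_one]
  have hXle : ‖ψ • X - X‖ ≤ ‖x2‖ ^ m * ‖X‖ := by
    set t := ψ • (x1 * ξ) / (x1 * ξ) with ht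
    have ht0 := hV.ne_zero
    have e : ψ • X - X = (ψ • η / η - t⁻¹) * t * X := by
      have e1 : ψ • X = t * (ψ • η / η) * X := by
        rw [hX, smul_mul', ht]; field_simp
      rw [e1]; field_simp
    rw [e, norm_mul, norm_mul, hV.norm, mul_one]
    exact mul_le_mul_of_nonneg_right hηle (norm_nonneg _)
  -- periodic
  obtain ⟨d, hd, hdX⟩ := Per.per ψ X
  obtain ⟨ζ, hζ, hζd, hζ1⟩ := poly (p := p) hψ.1 hd (fun _ => (1 : Ω)) (fun _ => by simp) (by simp)
  simp only [one_mul] at hζ1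
  have hTi : ∀ i, IsT p (ζ ^ (q ^ i)) := fun i => hζ.pow (pow_ne_zero i (hφ.ne_zero hpp))
  set S : Ω := ∑ i ∈ Finset.range d, ζ ^ (q ^ i) with hS
  have hS0 := norm_one_ne hζ1
  have hSB : S ∈ FF Ω B := sum_mem fun i _ => hTB _ (hTi i)
  have rot : ∀ g : ℕ → Ω, (∀ i, ψ • g i = g (i + 1)) → g d = g 0 →
      ψ • (∑ i ∈ Finset.range d, g i) = ∑ i ∈ Finset.range d, g i := by
    intro g hg hgd
    rw [Finset.smul_sum]
    have e2 := Finset.sum_range_succ g d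
    rw [Finset.sum_range_succ', hgd] at e2
    rw [← add_right_cancel e2]
    exact Finset.sum_congr rfl fun i _ => hg i
  have hψS : ψ • S = S := by
    refine rot _ (fun i => ?_) ?_
    · rw [hψ.2 _ (hTi i), ← pow_mul, pow_succ]
    · rw [hζd]; simp
  set Y : Ω := (∑ i ∈ Finset.range d, ζ ^ (q ^ i) * ψ ^ i • X) / S with hY
  have hψY : ψ • Y = Y := by
    rw [hY, smul_div₀', hψS]
    congr 1
    refine rot (fun i => ζ ^ (q ^ i) * ψ ^ i • X) (fun i => ?_) ?_
    · rw [smul_mul', hψ.2 _ (hTi i), ← pow_mul, pow_succ, pow_succ' ψ, mul_smul ψ]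
    · simp only [hζd, hdX]; simp
  have hYB : Y ∈ FF Ω B := div_mem (sum_mem fun i _ => mul_mem (hTB _ (hTi i))
    (((hnzB ψ hψG).pow i).smul_mem hXB)) hSB
  have hXi : ∀ i, ‖ψ ^ i • X - X‖ ≤ ‖x2‖ ^ m * ‖X‖ := by
    intro i
    induction i with
    | zero => simp only [pow_zero, one_smul, sub_self, norm_zero]; positivity
    | succ i ih =>
      refine u_trans (b := ψ ^ i • X) ?_ ih
      rw [pow_succ, mul_smul, ← smul_sub, norm_act]; exact hXle
  have hYX : ‖Y / X - 1‖ ≤ ‖x2‖ ^ m := by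
    have e : Y / X - 1 = (∑ i ∈ Finset.range d, ζ ^ (q ^ i) * (ψ ^ i • X - X)) / (S * X) := by
      have : ∑ i ∈ Finset.range d, ζ ^ (q ^ i) * (ψ ^ i • X - X) =
          (∑ i ∈ Finset.range d, ζ ^ (q ^ i) * ψ ^ i • X) - S * X := by
        rw [hS, Finset.sum_mul, ← Finset.sum_sub_distrib]
        exact Finset.sum_congr rfl fun i _ => by ring
      rw [this, hY]; field_simp
    rw [e, norm_div, norm_mul, hζ1, one_mul]
    refine div_le_of_le_mul₀ (norm_nonneg _) (by positivity) (u_sum _ (by positivity) fun i _ => ?_)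
    rw [norm_mul]
    exact (mul_le_of_le_one_left (norm_nonneg _) (hTi i).norm_le).trans (hXi i)
  have hYXB := div_mem hYB hXB
  have hx2m : ‖x2‖ ^ m < 1 := hm.trans_le (pow_le_one₀ hδ0.le hδ1)
  have hYX1 : ‖Y / X‖ = 1 := u_one (hYX.trans_lt hx2m)
  have hY0 : Y ≠ 0 := by
    intro h; rw [h] at hYX1; simp at hYX1
  have hNYA : rN A B (Y / X) ∈ FF Ω A := rN_mem h.fin hYXB
  have hNY : ‖rN A B (Y / X) - 1‖ < δ ^ (B.relIndex A) := by
    refine lt_of_le_of_lt ?_ hm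
    obtain ⟨f, hf⟩ := exists_Trv_fin h.fin
    rw [rN_eq_prod hf hYXB]
    have := u_prod_sub Finset.univ (f := fun i => f i • (Y / X)) (g := fun _ => (1 : Ω))
      (r := ‖x2‖ ^ m) (by positivity) (fun i _ => by rw [norm_act, hYX1]) (fun i _ => by simp)
      (fun i _ => by
        have : f i • (Y / X) - 1 = f i • (Y / X - 1) := by rw [smul_sub, smul_one]
        rw [this, norm_act]; exact hYX)
    simpa using this
  obtain ⟨r, hr, hr1, hrf⟩ := nroot Γ h.fin hδ0 hδ1 hδ hNY
  have hr1' : ‖r‖ = 1 := u_one (hr1.trans_le hδ1)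
  have hr0 := norm_one_ne hr1'
  have hrA : r ∈ FF Ω A := mem_FF.2 fun a ha => hrf a (mem_FF.1 hNYA a ha)
  have hrψ : ψ • r = r := by
    apply hrf
    rw [rN_div h.fin hYB hXB, hNX, smul_div₀', hφπ ψ hψG,
      ← rN_smul h.fin (hnzA ψ hψG) (hnzB ψ hψG) hYB, hψY]
  have hrB := FF_anti h.le hrA
  refine ⟨σ⁻¹, A.inv_mem hσ, Y / r, div_mem hYB hrB, ?_, ?_⟩
  · change ψ • (Y / r) = Y / r
    rw [smul_div₀', hψY, hrψ]
  · rw [rN_div h.fin hYB hrB, rN_of_mem h.fin h.le hrA, hr, rN_div h.fin hYB hXB, hNX]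
    have := rN_ne_zero h.fin hYB hY0
    field_simp

/-- main lemma -/
theorem TR.ml (h : TR p A B x) (hAb : Ab G B) (hAG : A ≤ G) {φ : Γ} (hφG : φ ∈ G) (hx : φ • x = x)
    {σ : Γ} (hσ : σ ∈ A) {f : ℕ} {y : Ω} (hy : y ∈ FF Ω B) (hyn : ‖y‖ = ‖x‖)
    (hψy : (σ * φ ^ f) • y = y) {w : Ω} (hw : w ∈ FF Ω A) (hw1 : ‖w‖ = 1) (hwf : φ ^ f • w = w)
    (hNy : rN A B y / rN A B x = φ • w / w) : σ ∈ B := by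
  have hnzB : ∀ g ∈ G, Nz g B := fun g hg => hAb.nz le_rfl (h.le.trans hAG) hg
  have hnzA : ∀ g ∈ G, Nz g A := fun g hg => hAb.nz h.le hAG hg
  set ψ := σ * φ ^ f with hψ
  have hσG := hAG hσ
  have hψG : ψ ∈ G := G.mul_mem hσG (G.pow_mem hφG f)
  have hx0 := h.x0
  have hw0 := norm_one_ne hw1
  have key : ∀ g ∈ G, ∀ t ∈ FF Ω B, ‖t‖ = 1 → rN A B t = 1 → VV A B (g • t / t) := by
    intro g hg t ht ht1 htN
    obtain ⟨τ, hτ, v, hv, rfl⟩ := h.hm1 ht ht1 htN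
    have e : g • (τ • x / x * v) / (τ • x / x * v) =
        (τ • (g • x / x) / (g • x / x)) * (g • v / v) := by
      have h1 := smul_ne0 hx0 g
      have h2 := smul_ne0 hx0 τ
      have h3 := smul_ne0 h1 τ
      have h4 := hv.ne_zero
      rw [smul_mul', smul_div₀', smul_div₀', hAb.swap hg (hAG hτ) h.mem]
      field_simp
    rw [e]
    exact (VV.gen hτ (div_mem ((hnzB g hg).smul_mem h.mem) h.mem)
      (by rw [norm_div, norm_act, div_self h.pos.ne'])).mul
      ((hv.smul (hnzA g hg) (hnzB g hg)).div hv)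
  obtain ⟨z, hz, hz1, hNz⟩ := h.ns hw hw1
  have hz0 := norm_one_ne hz1
  have hy0 : y ≠ 0 := by rw [← norm_ne_zero_iff, hyn]; exact h.pos.ne'
  set ξ := y / x with hξ
  have hξB : ξ ∈ FF Ω B := div_mem hy h.mem
  have hξ1 : ‖ξ‖ = 1 := by rw [hξ, norm_div, hyn, div_self h.pos.ne']
  have hξ0 := norm_one_ne hξ1
  have hφz := (hnzB φ hφG).smul_mem hz
  have hψz := (hnzB ψ hψG).smul_mem hz
  have hφz0 := smul_ne0 hz0 φ
  have hψz0 := smul_ne0 hz0 ψ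
  set ξ1 := ξ / (φ • z / z) with hξed
  have hξeB : ξ1 ∈ FF Ω B := div_mem hξB (div_mem hφz hz)
  have hφw0 := smul_ne0 hw0 φ
  have hNξ1 : rN A B ξ1 = 1 := by
    rw [hξed, rN_div h.fin hξB (div_mem hφz hz), rN_div h.fin hφz hz, hξ, rN_div h.fin hy h.mem,
      rN_smul h.fin (hnzA φ hφG) (hnzB φ hφG) hz, hNz, hNy, div_self (div_ne_zero hφw0 hw0)]
  have hψw : ψ • w = w := by
    rw [hψ, mul_smul, hwf, mem_FF.1 hw σ hσ]
  have hV1 := key ψ hψG ξ1 hξeB (by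
    rw [hξed, norm_div, hξ1, norm_div, norm_act, hz1]; simp) hNξ1
  have hV2 := key φ hφG (z / ψ • z) (div_mem hz hψz) (by rw [norm_div, norm_act, hz1]; simp) (by
    rw [rN_div h.fin hz hψz, rN_smul h.fin (hnzA ψ hψG) (hnzB ψ hψG) hz, hNz, hψw, div_self hw0])
  refine h.inj hσ ?_
  have hφfx : φ ^ f • x = x := by
    have : φ ∈ MulAction.stabilizer Γ x := hx
    exact (MulAction.stabilizer Γ x).pow_mem this f
  have e : σ • x / x = (ψ • ξ1 / ξ1)⁻¹ * (φ • (z / ψ • z) / (z / ψ • z)) := by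
    have e1 : ψ • x = σ • x := by rw [hψ, mul_smul, hφfx]
    have e2 : σ • x / x = ξ / ψ • ξ := by
      rw [hξ, smul_div₀', hψy, e1]
      have := smul_ne0 hx0 σ
      field_simp
    have e3 : ξ = ξ1 * (φ • z / z) := by rw [hξed]; field_simp
    have hξ10 : ξ1 ≠ 0 := by intro h0; rw [h0, zero_mul] at e3; exact hξ0 e3
    have := smul_ne0 hξ10 ψ
    have h5 := smul_ne0 hφz0 ψ
    have h6 := smul_ne0 hψz0 φ
    have h7 : ψ • (φ • z / z) = ψ • φ • z / ψ • z := smul_div₀' _ _ _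
    have h8 : φ • (z / ψ • z) = φ • z / ψ • φ • z := by
      rw [smul_div₀', hAb.swap hφG hψG hz]
    rw [e2, e3, smul_mul', h7, h8]
    field_simp
  rw [e]
  exact hV1.inv.mul hV2

end main

end LT

/-! ### Part 6 : algebraic closure of the p-adic numbers -/

namespace LT

set_option linter.unusedSectionVars false

section conc

variable {p : ℕ} [hp : Fact p.Prime] {Ω : Type*} [NormedField Ω] [NormedAlgebra ℚ_[p] Ω]
  [IsUltrametricDist Ω] [IsAlgClosed Ω] [CharZero Ω] [Algebra.IsAlgebraic ℚ_[p] Ω]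

instance instPer : Per (Ω ≃ₐ[ℚ_[p]] Ω) Ω := by
  refine ⟨fun γ x => ?_⟩
  have hx : IsIntegral ℚ_[p] x := Algebra.IsIntegral.isIntegral x
  have hfin : Set.Finite {y : Ω | Polynomial.aeval y (minpoly ℚ_[p] x) = 0} := by
    have := (minpoly ℚ_[p] x).rootSet_finite Ω
    refine this.subset ?_
    intro y hy
    rw [Polynomial.mem_rootSet]
    exact ⟨minpoly.ne_zero hx, hy⟩
  have hmem : ∀ i : ℕ, γ ^ i • x ∈ {y : Ω | Polynomial.aeval y (minpoly ℚ_[p] x) = 0} := by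
    intro i
    have : γ ^ i • x = (γ ^ i) x := rfl
    rw [Set.mem_ofPred_eq, this]
    have h2 := Polynomial.aeval_algHom_apply (γ ^ i).toAlgHom x (minpoly ℚ_[p] x)
    simp only [minpoly.aeval, map_zero] at h2
    exact h2
  obtain ⟨i, j, hij, he⟩ : ∃ i j : ℕ, i < j ∧ γ ^ i • x = γ ^ j • x := by
    by_contra hcon
    push Not at hcon
    have hinj : Function.Injective (fun i : ℕ => γ ^ i • x) := by
      intro a b hab
      rcases lt_trichotomy a b with h | h | h
      · exact absurd hab (hcon _ _ h)
      · exact h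
      · exact absurd hab.symm (hcon _ _ h)
    exact Set.infinite_of_injective_forall_mem hinj hmem hfin
  refine ⟨j - i, by omega, ?_⟩
  have : γ ^ j = γ ^ i * γ ^ (j - i) := by rw [← pow_add]; congr 1; omega
  rw [this, mul_smul] at he
  exact (smul_left_cancel _ he).symm

lemma compact_seq (K : IntermediateField ℚ_[p] Ω) [FiniteDimensional ℚ_[p] K] (f : ℕ → Ω)
    (hf : ∀ i, f i ∈ K) (hf1 : ∀ i, ‖f i‖ ≤ 1) : ∃ i j, i < j ∧ ‖f i - f j‖ < 1 := by
  let E := Subalgebra.toSubmodule K.toSubalgebra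
  have : FiniteDimensional ℚ_[p] E := ‹FiniteDimensional ℚ_[p] K›
  have hE : ProperSpace E := FiniteDimensional.proper ℚ_[p] E
  let g : ℕ → E := fun i => ⟨f i, hf i⟩
  obtain ⟨a, _, φ, hφ, hlim⟩ := (isCompact_closedBall (0 : E) 1).tendsto_subseq (x := g) (by
    intro i
    rw [mem_closedBall_zero_iff]
    exact hf1 i)
  have hc := hlim.cauchySeq
  rw [Metric.cauchySeq_iff'] at hc
  obtain ⟨N, hN⟩ := hc 1 one_pos
  refine ⟨φ N, φ (N + 1), hφ (Nat.lt_succ_self N), ?_⟩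
  have := hN (N + 1) (Nat.le_succ N)
  rw [dist_comm, dist_eq_norm] at this
  exact this

variable (Ω) in
/-- closed unit ball -/
def OO : Subring Ω where
  carrier := {x | ‖x‖ ≤ 1}
  mul_mem' {a b} ha hb := by
    simp only [Set.mem_ofPred_eq] at *
    rw [norm_mul]; exact mul_le_one₀ ha (norm_nonneg _) hb
  one_mem' := by simp
  add_mem' ha hb := u_add ha hb
  zero_mem' := by simp
  neg_mem' := by intro a; simp

lemma norm_p_lt : ‖(p : Ω)‖ < 1 := by
  have : ((p : ℕ) : Ω) = algebraMap ℚ_[p] Ω (p : ℚ_[p]) := by simp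
  rw [this, norm_algebraMap', Padic.norm_p]
  exact inv_lt_one_of_one_lt₀ (by exact_mod_cast hp.out.one_lt)

lemma u_frob_add {x y : Ω} (hx : ‖x‖ ≤ 1) (hy : ‖y‖ ≤ 1) (r : ℕ) :
    ‖(x + y) ^ (p ^ r) - (x ^ (p ^ r) + y ^ (p ^ r))‖ < 1 := by
  induction r with
  | zero => simp
  | succ r ih =>
    obtain ⟨c, hc⟩ := exists_add_pow_prime_eq hp.out (⟨x ^ (p ^ r), by
      change ‖_‖ ≤ 1; rw [norm_pow]; exact pow_le_one₀ (norm_nonneg _) hx⟩ : OO Ω) (⟨y ^ (p ^ r), by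
      change ‖_‖ ≤ 1; rw [norm_pow]; exact pow_le_one₀ (norm_nonneg _) hy⟩ : OO Ω)
    have hc' := congrArg (Subtype.val) hc
    simp only [Subring.coe_pow, Subring.coe_add, Subring.coe_mul] at hc'
    have hxr : ‖x ^ (p ^ r)‖ ≤ 1 := by rw [norm_pow]; exact pow_le_one₀ (norm_nonneg _) hx
    have hyr : ‖y ^ (p ^ r)‖ ≤ 1 := by rw [norm_pow]; exact pow_le_one₀ (norm_nonneg _) hy
    have hxyr : ‖(x + y) ^ (p ^ r)‖ ≤ 1 := by
      rw [norm_pow]; exact pow_le_one₀ (norm_nonneg _) (u_add hx hy)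
    have h1 := (u_pow_sub hxyr (u_add hxr hyr) p).trans_lt ih
    rw [pow_succ, pow_mul, pow_mul x, pow_mul y]
    refine u_trans_lt h1 ?_
    rw [hc', add_sub_cancel_left, norm_mul, norm_mul, norm_mul]
    have e1 : ‖(((p : OO Ω)) : Ω)‖ < 1 := by
      have := norm_p_lt (p := p) (Ω := Ω)
      simpa using this
    have e2 : ‖(((p : OO Ω)) : Ω)‖ * ‖x ^ p ^ r‖ < 1 :=
      (mul_le_of_le_one_right (norm_nonneg _) hxr).trans_lt e1
    have e3 := (mul_le_of_le_one_right (mul_nonneg (norm_nonneg _) (norm_nonneg _)) hyr).trans_lt e2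
    exact (mul_le_of_le_one_right (by positivity) c.2).trans_lt e3

lemma u_frob_sum {ι : Type*} (s : Finset ι) (f : ι → Ω) (hf : ∀ i ∈ s, ‖f i‖ ≤ 1) (r : ℕ) :
    ‖(∑ i ∈ s, f i) ^ (p ^ r) - ∑ i ∈ s, f i ^ (p ^ r)‖ < 1 := by
  classical
  induction s using Finset.induction_on with
  | empty => simp [hp.out.ne_zero]
  | insert a s ha ih =>
    rw [Finset.sum_insert ha, Finset.sum_insert ha]
    refine u_trans_lt (u_frob_add (hf a (by simp)) (u_sum _ zero_le_one
      fun i hi => hf i (by simp [hi])) r) ?_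
    rw [add_sub_add_left_eq_sub]
    exact ih fun i hi => hf i (by simp [hi])

lemma prod_roots {n : ℕ} (hn : n ≠ 0) (y : Ω) :
    ∏ ζ ∈ Polynomial.nthRootsFinset n (1 : Ω), (y - ζ) = y ^ n - 1 := by
  have : NeZero n := ⟨hn⟩
  obtain ⟨ε, hε⟩ : ∃ ζ : Ω, IsPrimitiveRoot ζ n := HasEnoughRootsOfUnity.exists_primitiveRoot Ω n
  have := congrArg (Polynomial.eval y) (Polynomial.X_pow_sub_one_eq_prod (Nat.pos_of_ne_zero hn) hε)
  rw [Polynomial.eval_prod] at this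
  simpa using this.symm

variable (p Ω) in
theorem mkTeichP : TeichP p Ω := by
  refine ⟨hp.out, norm_p_lt, fun y hy => ?_⟩
  rcases hy.lt_or_eq with hlt | h1
  · exact ⟨0, Or.inl rfl, by simpa using hlt⟩
  have hintg : IsIntegral ℚ_[p] y := Algebra.IsIntegral.isIntegral y
  have : FiniteDimensional ℚ_[p] (IntermediateField.adjoin ℚ_[p] {y}) :=
    IntermediateField.adjoin.finiteDimensional hintg
  obtain ⟨i, j, hij, hd⟩ := compact_seq (IntermediateField.adjoin ℚ_[p] {y}) (fun i => y ^ i)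
    (fun i => pow_mem (IntermediateField.mem_adjoin_simple_self ℚ_[p] y) i)
    (fun i => by rw [norm_pow, h1, one_pow])
  have hm : ‖y ^ (j - i) - 1‖ < 1 := by
    have e : y ^ i - y ^ j = - (y ^ i * (y ^ (j - i) - 1)) := by
      rw [mul_sub, ← pow_add, mul_one, show i + (j - i) = j by omega]; ring
    simp only [e, norm_neg, norm_mul, norm_pow, h1, one_pow, one_mul] at hd
    exact hd
  have hm0 : j - i ≠ 0 := by omega
  obtain ⟨a, m, hpm, hm'⟩ := Nat.exists_eq_pow_mul_and_not_dvd hm0 p hp.out.ne_one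
  rw [hm', mul_comm, pow_mul] at hm
  have hmne : m ≠ 0 := by rintro rfl; simp at hpm
  have hu : ‖y ^ m - 1‖ < 1 := by
    have h2 := u_frob_add (p := p) (x := y ^ m - 1) (y := 1)
      (u_sub (by rw [norm_pow, h1, one_pow]) (by simp)) (by simp) a
    rw [sub_add_cancel, one_pow] at h2
    have h3 : ‖(y ^ m - 1) ^ p ^ a‖ < 1 := by
      have := u_sub_lt hm h2
      rwa [show (y ^ m) ^ p ^ a - 1 - ((y ^ m) ^ p ^ a - ((y ^ m - 1) ^ p ^ a + 1))
        = (y ^ m - 1) ^ p ^ a by ring] at this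
    rw [norm_pow] at h3
    by_contra hcon
    exact absurd h3 (not_lt.2 (one_le_pow₀ (not_lt.1 hcon)))
  rw [← prod_roots hmne, norm_prod] at hu
  by_contra hcon
  push Not at hcon
  refine absurd hu (not_lt.2 (Finset.one_le_prod fun ζ hζ => hcon ζ (Or.inr ⟨m, ?_, ?_, ?_⟩)))
  · omega
  · exact ((Nat.Prime.coprime_iff_not_dvd hp.out).2 hpm).symm
  · exact (Polynomial.mem_nthRootsFinset (Nat.pos_of_ne_zero hmne) (1:Ω)).1 hζ

end conc
end LT

namespace LT

set_option linter.unusedSectionVars false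

section conc

variable {p : ℕ} [hp : Fact p.Prime] {Ω : Type*} [NormedField Ω] [NormedAlgebra ℚ_[p] Ω]
  [IsUltrametricDist Ω] [IsAlgClosed Ω] [CharZero Ω] [Algebra.IsAlgebraic ℚ_[p] Ω]
  [TeichP p Ω] [NInv (Ω ≃ₐ[ℚ_[p]] Ω) Ω]

instance instGal : IsGalois ℚ_[p] Ω := by
  have : IsAlgClosure ℚ_[p] Ω := ⟨inferInstance, inferInstance⟩
  have : Normal ℚ_[p] Ω := IsAlgClosure.normal ℚ_[p] Ω
  exact ⟨⟩

lemma IsT.mul {a b : Ω} (ha : IsT p a) (hb : IsT p b) : IsT p (a * b) := by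
  rcases ha with rfl | ⟨m, hm, hc, ha⟩
  · left; simp
  rcases hb with rfl | ⟨n, hn, hd, hb⟩
  · left; simp
  right
  exact ⟨m * n, Nat.mul_pos hm hn, Nat.Coprime.mul_left hc hd, by
    rw [mul_pow, pow_mul, ha, one_pow, mul_comm m n, pow_mul, hb, one_pow, one_mul]⟩

lemma IsT.inv {a : Ω} (ha : IsT p a) : IsT p a⁻¹ := by
  rcases ha with rfl | ⟨m, hm, hc, ha⟩
  · left; simp
  exact Or.inr ⟨m, hm, hc, by rw [inv_pow, ha, inv_one]⟩

lemma IsT.norm1 {a : Ω} (ha : IsT p a) (h0 : a ≠ 0) : ‖a‖ = 1 := by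
  rcases ha with rfl | ⟨m, hm, hc, ha⟩
  · exact absurd rfl h0
  · exact norm_rootOne hm.ne' ha

lemma IsT.act {a : Ω} (ha : IsT p a) (γ : Ω ≃ₐ[ℚ_[p]] Ω) : IsT p (γ • a) := by
  rcases ha with rfl | ⟨m, hm, hc, ha⟩
  · left; simp
  · exact Or.inr ⟨m, hm, hc, by rw [← smul_pow', ha, smul_one]⟩

lemma IsT.eq_of_lt {a b : Ω} (ha : IsT p a) (hb : IsT p b) (h : ‖a - b‖ < 1) : a = b := by
  by_cases hb0 : b = 0
  · subst hb0
    by_contra h0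
    rw [sub_zero, ha.norm1 h0] at h
    exact lt_irrefl _ h
  by_contra hne
  have hq : IsT p (a * b⁻¹) := ha.mul hb.inv
  have hn : ‖a * b⁻¹ - 1‖ < 1 := by
    have : a * b⁻¹ - 1 = (a - b) * b⁻¹ := by field_simp
    rw [this, norm_mul, norm_inv, hb.norm1 hb0]; simpa using h
  rcases hq with hq | ⟨m, hm, hc, hq⟩
  · rw [hq] at hn; simp at hn
  · have := rootOne_dist (u_coprime hc norm_p_lt) hq (by
      intro h1
      exact hne (by rwa [mul_inv_eq_one₀ hb0] at h1))
    linarith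

lemma mem_K_iff {K : IntermediateField ℚ_[p] Ω} {x : Ω} :
    x ∈ K ↔ x ∈ FF Ω K.fixingSubgroup := by
  rw [mem_FF]
  constructor
  · intro h γ hγ
    exact (IntermediateField.mem_fixingSubgroup_iff _ _).1 hγ x h
  · intro h
    rw [← InfiniteGalois.fixedField_fixingSubgroup K]
    rw [IntermediateField.mem_fixedField_iff]
    exact h

/-- Teichmueller representatives in `K` -/
def TK (K : IntermediateField ℚ_[p] Ω) : Set Ω := {z | z ∈ K ∧ IsT p z}

/-- residue cardinality -/
noncomputable def qK (K : IntermediateField ℚ_[p] Ω) : ℕ := Nat.card (TK K)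

lemma TK_near {K : IntermediateField ℚ_[p] Ω} {y : Ω} (hy : y ∈ K) (h1 : ‖y‖ ≤ 1) :
    ∃ t ∈ TK K, ‖y - t‖ < 1 := by
  obtain ⟨t, ht, hyt⟩ := TeichP.ex y h1
  refine ⟨t, ⟨?_, ht⟩, hyt⟩
  rw [mem_K_iff, mem_FF]
  intro γ hγ
  apply IsT.eq_of_lt (ht.act γ) ht
  have h2 : ‖γ • y - γ • t‖ < 1 := by rw [← smul_sub, norm_act]; exact hyt
  rw [mem_FF.1 (mem_K_iff.1 hy) γ hγ] at h2
  rw [norm_sub_rev] at h2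
  exact u_trans_lt h2 hyt

lemma TK_finite (K : IntermediateField ℚ_[p] Ω) [FiniteDimensional ℚ_[p] K] : (TK K).Finite := by
  by_contra h
  have h : (TK K).Infinite := h
  obtain ⟨i, j, hij, hd⟩ := compact_seq K (fun i => (h.natEmbedding _ i : Ω))
    (fun i => (h.natEmbedding _ i).2.1) (fun i => (h.natEmbedding _ i).2.2.norm_le)
  have := IsT.eq_of_lt (h.natEmbedding _ i).2.2 (h.natEmbedding _ j).2.2 hd
  exact hij.ne ((h.natEmbedding _).injective (Subtype.ext this))

/-- ring of integers of `K` -/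
noncomputable def OK (K : IntermediateField ℚ_[p] Ω) : Subring Ω := OO Ω ⊓ K.toSubfield.toSubring

lemma mem_OK {K : IntermediateField ℚ_[p] Ω} {x : Ω} : x ∈ OK K ↔ ‖x‖ ≤ 1 ∧ x ∈ K := Iff.rfl

lemma OK_isUnit {K : IntermediateField ℚ_[p] Ω} {x : OK K} : IsUnit x ↔ ‖(x : Ω)‖ = 1 := by
  constructor
  · rintro ⟨u, rfl⟩
    have h : ((u : OK K) : Ω) * ((u⁻¹ : (OK K)ˣ) : OK K) = 1 := by
      rw [← Subring.coe_mul]; simp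
    have h2 := congrArg norm h
    rw [norm_mul, norm_one] at h2
    have h3 := (u : OK K).2.1
    have h4 := ((u⁻¹ : (OK K)ˣ) : OK K).2.1
    change ‖_‖ ≤ 1 at h3 h4
    nlinarith [norm_nonneg ((u : OK K) : Ω), norm_nonneg (((u⁻¹ : (OK K)ˣ) : OK K) : Ω)]
  · intro h
    have h0 : (x : Ω) ≠ 0 := norm_ne_zero_iff.1 (by rw [h]; exact one_ne_zero)
    refine IsUnit.of_mul_eq_one ⟨(x : Ω)⁻¹, ?_, show _ ∈ K from inv_mem (mem_OK.1 x.2).2⟩ ?_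
    · change ‖_‖ ≤ 1
      rw [norm_inv, h, inv_one]
    · apply Subtype.ext
      simp [h0]

lemma OK_nonunit {K : IntermediateField ℚ_[p] Ω} {x : OK K} : x ∈ nonunits (OK K) ↔ ‖(x : Ω)‖ < 1 := by
  rw [mem_nonunits_iff, OK_isUnit]
  exact ⟨fun h => lt_of_le_of_ne x.2.1 h, fun h => h.ne⟩

instance OK_local (K : IntermediateField ℚ_[p] Ω) : IsLocalRing (OK K) := by
  apply IsLocalRing.of_nonunits_add
  intro a b ha hb
  rw [OK_nonunit] at *
  exact u_add_lt ha hb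

lemma OK_res {K : IntermediateField ℚ_[p] Ω} {x y : OK K} :
    IsLocalRing.residue (OK K) x = IsLocalRing.residue (OK K) y ↔ ‖(x : Ω) - y‖ < 1 := by
  rw [← sub_eq_zero, ← map_sub, IsLocalRing.residue_eq_zero_iff, IsLocalRing.mem_maximalIdeal,
    OK_nonunit]
  rfl

/-- `TK` to residue field -/
noncomputable def TKmap (K : IntermediateField ℚ_[p] Ω) (t : TK K) : IsLocalRing.ResidueField (OK K) :=
  IsLocalRing.residue (OK K) ⟨t.1, t.2.2.norm_le, t.2.1⟩

lemma TKmap_bij (K : IntermediateField ℚ_[p] Ω) : Function.Bijective (TKmap K) := by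
  constructor
  · intro a b hab
    exact Subtype.ext (IsT.eq_of_lt a.2.2 b.2.2 (OK_res.1 hab))
  · intro y
    obtain ⟨y, rfl⟩ := IsLocalRing.residue_surjective y
    obtain ⟨t, ht, h⟩ := TK_near (mem_OK.1 y.2).2 (mem_OK.1 y.2).1
    refine ⟨⟨t, ht⟩, OK_res.2 ?_⟩
    rw [norm_sub_rev]; exact h

lemma qK_eq (K : IntermediateField ℚ_[p] Ω) :
    qK K = Nat.card (IsLocalRing.ResidueField (OK K)) :=
  Nat.card_congr (Equiv.ofBijective _ (TKmap_bij K))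

lemma qK_pow (K : IntermediateField ℚ_[p] Ω) [FiniteDimensional ℚ_[p] K] :
    (∃ r : ℕ, r ≠ 0 ∧ qK K = p ^ r) ∧ ∀ t ∈ TK K, t ^ (qK K) = t := by
  have := (TK_finite K).to_subtype
  have hfin : Finite (IsLocalRing.ResidueField (OK K)) := Finite.of_surjective _ (TKmap_bij K).2
  have := Fintype.ofFinite (IsLocalRing.ResidueField (OK K))
  have hchar : CharP (IsLocalRing.ResidueField (OK K)) p := by
    refine (CharP.charP_iff_prime_eq_zero hp.out).2 ?_
    have h1 : ((p : ℕ) : IsLocalRing.ResidueField (OK K)) = IsLocalRing.residue (OK K) p := by simp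
    rw [h1, IsLocalRing.residue_eq_zero_iff, IsLocalRing.mem_maximalIdeal, OK_nonunit]
    have := norm_p_lt (p := p) (Ω := Ω)
    simpa using this
  constructor
  · obtain ⟨n, _, hn⟩ := FiniteField.card (IsLocalRing.ResidueField (OK K)) p
    refine ⟨n, n.ne_zero, ?_⟩
    rw [qK_eq, Nat.card_eq_fintype_card, hn]
  · intro t ht
    have h0 := FiniteField.pow_card (TKmap K ⟨t, ht⟩)
    have hq0 : qK K ≠ 0 := by rw [qK]; exact (Nat.card_ne_zero.2 ⟨⟨⟨t, ht⟩⟩, inferInstance⟩)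
    rw [← Nat.card_eq_fintype_card, ← qK_eq, TKmap, ← map_pow, OK_res] at h0
    exact IsT.eq_of_lt (ht.2.pow hq0) ht.2 h0

end conc
end LT

namespace LT

set_option linter.unusedSectionVars false

section conc

variable {p : ℕ} [hp : Fact p.Prime] {Ω : Type*} [NormedField Ω] [NormedAlgebra ℚ_[p] Ω]
  [IsUltrametricDist Ω] [IsAlgClosed Ω] [CharZero Ω] [Algebra.IsAlgebraic ℚ_[p] Ω]
  [TeichP p Ω] [NInv (Ω ≃ₐ[ℚ_[p]] Ω) Ω]

open Polynomial

lemma orb_finite (H : Subgroup (Ω ≃ₐ[ℚ_[p]] Ω)) (x : Ω) : {y | ∃ γ ∈ H, γ • x = y}.Finite := by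
  have hx : IsIntegral ℚ_[p] x := Algebra.IsIntegral.isIntegral x
  have := (minpoly ℚ_[p] x).rootSet_finite Ω
  refine this.subset ?_
  rintro y ⟨γ, _, rfl⟩
  rw [Polynomial.mem_rootSet]
  refine ⟨minpoly.ne_zero hx, ?_⟩
  have h2 := Polynomial.aeval_algHom_apply γ.toAlgHom x (minpoly ℚ_[p] x)
  simp only [minpoly.aeval, map_zero] at h2
  exact h2

/-- orbit -/
noncomputable def orb (H : Subgroup (Ω ≃ₐ[ℚ_[p]] Ω)) (x : Ω) : Finset Ω := (orb_finite H x).toFinset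

lemma mem_orb {H : Subgroup (Ω ≃ₐ[ℚ_[p]] Ω)} {x y : Ω} : y ∈ orb H x ↔ ∃ γ ∈ H, γ • x = y := by
  simp [orb]

/-- orbit polynomial -/
noncomputable def PP (H : Subgroup (Ω ≃ₐ[ℚ_[p]] Ω)) (x : Ω) : (Polynomial Ω) := ∏ z ∈ orb H x, (X - C z)

lemma PP_eval (H : Subgroup (Ω ≃ₐ[ℚ_[p]] Ω)) (x y : Ω) :
    (PP H x).eval y = ∏ z ∈ orb H x, (y - z) := by
  simp [PP, eval_prod]

lemma PP_self (H : Subgroup (Ω ≃ₐ[ℚ_[p]] Ω)) (x : Ω) : (PP H x).eval x = 0 := by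
  rw [PP_eval]
  exact Finset.prod_eq_zero (mem_orb.2 ⟨1, H.one_mem, one_smul _ x⟩) (sub_self x)

lemma PP_coeff_act {H : Subgroup (Ω ≃ₐ[ℚ_[p]] Ω)} {x : Ω} {γ : Ω ≃ₐ[ℚ_[p]] Ω} (hγ : γ ∈ H) (i : ℕ) :
    γ • (PP H x).coeff i = (PP H x).coeff i := by
  have h : (PP H x).map (γ : Ω →+* Ω) = PP H x := by
    rw [PP, Polynomial.map_prod]
    refine Finset.prod_bij (fun z _ => γ • z) ?_ ?_ ?_ ?_
    · intro z hz
      obtain ⟨g, hg, rfl⟩ := mem_orb.1 hz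
      exact mem_orb.2 ⟨γ * g, H.mul_mem hγ hg, mul_smul _ _ _⟩
    · intro a _ b _ hab
      exact smul_left_cancel _ hab
    · intro z hz
      obtain ⟨g, hg, rfl⟩ := mem_orb.1 hz
      exact ⟨γ⁻¹ • g • x, mem_orb.2 ⟨γ⁻¹ * g, H.mul_mem (H.inv_mem hγ) hg, mul_smul _ _ _⟩, by simp⟩
    · intro z _
      simp
  have h2 := congrArg (fun P => P.coeff i) h
  simp only [coeff_map] at h2
  exact h2

lemma coeff_prodX_le (s : Finset Ω) (hs : ∀ z ∈ s, ‖z‖ ≤ 1) (i : ℕ) :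
    ‖(∏ z ∈ s, (X - C z)).coeff i‖ ≤ 1 := by
  classical
  induction s using Finset.induction_on generalizing i with
  | empty => rw [Finset.prod_empty, coeff_one]; split_ifs <;> simp
  | insert a s ha ih =>
    have ih := ih fun z hz => hs z (by simp [hz])
    have ha1 := hs a (by simp)
    rw [Finset.prod_insert ha, mul_comm]
    cases i with
    | zero =>
      rw [mul_coeff_zero, norm_mul]
      refine mul_le_one₀ (ih 0) (norm_nonneg _) ?_
      simpa using ha1
    | succ i =>
      rw [coeff_mul_X_sub_C]
      refine u_sub (ih i) ?_
      rw [norm_mul]; exact mul_le_one₀ (ih _) (norm_nonneg _) ha1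

lemma PP_coeff_le {H : Subgroup (Ω ≃ₐ[ℚ_[p]] Ω)} {x : Ω} (hx : ‖x‖ ≤ 1) (i : ℕ) :
    ‖(PP H x).coeff i‖ ≤ 1 := by
  apply coeff_prodX_le
  intro z hz
  obtain ⟨g, hg, rfl⟩ := mem_orb.1 hz
  rwa [norm_act]

/-- if the orbit polynomial is small at a Teichmueller point, it is in the orbit -/
lemma PP_small {H : Subgroup (Ω ≃ₐ[ℚ_[p]] Ω)} {x y : Ω} (hx : IsT p x) (hy : IsT p y)
    (h : ‖(PP H x).eval y‖ < 1) : ∃ γ ∈ H, γ • x = y := by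
  rw [PP_eval, norm_prod] at h
  by_contra hcon
  push Not at hcon
  refine absurd h (not_lt.2 (Finset.one_le_prod fun z hz => ?_))
  obtain ⟨g, hg, rfl⟩ := mem_orb.1 hz
  by_contra h1
  exact hcon g hg (IsT.eq_of_lt hy (hx.act g) (not_le.1 h1)).symm

lemma frob_single {K : IntermediateField ℚ_[p] Ω} [FiniteDimensional ℚ_[p] K] {ζ : Ω} (hζ : IsT p ζ) :
    ∃ γ ∈ K.fixingSubgroup, γ • ζ = ζ ^ qK K := by
  obtain ⟨⟨r, hr, hq⟩, hT⟩ := qK_pow K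
  have hq0 : qK K ≠ 0 := by rw [hq]; exact pow_ne_zero _ hp.out.ne_zero
  apply PP_small hζ (hζ.pow hq0)
  set P := PP K.fixingSubgroup ζ with hP
  have hc1 : ∀ i, ‖P.coeff i‖ ≤ 1 := PP_coeff_le hζ.norm_le
  have hcK : ∀ i, P.coeff i ∈ K := fun i => mem_K_iff.2 (mem_FF.2 fun γ hγ => PP_coeff_act hγ i)
  have hcq : ∀ i, ‖P.coeff i ^ qK K - P.coeff i‖ < 1 := by
    intro i
    obtain ⟨t, ht, h⟩ := TK_near (hcK i) (hc1 i)
    have h2 := (u_pow_sub (hc1 i) ht.2.norm_le (qK K)).trans_lt h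
    rw [hT t ht] at h2
    rw [norm_sub_rev] at h
    exact u_trans_lt h2 h
  have h0 : (∑ i ∈ Finset.range (P.natDegree + 1), P.coeff i * ζ ^ i) = 0 := by
    rw [← eval_eq_sum_range]; exact PP_self _ _
  have h1 := u_frob_sum (p := p) (Finset.range (P.natDegree + 1)) (fun i => P.coeff i * ζ ^ i)
    (fun i _ => by
      rw [norm_mul, norm_pow]
      exact mul_le_one₀ (hc1 i) (by positivity) (pow_le_one₀ (norm_nonneg _) hζ.norm_le)) r
  rw [h0, ← hq, zero_pow hq0, zero_sub, norm_neg] at h1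
  rw [eval_eq_sum_range]
  have h2 : ‖∑ i ∈ Finset.range (P.natDegree + 1), (P.coeff i * ζ ^ i) ^ qK K -
      ∑ i ∈ Finset.range (P.natDegree + 1), P.coeff i * (ζ ^ qK K) ^ i‖ < 1 := by
    rw [← Finset.sum_sub_distrib]
    refine u_sum_lt _ one_pos fun i _ => ?_
    have e : (P.coeff i * ζ ^ i) ^ qK K - P.coeff i * (ζ ^ qK K) ^ i =
      (P.coeff i ^ qK K - P.coeff i) * (ζ ^ qK K) ^ i := by
      rw [mul_pow, ← pow_mul, ← pow_mul, mul_comm i]; ring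
    rw [e, norm_mul]
    refine (mul_le_of_le_one_right (norm_nonneg _) ?_).trans_lt (hcq i)
    rw [norm_pow]
    exact pow_le_one₀ (norm_nonneg _) (hζ.pow hq0).norm_le
  have h3 := u_sub_lt h1 h2
  rwa [sub_sub_cancel] at h3

lemma TK_of_pow {K : IntermediateField ℚ_[p] Ω} [FiniteDimensional ℚ_[p] K] {t : Ω}
    (ht : t ^ qK K = t) : t ∈ TK K := by
  obtain ⟨⟨r, hr, hq⟩, hT⟩ := qK_pow K
  have hq2 : 2 ≤ qK K := by rw [hq]; exact hp.out.two_le.trans (Nat.le_self_pow hr p)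
  have hdeg : (X ^ qK K - X : (Polynomial Ω)).natDegree = qK K := FiniteField.X_pow_card_sub_X_natDegree_eq Ω (by omega)
  have hne : (X ^ qK K - X : (Polynomial Ω)) ≠ 0 := by
    intro h; rw [h] at hdeg; simp at hdeg; omega
  classical
  have hsub : (TK_finite K).toFinset ⊆ (X ^ qK K - X : (Polynomial Ω)).roots.toFinset := by
    intro z hz
    rw [Set.Finite.mem_toFinset] at hz
    rw [Multiset.mem_toFinset, mem_roots hne]
    simp [IsRoot, hT z hz]
  have hcard : (TK_finite K).toFinset.card = qK K := by
    rw [qK, Nat.card_coe_set_eq, Set.ncard_eq_toFinset_card _ (TK_finite K)]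
  have heq := Finset.eq_of_subset_of_card_le hsub (by
    rw [hcard]
    exact (Multiset.toFinset_card_le _).trans ((card_roots' _).trans hdeg.le))
  have : t ∈ (X ^ qK K - X : (Polynomial Ω)).roots.toFinset := by
    rw [Multiset.mem_toFinset, mem_roots hne]
    simp [IsRoot, ht]
  rw [← heq, Set.Finite.mem_toFinset] at this
  exact this

lemma frob_orbit {K : IntermediateField ℚ_[p] Ω} [FiniteDimensional ℚ_[p] K] {φ : Ω ≃ₐ[ℚ_[p]] Ω}
    (hφ : IsFrob p Ω (qK K) φ) {γ : Ω ≃ₐ[ℚ_[p]] Ω} (hγ : γ ∈ K.fixingSubgroup) {ζ : Ω} (hζ : IsT p ζ) :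
    ∃ j : ℤ, γ • ζ = φ ^ j • ζ := by
  suffices h : ∃ g ∈ Subgroup.zpowers φ, g • ζ = γ • ζ by
    obtain ⟨g, ⟨j, rfl⟩, h⟩ := h
    exact ⟨j, h.symm⟩
  apply PP_small hζ (hζ.act γ)
  set P := PP (Subgroup.zpowers φ) ζ with hP
  have hc1 : ∀ i, ‖P.coeff i‖ ≤ 1 := PP_coeff_le hζ.norm_le
  have hq0 : qK K ≠ 0 := hφ.ne_zero hp.out
  have hcγ : ∀ i, ‖P.coeff i - γ • P.coeff i‖ < 1 := by
    intro i
    obtain ⟨t, ht, h⟩ := TeichP.ex (P.coeff i) (hc1 i)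
    have e1 : φ • P.coeff i = P.coeff i := PP_coeff_act (Subgroup.mem_zpowers φ) i
    have e2 : ‖P.coeff i - φ • t‖ < 1 := by
      rw [← norm_act φ, smul_sub, e1] at h
      exact h
    have e3 : t ^ qK K = t := by
      rw [hφ.2 t ht, norm_sub_rev] at e2
      exact IsT.eq_of_lt (ht.pow hq0) ht (u_trans_lt e2 h)
    have e4 : γ • t = t := mem_FF.1 (mem_K_iff.1 (TK_of_pow e3).1) γ hγ
    have e5 := h
    rw [← norm_act γ, smul_sub, e4, norm_sub_rev] at e5
    exact u_trans_lt h e5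
  have h0 : γ • (∑ i ∈ Finset.range (P.natDegree + 1), P.coeff i * ζ ^ i) = 0 := by
    rw [← eval_eq_sum_range, PP_self, smul_zero]
  rw [eval_eq_sum_range, ← sub_zero (∑ i ∈ _, _), ← h0, Finset.smul_sum, ← Finset.sum_sub_distrib]
  refine u_sum_lt _ one_pos fun i _ => ?_
  rw [smul_mul', smul_pow', ← sub_mul, norm_mul]
  refine (mul_le_of_le_one_right (norm_nonneg _) ?_).trans_lt (hcγ i)
  rw [norm_pow]
  exact pow_le_one₀ (norm_nonneg _) (hζ.act γ).norm_le

lemma isClosed_act (x y : Ω) : IsClosed {γ : Ω ≃ₐ[ℚ_[p]] Ω | γ • x = y} := by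
  by_cases h : ∃ g : Ω ≃ₐ[ℚ_[p]] Ω, g • x = y
  · obtain ⟨g, rfl⟩ := h
    have h1 : IsOpen (MulAction.stabilizer (Ω ≃ₐ[ℚ_[p]] Ω) x : Set (Ω ≃ₐ[ℚ_[p]] Ω)) :=
      stabilizer_isOpen_of_isIntegral (K := ℚ_[p]) x
    have h2 := (Subgroup.isClosed_of_isOpen _ h1).leftCoset g
    convert h2 using 1
    ext γ
    rw [mem_leftCoset_iff]
    simp only [Set.mem_ofPred_eq, SetLike.mem_coe, MulAction.mem_stabilizer_iff, mul_smul,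
      inv_smul_eq_iff]
  · convert isClosed_empty
    ext γ
    simp only [Set.mem_ofPred_eq, Set.mem_empty_iff_false, iff_false]
    exact fun h' => h ⟨γ, h'⟩

lemma isClosed_fix (K : IntermediateField ℚ_[p] Ω) :
    IsClosed (K.fixingSubgroup : Set (Ω ≃ₐ[ℚ_[p]] Ω)) := by
  have : (K.fixingSubgroup : Set (Ω ≃ₐ[ℚ_[p]] Ω)) = ⋂ x ∈ K, {γ | γ • x = x} := by
    ext γ
    simp only [SetLike.mem_coe, IntermediateField.mem_fixingSubgroup_iff, Set.mem_iInter,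
      Set.mem_ofPred_eq]
    rfl
  rw [this]
  exact isClosed_biInter fun x _ => isClosed_act x x

lemma exists_prim {m : ℕ} (hm : m ≠ 0) : ∃ ε : Ω, IsPrimitiveRoot ε m := by
  have : NeZero m := ⟨hm⟩
  exact HasEnoughRootsOfUnity.exists_primitiveRoot Ω m

lemma isT_of_pow {m : ℕ} (hm : 0 < m) (hc : m.Coprime p) {z : Ω} (hz : z ^ m = 1) : IsT p z :=
  Or.inr ⟨m, hm, hc, hz⟩

theorem exists_frob (K : IntermediateField ℚ_[p] Ω) [FiniteDimensional ℚ_[p] K] :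
    ∃ φ ∈ K.fixingSubgroup, IsFrob p Ω (qK K) φ := by
  let ι := {m : ℕ // 0 < m ∧ m.Coprime p}
  let t : ι → Set (Ω ≃ₐ[ℚ_[p]] Ω) := fun m => K.fixingSubgroup ∩
    ⋂ z ∈ {z : Ω | z ^ m.1 = 1}, {γ : Ω ≃ₐ[ℚ_[p]] Ω | γ • z = z ^ qK K}
  have hne : Nonempty ι := ⟨⟨1, one_pos, Nat.coprime_one_left p⟩⟩
  have hcl : ∀ m, IsClosed (t m) := fun m =>
    (isClosed_fix K).inter (isClosed_biInter fun z _ => isClosed_act z _)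
  obtain ⟨φ, hφ⟩ := IsCompact.nonempty_iInter_of_directed_nonempty_isCompact_isClosed t (by
      intro a b
      refine ⟨⟨a.1 * b.1, Nat.mul_pos a.2.1 b.2.1, Nat.Coprime.mul_left a.2.2 b.2.2⟩, ?_, ?_⟩
      · rintro γ ⟨h1, h2⟩
        refine ⟨h1, ?_⟩
        simp only [Set.mem_iInter] at h2 ⊢
        intro z hz
        refine h2 z ?_
        simp only [Set.mem_ofPred_eq] at hz ⊢
        rw [pow_mul, hz, one_pow]
      · rintro γ ⟨h1, h2⟩
        refine ⟨h1, ?_⟩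
        simp only [Set.mem_iInter] at h2 ⊢
        intro z hz
        refine h2 z ?_
        simp only [Set.mem_ofPred_eq] at hz ⊢
        rw [mul_comm, pow_mul, hz, one_pow]) (by
      intro m
      obtain ⟨ε, hε⟩ := exists_prim (Ω := Ω) m.2.1.ne'
      obtain ⟨γ, hγ, h⟩ := frob_single (K := K) (isT_of_pow m.2.1 m.2.2 hε.pow_eq_one)
      refine ⟨γ, hγ, ?_⟩
      simp only [Set.mem_iInter]
      intro z hz
      have : NeZero m.1 := ⟨m.2.1.ne'⟩
      obtain ⟨i, _, rfl⟩ := hε.eq_pow_of_pow_eq_one hz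
      change γ • ε ^ i = _
      rw [smul_pow', h, ← pow_mul, mul_comm, pow_mul]) (fun m => (hcl m).isCompact) hcl
  rw [Set.mem_iInter] at hφ
  refine ⟨φ, (hφ hne.some).1, (qK_pow K).1, ?_⟩
  rintro z (rfl | ⟨m, hm, hc, hz⟩)
  · obtain ⟨⟨r, hr, hq⟩, hT⟩ := qK_pow K
    rw [smul_zero, zero_pow]
    rw [hq]; exact pow_ne_zero _ hp.out.ne_zero
  · have := (hφ ⟨m, hm, hc⟩).2
    simp only [Set.mem_iInter] at this
    exact this z hz

variable (p Ω) in
/-- inertia -/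
def II : Subgroup (Ω ≃ₐ[ℚ_[p]] Ω) where
  carrier := {γ | ∀ z : Ω, IsT p z → γ • z = z}
  one_mem' := fun z _ => one_smul _ z
  mul_mem' {a b} ha hb z hz := by rw [mul_smul, hb z hz, ha z hz]
  inv_mem' {a} ha z hz := by rw [inv_smul_eq_iff, ha z hz]

lemma mem_II {γ : Ω ≃ₐ[ℚ_[p]] Ω} : γ ∈ II p Ω ↔ ∀ z : Ω, IsT p z → γ • z = z := Iff.rfl

lemma II_nz (γ : Ω ≃ₐ[ℚ_[p]] Ω) : Nz γ (II p Ω) := by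
  have key : ∀ g h : Ω ≃ₐ[ℚ_[p]] Ω, h ∈ II p Ω → g⁻¹ * h * g ∈ II p Ω := by
    intro g h hh z hz
    rw [mul_smul, mul_smul, hh _ (hz.act g), inv_smul_smul]
  intro h
  refine ⟨key γ h, fun hh => ?_⟩
  have := key γ⁻¹ _ hh
  simpa [mul_assoc] using this

/-- inertia of `K` -/
noncomputable def IK (K : IntermediateField ℚ_[p] Ω) : Subgroup (Ω ≃ₐ[ℚ_[p]] Ω) := K.fixingSubgroup ⊓ II p Ω

lemma IK_le (K : IntermediateField ℚ_[p] Ω) : IK K ≤ K.fixingSubgroup := inf_le_left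

lemma IK_mono {K L : IntermediateField ℚ_[p] Ω} (h : K ≤ L) : IK L ≤ IK K :=
  inf_le_inf_right _ (IntermediateField.fixingSubgroup_antitone h)

lemma IK_nz {K : IntermediateField ℚ_[p] Ω} {γ : Ω ≃ₐ[ℚ_[p]] Ω} (h : γ ∈ K.fixingSubgroup) :
    Nz γ (IK K) := (Nz.of_mem h).inf (II_nz γ)

lemma T_mem_IK (K : IntermediateField ℚ_[p] Ω) {z : Ω} (hz : IsT p z) : z ∈ FF Ω (IK K) :=
  mem_FF.2 fun _ hγ => hγ.2 z hz

theorem unram (K : IntermediateField ℚ_[p] Ω) {z : Ω} (hz : z ∈ FF Ω (IK K)) :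
    ∃ m : ℕ, 0 < m ∧ m.Coprime p ∧ ∀ γ ∈ K.fixingSubgroup, (∀ ζ : Ω, ζ ^ m = 1 → γ • ζ = ζ) →
      γ • z = z := by
  by_contra hcon
  push Not at hcon
  let ι := {m : ℕ // 0 < m ∧ m.Coprime p}
  let t : ι → Set (Ω ≃ₐ[ℚ_[p]] Ω) := fun m => (K.fixingSubgroup ∩
    ⋂ z ∈ {z : Ω | z ^ m.1 = 1}, {γ : Ω ≃ₐ[ℚ_[p]] Ω | γ • z = z}) ∩ {γ | γ • z = z}ᶜ
  have hne : Nonempty ι := ⟨⟨1, one_pos, Nat.coprime_one_left p⟩⟩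
  have hcl : ∀ m, IsClosed (t m) := fun m => by
    refine ((isClosed_fix K).inter (isClosed_biInter fun z _ => isClosed_act z _)).inter ?_
    rw [isClosed_compl_iff]
    exact stabilizer_isOpen_of_isIntegral (K := ℚ_[p]) z
  obtain ⟨φ, hφ⟩ := IsCompact.nonempty_iInter_of_directed_nonempty_isCompact_isClosed t (by
      intro a b
      refine ⟨⟨a.1 * b.1, Nat.mul_pos a.2.1 b.2.1, Nat.Coprime.mul_left a.2.2 b.2.2⟩, ?_, ?_⟩
      · rintro γ ⟨⟨h1, h2⟩, h3⟩
        refine ⟨⟨h1, ?_⟩, h3⟩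
        simp only [Set.mem_iInter] at h2 ⊢
        intro z hz
        refine h2 z ?_
        simp only [Set.mem_ofPred_eq] at hz ⊢
        rw [pow_mul, hz, one_pow]
      · rintro γ ⟨⟨h1, h2⟩, h3⟩
        refine ⟨⟨h1, ?_⟩, h3⟩
        simp only [Set.mem_iInter] at h2 ⊢
        intro z hz
        refine h2 z ?_
        simp only [Set.mem_ofPred_eq] at hz ⊢
        rw [mul_comm, pow_mul, hz, one_pow]) (by
      intro m
      obtain ⟨γ, hγ, h1, h2⟩ := hcon m.1 m.2.1 m.2.2
      refine ⟨γ, ⟨hγ, ?_⟩, h2⟩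
      simp only [Set.mem_iInter]
      exact h1) (fun m => (hcl m).isCompact) hcl
  rw [Set.mem_iInter] at hφ
  refine (hφ hne.some).2 (mem_FF.1 hz φ ⟨(hφ hne.some).1.1, ?_⟩)
  rintro z (rfl | ⟨m, hm, hc, hz⟩)
  · rw [smul_zero]
  · have := (hφ ⟨m, hm, hc⟩).1.2
    simp only [Set.mem_iInter] at this
    exact this z hz

theorem top_mem {K : IntermediateField ℚ_[p] Ω} [FiniteDimensional ℚ_[p] K] {φ : Ω ≃ₐ[ℚ_[p]] Ω}
    (hφK : φ ∈ K.fixingSubgroup)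
    (hφ : IsFrob p Ω (qK K) φ) {z : Ω} (hz : z ∈ FF Ω (IK K)) (hφz : φ • z = z) : z ∈ K := by
  rw [mem_K_iff, mem_FF]
  intro γ hγ
  obtain ⟨m, hm, hc, h⟩ := unram K hz
  obtain ⟨ε, hε⟩ := exists_prim (Ω := Ω) hm.ne'
  obtain ⟨j, hj⟩ := frob_orbit hφ hγ (isT_of_pow hm hc hε.pow_eq_one)
  have h1 := h ((φ ^ j)⁻¹ * γ) (Subgroup.mul_mem _ (Subgroup.inv_mem _ (Subgroup.zpow_mem _ hφK j)) hγ) (by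
    intro ζ hζ
    have : NeZero m := ⟨hm.ne'⟩
    obtain ⟨i, _, rfl⟩ := hε.eq_pow_of_pow_eq_one hζ
    rw [smul_pow', mul_smul, hj, inv_smul_smul])
  rw [mul_smul, inv_smul_eq_iff] at h1
  rw [h1]
  have : φ ^ j ∈ MulAction.stabilizer (Ω ≃ₐ[ℚ_[p]] Ω) z := Subgroup.zpow_mem _ hφz j
  exact this

end conc
end LT

namespace LT

set_option linter.unusedSectionVars false

section conc

variable {p : ℕ} [hp : Fact p.Prime] {Ω : Type*} [NormedField Ω] [NormedAlgebra ℚ_[p] Ω]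
  [IsUltrametricDist Ω] [IsAlgClosed Ω] [CharZero Ω] [Algebra.IsAlgebraic ℚ_[p] Ω]
  [TeichP p Ω] [NInv (Ω ≃ₐ[ℚ_[p]] Ω) Ω]

lemma index_fix (K : IntermediateField ℚ_[p] Ω) :
    K.fixingSubgroup.index = Module.finrank ℚ_[p] K :=
  (IntermediateField.finrank_eq_fixingSubgroup_index Ω K).symm

lemma index_fix_ne (K : IntermediateField ℚ_[p] Ω) [FiniteDimensional ℚ_[p] K] :
    K.fixingSubgroup.index ≠ 0 := by
  rw [index_fix]; exact Module.finrank_pos.ne'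

lemma rel_fix_ne (K : IntermediateField ℚ_[p] Ω) [FiniteDimensional ℚ_[p] K]
    (H : Subgroup (Ω ≃ₐ[ℚ_[p]] Ω)) : K.fixingSubgroup.relIndex H ≠ 0 := by
  have h := index_fix_ne K
  have : K.fixingSubgroup.FiniteIndex := ⟨h⟩
  exact Subgroup.FiniteIndex.index_ne_zero (H := K.fixingSubgroup.subgroupOf H)

lemma IK_eq {K L : IntermediateField ℚ_[p] Ω} (h : K ≤ L) : IK L = L.fixingSubgroup ⊓ IK K := by
  rw [IK, IK, ← inf_assoc, inf_eq_left.2 (IntermediateField.fixingSubgroup_antitone h)]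

lemma rel_IK_ne {K L : IntermediateField ℚ_[p] Ω} [FiniteDimensional ℚ_[p] L] (h : K ≤ L) :
    (IK L).relIndex (IK K) ≠ 0 := by
  rw [IK_eq h, Subgroup.inf_relIndex_right]
  exact rel_fix_ne L _

lemma norm_Qp {x : Ω} (hx : x ∈ FF Ω (⊤ : Subgroup (Ω ≃ₐ[ℚ_[p]] Ω))) (h0 : x ≠ 0) :
    ∃ i : ℤ, ‖x‖ = (p : ℝ) ^ (-i) := by
  have h1 : x ∈ (⊥ : IntermediateField ℚ_[p] Ω) := by
    rw [mem_K_iff]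
    exact FF_anti le_top hx
  obtain ⟨y, rfl⟩ := IntermediateField.mem_bot.1 h1
  refine ⟨y.valuation, ?_⟩
  rw [norm_algebraMap']
  exact Padic.norm_eq_zpow_neg_valuation (by rintro rfl; simp at h0)

/-- uniformizer of `K` -/
structure IsU (K : IntermediateField ℚ_[p] Ω) (ϖ : Ω) : Prop where
  mem : ϖ ∈ K
  pos : 0 < ‖ϖ‖
  lt : ‖ϖ‖ < 1
  val : ∀ y ∈ K, y ≠ 0 → ∃ i : ℤ, ‖y‖ = ‖ϖ‖ ^ i

/-- maximal norm less than one implies uniformizer -/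
lemma IsU.of_max {K : IntermediateField ℚ_[p] Ω} {ϖ : Ω} (h : ϖ ∈ K) (h0 : 0 < ‖ϖ‖) (h1 : ‖ϖ‖ < 1)
    (hm : ∀ y ∈ K, ‖y‖ < 1 → ‖y‖ ≤ ‖ϖ‖) : IsU K ϖ := by
  refine ⟨h, h0, h1, fun y hy hy0 => ?_⟩
  obtain ⟨i, hi⟩ := exists_mem_Ico_zpow (norm_pos_iff.2 hy0) ((one_lt_inv₀ h0).2 h1)
  have hw0 : ϖ ≠ 0 := norm_pos_iff.1 h0
  refine ⟨-i, ?_⟩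
  rw [inv_zpow', inv_zpow'] at hi
  set z := y * ϖ ^ (i + 1) with hz
  have hzK : z ∈ K := mul_mem hy (zpow_mem h _)
  have hpp : 0 < ‖ϖ‖ ^ (i + 1) := zpow_pos h0 _
  have hz1 : ‖z‖ < 1 := by
    rw [hz, norm_mul, norm_zpow]
    calc _ < ‖ϖ‖ ^ (-(i+1)) * ‖ϖ‖ ^ (i + 1) := mul_lt_mul_of_pos_right hi.2 hpp
      _ = 1 := by rw [← zpow_add₀ h0.ne']; simp
  have h2 := hm z hzK hz1
  rw [hz, norm_mul, norm_zpow, zpow_add_one₀ h0.ne', ← mul_assoc] at h2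
  have h3 : ‖y‖ * ‖ϖ‖ ^ i ≤ 1 := by
    by_contra hc
    push Not at hc
    nlinarith
  refine le_antisymm ?_ hi.1
  rw [zpow_neg]
  rwa [← le_div_iff₀ (zpow_pos h0 _), one_div] at h3

theorem exists_U (K : IntermediateField ℚ_[p] Ω) [FiniteDimensional ℚ_[p] K] : ∃ ϖ, IsU K ϖ := by
  have hp1 : (1 : ℝ) < p := by exact_mod_cast hp.out.one_lt
  have hn := index_fix_ne K
  set n := K.fixingSubgroup.index with hnn
  have hv : ∀ y ∈ K, y ≠ 0 → ∃ i : ℤ, ‖y‖ ^ n = (p : ℝ) ^ (-i) := by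
    intro y hy hy0
    have hy' := mem_K_iff.1 hy
    have hr : K.fixingSubgroup.relIndex ⊤ ≠ 0 := by rwa [Subgroup.relIndex_top_right]
    obtain ⟨i, hi⟩ := norm_Qp (rN_mem hr hy') (rN_ne_zero hr hy' hy0)
    rw [norm_rN hr hy', Subgroup.relIndex_top_right] at hi
    exact ⟨i, hi⟩
  have hv' : ∀ y ∈ K, y ≠ 0 → ‖y‖ < 1 → ∃ i : ℕ, ‖y‖ ^ n = (p : ℝ) ^ (-(i : ℤ)) := by
    intro y hy hy0 hy1
    obtain ⟨i, hi⟩ := hv y hy hy0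
    have : (p : ℝ) ^ (-i) < 1 := by rw [← hi]; exact pow_lt_one₀ (norm_nonneg _) hy1 hn
    have h0 : 0 ≤ i := by
      by_contra hc
      exact absurd this (not_lt.2 (one_le_zpow₀ hp1.le (by omega)))
    lift i to ℕ using h0
    exact ⟨i, hi⟩
  have hex : ∃ i : ℕ, ∃ y ∈ K, y ≠ 0 ∧ ‖y‖ < 1 ∧ ‖y‖ ^ n = (p : ℝ) ^ (-(i : ℤ)) := by
    have h1 : (p : Ω) ∈ K := natCast_mem K p
    have h2 : (p : Ω) ≠ 0 := by exact_mod_cast hp.out.ne_zero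
    obtain ⟨i, hi⟩ := hv' _ h1 h2 norm_p_lt
    exact ⟨i, _, h1, h2, norm_p_lt, hi⟩
  classical
  obtain ⟨y, hy, hy0, hy1, hyi⟩ := Nat.find_spec hex
  refine ⟨y, IsU.of_max hy (norm_pos_iff.2 hy0) hy1 fun z hz hz1 => ?_⟩
  by_cases hz0 : z = 0
  · rw [hz0, norm_zero]; exact norm_nonneg _
  obtain ⟨j, hj⟩ := hv' z hz hz0 hz1
  have := Nat.find_min' hex ⟨z, hz, hz0, hz1, hj⟩
  rw [← pow_le_pow_iff_left₀ (norm_nonneg _) (norm_nonneg _) hn, hyi, hj]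
  exact zpow_le_zpow_right₀ hp1.le (by omega)

theorem IsU.val_IK {K : IntermediateField ℚ_[p] Ω} [FiniteDimensional ℚ_[p] K] {ϖ : Ω} (h : IsU K ϖ)
    {z : Ω} (hz : z ∈ FF Ω (IK K)) (hz0 : z ≠ 0) : ∃ i : ℤ, ‖z‖ = ‖ϖ‖ ^ i := by
  obtain ⟨φ, hφK, hφ⟩ := exists_frob K
  obtain ⟨d, hd, hdz⟩ := Per.per φ z
  obtain ⟨ζ, hζ, h1, h2⟩ := unif hφ hd hz0 hdz
  rw [← h2]
  apply h.val
  · refine top_mem hφK hφ (sum_mem fun i _ => ((IK_nz hφK).pow i).smul_mem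
      (mul_mem (T_mem_IK K hζ) hz)) h1
  · rw [← norm_ne_zero_iff, h2]; exact norm_ne_zero_iff.2 hz0

lemma IsU.disc {K : IntermediateField ℚ_[p] Ω} {ϖ : Ω} (h : IsU K ϖ) {y : Ω} (hy : y ∈ K)
    (h1 : ‖y‖ < 1) : ‖y‖ ≤ ‖ϖ‖ := by
  by_cases hy0 : y = 0
  · rw [hy0, norm_zero]; exact norm_nonneg _
  obtain ⟨i, hi⟩ := h.val y hy hy0
  rw [hi] at h1 ⊢
  have hi1 : 1 ≤ i := by
    by_contra hc
    exact absurd h1 (not_lt.2 (one_le_zpow_of_nonpos₀ h.pos h.lt.le (by omega)))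
  calc ‖ϖ‖ ^ i ≤ ‖ϖ‖ ^ (1 : ℤ) := zpow_le_zpow_right_of_le_one₀ h.pos h.lt.le hi1
    _ = ‖ϖ‖ := zpow_one _

/-- same uniformizer norm -/
lemma IsU.norm_eq {K : IntermediateField ℚ_[p] Ω} {a b : Ω} (h : IsU K a) (h' : IsU K b) : ‖a‖ = ‖b‖ :=
  le_antisymm (h'.disc h.mem h.lt) (h.disc h'.mem h'.lt)

lemma qK_bot : qK (⊥ : IntermediateField ℚ_[p] Ω) = p := by
  obtain ⟨⟨r, hr, hq⟩, hT⟩ := qK_pow (⊥ : IntermediateField ℚ_[p] Ω)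
  have hex : ∀ t : TK (⊥ : IntermediateField ℚ_[p] Ω), ∃ n : Fin p, ‖t.1 - (n : ℕ)‖ < 1 := by
    intro t
    obtain ⟨y, hy⟩ := IntermediateField.mem_bot.1 t.2.1
    have hy1 : ‖y‖ ≤ 1 := by
      have := t.2.2.norm_le
      rwa [← hy, norm_algebraMap'] at this
    obtain ⟨n, hn, hm⟩ := PadicInt.exists_mem_range (⟨y, hy1⟩ : ℤ_[p])
    rw [IsLocalRing.mem_maximalIdeal, PadicInt.mem_nonunits] at hm
    refine ⟨⟨n, hn⟩, ?_⟩
    rw [← hy]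
    have e : algebraMap ℚ_[p] Ω y - ((n : ℕ) : Ω) = algebraMap ℚ_[p] Ω (y - n) := by simp
    rw [e, norm_algebraMap']
    exact hm
  choose g hg using hex
  have hinj : Function.Injective g := by
    intro a b hab
    apply Subtype.ext
    apply IsT.eq_of_lt a.2.2 b.2.2
    have h1 := hg a
    have h2 := hg b
    rw [← hab, norm_sub_rev] at h2
    exact u_trans_lt h1 h2
  have hle : qK (⊥ : IntermediateField ℚ_[p] Ω) ≤ p := by
    have := Nat.card_le_card_of_injective g hinj
    simpa [qK] using this
  rw [hq] at hle ⊢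
  exact le_antisymm hle (Nat.le_self_pow hr p)

end conc
end LT

namespace LT

set_option linter.unusedSectionVars false

section conc

variable {p : ℕ} [hp : Fact p.Prime] {Ω : Type*} [NormedField Ω] [NormedAlgebra ℚ_[p] Ω]
  [IsUltrametricDist Ω] [IsAlgClosed Ω] [CharZero Ω] [Algebra.IsAlgebraic ℚ_[p] Ω]
  [TeichP p Ω] [NInv (Ω ≃ₐ[ℚ_[p]] Ω) Ω]

/-- generators of `L` over `K` -/
def gens (L : IntermediateField ℚ_[p] Ω) (ϖ : Ω) (e : ℕ) : Set Ω :=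
  {z | ∃ t ∈ TK L, ∃ j < e, z = t * ϖ ^ j}

lemma gens_finite (L : IntermediateField ℚ_[p] Ω) [FiniteDimensional ℚ_[p] L] (ϖ : Ω) (e : ℕ) :
    (gens L ϖ e).Finite := by
  refine (((TK_finite L).prod (Set.finite_Iio e)).image (fun t => t.1 * ϖ ^ t.2)).subset ?_
  rintro z ⟨t, ht, j, hj, rfl⟩
  exact ⟨(t, j), ⟨ht, hj⟩, rfl⟩

lemma span_gens {K L : IntermediateField ℚ_[p] Ω} [FiniteDimensional ℚ_[p] L] (hKL : K ≤ L)
    {a ϖ : Ω} {e : ℕ} (haK : a ∈ K) (h : IsU L ϖ) (ha1 : ‖a‖ < 1) (hae : ‖a‖ = ‖ϖ‖ ^ e)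
    {y : Ω} (hy : y ∈ L) : y ∈ Submodule.span K (gens L ϖ e) := by
  have : FiniteDimensional ℚ_[p] K :=
    Module.Finite.of_injective (IntermediateField.inclusion hKL).toLinearMap
      (IntermediateField.inclusion_injective hKL)
  set W := Submodule.span K (gens L ϖ e) with hW
  have hfW : Module.Finite K W := Module.Finite.span_of_finite K (gens_finite L ϖ e)
  have hfW' : Module.Finite ℚ_[p] W := Module.Finite.trans K W
  have hcl : IsClosed (W : Set Ω) := by
    have : FiniteDimensional ℚ_[p] (W.restrictScalars ℚ_[p]) := hfW'
    exact (W.restrictScalars ℚ_[p]).closed_of_finiteDimensional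
  have hw0 : ϖ ≠ 0 := norm_pos_iff.1 h.pos
  have ha0 : a ≠ 0 := by rw [← norm_pos_iff, hae]; exact pow_pos h.pos _
  have hsm : ∀ (k : ℕ) (w : Ω), w ∈ W → a ^ k * w ∈ W := fun k w hw =>
    W.smul_mem (⟨a ^ k, pow_mem haK k⟩ : K) hw
  have s1 : ∀ y ∈ L, ‖y‖ ≤ 1 → ∀ j ≤ e, ∃ w ∈ W, ∃ y' ∈ L, ‖y'‖ ≤ 1 ∧ y = w + ϖ ^ j * y' := by
    intro y hy hy1 j
    induction j with
    | zero => exact fun _ => ⟨0, W.zero_mem, y, hy, hy1, by simp⟩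
    | succ j ih =>
      intro hj
      obtain ⟨w, hw, y', hy', hy'1, he⟩ := ih (by omega)
      obtain ⟨t, ht, hlt⟩ := TK_near hy' hy'1
      refine ⟨w + t * ϖ ^ j, W.add_mem hw (Submodule.subset_span ⟨t, ht, j, by omega, rfl⟩),
        (y' - t) / ϖ, div_mem (sub_mem hy' ht.1) h.mem, ?_, ?_⟩
      · rw [norm_div, div_le_one h.pos]
        exact h.disc (sub_mem hy' ht.1) hlt
      · rw [he]; field_simp; ring
  have s2 : ∀ y ∈ L, ‖y‖ ≤ 1 → ∃ w ∈ W, ∃ y' ∈ L, ‖y'‖ ≤ 1 ∧ y = w + a * y' := by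
    intro y hy hy1
    obtain ⟨w, hw, y', hy', hy'1, he⟩ := s1 y hy hy1 e le_rfl
    refine ⟨w, hw, ϖ ^ e / a * y', mul_mem (div_mem (pow_mem h.mem _) (hKL haK)) hy', ?_, ?_⟩
    · rw [norm_mul, norm_div, norm_pow, hae, div_self (pow_pos h.pos _).ne', one_mul]; exact hy'1
    · rw [he]; field_simp
  have s3 : ∀ y ∈ L, ‖y‖ ≤ 1 → y ∈ W := by
    intro y hy hy1
    have s4 : ∀ k : ℕ, ∃ w ∈ W, ∃ y' ∈ L, ‖y'‖ ≤ 1 ∧ y = w + a ^ k * y' := by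
      intro k
      induction k with
      | zero => exact ⟨0, W.zero_mem, y, hy, hy1, by simp⟩
      | succ k ih =>
        obtain ⟨w, hw, y', hy', hy'1, he⟩ := ih
        obtain ⟨w', hw', y'', hy'', hy''1, he'⟩ := s2 y' hy' hy'1
        exact ⟨w + a ^ k * w', W.add_mem hw (hsm k _ hw'), y'', hy'', hy''1, by rw [he, he']; ring⟩
    have : y ∈ closure (W : Set Ω) := by
      rw [Metric.mem_closure_iff]
      intro ε hε
      obtain ⟨k, hk⟩ := exists_pow_lt_of_lt_one hε ha1
      obtain ⟨w, hw, y', hy', hy'1, he⟩ := s4 k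
      refine ⟨w, hw, ?_⟩
      rw [dist_eq_norm, he, add_sub_cancel_left, norm_mul, norm_pow]
      calc ‖a‖ ^ k * ‖y'‖ ≤ ‖a‖ ^ k * 1 := by gcongr
        _ < ε := by rwa [mul_one]
    rwa [hcl.closure_eq] at this
  have hm : 0 < max 1 ‖y‖ := lt_of_lt_of_le one_pos (le_max_left _ _)
  obtain ⟨k, hk⟩ := exists_pow_lt_of_lt_one (inv_pos.2 hm) ha1
  have h5 : a ^ k * y ∈ W := by
    apply s3 _ (mul_mem (pow_mem (hKL haK) k) hy)
    rw [norm_mul, norm_pow]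
    calc _ ≤ (max 1 ‖y‖)⁻¹ * max 1 ‖y‖ := mul_le_mul hk.le (le_max_right _ _) (norm_nonneg _) (by positivity)
      _ = 1 := inv_mul_cancel₀ hm.ne'
  have h6 := W.smul_mem (⟨(a ^ k)⁻¹, inv_mem (pow_mem haK k)⟩ : K) h5
  have h7 : (⟨(a ^ k)⁻¹, inv_mem (pow_mem haK k)⟩ : K) • (a ^ k * y) = y := by
    change (a ^ k)⁻¹ * (a ^ k * y) = y
    rw [inv_mul_cancel_left₀ (pow_ne_zero _ ha0)]
  rwa [h7] at h6

/-- elements of `Γ_K` trivial on the residue field of `L` -/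
def SS (K L : IntermediateField ℚ_[p] Ω) : Subgroup (Ω ≃ₐ[ℚ_[p]] Ω) where
  carrier := {γ | γ ∈ K.fixingSubgroup ∧ ∀ t ∈ TK L, γ • t = t}
  one_mem' := ⟨one_mem _, fun t _ => one_smul _ t⟩
  mul_mem' {a b} ha hb := ⟨mul_mem ha.1 hb.1, fun t ht => by rw [mul_smul, hb.2 t ht, ha.2 t ht]⟩
  inv_mem' {a} ha := ⟨inv_mem ha.1, fun t ht => by rw [inv_smul_eq_iff, ha.2 t ht]⟩

lemma mem_SS {K L : IntermediateField ℚ_[p] Ω} {γ : Ω ≃ₐ[ℚ_[p]] Ω} :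
    γ ∈ SS K L ↔ γ ∈ K.fixingSubgroup ∧ ∀ t ∈ TK L, γ • t = t := Iff.rfl

lemma SS_le {K L : IntermediateField ℚ_[p] Ω} : SS K L ≤ K.fixingSubgroup := fun _ h => h.1

lemma mem_fix {K : IntermediateField ℚ_[p] Ω} {γ : Ω ≃ₐ[ℚ_[p]] Ω} :
    γ ∈ K.fixingSubgroup ↔ ∀ x ∈ K, γ • x = x := by
  rw [IntermediateField.mem_fixingSubgroup_iff]; rfl

lemma le_SS {K L : IntermediateField ℚ_[p] Ω} (h : K ≤ L) : L.fixingSubgroup ≤ SS K L := fun _ hγ =>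
  ⟨IntermediateField.fixingSubgroup_antitone h hγ, fun t ht => mem_fix.1 hγ t ht.1⟩

lemma IK_le_SS {K L : IntermediateField ℚ_[p] Ω} : IK K ≤ SS K L := fun _ hγ =>
  ⟨hγ.1, fun t ht => hγ.2 t ht.2⟩

lemma mem_of_SS {K L : IntermediateField ℚ_[p] Ω} [FiniteDimensional ℚ_[p] L] (hKL : K ≤ L)
    {a ϖ : Ω} {e : ℕ} (haK : a ∈ K) (h : IsU L ϖ) (ha1 : ‖a‖ < 1) (hae : ‖a‖ = ‖ϖ‖ ^ e)
    {γ : Ω ≃ₐ[ℚ_[p]] Ω} (hγ : γ ∈ SS K L) (hγϖ : γ • ϖ = ϖ) : γ ∈ L.fixingSubgroup := by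
  rw [mem_fix]
  intro y hy
  have hs := span_gens hKL haK h ha1 hae hy
  clear hy
  induction hs using Submodule.span_induction with
  | mem x hx =>
    obtain ⟨t, ht, j, hj, rfl⟩ := hx
    rw [smul_mul', smul_pow', hγϖ, hγ.2 t ht]
  | zero => simp
  | add x y _ _ hx hy => rw [smul_add, hx, hy]
  | smul c x _ hx =>
    change γ • ((c : Ω) * x) = (c : Ω) * x
    rw [smul_mul', hx, mem_fix.1 hγ.1 c c.2]

open Polynomial in
lemma rel_SS_le {K L : IntermediateField ℚ_[p] Ω} [FiniteDimensional ℚ_[p] L] (hKL : K ≤ L)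
    {a ϖ : Ω} {e : ℕ} (haK : a ∈ K) (h : IsU L ϖ) (ha1 : ‖a‖ < 1) (hae : ‖a‖ = ‖ϖ‖ ^ e) :
    L.fixingSubgroup.relIndex (SS K L) ≤ e := by
  classical
  have hex : ∃ c : ℕ → Ω, (∀ j, c j ∈ FF Ω (SS K L)) ∧ ϖ ^ e = ∑ j ∈ Finset.range e, c j * ϖ ^ j := by
    have hs := span_gens hKL haK h ha1 hae (pow_mem h.mem e)
    generalize ϖ ^ e = y at hs
    induction hs using Submodule.span_induction with
    | mem x hx =>
      obtain ⟨t, ht, j, hj, rfl⟩ := hx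
      refine ⟨fun i => if i = j then t else 0, fun i => ?_, ?_⟩
      · dsimp only
        split_ifs
        · exact mem_FF.2 fun γ hγ => hγ.2 t ht
        · exact zero_mem _
      · simp [hj]
    | zero => exact ⟨0, fun _ => zero_mem _, by simp⟩
    | add x y _ _ hx hy =>
      obtain ⟨c, hc, rfl⟩ := hx
      obtain ⟨d, hd, rfl⟩ := hy
      exact ⟨c + d, fun j => add_mem (hc j) (hd j), by
        simp [add_mul, Finset.sum_add_distrib]⟩
    | smul k x _ hx =>
      obtain ⟨c, hc, rfl⟩ := hx
      refine ⟨fun j => k * c j, fun j => mul_mem (mem_FF.2 fun γ hγ => mem_fix.1 hγ.1 k k.2) (hc j), ?_⟩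
      change (k : Ω) * _ = _
      rw [Finset.mul_sum]
      exact Finset.sum_congr rfl fun j _ => (mul_assoc _ _ _).symm
  obtain ⟨c, hc, he⟩ := hex
  have hR : ∀ γ ∈ SS K L, (γ • ϖ) ^ e = ∑ j ∈ Finset.range e, c j * (γ • ϖ) ^ j := by
    intro γ hγ
    rw [← smul_pow', he, Finset.smul_sum]
    exact Finset.sum_congr rfl fun j _ => by rw [smul_mul', smul_pow', mem_FF.1 (hc j) γ hγ]
  set R : Polynomial Ω := ∑ j ∈ Finset.range e, C (c j) * X ^ j with hRd
  have hdeg : R.degree < e := by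
    refine mem_degreeLT.1 (Submodule.sum_mem (degreeLT Ω e) fun j hj => mem_degreeLT.2 ?_)
    refine (degree_C_mul_X_pow_le j _).trans_lt ?_
    exact_mod_cast Finset.mem_range.1 hj
  have hdegQ : (X ^ e - R).natDegree = e := by
    apply natDegree_eq_of_degree_eq_some
    rw [degree_sub_eq_left_of_degree_lt, degree_X_pow]
    rwa [degree_X_pow]
  have hQ0 : (X ^ e - R) ≠ 0 := by
    intro h0
    have h1 : (X ^ e : Polynomial Ω) = R := sub_eq_zero.1 h0
    rw [← h1, degree_X_pow] at hdeg
    exact lt_irrefl _ hdeg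
  have hroot : ∀ γ ∈ SS K L, γ • ϖ ∈ (X ^ e - R).roots := by
    intro γ hγ
    rw [mem_roots hQ0, IsRoot.def, eval_sub, eval_pow, eval_X, hR γ hγ, hRd, eval_finsetSum]
    simp
  obtain ⟨f, hf⟩ := exists_Trv_fin (rel_fix_ne L (SS K L))
  have hinj : Function.Injective (fun i => f i • ϖ) := by
    intro i j hij
    have h1 : (f i)⁻¹ * f j ∈ L.fixingSubgroup := by
      apply mem_of_SS hKL haK h ha1 hae (mul_mem (inv_mem (hf.1 i)) (hf.1 j))
      rw [mul_smul, inv_smul_eq_iff]; exact hij.symm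
    obtain ⟨k, hk, hu⟩ := hf.2 (f j) (hf.1 j)
    rw [hu i h1, hu j (by simp)]
  calc _ = (Finset.univ.image (fun i => f i • ϖ)).card := by
        rw [Finset.card_image_of_injective _ hinj, Finset.card_univ, Fintype.card_fin]
    _ ≤ (X ^ e - R).roots.toFinset.card := by
        apply Finset.card_le_card
        intro z hz
        obtain ⟨i, -, rfl⟩ := Finset.mem_image.1 hz
        exact Multiset.mem_toFinset.2 (hroot _ (hf.1 i))
    _ ≤ (X ^ e - R).natDegree := (Multiset.toFinset_card_le _).trans (card_roots' _)
    _ = e := hdegQ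

theorem ram {K L : IntermediateField ℚ_[p] Ω} [FiniteDimensional ℚ_[p] K] [FiniteDimensional ℚ_[p] L] (hKL : K ≤ L)
    {a ϖ : Ω} (ha : IsU K a) (h : IsU L ϖ) :
    ‖a‖ = ‖ϖ‖ ^ ((IK L).relIndex (IK K)) ∧ ∀ γ ∈ SS K L, ∃ i ∈ IK K, i⁻¹ * γ ∈ L.fixingSubgroup := by
  obtain ⟨e, he⟩ := h.val a (hKL ha.mem) (norm_pos_iff.1 ha.pos)
  have he0 : 0 < e := by
    by_contra hc
    have := ha.lt
    rw [he] at this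
    exact absurd this (not_lt.2 (one_le_zpow_of_nonpos₀ h.pos h.lt.le (by omega)))
  lift e to ℕ using he0.le
  rw [zpow_natCast] at he
  have hle := rel_SS_le hKL ha.mem h ha.lt he
  have hn' := rel_IK_ne hKL
  obtain ⟨g, hg⟩ := exists_Trv_fin hn'
  obtain ⟨f, hf⟩ := exists_Trv_fin (rel_fix_ne L (SS K L))
  have hϖ : ϖ ∈ FF Ω (IK L) := FF_anti (IK_le L) (mem_K_iff.1 h.mem)
  have hdvd : e ≤ (IK L).relIndex (IK K) := by
    obtain ⟨i, hi⟩ := ha.val_IK (rN_mem hn' hϖ) (rN_ne_zero hn' hϖ (norm_pos_iff.1 h.pos))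
    rw [norm_rN hn' hϖ, he, ← zpow_natCast, ← zpow_natCast, ← zpow_mul] at hi
    have h1 := zpow_right_injective₀ h.pos h.lt.ne hi
    have h2 : (e : ℤ) ∣ ((IK L).relIndex (IK K) : ℤ) := ⟨i, h1⟩
    exact Nat.le_of_dvd (Nat.pos_of_ne_zero hn') (Int.natCast_dvd_natCast.1 h2)
  have hgS : ∀ i, ∃ j, (f j)⁻¹ * g i ∈ L.fixingSubgroup := fun i => (hf.2 _ (IK_le_SS (hg.1 i))).exists
  choose m hm using hgS
  have hinj : Function.Injective m := by
    intro i j hij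
    have h1 : (g i)⁻¹ * g j ∈ L.fixingSubgroup := by
      have := mul_mem (inv_mem (hm i)) (hm j)
      rw [hij] at this
      simpa [mul_assoc] using this
    have h2 : (g i)⁻¹ * g j ∈ IK L := by
      rw [IK_eq hKL]; exact ⟨h1, (IK K).mul_mem ((IK K).inv_mem (hg.1 i)) (hg.1 j)⟩
    obtain ⟨k, hk, hu⟩ := hg.2 (g j) (hg.1 j)
    rw [hu i h2, hu j (by simp)]
  have hle2 : (IK L).relIndex (IK K) ≤ L.fixingSubgroup.relIndex (SS K L) := by
    simpa using Fintype.card_le_of_injective m hinj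
  have hbij : Function.Bijective m := by
    rw [Fintype.bijective_iff_injective_and_card]
    refine ⟨hinj, ?_⟩
    simp only [Fintype.card_fin]
    omega
  constructor
  · rw [he]; congr 1; omega
  · intro γ hγ
    obtain ⟨j, hj⟩ := (hf.2 γ hγ).exists
    obtain ⟨i, rfl⟩ := hbij.2 j
    refine ⟨g i, hg.1 i, ?_⟩
    have := mul_mem (inv_mem (hm i)) hj
    simpa [mul_assoc] using this

theorem mkTR {K L : IntermediateField ℚ_[p] Ω} [FiniteDimensional ℚ_[p] K] [FiniteDimensional ℚ_[p] L] (hKL : K ≤ L)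
    {x : Ω} (hx : x ∈ FF Ω (IK L)) {ϖ : Ω} (h : IsU L ϖ) (hxn : ‖x‖ = ‖ϖ‖)
    (hab : Ab K.fixingSubgroup L.fixingSubgroup) : TR p (IK K) (IK L) x where
  le := IK_mono hKL
  comm := fun a ha b hb => by
    rw [IK_eq hKL]
    exact ⟨hab a ha.1 b hb.1, (IK K).mul_mem ((IK K).mul_mem ((IK K).mul_mem ha hb) ((IK K).inv_mem ha)) ((IK K).inv_mem hb)⟩
  fin := rel_IK_ne hKL
  mem := hx
  pos := hxn ▸ h.pos
  lt := hxn ▸ h.lt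
  valB := fun y hy hy0 => hxn ▸ h.val_IK hy hy0
  valA := fun y hy hy0 => by
    obtain ⟨a, ha⟩ := exists_U K
    obtain ⟨i, hi⟩ := ha.val_IK hy hy0
    refine ⟨i, ?_⟩
    rw [hi, (ram hKL ha h).1, hxn, ← zpow_natCast, ← zpow_mul]
  tei := fun a ha z hz => ha.2 z hz

/-- transversal for the unramified part -/
theorem Trv_unr {K L : IntermediateField ℚ_[p] Ω} [FiniteDimensional ℚ_[p] K] [FiniteDimensional ℚ_[p] L]
    {f : ℕ} (hq : qK L = qK K ^ f) {φ : Ω ≃ₐ[ℚ_[p]] Ω} (hφK : φ ∈ K.fixingSubgroup)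
    (hφ : IsFrob p Ω (qK K) φ) : Trv K.fixingSubgroup (SS K L) (fun i : Fin f => φ ^ (i : ℕ)) := by
  obtain ⟨⟨r, hr, hqL⟩, hT⟩ := qK_pow L
  have hq2L : 2 ≤ qK L := by rw [hqL]; exact hp.out.two_le.trans (Nat.le_self_pow hr p)
  have hq2 : 2 ≤ qK K := hφ.two_le hp.out
  have hf0 : 0 < f := by
    by_contra hc
    have : f = 0 := by omega
    rw [this, pow_zero] at hq
    omega
  obtain ⟨ε, hε⟩ := exists_prim (Ω := Ω) (m := qK L - 1) (by omega)
  have hε0 : ε ^ qK L = ε := by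
    have : qK L = qK L - 1 + 1 := by omega
    rw [this, pow_succ, hε.pow_eq_one, one_mul]
  have hεT : ε ∈ TK L := TK_of_pow hε0
  have hgen : ∀ t ∈ TK L, t ≠ 0 → ∃ j : ℕ, ε ^ j = t := by
    intro t ht ht0
    have h1 : t ^ (qK L - 1) = 1 := by
      have h2 := hT t ht
      have : qK L = qK L - 1 + 1 := by omega
      rw [this, pow_succ] at h2
      exact mul_right_cancel₀ ht0 (by rw [h2, one_mul])
    have : NeZero (qK L - 1) := ⟨by omega⟩
    obtain ⟨j, -, hj⟩ := hε.eq_pow_of_pow_eq_one h1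
    exact ⟨j, hj⟩
  have hSS : ∀ γ ∈ K.fixingSubgroup, γ • ε = ε → γ ∈ SS K L := by
    intro γ hγ h
    refine ⟨hγ, fun t ht => ?_⟩
    by_cases ht0 : t = 0
    · rw [ht0, smul_zero]
    obtain ⟨j, rfl⟩ := hgen t ht ht0
    rw [smul_pow', h]
  have hpw : ∀ i : ℕ, φ ^ i • ε = ε ^ (qK K ^ i) := fun i => by
    rw [hφ.pow_smul _ hεT.2]; exact hp.out
  have hf1 : φ ^ f • ε = ε := by rw [hpw, ← hq, hε0]
  apply Trv.cyc hf0 hφK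
  · exact hSS _ (pow_mem hφK f) hf1
  · intro i hi hif hmem
    have h1 := hmem.2 ε hεT
    rw [hpw] at h1
    have h2 : qK K ^ i < qK L - 1 := by
      have h3 : qK K ^ i * qK K ≤ qK K ^ f := by
        rw [← pow_succ]; exact Nat.pow_le_pow_right (by omega) hif
      have h4 : 2 ≤ qK K ^ i := hq2.trans (Nat.le_self_pow hi.ne' _)
      rw [hq]
      have h5 := Nat.mul_le_mul_left (qK K ^ i) hq2
      omega
    have h5 : 1 < qK L - 1 := by
      have h4 : 2 ≤ qK K ^ i := hq2.trans (Nat.le_self_pow hi.ne' _)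
      omega
    have h3 := hε.pow_inj h2 h5 (by rw [h1, pow_one])
    have h4 : 2 ≤ qK K ^ i := hq2.trans (Nat.le_self_pow hi.ne' _)
    omega
  · intro γ hγ
    obtain ⟨j, hj⟩ := frob_orbit hφ hγ hεT.2
    have hfz : ∀ k : ℤ, (φ ^ f) ^ k • ε = ε := by
      intro k
      have : φ ^ f ∈ MulAction.stabilizer (Ω ≃ₐ[ℚ_[p]] Ω) ε := hf1
      exact (Subgroup.zpow_mem _ this k)
    have hmod : 0 ≤ j % f := Int.emod_nonneg _ (by omega)
    refine ⟨(j % f).toNat, hSS _ (mul_mem (inv_mem (pow_mem hφK _)) hγ) ?_⟩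
    rw [mul_smul, inv_smul_eq_iff, hj]
    have e1 : φ ^ j = φ ^ (j % f).toNat * (φ ^ f) ^ (j / f) := by
      rw [← zpow_natCast, ← zpow_natCast φ f, ← zpow_mul, ← zpow_add, Int.toNat_of_nonneg hmod,
        Int.emod_add_mul_ediv]
    rw [e1, mul_smul, hfz]

end conc
end LT

namespace LT

set_option linter.unusedSectionVars false

section conc

variable {p : ℕ} [hp : Fact p.Prime] {Ω : Type*} [NormedField Ω] [NormedAlgebra ℚ_[p] Ω]
  [IsUltrametricDist Ω] [IsAlgClosed Ω] [CharZero Ω] [Algebra.IsAlgebraic ℚ_[p] Ω]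
  [TeichP p Ω] [NInv (Ω ≃ₐ[ℚ_[p]] Ω) Ω]

lemma T_comm (γ δ : Ω ≃ₐ[ℚ_[p]] Ω) {z : Ω} (hz : IsT p z) : (γ * δ) • z = (δ * γ) • z := by
  by_cases hz0 : z = 0
  · simp [hz0]
  rcases hz with h | ⟨m, hm, -, hzm⟩
  · exact absurd h hz0
  have hpr : IsPrimitiveRoot z (orderOf z) := IsPrimitiveRoot.orderOf z
  have hpos : 0 < orderOf z := orderOf_pos_iff.2 (isOfFinOrder_iff_pow_eq_one.2 ⟨m, hm, hzm⟩)
  have : NeZero (orderOf z) := ⟨hpos.ne'⟩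
  have key : ∀ g : Ω ≃ₐ[ℚ_[p]] Ω, ∃ i : ℕ, g • z = z ^ i := by
    intro g
    have h1 : (g • z) ^ orderOf z = 1 := by rw [← smul_pow', pow_orderOf_eq_one, smul_one]
    obtain ⟨i, -, hi⟩ := hpr.eq_pow_of_pow_eq_one h1
    exact ⟨i, hi.symm⟩
  obtain ⟨i, hi⟩ := key γ
  obtain ⟨j, hj⟩ := key δ
  rw [mul_smul, mul_smul, hi, hj, smul_pow', smul_pow', hi, hj, ← pow_mul, ← pow_mul, mul_comm]

lemma II_comm (a b : Ω ≃ₐ[ℚ_[p]] Ω) : a * b * a⁻¹ * b⁻¹ ∈ II p Ω := by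
  intro z hz
  have h := T_comm a b (hz.act (a⁻¹ * b⁻¹))
  rw [← mul_smul, ← mul_smul] at h
  simpa [mul_assoc] using h

lemma Ab.IK {K L : IntermediateField ℚ_[p] Ω} (h : Ab K.fixingSubgroup L.fixingSubgroup) :
    Ab K.fixingSubgroup (IK L) := fun a ha b hb => ⟨h a ha b hb, II_comm a b⟩

/-- surjectivity from a count -/
lemma surj_of_card {Γ : Type*} [Group Γ] {A B I : Subgroup Γ} (hIA : I ≤ A) (h0 : B.relIndex A ≠ 0)
    (h : B.relIndex A ≤ (B ⊓ I).relIndex I) : ∀ a ∈ A, ∃ i ∈ I, i⁻¹ * a ∈ B := by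
  have h0' : (B ⊓ I).relIndex I ≠ 0 := by omega
  obtain ⟨g, hg⟩ := exists_Trv_fin h0'
  obtain ⟨f, hf⟩ := exists_Trv_fin h0
  have hgS : ∀ i, ∃ j, (f j)⁻¹ * g i ∈ B := fun i => (hf.2 _ (hIA (hg.1 i))).exists
  choose m hm using hgS
  have hinj : Function.Injective m := by
    intro i j hij
    have h1 : (g i)⁻¹ * g j ∈ B := by
      have := mul_mem (inv_mem (hm i)) (hm j)
      rw [hij] at this
      simpa [mul_assoc] using this
    have h2 : (g i)⁻¹ * g j ∈ B ⊓ I := ⟨h1, I.mul_mem (I.inv_mem (hg.1 i)) (hg.1 j)⟩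
    obtain ⟨k, hk, hu⟩ := hg.2 (g j) (hg.1 j)
    rw [hu i h2, hu j (by simp)]
  have hle2 : (B ⊓ I).relIndex I ≤ B.relIndex A := by
    simpa using Fintype.card_le_of_injective m hinj
  have hbij : Function.Bijective m := by
    rw [Fintype.bijective_iff_injective_and_card]
    refine ⟨hinj, ?_⟩
    simp only [Fintype.card_fin]
    omega
  intro γ hγ
  obtain ⟨j, hj⟩ := (hf.2 γ hγ).exists
  obtain ⟨i, rfl⟩ := hbij.2 j
  refine ⟨g i, hg.1 i, ?_⟩
  have := mul_mem (inv_mem (hm i)) hj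
  simpa [mul_assoc] using this

/-- totally ramified if the uniformizer is a norm -/
lemma tot_ram {K L : IntermediateField ℚ_[p] Ω} [FiniteDimensional ℚ_[p] K] [FiniteDimensional ℚ_[p] L]
    (hKL : K ≤ L) {π x : Ω} (hπ : IsU K π) (hx : x ∈ L)
    (hN : rN K.fixingSubgroup L.fixingSubgroup x = π) :
    IsU L x ∧ ∀ γ ∈ K.fixingSubgroup, ∃ i ∈ IK K, i⁻¹ * γ ∈ L.fixingSubgroup := by
  obtain ⟨ϖ, h⟩ := exists_U L
  have h0 := rel_fix_ne L K.fixingSubgroup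
  have hxF := mem_K_iff.1 hx
  have h1 := norm_rN h0 hxF
  rw [hN, (ram hKL hπ h).1] at h1
  have hx0 : x ≠ 0 := by
    rintro rfl
    rw [norm_zero, zero_pow h0] at h1
    exact absurd h1 (pow_pos h.pos _).ne'
  obtain ⟨a, ha⟩ := h.val x hx hx0
  rw [ha, ← zpow_natCast, ← zpow_natCast, ← zpow_mul] at h1
  have h2 := zpow_right_injective₀ h.pos h.lt.ne h1
  have hle : (IK L).relIndex (IK K) ≤ L.fixingSubgroup.relIndex K.fixingSubgroup := by
    rw [IK_eq hKL, Subgroup.inf_relIndex_right]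
    exact Subgroup.relIndex_le_of_le_right (IK_le K) h0
  have hn' := rel_IK_ne hKL
  have ha0 : 0 < a := by
    by_contra hc
    have h3 : (0 : ℤ) < ((IK L).relIndex (IK K) : ℤ) := by exact_mod_cast Nat.pos_of_ne_zero hn'
    nlinarith
  have ha1 : a = 1 := by
    have h3 : (0 : ℤ) < (L.fixingSubgroup.relIndex K.fixingSubgroup : ℤ) := by exact_mod_cast Nat.pos_of_ne_zero h0
    have h4 : ((IK L).relIndex (IK K) : ℤ) ≤ (L.fixingSubgroup.relIndex K.fixingSubgroup : ℤ) := by exact_mod_cast hle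
    nlinarith
  subst ha1
  rw [zpow_one] at ha
  refine ⟨⟨hx, ha ▸ h.pos, ha ▸ h.lt, ha ▸ h.val⟩, ?_⟩
  apply surj_of_card (IK_le K) h0
  rw [one_mul] at h2
  rw [← IK_eq hKL]
  exact_mod_cast h2.symm.le

lemma rN_ram {K L : IntermediateField ℚ_[p] Ω} (hKL : K ≤ L)
    (hs : ∀ γ ∈ K.fixingSubgroup, ∃ i ∈ IK K, i⁻¹ * γ ∈ L.fixingSubgroup) {x : Ω} (hx : x ∈ L) :
    rN K.fixingSubgroup L.fixingSubgroup x = rN (IK K) (IK L) x := by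
  rw [rN_of_sub (IK_le K) hs (mem_K_iff.1 hx), IK_eq hKL]

/-- norm through the inertia group -/
lemma rN_unr {K L : IntermediateField ℚ_[p] Ω} [FiniteDimensional ℚ_[p] K] [FiniteDimensional ℚ_[p] L]
    (hKL : K ≤ L) {f : ℕ} (hq : qK L = qK K ^ f) {φ : Ω ≃ₐ[ℚ_[p]] Ω} (hφK : φ ∈ K.fixingSubgroup)
    (hφ : IsFrob p Ω (qK K) φ) {x : Ω} (hx : x ∈ L) :
    φ ^ f • rN (IK K) (IK L) x = rN (IK K) (IK L) x ∧
    rN K.fixingSubgroup L.fixingSubgroup x = ∏ i ∈ Finset.range f, φ ^ i • rN (IK K) (IK L) x := by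
  obtain ⟨a, ha⟩ := exists_U K
  obtain ⟨ϖ, h⟩ := exists_U L
  have hT := Trv_unr hq hφK hφ
  have hxF := mem_K_iff.1 hx
  have e1 : rN (SS K L) L.fixingSubgroup x = rN (IK K) (IK L) x := by
    rw [rN_of_sub IK_le_SS (ram hKL ha h).2 hxF, IK_eq hKL]
  have hm := rN_mem (rel_fix_ne L (SS K L)) hxF
  have hidx : (SS K L).relIndex K.fixingSubgroup ≠ 0 := by
    rw [← hT.card]
    simp only [Nat.card_eq_fintype_card, Fintype.card_fin]
    rintro rfl
    obtain ⟨⟨r, hr, hqL⟩, -⟩ := qK_pow L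
    rw [hq, pow_zero] at hqL
    have := Nat.le_self_pow hr p
    have := hp.out.two_le
    omega
  have e2 := rN_tower' SS_le (le_SS hKL) hidx (rel_fix_ne L (SS K L)) hxF
  rw [rN_eq_prod hT hm, Finset.prod_range fun i => φ ^ i • rN (IK K) (IK L) x, e1] at *
  refine ⟨?_, e2⟩
  refine mem_FF.1 hm _ ⟨pow_mem hφK f, fun t ht => ?_⟩
  rw [hφ.pow_smul hp.out ht.2, ← hq]
  exact (qK_pow L).2 t ht

theorem core {K₁ K₂ L M : IntermediateField ℚ_[p] Ω} [FiniteDimensional ℚ_[p] K₁]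
    [FiniteDimensional ℚ_[p] K₂] [FiniteDimensional ℚ_[p] L] [FiniteDimensional ℚ_[p] M]
    (h12 : K₁ ≤ K₂) (h1L : K₁ ≤ L) (h2M : K₂ ≤ M) (hLM : L ≤ M)
    {π₁ π₂ : Ω} (hπ₁ : IsU K₁ π₁) (hπ₂ : IsU K₂ π₂) {f : ℕ} (hq : qK K₂ = qK K₁ ^ f)
    (hN : rN K₁.fixingSubgroup K₂.fixingSubgroup π₂ = π₁ ^ f)
    (habL : Ab K₁.fixingSubgroup L.fixingSubgroup) (habM : Ab K₂.fixingSubgroup M.fixingSubgroup)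
    {x₁ : Ω} (hx₁ : x₁ ∈ L) (hNx₁ : rN K₁.fixingSubgroup L.fixingSubgroup x₁ = π₁)
    {φ' : Ω ≃ₐ[ℚ_[p]] Ω} (hφ'2 : φ' ∈ K₂.fixingSubgroup) (hφ' : IsFrob p Ω (qK K₂) φ')
    {x' : Ω} (hx' : x' ∈ FF Ω (IK M)) (hφx' : φ' • x' = x') (hNx' : rN (IK K₂) (IK M) x' = π₂) :
    φ' ∈ L.fixingSubgroup := by
  have hanti : K₂.fixingSubgroup ≤ K₁.fixingSubgroup := IntermediateField.fixingSubgroup_antitone h12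
  have hL1 : L.fixingSubgroup ≤ K₁.fixingSubgroup := IntermediateField.fixingSubgroup_antitone h1L
  have hM2 : M.fixingSubgroup ≤ K₂.fixingSubgroup := IntermediateField.fixingSubgroup_antitone h2M
  obtain ⟨hU₁, hs⟩ := tot_ram h1L hπ₁ hx₁ hNx₁
  obtain ⟨φ, hφ1, hφ⟩ := exists_frob K₁
  obtain ⟨s, hsI, hsL⟩ := hs φ hφ1
  set φ₁ := s⁻¹ * φ with hφ₁
  have hF₁ : IsFrob p Ω (qK K₁) φ₁ := hφ.mul_left hp.out fun z hz => (inv_mem hsI : s⁻¹ ∈ IK K₁).2 z hz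
  have hφ₁K : φ₁ ∈ K₁.fixingSubgroup := hL1 hsL
  set σ := φ' * (φ₁ ^ f)⁻¹ with hσ
  have hσφ : σ * φ₁ ^ f = φ' := by rw [hσ]; group
  have hσI : σ ∈ IK K₁ := by
    refine ⟨Subgroup.mul_mem _ (hanti hφ'2) (Subgroup.inv_mem _ (pow_mem hφ₁K f)), fun z hz => ?_⟩
    have h1 : φ₁ ^ f • ((φ₁ ^ f)⁻¹ • z) = z := smul_inv_smul _ _
    have h2 := hz.act (φ₁ ^ f)⁻¹
    rw [hσ, mul_smul, hφ'.2 _ h2, hq, ← hF₁.pow_smul hp.out h2, h1]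
  have hTR : TR p (IK K₁) (IK L) x₁ :=
    mkTR h1L (FF_anti (IK_le L) (mem_K_iff.1 hx₁)) hU₁ rfl habL
  have hLMn := rel_IK_ne hLM
  have h2Mn := rel_IK_ne h2M
  have h12n := rel_IK_ne h12
  have h1Ln := rel_IK_ne h1L
  obtain ⟨ϖ, hϖ⟩ := exists_U M
  have hx'n : ‖x'‖ = ‖ϖ‖ := by
    have h1 := norm_rN h2Mn hx'
    rw [hNx', (ram h2M hπ₂ hϖ).1] at h1
    exact ((pow_left_inj₀ (norm_nonneg _) (norm_nonneg _) h2Mn).1 h1).symm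
  set y := rN (IK L) (IK M) x' with hy
  have hyF : y ∈ FF Ω (IK L) := rN_mem hLMn hx'
  have hyn : ‖y‖ = ‖x₁‖ := by
    rw [hy, norm_rN hLMn hx', hx'n, (ram hLM hU₁ hϖ).1]
  have hnL : Nz φ' (IK L) := (habL.nz le_rfl hL1 (hanti hφ'2)).inf (II_nz φ')
  have hnM : Nz φ' (IK M) := (habM.nz le_rfl hM2 hφ'2).inf (II_nz φ')
  have hψy : (σ * φ₁ ^ f) • y = y := by
    rw [hσφ, hy, ← rN_smul hLMn hnL hnM hx', hφx']
  set ρ := rN (IK K₁) (IK K₂) π₂ with hρ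
  have hNy : rN (IK K₁) (IK L) y = ρ := by
    rw [hy, ← rN_tower' (IK_mono h1L) (IK_mono hLM) h1Ln hLMn hx',
      rN_tower' (IK_mono h12) (IK_mono h2M) h12n h2Mn hx', hNx']
  have hNx : rN (IK K₁) (IK L) x₁ = π₁ := by rw [← rN_ram h1L hs hx₁, hNx₁]
  obtain ⟨u1, u2⟩ := rN_unr h12 hq hφ₁K hF₁ hπ₂.mem
  rw [← hρ] at u1 u2
  have hπ₁F : π₁ ∈ FF Ω K₁.fixingSubgroup := mem_K_iff.1 hπ₁.mem
  have hπ₂F : π₂ ∈ FF Ω (IK K₂) := FF_anti (IK_le K₂) (mem_K_iff.1 hπ₂.mem)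
  have hπ₁0 : π₁ ≠ 0 := norm_pos_iff.1 hπ₁.pos
  have hf0 : 0 < f := by
    rcases Nat.eq_zero_or_pos f with rfl | h
    · obtain ⟨⟨r, hr, hqL⟩, -⟩ := qK_pow K₂
      rw [hq, pow_zero] at hqL
      have := Nat.le_self_pow hr p
      have := hp.out.two_le
      omega
    · exact h
  have hfixπ : ∀ i : ℕ, φ₁ ^ i • π₁ = π₁ := fun i => mem_FF.1 hπ₁F _ (pow_mem hφ₁K i)
  obtain ⟨w, hwF, hw1, hwf, hw⟩ := h90u (A := IK K₁) (u := ρ / π₁) hF₁ hf0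
    (by rw [norm_div, hρ, norm_rN h12n hπ₂F, (ram h12 hπ₁ hπ₂).1, div_self (pow_pos hπ₂.pos _).ne'])
    (by rw [smul_div₀', u1, hfixπ])
    (by
      simp_rw [smul_div₀', hfixπ]
      rw [Finset.prod_div_distrib, ← u2, hN, Finset.prod_const, Finset.card_range,
        div_self (pow_ne_zero _ hπ₁0)])
    (IK_nz hφ₁K) (fun z hz => T_mem_IK K₁ hz)
    (div_mem (rN_mem h12n hπ₂F) (FF_anti (IK_le K₁) hπ₁F))
  have hσL : σ ∈ IK L := hTR.ml habL.IK (IK_le K₁) hφ₁K (mem_fix.1 hsL x₁ hx₁) hσI hyF hyn hψy hwF hw1 hwf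
    (by rw [hNy, hNx, hw])
  rw [← hσφ]
  exact mul_mem hσL.1 (pow_mem hsL f)

/-- existence -/
theorem exs {K M : IntermediateField ℚ_[p] Ω} [FiniteDimensional ℚ_[p] K] [FiniteDimensional ℚ_[p] M]
    (h : K ≤ M) (hab : Ab K.fixingSubgroup M.fixingSubgroup) {π : Ω} (hπ : IsU K π) :
    ∃ φ' ∈ K.fixingSubgroup, IsFrob p Ω (qK K) φ' ∧ ∃ x' ∈ FF Ω (IK M), φ' • x' = x' ∧
      rN (IK K) (IK M) x' = π := by
  obtain ⟨ϖ, hϖ⟩ := exists_U M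
  obtain ⟨φ, hφ1, hφ⟩ := exists_frob K
  have hTR : TR p (IK K) (IK M) ϖ := mkTR h (FF_anti (IK_le M) (mem_K_iff.1 hϖ.mem)) hϖ rfl hab
  obtain ⟨σ, hσ, y, hy, h1, h2⟩ := hTR.ex hab.IK (IK_le K) hφ1 hφ (mem_K_iff.1 hπ.mem) (ram h hπ hϖ).1
  exact ⟨σ * φ, mul_mem hσ.1 hφ1, hφ.mul_left hp.out (fun z hz => hσ.2 z hz), y, hy, h1, h2⟩

theorem fin_step {K M : IntermediateField ℚ_[p] Ω} [FiniteDimensional ℚ_[p] K] [FiniteDimensional ℚ_[p] M]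
    (h : K ≤ M) {π : Ω} (hπ : IsU K π) {φ' : Ω ≃ₐ[ℚ_[p]] Ω} (hφM : φ' ∈ M.fixingSubgroup)
    (hφ : IsFrob p Ω (qK K) φ') {x' : Ω} (hx' : x' ∈ FF Ω (IK M)) (hφx : φ' • x' = x')
    (hN : rN (IK K) (IK M) x' = π) :
    x' ∈ M ∧ rN K.fixingSubgroup M.fixingSubgroup x' = π := by
  obtain ⟨ϖ, hϖ⟩ := exists_U M
  have hT : TK M = TK K := by
    ext t
    constructor
    · intro ht
      apply TK_of_pow
      rw [← hφ.2 t ht.2]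
      exact mem_fix.1 hφM t ht.1
    · intro ht
      exact ⟨h ht.1, ht.2⟩
  have hq : qK M = qK K := by rw [qK, qK, hT]
  have hxM : x' ∈ M := top_mem hφM (hq ▸ hφ) hx' hφx
  refine ⟨hxM, ?_⟩
  rw [rN_ram h _ hxM, hN]
  intro γ hγ
  refine (ram h hπ hϖ).2 γ ⟨hγ, fun t ht => ?_⟩
  rw [hT] at ht
  exact mem_fix.1 hγ t ht.1

/-- abelian extension with `π` as a norm -/
structure Good (K L : IntermediateField ℚ_[p] Ω) (π : Ω) : Prop where
  le : K ≤ L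
  fin : FiniteDimensional ℚ_[p] L
  ab : Ab K.fixingSubgroup L.fixingSubgroup
  ex : ∃ x ∈ L, rN K.fixingSubgroup L.fixingSubgroup x = π

theorem good_fwd {K₁ K₂ L : IntermediateField ℚ_[p] Ω} [FiniteDimensional ℚ_[p] K₁]
    [FiniteDimensional ℚ_[p] K₂] (h12 : K₁ ≤ K₂)
    {π₁ π₂ : Ω} (hπ₁ : IsU K₁ π₁) (hπ₂ : IsU K₂ π₂) {f : ℕ} (hq : qK K₂ = qK K₁ ^ f)
    (hN : rN K₁.fixingSubgroup K₂.fixingSubgroup π₂ = π₁ ^ f) (hL : Good K₁ L π₁) :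
    ∃ M, Good K₂ M π₂ ∧ L ≤ M := by
  obtain ⟨h1L, hLf, hab, x₁, hx₁, hNx₁⟩ := hL
  have habM : Ab K₂.fixingSubgroup (K₂ ⊔ L).fixingSubgroup := by
    intro a ha b hb
    rw [IntermediateField.fixingSubgroup_sup]
    have hanti : K₂.fixingSubgroup ≤ K₁.fixingSubgroup := IntermediateField.fixingSubgroup_antitone h12
    exact ⟨Subgroup.mul_mem _ (Subgroup.mul_mem _ (Subgroup.mul_mem _ ha hb) (Subgroup.inv_mem _ ha)) (Subgroup.inv_mem _ hb), hab a (hanti ha) b (hanti hb)⟩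
  have hfin : FiniteDimensional ℚ_[p] ↥(K₂ ⊔ L) := IntermediateField.finiteDimensional_sup K₂ L
  obtain ⟨φ', h1, h2, x', h3, h4, h5⟩ := exs (le_sup_left : K₂ ≤ K₂ ⊔ L) habM hπ₂
  have h6 := core h12 h1L le_sup_left le_sup_right hπ₁ hπ₂ hq hN hab habM hx₁ hNx₁ h1 h2 h3 h4 h5
  obtain ⟨h7, h8⟩ := fin_step (le_sup_left : K₂ ≤ K₂ ⊔ L) hπ₂
    (by rw [IntermediateField.fixingSubgroup_sup]; exact ⟨h1, h6⟩) h2 h3 h4 h5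
  exact ⟨K₂ ⊔ L, ⟨le_sup_left, hfin, habM, x', h7, h8⟩, le_sup_right⟩

theorem good_dir {K L L' : IntermediateField ℚ_[p] Ω} [FiniteDimensional ℚ_[p] K]
    {π : Ω} (hπ : IsU K π) (hL : Good K L π) (hL' : Good K L' π) :
    Good K (L ⊔ L') π := by
  obtain ⟨h1L, hLf, hab, x₁, hx₁, hNx₁⟩ := hL
  obtain ⟨h1L', hLf', hab', x₁', hx₁', hNx₁'⟩ := hL'
  have habM : Ab K.fixingSubgroup (L ⊔ L').fixingSubgroup := by
    intro a ha b hb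
    rw [IntermediateField.fixingSubgroup_sup]
    exact ⟨hab a ha b hb, hab' a ha b hb⟩
  have hle : K ≤ L ⊔ L' := h1L.trans le_sup_left
  have hfin : FiniteDimensional ℚ_[p] ↥(L ⊔ L') := IntermediateField.finiteDimensional_sup L L'
  obtain ⟨φ', h1, h2, x', h3, h4, h5⟩ := exs hle habM hπ
  have hN : rN K.fixingSubgroup K.fixingSubgroup π = π ^ 1 := by
    rw [rN_self (mem_K_iff.1 hπ.mem), pow_one]
  have hq : qK K = qK K ^ 1 := (pow_one _).symm
  have h6 := core le_rfl h1L hle le_sup_left hπ hπ hq hN hab habM hx₁ hNx₁ h1 h2 h3 h4 h5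
  have h6' := core le_rfl h1L' hle le_sup_right hπ hπ hq hN hab' habM hx₁' hNx₁' h1 h2 h3 h4 h5
  obtain ⟨h7, h8⟩ := fin_step hle hπ
    (by rw [IntermediateField.fixingSubgroup_sup]; exact ⟨h6, h6'⟩) h2 h3 h4 h5
  exact ⟨hle, hfin, habM, x', h7, h8⟩

end conc
end LT

namespace LT

set_option linter.unusedSectionVars false

section poly
open Polynomial

variable {R : Type*} [CommRing R] [IsDomain R]

/-- the Lubin-Tate polynomial -/
noncomputable def ltp (π : R) (q : ℕ) : Polynomial R := C π * X + X ^ q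

/-- commutation modulo `X^M` -/
def Cm (π : R) (q M : ℕ) (g : Polynomial R) : Prop :=
  X ∣ g ∧ X ^ M ∣ (ltp π q).comp g - g.comp (ltp π q)

lemma ltp_comp (π : R) (q : ℕ) (g : Polynomial R) : (ltp π q).comp g = C π * g + g ^ q := by
  simp [ltp]

lemma X_dvd_ltp (π : R) {q : ℕ} (hq : 2 ≤ q) : (X : Polynomial R) ∣ ltp π q := by
  rw [ltp]
  exact dvd_add (dvd_mul_left _ _) (dvd_pow_self _ (by omega))

lemma comp_dvd {M : ℕ} {P g : Polynomial R} (h : X ^ M ∣ P) (hg : X ∣ g) : X ^ M ∣ P.comp g := by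
  obtain ⟨Q, rfl⟩ := h
  rw [mul_comp, pow_comp, X_comp]
  exact (pow_dvd_pow_of_dvd hg M).mul_right _

lemma comp_sub_dvd (g P Q : Polynomial R) : P - Q ∣ g.comp P - g.comp Q := by
  rw [comp, comp, eval₂_eq_eval_map, eval₂_eq_eval_map]
  exact sub_dvd_eval_sub P Q _

lemma X_dvd_comp {P g : Polynomial R} (h : X ∣ P) (hg : X ∣ g) : X ∣ P.comp g := by
  have := comp_dvd (M := 1) (P := P) (by rwa [pow_one]) hg
  rwa [pow_one] at this

lemma Cm.mono {π : R} {q M M' : ℕ} {g : Polynomial R} (h : Cm π q M g) (hM : M' ≤ M) : Cm π q M' g :=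
  ⟨h.1, (pow_dvd_pow X hM).trans h.2⟩

lemma Cm.comp {π : R} {q M : ℕ} (hq : 2 ≤ q) {g h : Polynomial R} (hg : Cm π q M g) (hh : Cm π q M h) :
    Cm π q M (g.comp h) := by
  refine ⟨X_dvd_comp hg.1 hh.1, ?_⟩
  have h1 : X ^ M ∣ ((ltp π q).comp g - g.comp (ltp π q)).comp h := comp_dvd hg.2 hh.1
  have h2 : X ^ M ∣ g.comp ((ltp π q).comp h) - g.comp (h.comp (ltp π q)) :=
    hh.2.trans (comp_sub_dvd _ _ _)
  have := dvd_add h1 h2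
  rw [sub_comp, comp_assoc, comp_assoc] at this
  rw [comp_assoc]
  simpa using this

/-- first order change -/
lemma step_change {π : R} {q : ℕ} (hq : 2 ≤ q) {m : ℕ} (hm : 1 ≤ m) {a b : Polynomial R} {c : R} (ha : X ∣ a)
    (hb : X ∣ b) (h : X ^ (m + 1) ∣ a - b - C c * X ^ m) :
    X ^ (m + 1) ∣ ((ltp π q).comp a - a.comp (ltp π q)) - ((ltp π q).comp b - b.comp (ltp π q))
      - C ((π - π ^ m) * c) * X ^ m := by
  obtain ⟨r, hr⟩ := h
  have ea : a = b + C c * X ^ m + X ^ (m + 1) * r := by rw [← hr]; ring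
  -- `q`-th powers
  have h1 : X ^ (m + 1) ∣ a ^ q - b ^ q := by
    have hab : X ^ m ∣ a - b := ⟨C c + X * r, by rw [ea]; ring⟩
    have hs : X ∣ ∑ i ∈ Finset.range q, a ^ i * b ^ (q - 1 - i) := by
      refine Finset.dvd_sum fun i hi => ?_
      rcases Nat.eq_zero_or_pos i with rfl | h0
      · exact (dvd_pow hb (by omega)).mul_left _
      · exact (dvd_pow ha h0.ne').mul_right _
    rw [← (Commute.all a b).geom_sum₂_mul, pow_succ]
    rw [mul_comm (∑ i ∈ Finset.range q, a ^ i * b ^ (q - 1 - i))]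
    exact mul_dvd_mul hab hs
  have h2 : X ^ (m + 1) ∣ (C c * X ^ m).comp (ltp π q) - C (π ^ m * c) * X ^ m := by
    have e : (C c * X ^ m).comp (ltp π q) - C (π ^ m * c) * X ^ m
        = C c * ((ltp π q) ^ m - (C π * X) ^ m) := by
      rw [mul_comp, C_comp, pow_comp, X_comp, mul_pow, C_mul, C_pow]; ring
    rw [e]
    refine Dvd.dvd.mul_left ?_ _
    rw [← (Commute.all (ltp π q) (C π * X)).geom_sum₂_mul, mul_comm]
    have e3 : ltp π q - C π * X = X ^ q := by rw [ltp]; ring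
    rw [e3]
    have hs : X ^ (m - 1) ∣ ∑ i ∈ Finset.range m, ltp π q ^ i * (C π * X) ^ (m - 1 - i) := by
      refine Finset.dvd_sum fun i hi => ?_
      have hi' := Finset.mem_range.1 hi
      have e4 : X ^ (m - 1) = (X : Polynomial R) ^ i * X ^ (m - 1 - i) := by
        rw [← pow_add]; congr 1; omega
      rw [e4]
      exact mul_dvd_mul (pow_dvd_pow_of_dvd (X_dvd_ltp π hq) i)
        (pow_dvd_pow_of_dvd (dvd_mul_left _ _) _)
    have e5 : X ^ (m + 1) = (X : Polynomial R) ^ 2 * X ^ (m - 1) := by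
      rw [← pow_add]; congr 1; omega
    rw [e5]
    exact mul_dvd_mul (pow_dvd_pow X hq) hs
  have h3 : X ^ (m + 1) ∣ (X ^ (m + 1) * r).comp (ltp π q) :=
    comp_dvd (dvd_mul_right _ _) (X_dvd_ltp π hq)
  have e6 : ((ltp π q).comp a - a.comp (ltp π q)) - ((ltp π q).comp b - b.comp (ltp π q))
      - C ((π - π ^ m) * c) * X ^ m = (a ^ q - b ^ q) + X ^ (m + 1) * (C π * r)
        - ((C c * X ^ m).comp (ltp π q) - C (π ^ m * c) * X ^ m) - (X ^ (m + 1) * r).comp (ltp π q) := by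
    have e7 : a.comp (ltp π q) = b.comp (ltp π q) + (C c * X ^ m).comp (ltp π q)
        + (X ^ (m + 1) * r).comp (ltp π q) := by rw [← add_comp, ← add_comp, ← ea]
    rw [e7, ltp_comp, ltp_comp]
    have e8 : C π * a = C π * b + C π * C c * X ^ m + X ^ (m + 1) * (C π * r) := by rw [ea]; ring
    rw [e8, C_mul, C_sub, C_mul]; ring
  rw [e6]
  exact dvd_sub (dvd_sub (dvd_add h1 (dvd_mul_right _ _)) h2) h3

lemma Cm.unique {π : R} {q M : ℕ} (hq : 2 ≤ q) (hπ : ∀ m, 2 ≤ m → π - π ^ m ≠ 0) {a b : Polynomial R}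
    (ha : Cm π q M a) (hb : Cm π q M b) (h1 : a.coeff 1 = b.coeff 1) : X ^ M ∣ a - b := by
  have key : ∀ m, m ≤ M → X ^ m ∣ a - b := by
    intro m
    induction m with
    | zero => simp
    | succ m ih =>
      intro hm
      have ih := ih (by omega)
      rcases Nat.lt_or_ge m 2 with h2 | h2
      · rw [X_pow_dvd_iff]
        intro d hd
        rw [coeff_sub]
        have : d = 0 ∨ d = 1 := by omega
        rcases this with rfl | rfl
        · rw [X_dvd_iff.1 ha.1, X_dvd_iff.1 hb.1, sub_zero]
        · rw [h1, sub_self]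
      · obtain ⟨r, hr⟩ := ih
        have h3 : X ^ (m + 1) ∣ a - b - C (r.coeff 0) * X ^ m := by
          have : X ∣ r - C (r.coeff 0) := by rw [X_dvd_iff]; simp
          obtain ⟨s, hs⟩ := this
          exact ⟨s, by rw [hr, pow_succ, mul_assoc, ← hs]; ring⟩
        have h4 := step_change (π := π) hq (by omega) ha.1 hb.1 h3
        have h5 := dvd_sub (dvd_sub (ha.mono hm).2 (hb.mono hm).2) h4
        rw [sub_sub_cancel] at h5
        have h6 := X_pow_dvd_iff.1 h5 m (by omega)
        rw [coeff_C_mul, coeff_X_pow_self, mul_one] at h6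
        have h7 : r.coeff 0 = 0 := (mul_eq_zero.1 h6).resolve_left (hπ m h2)
        rw [h7] at h3
        simpa using h3
  exact key M le_rfl

lemma Cm.comm {π : R} {q M : ℕ} (hq : 2 ≤ q) (hπ : ∀ m, 2 ≤ m → π - π ^ m ≠ 0) {a b : Polynomial R}
    (ha : Cm π q M a) (hb : Cm π q M b) : X ^ M ∣ a.comp b - b.comp a := by
  apply (ha.comp hq hb).unique hq hπ (hb.comp hq ha)
  have key : ∀ a b : Polynomial R, X ∣ a → X ∣ b → (a.comp b).coeff 1 = a.coeff 1 * b.coeff 1 := by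
    rintro _ _ ⟨a, rfl⟩ ⟨b, rfl⟩
    rw [mul_comp, X_comp, mul_assoc, ← pow_one (X : Polynomial R), coeff_X_pow_mul' ]
    simp [coeff_zero_eq_eval_zero, mul_comm]
  rw [key a b ha.1 hb.1, key b a hb.1 ha.1, mul_comm]

theorem exists_Cm {π : R} {q : ℕ} (hq : 2 ≤ q) (hun : ∀ m, 1 ≤ m → IsUnit (1 - π ^ m))
    {k : Type*} [Field k] [Fintype k] (hk : Fintype.card k = q) (ρ : R →+* k)
    (hρ : ∀ r, ρ r = 0 ↔ π ∣ r) (u : R) (M : ℕ) : ∃ g, Cm π q M g ∧ g.coeff 1 = u := by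
  induction M with
  | zero => exact ⟨C u * X, ⟨dvd_mul_left _ _, by simp⟩, by simp⟩
  | succ m ih =>
    obtain ⟨g, hg, hu⟩ := ih
    rcases Nat.lt_or_ge m 2 with h2 | h2
    · refine ⟨C u * X, ⟨dvd_mul_left _ _, ?_⟩, by simp⟩
      have e : (ltp π q).comp (C u * X) - (C u * X).comp (ltp π q) = (C u ^ q - C u) * X ^ q := by
        rw [ltp_comp]; simp [ltp]; ring
      rw [e]
      exact ((pow_dvd_pow X (by omega)).mul_left _)
    · set d := ((ltp π q).comp g - g.comp (ltp π q)).coeff m with hd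
      have hdπ : π ∣ d := by
        rw [← hρ, hd, ← coeff_map, Polynomial.map_sub, map_comp, map_comp]
        have e : (ltp π q).map ρ = X ^ q := by
          have : ρ π = 0 := (hρ π).2 dvd_rfl
          simp [ltp, this]
        rw [e, pow_comp, X_comp, ← expand_eq_comp_X_pow, ← hk, FiniteField.expand_card, sub_self, coeff_zero]
      obtain ⟨d', hd'⟩ := hdπ
      obtain ⟨v, hv⟩ := hun (m - 1) (by omega)
      set c := -(d' * (↑v⁻¹ : R)) with hc
      have hcd : (π - π ^ m) * c = - d := by
        have e : π - π ^ m = π * v := by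
          rw [hv, mul_sub, mul_one, ← pow_succ']; congr 2; omega
        rw [e, hc, hd']
        calc π * v * -(d' * (↑v⁻¹ : R)) = -(π * d') * (v * (↑v⁻¹ : R)) := by ring
          _ = _ := by rw [Units.mul_inv, mul_one]
      refine ⟨g + C c * X ^ m, ⟨dvd_add hg.1 ((dvd_pow_self X (by omega)).mul_left _), ?_⟩, ?_⟩
      · have h4 := step_change (π := π) hq (m := m) (by omega) (c := c) (a := g + C c * X ^ m)
          (dvd_add hg.1 ((dvd_pow_self X (by omega : m ≠ 0)).mul_left (C c))) hg.1 (by simp)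
        have h5 : X ^ (m + 1) ∣ ((ltp π q).comp g - g.comp (ltp π q)) + C ((π - π ^ m) * c) * X ^ m := by
          rw [X_pow_dvd_iff]
          intro i hi
          rw [coeff_add, coeff_C_mul, coeff_X_pow]
          rcases Nat.lt_or_ge i m with h | h
          · rw [X_pow_dvd_iff.1 hg.2 i h, if_neg (by omega)]; ring
          · have : i = m := by omega
            subst this
            rw [← hd, hcd]; simp
        have h6 := dvd_add h4 h5
        convert h6 using 1
        ring
      · rw [coeff_add, hu, coeff_C_mul, coeff_X_pow, if_neg (by omega)]; ring

end poly
end LT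

namespace LT

set_option linter.unusedSectionVars false

section sym
open MvPolynomial

variable {R : Type*} [CommRing R] [IsDomain R]

lemma esymm_frob {k : Type*} [Field k] [Fintype k] (σ : Type*) [Fintype σ] (m : ℕ) :
    aeval (fun i => (X i : MvPolynomial σ k) ^ (Fintype.card k)) (esymm σ k m)
      = (esymm σ k m) ^ (Fintype.card k) := by
  obtain ⟨p, hp⟩ := CharP.exists k
  obtain ⟨n, hpp, hn⟩ := FiniteField.card k p
  have : Fact p.Prime := ⟨hpp⟩
  rw [hn, esymm, map_sum, sum_pow_char_pow]
  refine Finset.sum_congr rfl fun t _ => ?_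
  rw [map_prod, ← Finset.prod_pow]
  exact Finset.prod_congr rfl fun i _ => aeval_X _ _

lemma esymm_step {π : R} {q : ℕ} {k : Type*} [Field k] [Fintype k] (hk : Fintype.card k = q)
    (ρ : R →+* k) (hρ : ∀ r, ρ r = 0 ↔ π ∣ r) (hπ : π ≠ 0) (d m : ℕ) :
    ∃ Ψ : MvPolynomial (Fin d) R,
      aeval (fun i => C π * X i + (X i : MvPolynomial (Fin d) R) ^ q) (esymm (Fin d) R m)
        = (esymm (Fin d) R m) ^ q + C π * aeval (fun i : Fin d => esymm (Fin d) R (i + 1)) Ψ := by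
  set D := aeval (fun i => C π * X i + (X i : MvPolynomial (Fin d) R) ^ q) (esymm (Fin d) R m)
    - (esymm (Fin d) R m) ^ q with hD
  have hπ0 : ρ π = 0 := (hρ π).2 dvd_rfl
  have h1 : C π ∣ D := by
    rw [C_dvd_iff_map_hom_eq_zero ρ π hρ, hD, map_sub, map_pow]
    have e1 : (MvPolynomial.map ρ) (esymm (Fin d) R m) = esymm (Fin d) k m := map_esymm _ _ _ ρ
    rw [e1, ← hk, ← esymm_frob, sub_eq_zero]
    rw [esymm, esymm, map_sum, map_sum, map_sum]
    refine Finset.sum_congr rfl fun t _ => ?_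
    rw [map_prod, map_prod, map_prod]
    refine Finset.prod_congr rfl fun i _ => ?_
    rw [aeval_X, aeval_X]
    simp [hπ0]
  obtain ⟨Q, hQ⟩ := h1
  have hDs : D.IsSymmetric := by
    intro e
    rw [hD, map_sub, map_pow, rename_esymm]
    congr 1
    have : ∀ P : MvPolynomial (Fin d) R, rename e (aeval (fun i => C π * X i + (X i : MvPolynomial (Fin d) R) ^ q) P)
        = aeval (fun i => C π * X i + (X i : MvPolynomial (Fin d) R) ^ q) (rename e P) := by
      intro P
      rw [aeval_rename, ← AlgHom.comp_apply]
      congr 1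
      apply algHom_ext
      intro i
      simp
    rw [this, rename_esymm]
  have hQs : Q.IsSymmetric := by
    intro e
    have := hDs e
    rw [hQ, map_mul, rename_C] at this
    exact mul_left_cancel₀ (by simpa using hπ) this
  obtain ⟨Ψ, hΨ⟩ := (esymmAlgHom_fin_bijective R d).2 ⟨Q, hQs⟩
  refine ⟨Ψ, ?_⟩
  have h2 := congrArg Subtype.val hΨ
  rw [esymmAlgHom_apply] at h2
  rw [h2, ← hQ, hD]; ring

lemma dvd_pow_q {π : R} {q : ℕ} {k : Type*} [Field k] [Fintype k] (hk : Fintype.card k = q)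
    (ρ : R →+* k) (hρ : ∀ r, ρ r = 0 ↔ π ∣ r) {n : ℕ} {a b : R} (h : π ^ (n + 1) ∣ a - b) :
    π ^ (n + 2) ∣ a ^ q - b ^ q := by
  have hab : ρ a = ρ b := by
    rw [← sub_eq_zero, ← map_sub, hρ]
    exact (dvd_pow_self _ (by omega)).trans h
  rw [← (Commute.all a b).geom_sum₂_mul, pow_succ, mul_comm (π ^ (n + 1))]
  refine mul_dvd_mul ?_ h
  rw [← hρ, map_sum]
  have : ∀ i ∈ Finset.range q, ρ (a ^ i * b ^ (q - 1 - i)) = ρ b ^ (q - 1) := by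
    intro i hi
    have := Finset.mem_range.1 hi
    rw [map_mul, map_pow, map_pow, hab, ← pow_add]; congr 1; omega
  rw [Finset.sum_congr rfl this, Finset.sum_const, Finset.card_range, nsmul_eq_mul, ← hk,
    FiniteField.cast_card_eq_zero, zero_mul]

lemma dvd_aeval {ι : Type*} {c : R} {a b : ι → R} (h : ∀ i, c ∣ a i - b i) (P : MvPolynomial ι R) :
    c ∣ aeval a P - aeval b P := by
  induction P using MvPolynomial.induction_on with
  | C r => simp
  | add P Q hP hQ =>
    rw [map_add, map_add, add_sub_add_comm]; exact dvd_add hP hQ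
  | mul_X P i hP =>
    rw [map_mul, map_mul, aeval_X, aeval_X]
    have e : aeval a P * a i - aeval b P * b i = (aeval a P - aeval b P) * a i + aeval b P * (a i - b i) := by ring
    rw [e]
    exact dvd_add (hP.mul_right _) ((h i).mul_left _)

/-- congruence between consecutive iterates -/
theorem iter_cong {π : R} {q : ℕ} {k : Type*} [Field k] [Fintype k] (hk : Fintype.card k = q)
    (ρ : R →+* k) (hρ : ∀ r, ρ r = 0 ↔ π ∣ r) (hπ : π ≠ 0)
    {S : Type*} [CommRing S] [Algebra R S] {d : ℕ} (hd : d ≠ 0) (s : Fin d → S) (g : Polynomial R)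
    (hg : g.map (algebraMap R S) = ∏ i, (Polynomial.X - Polynomial.C (s i))) :
    ∃ r : ℕ → R, (∀ n, algebraMap R S (r n)
        = ∏ i, (fun x => algebraMap R S π * x + x ^ q)^[n] (s i)) ∧
      ∀ n, π ^ (n + 1) ∣ r (n + 1) - r n := by
  choose Ψ hΨ using fun m : Fin d => esymm_step (π := π) hk ρ hρ hπ d (m + 1)
  set φ : S → S := fun x => algebraMap R S π * x + x ^ q with hφ
  -- the elementary symmetric functions descend to `R`
  let e : ℕ → Fin d → R := fun n => Nat.rec
    (fun m => (-1) ^ ((m : ℕ) + 1) * g.coeff (d - (m + 1)))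
    (fun _ e m => (e m) ^ q + π * aeval e (Ψ m)) n
  have e0 : ∀ m, e 0 m = (-1) ^ ((m : ℕ) + 1) * g.coeff (d - (m + 1)) := fun m => rfl
  have e1 : ∀ n m, e (n + 1) m = (e n m) ^ q + π * aeval (e n) (Ψ m) := fun n m => rfl
  have key : ∀ n m, algebraMap R S (e n m) = aeval (fun i => φ^[n] (s i)) (esymm (Fin d) R (m + 1)) := by
    intro n
    induction n with
    | zero =>
      intro m
      have hm := m.2
      rw [e0, map_mul, ← Polynomial.coeff_map, hg]
      rw [aeval_esymm_eq_multiset_esymm]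
      have h := Multiset.prod_X_sub_C_coeff (Finset.univ.val.map s) (k := d - (m + 1)) (by simp)
      rw [Multiset.map_map] at h
      have h2 : (Multiset.map ((fun t => Polynomial.X - Polynomial.C t) ∘ s) Finset.univ.val).prod
        = ∏ i, (Polynomial.X - Polynomial.C (s i)) := rfl
      rw [h2] at h
      rw [h]
      have h3 : (Multiset.map s Finset.univ.val).card - (d - ((m : ℕ) + 1)) = m + 1 := by simp; omega
      rw [h3, map_pow, map_neg, map_one, ← mul_assoc, ← mul_pow]
      simp
    | succ n ih =>
      intro m
      rw [e1, map_add, map_pow, map_mul, ih]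
      have h := congrArg (aeval (fun i => φ^[n] (s i))) (hΨ m)
      rw [map_add, map_pow, map_mul, ← AlgHom.comp_apply, ← AlgHom.comp_apply] at h
      have h1 : (aeval (fun i => φ^[n] (s i))).comp
          (aeval fun i => C π * X i + (X i : MvPolynomial (Fin d) R) ^ q)
          = (aeval (fun i => φ^[n + 1] (s i)) : MvPolynomial (Fin d) R →ₐ[R] S) := by
        apply algHom_ext
        intro i
        rw [AlgHom.comp_apply, aeval_X, aeval_X, Function.iterate_succ_apply', hφ]
        simp
      have h2 : (aeval (fun i => φ^[n] (s i))).comp (aeval fun i : Fin d => esymm (Fin d) R (↑i + 1))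
          = ((Algebra.ofId R S).comp (aeval (e n)) : MvPolynomial (Fin d) R →ₐ[R] S) := by
        apply algHom_ext
        intro i
        rw [AlgHom.comp_apply, aeval_X, AlgHom.comp_apply, aeval_X, ← ih]; rfl
      rw [h1, h2, AlgHom.comp_apply] at h
      rw [h]
      simp [Algebra.ofId_apply]
  have cong : ∀ n m, π ^ (n + 1) ∣ e (n + 1) m - e n m := by
    intro n
    induction n with
    | zero =>
      intro m
      rw [e1, pow_one, ← hρ]
      have : ρ π = 0 := (hρ π).2 dvd_rfl
      rw [map_sub, map_add, map_mul, this, map_pow, ← hk, FiniteField.pow_card]; ring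
    | succ n ih =>
      intro m
      have e2 := e1 n m
      rw [e1 (n + 1), sub_eq_add_neg, e2]
      have h1 := dvd_pow_q hk ρ hρ (ih m)
      have h2 : π ^ (n + 2) ∣ π * (aeval (e (n + 1)) (Ψ m) - aeval (e n) (Ψ m)) := by
        rw [pow_succ']; exact mul_dvd_mul_left _ (dvd_aeval ih _)
      have h3 := dvd_add h1 h2
      convert h3 using 1
      ring
  obtain ⟨d, rfl⟩ := Nat.exists_eq_succ_of_ne_zero hd
  refine ⟨fun n => e n (Fin.last d), fun n => ?_, fun n => cong n _⟩
  rw [key, esymm]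
  have : Finset.powersetCard (↑(Fin.last d) + 1) (Finset.univ : Finset (Fin (d + 1))) = {Finset.univ} := by
    have h := Finset.powersetCard_self (Finset.univ : Finset (Fin (d + 1)))
    rw [Finset.card_univ, Fintype.card_fin] at h
    exact h
  rw [this, Finset.sum_singleton, map_prod]
  exact Finset.prod_congr rfl fun i _ => aeval_X _ _

end sym
end LT

namespace LT

set_option linter.unusedSectionVars false

section ana
open Polynomial

variable {Ω : Type*} [NormedField Ω] [IsUltrametricDist Ω] [IsAlgClosed Ω] [CharZero Ω]

/-- the Lubin-Tate map -/
def ft (π : Ω) (q : ℕ) (x : Ω) : Ω := π * x + x ^ q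

/-- iterates as polynomials -/
noncomputable def Lit (π : Ω) (q : ℕ) : ℕ → Polynomial Ω
  | 0 => X
  | n + 1 => C π * Lit π q n + Lit π q n ^ q

lemma Lit_eval (π : Ω) (q n : ℕ) (x : Ω) : (Lit π q n).eval x = (ft π q)^[n] x := by
  induction n with
  | zero => simp [Lit]
  | succ n ih => rw [Function.iterate_succ_apply', ← ih]; simp [Lit, ft]

lemma Lit_deg (π : Ω) {q : ℕ} (hq : 2 ≤ q) (n : ℕ) : (Lit π q n).Monic ∧ (Lit π q n).natDegree = q ^ n := by
  induction n with
  | zero => exact ⟨monic_X, by simp [Lit]⟩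
  | succ n ih =>
    obtain ⟨h1, h2⟩ := ih
    have h3 : (Lit π q n ^ q).natDegree = q ^ (n + 1) := by rw [h1.natDegree_pow, h2, pow_succ']
    have h4 : (C π * Lit π q n).natDegree < (Lit π q n ^ q).natDegree := by
      refine (natDegree_C_mul_le _ _).trans_lt ?_
      rw [h2, h3]; exact Nat.pow_lt_pow_right (by omega) (by omega)
    have h5 : (C π * Lit π q n).degree < (Lit π q n ^ q).degree := by
      refine degree_lt_degree h4
    refine ⟨(h1.pow q).add_of_right h5, ?_⟩
    rw [Lit, natDegree_add_eq_right_of_natDegree_lt h4, h3]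

structure Hyp (π : Ω) (q : ℕ) : Prop where
  pos : 0 < ‖π‖
  lt : ‖π‖ < 1
  two : 2 ≤ q
  qn : ‖(q : Ω)‖ ≤ ‖π‖

lemma ft_le {π : Ω} {q : ℕ} (h : Hyp π q) {x : Ω} (hx : ‖x‖ ≤ 1) : ‖ft π q x‖ ≤ ‖x‖ := by
  refine u_add (by rw [norm_mul]; exact mul_le_of_le_one_left (norm_nonneg _) h.lt.le) ?_
  rw [norm_pow]
  exact pow_le_of_le_one (norm_nonneg _) hx (by have := h.two; omega)

lemma ft_it_le {π : Ω} {q : ℕ} (h : Hyp π q) {x : Ω} (hx : ‖x‖ ≤ 1) (n : ℕ) : ‖(ft π q)^[n] x‖ ≤ ‖x‖ := by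
  induction n with
  | zero => simp
  | succ n ih => rw [Function.iterate_succ_apply']; exact (ft_le h (ih.trans hx)).trans ih

lemma ft_it_ge {π : Ω} {q : ℕ} (h : Hyp π q) {x : Ω} (hx : 1 ≤ ‖x‖) (n : ℕ) : 1 ≤ ‖(ft π q)^[n] x‖ := by
  induction n with
  | zero => simpa
  | succ n ih =>
    rw [Function.iterate_succ_apply', ft]
    set y := (ft π q)^[n] x
    have h1 : ‖π * y‖ < ‖y ^ q‖ := by
      rw [norm_mul, norm_pow]
      calc ‖π‖ * ‖y‖ < 1 * ‖y‖ := by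
            have := h.lt
            gcongr
        _ = ‖y‖ ^ 1 := by ring
        _ ≤ ‖y‖ ^ q := pow_le_pow_right₀ ih (by have := h.two; omega)
    rw [IsUltrametricDist.norm_add_eq_max_of_norm_ne_norm h1.ne, max_eq_right h1.le, norm_pow]
    exact one_le_pow₀ ih

lemma ft_sub {π : Ω} {q : ℕ} (h : Hyp π q) {x y : Ω} (hx : ‖x‖ ≤ 1) (hy : ‖y‖ ≤ 1) :
    ‖ft π q x - ft π q y‖ ≤ ‖x - y‖ := by
  have e : ft π q x - ft π q y = π * (x - y) + (x ^ q - y ^ q) := by rw [ft, ft]; ring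
  rw [e]
  refine u_add (by rw [norm_mul]; exact mul_le_of_le_one_left (norm_nonneg _) h.lt.le) ?_
  exact u_pow_sub hx hy q

lemma ft_it_sub {π : Ω} {q : ℕ} (h : Hyp π q) {x y : Ω} (hx : ‖x‖ ≤ 1) (hy : ‖y‖ ≤ 1) (n : ℕ) :
    ‖(ft π q)^[n] x - (ft π q)^[n] y‖ ≤ ‖x - y‖ := by
  induction n with
  | zero => simp
  | succ n ih =>
    rw [Function.iterate_succ_apply', Function.iterate_succ_apply']
    exact (ft_sub h ((ft_it_le h hx n).trans hx) ((ft_it_le h hy n).trans hy)).trans ih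

lemma Lit_der {π : Ω} {q : ℕ} (h : Hyp π q) {x : Ω} (hx : ‖x‖ < 1) (n : ℕ) :
    (derivative (Lit π q n)).eval x ≠ 0 := by
  induction n with
  | zero => simp [Lit]
  | succ n ih =>
    have e : derivative (Lit π q (n + 1)) = (C π + C (q : Ω) * Lit π q n ^ (q - 1)) * derivative (Lit π q n) := by
      rw [Lit, derivative_add, derivative_C_mul, derivative_pow]; simp; ring
    rw [e, eval_mul]
    refine mul_ne_zero ?_ ih
    rw [eval_add, eval_mul, eval_C, eval_C, eval_pow, Lit_eval]
    have h1 : ‖(q : Ω) * ((ft π q)^[n] x) ^ (q - 1)‖ < ‖π‖ := by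
      rw [norm_mul, norm_pow]
      have h2 : ‖(ft π q)^[n] x‖ ^ (q - 1) < 1 :=
        pow_lt_one₀ (norm_nonneg _) ((ft_it_le h hx.le n).trans_lt hx) (by have := h.two; omega)
      calc ‖(q : Ω)‖ * ‖(ft π q)^[n] x‖ ^ (q - 1) ≤ ‖π‖ * ‖(ft π q)^[n] x‖ ^ (q - 1) := by
            have := h.qn
            gcongr
        _ < ‖π‖ * 1 := by
          have := h.pos
          gcongr
        _ = _ := mul_one _
    intro h0
    have h3 : π = -((q : Ω) * ((ft π q)^[n] x) ^ (q - 1)) := eq_neg_of_add_eq_zero_left h0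
    rw [← norm_neg, ← h3] at h1
    exact lt_irrefl _ h1

/-- the polynomial of primitive points of level `n` -/
noncomputable def Pn (π : Ω) (q n : ℕ) : Polynomial Ω := Lit π q n ^ (q - 1) + C π

lemma Pn_deg (π : Ω) {q : ℕ} (hq : 2 ≤ q) (n : ℕ) :
    (Pn π q n).Monic ∧ (Pn π q n).natDegree = q ^ n * (q - 1) := by
  obtain ⟨h1, h2⟩ := Lit_deg π hq n
  have h3 : (Lit π q n ^ (q - 1)).natDegree = q ^ n * (q - 1) := by rw [h1.natDegree_pow, h2, mul_comm]
  have h4 : (C π).natDegree < (Lit π q n ^ (q - 1)).natDegree := by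
    rw [natDegree_C, h3]; exact Nat.mul_pos (pow_pos (by omega) _) (by omega)
  refine ⟨(h1.pow _).add_of_left (degree_lt_degree h4), ?_⟩
  rw [Pn, natDegree_add_eq_left_of_natDegree_lt h4, h3]

lemma Pn_eval (π : Ω) (q n : ℕ) (x : Ω) : (Pn π q n).eval x = ((ft π q)^[n] x) ^ (q - 1) + π := by
  simp [Pn, Lit_eval]

open Classical in
/-- the primitive points of level `n` -/
noncomputable def Lp (π : Ω) (q n : ℕ) : Finset Ω := (Pn π q n).roots.toFinset

lemma mem_Lp {π : Ω} {q : ℕ} (hq : 2 ≤ q) {n : ℕ} {x : Ω} :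
    x ∈ Lp π q n ↔ ((ft π q)^[n] x) ^ (q - 1) + π = 0 := by
  classical
  rw [Lp, Multiset.mem_toFinset, mem_roots (Pn_deg π hq n).1.ne_zero, IsRoot, Pn_eval]

lemma Lp_lt {π : Ω} {q : ℕ} (h : Hyp π q) {n : ℕ} {x : Ω} (hx : x ∈ Lp π q n) : ‖x‖ < 1 := by
  by_contra hc
  have h1 := ft_it_ge h (not_lt.1 hc) n
  rw [mem_Lp h.two] at hx
  have h2 := congrArg norm (eq_neg_of_add_eq_zero_left hx)
  rw [norm_pow, norm_neg] at h2
  have := one_le_pow₀ h1 (n := q - 1)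
  have := h.lt
  linarith

lemma Lp_nodup {π : Ω} {q : ℕ} (h : Hyp π q) (n : ℕ) : (Pn π q n).roots.Nodup := by
  classical
  rw [Multiset.nodup_iff_count_le_one]
  intro x
  rw [count_roots]
  by_contra hc
  have h0 := (Pn_deg π h.two n).1.ne_zero
  have h1 := (one_lt_rootMultiplicity_iff_isRoot h0).1 (not_le.1 hc)
  have hx : x ∈ Lp π q n := by
    rw [Lp, Multiset.mem_toFinset, mem_roots h0]; exact h1.1
  have h2 := h1.2
  have hx' := (mem_Lp h.two).1 hx
  rw [IsRoot, Pn, derivative_add, derivative_C, add_zero, derivative_pow, eval_mul, eval_mul, eval_pow,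
    Lit_eval, eval_C] at h2
  have h3 : (ft π q)^[n] x ≠ 0 := by
    intro h3
    rw [h3, zero_pow (by have := h.two; omega), zero_add] at hx'
    have := h.pos
    rw [hx', norm_zero] at this
    exact lt_irrefl _ this
  have h4 : ((q - 1 : ℕ) : Ω) ≠ 0 := Nat.cast_ne_zero.2 (by have := h.two; omega)
  exact mul_ne_zero (mul_ne_zero h4 (pow_ne_zero _ h3)) (Lit_der h (Lp_lt h hx) n) h2

lemma Lp_prod {π : Ω} {q : ℕ} (h : Hyp π q) (n : ℕ) (s : Ω) :
    ∏ x ∈ Lp π q n, (s - x) = ((ft π q)^[n] s) ^ (q - 1) + π := by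
  classical
  have h1 := (IsAlgClosed.splits (Pn π q n)).eq_prod_roots_of_monic (Pn_deg π h.two n).1
  rw [← Pn_eval, h1, eval_multiset_prod, Finset.prod_eq_multiset_prod, Lp, Multiset.toFinset_val,
    (Lp_nodup h n).dedup, Multiset.map_map]
  simp

lemma Lp_card {π : Ω} {q : ℕ} (h : Hyp π q) (n : ℕ) : (Lp π q n).card = q ^ n * (q - 1) := by
  classical
  rw [Lp, Multiset.toFinset_card_of_nodup (Lp_nodup h n), ← (Pn_deg π h.two n).2]
  exact splits_iff_card_roots.1 (IsAlgClosed.splits _)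

lemma Lp_norm {π : Ω} {q : ℕ} (h : Hyp π q) (n : ℕ) : ∀ {x : Ω}, x ∈ Lp π q n →
    ‖x‖ ^ (q ^ n * (q - 1)) = ‖π‖ := by
  induction n with
  | zero =>
    intro x hx
    rw [mem_Lp h.two] at hx
    have h2 := congrArg norm (eq_neg_of_add_eq_zero_left hx)
    rw [norm_pow, norm_neg] at h2
    simpa using h2
  | succ n ih =>
    intro x hx
    have hl := Lp_lt h hx
    have h1 : ft π q x ∈ Lp π q n := by
      rw [mem_Lp h.two] at hx ⊢
      rwa [Function.iterate_succ_apply] at hx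
    have h2 := ih h1
    have h3 : ‖π‖ ≤ ‖ft π q x‖ := by
      rw [← h2]
      exact pow_le_of_le_one (norm_nonneg _) ((ft_le h hl.le).trans hl.le)
        (Nat.mul_pos (pow_pos (by have := h.two; omega) _) (by have := h.two; omega)).ne'
    have h4 : ‖π * x‖ < ‖x ^ q‖ := by
      by_contra hc
      have h5 : ‖ft π q x‖ ≤ ‖π * x‖ := u_add le_rfl (not_lt.1 hc)
      rw [norm_mul] at h5
      have : ‖π‖ * ‖x‖ < ‖π‖ * 1 := by
        have := h.pos
        gcongr
      linarith
    have h6 : ‖ft π q x‖ = ‖x‖ ^ q := by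
      rw [ft, IsUltrametricDist.norm_add_eq_max_of_norm_ne_norm h4.ne, max_eq_right h4.le, norm_pow]
    rw [h6, ← pow_mul] at h2
    rw [← h2]; congr 1; ring

lemma exists_ft (π : Ω) {q : ℕ} (hq : 2 ≤ q) (y : Ω) : ∃ x, ft π q x = y := by
  obtain ⟨x, hx⟩ := IsAlgClosed.exists_root (Lit π q 1 - C y) (by
    obtain ⟨h1, h2⟩ := Lit_deg π hq 1
    have : (Lit π q 1 - C y).natDegree = q ^ 1 := by rw [natDegree_sub_C, h2]
    intro h0
    have h4 : (Lit π q 1 - C y).natDegree = 0 := natDegree_eq_of_degree_eq_some h0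
    rw [h4, pow_one] at this
    omega)
  refine ⟨x, ?_⟩
  rw [IsRoot, eval_sub, eval_C, Lit_eval, sub_eq_zero] at hx
  simpa using hx

lemma Lp_lift {π : Ω} {q : ℕ} (hq : 2 ≤ q) {j i : ℕ} {x : Ω} (hx : x ∈ Lp π q j) :
    ∃ y ∈ Lp π q (j + i), (ft π q)^[i] y = x := by
  induction i with
  | zero => exact ⟨x, hx, rfl⟩
  | succ i ih =>
    obtain ⟨y, hy, hyx⟩ := ih
    obtain ⟨z, rfl⟩ := exists_ft π hq y
    refine ⟨z, ?_, hyx⟩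
    rw [mem_Lp hq] at hy ⊢
    rwa [← add_assoc, Function.iterate_succ_apply]

/-- all torsion points of level at most `n` come from primitive points of level `n` -/
lemma Lam_cases {π : Ω} {q : ℕ} (hq : 2 ≤ q) {n : ℕ} {x : Ω} (hx : (ft π q)^[n + 1] x = 0) :
    x = 0 ∨ ∃ i, ∃ y ∈ Lp π q n, (ft π q)^[i] y = x := by
  induction n with
  | zero =>
    have e : ft π q x = x * (x ^ (q - 1) + π) := by
      have : x ^ q = x * x ^ (q - 1) := by rw [← pow_succ']; congr 1; omega
      rw [ft, this]; ring
    have hx : ft π q x = 0 := hx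
    rw [e] at hx
    rcases mul_eq_zero.1 hx with h | h
    · exact Or.inl h
    · exact Or.inr ⟨0, x, (mem_Lp hq).2 h, rfl⟩
  | succ n ih =>
    set y := (ft π q)^[n + 1] x with hy
    have e : ft π q y = y * (y ^ (q - 1) + π) := by
      have : y ^ q = y * y ^ (q - 1) := by rw [← pow_succ']; congr 1; omega
      rw [ft, this]; ring
    rw [Function.iterate_succ_apply', ← hy, e] at hx
    rcases mul_eq_zero.1 hx with h | h
    · rcases ih h with h0 | ⟨i, z, hz, hzx⟩
      · exact Or.inl h0
      · right
        obtain ⟨w, hw, hwz⟩ := Lp_lift hq (i := 1) hz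
        exact ⟨i + 1, w, hw, by rw [Function.iterate_add_apply, hwz, hzx]⟩
    · exact Or.inr ⟨0, x, (mem_Lp hq).2 h, rfl⟩

/-- coefficients are controlled by values -/
lemma coeff_bound (s : Finset Ω) (c : ℕ) : ∃ B : ℝ, 0 ≤ B ∧ ∀ P : Polynomial Ω, P.degree < s.card → ∀ η : ℝ,
    0 ≤ η → (∀ x ∈ s, ‖P.eval x‖ ≤ η) → ‖P.coeff c‖ ≤ B * η := by
  classical
  refine ⟨∑ x ∈ s, ‖(Lagrange.basis s id x).coeff c‖, Finset.sum_nonneg fun _ _ => norm_nonneg _, ?_⟩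
  intro P hP η hη hx
  have h := Lagrange.eq_interpolate (s := s) (v := id) (f := P) (fun _ _ _ _ h => h) hP
  rw [h, Lagrange.interpolate_apply, finsetSum_coeff, Finset.sum_mul]
  refine (norm_sum_le _ _).trans (Finset.sum_le_sum fun x hxs => ?_)
  rw [coeff_C_mul, norm_mul, mul_comm]
  exact mul_le_mul_of_nonneg_left (hx x hxs) (norm_nonneg _)

end ana
end LT

namespace LT

set_option linter.unusedSectionVars false

section conc

variable {p : ℕ} [hp : Fact p.Prime] {Ω : Type*} [NormedField Ω] [NormedAlgebra ℚ_[p] Ω]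
  [IsUltrametricDist Ω] [IsAlgClosed Ω] [CharZero Ω] [Algebra.IsAlgebraic ℚ_[p] Ω]
  [TeichP p Ω] [NInv (Ω ≃ₐ[ℚ_[p]] Ω) Ω]

lemma IsU.hyp {K : IntermediateField ℚ_[p] Ω} [FiniteDimensional ℚ_[p] K] {π : Ω} (h : IsU K π) :
    Hyp π (qK K) := by
  obtain ⟨⟨r, hr, hq⟩, -⟩ := qK_pow K
  refine ⟨h.pos, h.lt, ?_, ?_⟩
  · rw [hq]
    calc 2 ≤ p := hp.out.two_le
      _ = p ^ 1 := (pow_one p).symm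
      _ ≤ p ^ r := Nat.pow_le_pow_right hp.out.pos (by omega)
  · refine h.disc (natCast_mem K _) ?_
    rw [hq, Nat.cast_pow, norm_pow]
    exact pow_lt_one₀ (norm_nonneg _) norm_p_lt hr

/-- the field generated by a point -/
noncomputable def LF (K : IntermediateField ℚ_[p] Ω) (x : Ω) : IntermediateField ℚ_[p] Ω :=
  K ⊔ IntermediateField.adjoin ℚ_[p] {x}

lemma LF_le (K : IntermediateField ℚ_[p] Ω) (x : Ω) : K ≤ LF K x := le_sup_left

lemma LF_mem (K : IntermediateField ℚ_[p] Ω) (x : Ω) : x ∈ LF K x :=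
  (le_sup_right : _ ≤ LF K x) (IntermediateField.mem_adjoin_simple_self _ _)

instance LF_fin (K : IntermediateField ℚ_[p] Ω) [FiniteDimensional ℚ_[p] K] (x : Ω) :
    FiniteDimensional ℚ_[p] (LF K x) := by
  have : FiniteDimensional ℚ_[p] (IntermediateField.adjoin ℚ_[p] {x}) :=
    IntermediateField.adjoin.finiteDimensional (Algebra.IsIntegral.isIntegral x)
  exact IntermediateField.finiteDimensional_sup _ _

lemma LF_fix {K : IntermediateField ℚ_[p] Ω} {x : Ω} {γ : Ω ≃ₐ[ℚ_[p]] Ω} :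
    γ ∈ (LF K x).fixingSubgroup ↔ γ ∈ K.fixingSubgroup ∧ γ • x = x := by
  rw [LF, IntermediateField.fixingSubgroup_sup, Subgroup.mem_inf]
  refine and_congr_right fun _ => ⟨fun h => mem_fix.1 h x (IntermediateField.mem_adjoin_simple_self _ _), ?_⟩
  intro h
  have h1 : IntermediateField.adjoin ℚ_[p] {x} ≤ IntermediateField.fixedField (Subgroup.zpowers γ) := by
    rw [IntermediateField.adjoin_simple_le_iff, IntermediateField.mem_fixedField_iff]
    intro f hf
    obtain ⟨n, rfl⟩ := Subgroup.mem_zpowers_iff.1 hf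
    have : γ ^ n ∈ MulAction.stabilizer (Ω ≃ₐ[ℚ_[p]] Ω) x := zpow_mem (by exact h) n
    exact this
  have h2 := (IntermediateField.le_iff_le _ _).1 h1
  exact h2 (Subgroup.mem_zpowers γ)

lemma act_ft {K : IntermediateField ℚ_[p] Ω} {π : Ω} (hπ : π ∈ K) {γ : Ω ≃ₐ[ℚ_[p]] Ω}
    (hγ : γ ∈ K.fixingSubgroup) (q n : ℕ) (x : Ω) : γ • (ft π q)^[n] x = (ft π q)^[n] (γ • x) := by
  induction n with
  | zero => rfl
  | succ n ih =>
    rw [Function.iterate_succ_apply', Function.iterate_succ_apply', ← ih, ft, ft, smul_add, smul_mul', smul_pow',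
      mem_fix.1 hγ π hπ]

lemma act_Lp {K : IntermediateField ℚ_[p] Ω} {π : Ω} (hπ : π ∈ K) {γ : Ω ≃ₐ[ℚ_[p]] Ω}
    (hγ : γ ∈ K.fixingSubgroup) {q n : ℕ} (hq : 2 ≤ q) {x : Ω} (hx : x ∈ Lp π q n) : γ • x ∈ Lp π q n := by
  rw [mem_Lp hq] at hx ⊢
  rw [← act_ft hπ hγ, ← smul_pow']
  have := congrArg (γ • ·) hx
  simp only [smul_add, smul_zero, mem_fix.1 hγ π hπ] at this
  exact this

theorem lt_main {K : IntermediateField ℚ_[p] Ω} [FiniteDimensional ℚ_[p] K] {π : Ω} (hπ : IsU K π) {n : ℕ}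
    {x : Ω} (hx : x ∈ Lp π (qK K) n) :
    (∀ y ∈ Lp π (qK K) n, ∃ γ ∈ K.fixingSubgroup, γ • x = y) ∧
    (∀ F : Ω → Ω, (∀ γ ∈ K.fixingSubgroup, ∀ y, γ • F y = F (γ • y)) →
      rN K.fixingSubgroup (LF K x).fixingSubgroup (F x) = ∏ y ∈ Lp π (qK K) n, F y) := by
  classical
  have H := hπ.hyp
  set q := qK K with hq
  set N := q ^ n * (q - 1) with hN
  have hN0 : 0 < N := Nat.mul_pos (pow_pos (by have := H.two; omega) _) (by have := H.two; omega)
  obtain ⟨ϖ, hϖ⟩ := exists_U (LF K x)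
  have hnx := Lp_norm H n hx
  have hx0 : x ≠ 0 := by
    rintro rfl
    rw [norm_zero, zero_pow hN0.ne'] at hnx
    exact H.pos.ne hnx
  obtain ⟨a, ha⟩ := hϖ.val x (LF_mem K x) hx0
  have h1 := (ram (LF_le K x) hπ hϖ).1
  set e := (IK (LF K x)).relIndex (IK K) with he
  have h2 : a * N = e := by
    have h3 : ‖ϖ‖ ^ (a * N) = ‖ϖ‖ ^ (e : ℤ) := by
      rw [zpow_mul, ← ha, zpow_natCast, zpow_natCast, ← h1]; exact hnx
    exact (zpow_right_strictAnti₀ hϖ.pos hϖ.lt).injective h3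
  have he0 : e ≠ 0 := rel_IK_ne (LF_le K x)
  have h4 : N ≤ e := by
    have : (N : ℤ) ∣ e := ⟨a, by rw [← h2]; ring⟩
    exact Nat.le_of_dvd (Nat.pos_of_ne_zero he0) (by exact_mod_cast this)
  have h0 := rel_fix_ne (LF K x) K.fixingSubgroup
  have h5 : e ≤ (LF K x).fixingSubgroup.relIndex K.fixingSubgroup := by
    rw [he, IK_eq (LF_le K x), Subgroup.inf_relIndex_right]
    exact Subgroup.relIndex_le_of_le_right (IK_le K) h0
  obtain ⟨f, hf⟩ := exists_Trv_fin h0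
  have hinj : Function.Injective fun i => f i • x := by
    intro i j hij
    obtain ⟨k, _, hk⟩ := hf.2 (f j) (hf.1 j)
    rw [hk i, hk j]
    · simp
    · refine LF_fix.2 ⟨mul_mem (inv_mem (hf.1 i)) (hf.1 j), ?_⟩
      rw [mul_smul, inv_smul_eq_iff]; exact hij.symm
  have hsub : Finset.univ.image (fun i => f i • x) ⊆ Lp π q n := by
    intro y hy
    obtain ⟨i, -, rfl⟩ := Finset.mem_image.1 hy
    exact act_Lp hπ.mem (hf.1 i) H.two hx
  have heq : Finset.univ.image (fun i => f i • x) = Lp π q n := by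
    refine Finset.eq_of_subset_of_card_le hsub ?_
    rw [Finset.card_image_of_injective _ hinj, Finset.card_univ, Fintype.card_fin, Lp_card H]
    exact h4.trans h5
  refine ⟨fun y hy => ?_, fun F hF => ?_⟩
  · rw [← heq] at hy
    obtain ⟨i, -, rfl⟩ := Finset.mem_image.1 hy
    exact ⟨f i, hf.1 i, rfl⟩
  · have hFx : F x ∈ FF Ω (LF K x).fixingSubgroup := by
      rw [mem_FF]
      intro γ hγ
      obtain ⟨g1, g2⟩ := LF_fix.1 hγ
      rw [hF γ g1, g2]
    rw [rN_eq_prod hf hFx, ← heq, Finset.prod_image (fun i _ j _ h => hinj h)]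
    exact Finset.prod_congr rfl fun i _ => hF _ (hf.1 i) _

/-- the uniformizer of the Lubin-Tate field -/
theorem lt_unif {K : IntermediateField ℚ_[p] Ω} [FiniteDimensional ℚ_[p] K] {π : Ω} (hπ : IsU K π) {n : ℕ}
    {x : Ω} (hx : x ∈ Lp π (qK K) n) : rN K.fixingSubgroup (LF K x).fixingSubgroup (-x) = π := by
  have H := hπ.hyp
  rw [(lt_main hπ hx).2 (fun y => -y) (fun γ _ y => smul_neg γ y)]
  have h := Lp_prod H n 0
  simp only [zero_sub] at h
  rw [h]
  have h0 : (ft π (qK K))^[n] 0 = 0 := by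
    refine Function.iterate_fixed ?_ n
    rw [ft, mul_zero, zero_pow (by have := H.two; omega), add_zero]
  rw [h0, zero_pow (by have := H.two; omega), zero_add]

lemma lt_U {K : IntermediateField ℚ_[p] Ω} [FiniteDimensional ℚ_[p] K] {π : Ω} (hπ : IsU K π) {n : ℕ}
    {x : Ω} (hx : x ∈ Lp π (qK K) n) : IsU (LF K x) x ∧ TK (LF K x) ⊆ TK K := by
  obtain ⟨h1, h2⟩ := tot_ram (LF_le K x) hπ (neg_mem (LF_mem K x)) (lt_unif hπ hx)
  refine ⟨⟨LF_mem K x, by simpa using h1.pos, by simpa using h1.lt, by simpa using h1.val⟩, ?_⟩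
  rintro t ⟨ht, ht'⟩
  refine ⟨mem_K_iff.2 (mem_FF.2 fun γ hγ => ?_), ht'⟩
  obtain ⟨i, hi, hiγ⟩ := h2 γ hγ
  have h3 : (i⁻¹ * γ) • t = t := mem_fix.1 hiγ t ht
  have h4 : i • t = t := hi.2 t ht'
  rw [mul_smul, inv_smul_eq_iff, h4] at h3
  exact h3

end conc
end LT

namespace LT

set_option linter.unusedSectionVars false

section conc
open Polynomial

variable {p : ℕ} [hp : Fact p.Prime] {Ω : Type*} [NormedField Ω] [NormedAlgebra ℚ_[p] Ω]
  [IsUltrametricDist Ω] [IsAlgClosed Ω] [CharZero Ω] [Algebra.IsAlgebraic ℚ_[p] Ω]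
  [TeichP p Ω] [NInv (Ω ≃ₐ[ℚ_[p]] Ω) Ω]

/-- the uniformizer as an integer -/
def pK {K : IntermediateField ℚ_[p] Ω} {π : Ω} (h : IsU K π) : OK K := ⟨π, h.lt.le, h.mem⟩

lemma pK_dvd {K : IntermediateField ℚ_[p] Ω} {π : Ω} (h : IsU K π) {n : ℕ} {r : OK K} :
    pK h ^ n ∣ r ↔ ‖(r : Ω)‖ ≤ ‖π‖ ^ n := by
  have h0 : π ≠ 0 := norm_pos_iff.1 h.pos
  constructor
  · rintro ⟨s, rfl⟩
    have e : ((pK h ^ n * s : OK K) : Ω) = π ^ n * s := rfl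
    rw [e, norm_mul, norm_pow]
    exact mul_le_of_le_one_right (by positivity) (mem_OK.1 s.2).1
  · intro hr
    refine ⟨⟨(r : Ω) / π ^ n, mem_OK.2 ⟨?_, div_mem (mem_OK.1 r.2).2 (pow_mem h.mem _)⟩⟩, ?_⟩
    · rw [norm_div, norm_pow]
      exact div_le_one_of_le₀ hr (by positivity)
    · ext
      change (r : Ω) = π ^ n * (r / π ^ n)
      field_simp

lemma pK_res {K : IntermediateField ℚ_[p] Ω} {π : Ω} (h : IsU K π) (r : OK K) :
    IsLocalRing.residue (OK K) r = 0 ↔ pK h ∣ r := by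
  have h1 := OK_res (x := r) (y := 0)
  rw [map_zero] at h1
  rw [h1, ← pow_one (pK h), pK_dvd h, pow_one]
  simp only [ZeroMemClass.coe_zero, sub_zero]
  exact ⟨fun h2 => h.disc (mem_OK.1 r.2).2 h2, fun h2 => h2.trans_lt h.lt⟩

instance res_finite (K : IntermediateField ℚ_[p] Ω) [FiniteDimensional ℚ_[p] K] :
    Finite (IsLocalRing.ResidueField (OK K)) := by
  have := (TK_finite K).to_subtype
  exact Finite.of_surjective _ (TKmap_bij K).2

noncomputable instance res_fintype (K : IntermediateField ℚ_[p] Ω) [FiniteDimensional ℚ_[p] K] :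
    Fintype (IsLocalRing.ResidueField (OK K)) := Fintype.ofFinite _

lemma res_card (K : IntermediateField ℚ_[p] Ω) [FiniteDimensional ℚ_[p] K] :
    Fintype.card (IsLocalRing.ResidueField (OK K)) = qK K := by
  rw [qK_eq, Nat.card_eq_fintype_card]

lemma act_aeval {K : IntermediateField ℚ_[p] Ω} {γ : Ω ≃ₐ[ℚ_[p]] Ω} (hγ : γ ∈ K.fixingSubgroup)
    (g : Polynomial (OK K)) (y : Ω) : γ • aeval y g = aeval (γ • y) g := by
  induction g using Polynomial.induction_on' with
  | add P Q hP hQ => rw [map_add, map_add, smul_add, hP, hQ]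
  | monomial n a =>
    rw [aeval_monomial, aeval_monomial, smul_mul', smul_pow']
    congr 1
    exact mem_fix.1 hγ _ (mem_OK.1 a.2).2

lemma aeval_le {K : IntermediateField ℚ_[p] Ω} (g : Polynomial (OK K)) {y : Ω} (hy : ‖y‖ ≤ 1) :
    ‖aeval y g‖ ≤ 1 := by
  rw [aeval_eq_sum_range]
  refine u_sum _ zero_le_one fun i _ => ?_
  change ‖(g.coeff i : Ω) * y ^ i‖ ≤ 1
  rw [norm_mul, norm_pow]
  exact mul_le_one₀ (mem_OK.1 (g.coeff i).2).1 (by positivity) (pow_le_one₀ (norm_nonneg _) hy)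

lemma approx_poly {K : IntermediateField ℚ_[p] Ω} [FiniteDimensional ℚ_[p] K] {π : Ω} (hπ : IsU K π) {n : ℕ}
    {x : Ω} (hx : x ∈ Lp π (qK K) n) (m : ℕ) : ∀ u ∈ LF K x, ‖u‖ ≤ 1 →
    ∃ g : Polynomial (OK K), ‖u - aeval x g‖ ≤ ‖x‖ ^ m := by
  obtain ⟨hU, hT⟩ := lt_U hπ hx
  have hx0 : x ≠ 0 := norm_pos_iff.1 hU.pos
  induction m with
  | zero => intro u hu h1; exact ⟨0, by simpa using h1⟩
  | succ m ih =>
    intro u hu h1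
    obtain ⟨t, ht, htu⟩ := TK_near hu h1
    have htK := hT ht
    have ht1 : ‖t‖ ≤ 1 := by
      have : t = u - (u - t) := by ring
      rw [this]; exact u_sub h1 htu.le
    obtain ⟨g, hg⟩ := ih ((u - t) / x) (div_mem (sub_mem hu ht.1) hU.mem) (by
      rw [norm_div]; exact div_le_one_of_le₀ (hU.disc (sub_mem hu ht.1) htu) (norm_nonneg _))
    refine ⟨C ⟨t, mem_OK.2 ⟨ht1, htK.1⟩⟩ + X * g, ?_⟩
    have e : u - aeval x (C (⟨t, mem_OK.2 ⟨ht1, htK.1⟩⟩ : OK K) + X * g) = x * ((u - t) / x - aeval x g) := by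
      rw [map_add, map_mul, aeval_C, aeval_X]
      change u - (t + x * aeval x g) = _
      field_simp
      ring
    rw [e, norm_mul, pow_succ']
    exact mul_le_mul_of_nonneg_left hg (norm_nonneg _)

lemma ms_fin {α : Type*} {m : Multiset α} {d : ℕ} (h : m.card = d) :
    ∃ s : Fin d → α, Multiset.map s Finset.univ.val = m := by
  induction m using Quotient.inductionOn with
  | _ l =>
    subst h
    refine ⟨fun i => l.get i, ?_⟩
    rw [Fin.univ_val_map]
    exact congrArg _ (List.ofFn_get l)

/-- norms of units from the Lubin-Tate fields -/
theorem lt_norm {K : IntermediateField ℚ_[p] Ω} [FiniteDimensional ℚ_[p] K] {π : Ω} (hπ : IsU K π) {n : ℕ}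
    {x : Ω} (hx : x ∈ Lp π (qK K) n) {u : Ω} (hu : u ∈ LF K x) (hu1 : ‖u‖ = 1) :
    ‖rN K.fixingSubgroup (LF K x).fixingSubgroup u - 1‖ ≤ ‖π‖ ^ (n + 1) := by
  have H := hπ.hyp
  obtain ⟨hU, hT⟩ := lt_U hπ hx
  set q := qK K with hq
  set N := q ^ n * (q - 1) with hN
  have hN0 : 0 < N := Nat.mul_pos (pow_pos (by have := H.two; omega) _) (by have := H.two; omega)
  have hxn := Lp_norm H n hx
  set m := N * (n + 1) with hm
  have hxm : ‖x‖ ^ m = ‖π‖ ^ (n + 1) := by rw [hm, pow_mul, hxn]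
  have hm0 : 0 < m := Nat.mul_pos hN0 (by omega)
  obtain ⟨g0, hg0⟩ := approx_poly hπ hx m u hu hu1.le
  -- a monic approximation of even degree
  set D := g0.natDegree + m + 1 with hD
  set g := X ^ (2 * D) + g0 with hg
  have hdeg : g0.degree < ((2 * D : ℕ) : WithBot ℕ) := by
    refine degree_le_natDegree.trans_lt ?_
    exact_mod_cast (by omega)
  have hmon : g.Monic := monic_X_pow_add hdeg
  have hnd : g.natDegree = 2 * D := by
    rw [hg, natDegree_add_eq_left_of_degree_lt, natDegree_X_pow]
    rw [degree_X_pow]; exact hdeg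
  have happ : ‖u - aeval x g‖ ≤ ‖x‖ ^ m := by
    have e : u - aeval x g = (u - aeval x g0) - x ^ (2 * D) := by rw [hg]; simp; ring
    rw [e]
    refine u_sub hg0 ?_
    rw [norm_pow]
    exact pow_le_pow_of_le_one (norm_nonneg _) hU.lt.le (by omega)
  have hxm1 : ‖x‖ ^ m < 1 := pow_lt_one₀ (norm_nonneg _) hU.lt hm0.ne'
  have hgx : ‖aeval x g‖ = 1 := by
    rw [← hu1]; exact u_eq (by rw [hu1]; exact happ.trans_lt hxm1)
  -- constant term
  have hg00 : ‖(g.coeff 0 : Ω)‖ = 1 := by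
    obtain ⟨s, hs⟩ : X ∣ g - C (g.coeff 0) := by rw [X_dvd_iff]; simp
    have h1 : aeval x g - (g.coeff 0 : Ω) = x * aeval x s := by
      have := congrArg (aeval x) hs
      rw [map_sub, map_mul, aeval_X, aeval_C] at this
      exact this
    rw [← hgx]
    refine u_eq ?_
    rw [h1, hgx, norm_mul]
    calc ‖x‖ * ‖aeval x s‖ ≤ ‖x‖ * 1 := by
          have := aeval_le s hU.lt.le
          gcongr
      _ < 1 := by rw [mul_one]; exact hU.lt
  -- the roots
  set G := g.map (algebraMap (OK K) Ω) with hG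
  have hGm : G.Monic := hmon.map _
  have hGd : G.natDegree = 2 * D := by rw [hG, hmon.natDegree_map, hnd]
  have hcard : G.roots.card = 2 * D := by
    rw [← hGd]; exact splits_iff_card_roots.1 (IsAlgClosed.splits _)
  obtain ⟨s, hs⟩ : ∃ s : Fin (2 * D) → Ω, Multiset.map s Finset.univ.val = G.roots := ms_fin hcard
  have hGp : G = ∏ i, (X - C (s i)) := by
    have h1 := (IsAlgClosed.splits G).eq_prod_roots_of_monic hGm
    rw [h1, ← hs, Multiset.map_map]; rfl
  have hev : ∀ y : Ω, aeval y g = ∏ i, (y - s i) := by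
    intro y
    rw [aeval_def, eval₂_eq_eval_map, ← hG, hGp, eval_prod]; simp
  have hpK0 : pK hπ ≠ 0 := fun h => (norm_pos_iff.1 hπ.pos) (congrArg Subtype.val h)
  obtain ⟨r, hr1, hr2⟩ := iter_cong (res_card K) (IsLocalRing.residue (OK K)) (pK_res hπ) hpK0
    (by omega : 2 * D ≠ 0) s g hGp
  have hr1' : ∀ n, ((r n : OK K) : Ω) = ∏ i, (ft π q)^[n] (s i) := hr1
  have hr2' : ∀ n, ‖(r (n + 1) : Ω) - r n‖ ≤ ‖π‖ ^ (n + 1) := fun n => (pK_dvd hπ).1 (hr2 n)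
  have hrn : ∀ n, ‖(r n : Ω)‖ = 1 := by
    intro n
    induction n with
    | zero =>
      rw [hr1', ← hg00]
      have h1 := hev 0
      have h2 : aeval (0 : Ω) g = (g.coeff 0 : Ω) := by
        rw [← coeff_zero_eq_aeval_zero']; rfl
      rw [← h2, h1, norm_prod, norm_prod]
      simp
    | succ n ih =>
      rw [← ih]
      refine u_eq ?_
      rw [ih, norm_sub_rev]
      exact (hr2' n).trans_lt (pow_lt_one₀ (norm_nonneg _) hπ.lt (by omega))
  -- the norm of `g x`
  have hNg : rN K.fixingSubgroup (LF K x).fixingSubgroup (aeval x g) = ∏ y ∈ Lp π q n, aeval y g :=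
    (lt_main hπ hx).2 (fun y => aeval y g) fun γ hγ y => act_aeval hγ g y
  have hNr : (∏ y ∈ Lp π q n, aeval y g) * r n = r (n + 1) := by
    rw [hr1', hr1', Finset.prod_congr rfl fun y _ => hev y, Finset.prod_comm]
    have h1 : ∀ i, ∏ y ∈ Lp π q n, (y - s i) = (-1) ^ N * (((ft π q)^[n] (s i)) ^ (q - 1) + π) := by
      intro i
      rw [← Lp_prod H, hN, ← Lp_card H n, ← Finset.prod_const, ← Finset.prod_mul_distrib]
      exact Finset.prod_congr rfl fun y _ => by ring
    have h2 : ((-1 : Ω) ^ N) ^ (2 * D) = 1 := by rw [← pow_mul, mul_left_comm, pow_mul, neg_one_sq, one_pow]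
    rw [Finset.prod_congr rfl fun i _ => h1 i, Finset.prod_mul_distrib, Finset.prod_const, Finset.card_univ,
      Fintype.card_fin, h2, one_mul, ← Finset.prod_mul_distrib]
    refine Finset.prod_congr rfl fun i _ => ?_
    rw [Function.iterate_succ_apply', ft]
    set y := (ft π q)^[n] (s i)
    have : y ^ q = y ^ (q - 1) * y := by rw [← pow_succ]; congr 1; have := H.two; omega
    rw [this]; ring
  have hfin : ‖rN K.fixingSubgroup (LF K x).fixingSubgroup (aeval x g) - 1‖ ≤ ‖π‖ ^ (n + 1) := by
    rw [hNg]
    have h1 := hr2' n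
    rw [← hNr] at h1
    have e : (∏ y ∈ Lp π q n, aeval y g) * (r n : Ω) - r n = ((∏ y ∈ Lp π q n, aeval y g) - 1) * r n := by ring
    rwa [e, norm_mul, hrn, mul_one] at h1
  refine u_trans ?_ hfin
  -- compare
  have h0 := rel_fix_ne (LF K x) K.fixingSubgroup
  obtain ⟨f, hf⟩ := exists_Trv_fin h0
  have hgF : aeval x g ∈ LF K x := by
    rw [mem_K_iff, mem_FF]
    intro γ hγ
    obtain ⟨g1, g2⟩ := LF_fix.1 hγ
    rw [act_aeval g1, g2]
  rw [rN_eq_prod hf (mem_K_iff.1 hu), rN_eq_prod hf (mem_K_iff.1 hgF)]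
  refine u_prod_sub _ (by positivity) (fun i _ => by rw [norm_act, hu1]) (fun i _ => by rw [norm_act, hgx]) ?_
  intro i _
  rw [← smul_sub, norm_act, ← hxm]
  exact happ

end conc
end LT

namespace LT

set_option linter.unusedSectionVars false

section abel
open Polynomial

variable {p : ℕ} [hp : Fact p.Prime] {Ω : Type*} [NormedField Ω] [NormedAlgebra ℚ_[p] Ω]
  [IsUltrametricDist Ω] [IsAlgClosed Ω] [CharZero Ω] [Algebra.IsAlgebraic ℚ_[p] Ω]
  [TeichP p Ω] [NInv (Ω ≃ₐ[ℚ_[p]] Ω) Ω]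

lemma aeval_sub_le {K : IntermediateField ℚ_[p] Ω} (g : Polynomial (OK K)) {x y : Ω} (hx : ‖x‖ ≤ 1)
    (hy : ‖y‖ ≤ 1) : ‖aeval x g - aeval y g‖ ≤ ‖x - y‖ := by
  rw [aeval_eq_sum_range, aeval_eq_sum_range, ← Finset.sum_sub_distrib]
  refine u_sum _ (norm_nonneg _) fun i _ => ?_
  change ‖(g.coeff i : Ω) * x ^ i - (g.coeff i : Ω) * y ^ i‖ ≤ _
  rw [← mul_sub, norm_mul]
  exact (mul_le_of_le_one_left (norm_nonneg _) (mem_OK.1 (g.coeff i).2).1).trans (u_pow_sub hx hy i)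

lemma aeval_dvd_le {K : IntermediateField ℚ_[p] Ω} {g : Polynomial (OK K)} {M : ℕ} (h : X ^ M ∣ g) {x : Ω}
    (hx : ‖x‖ ≤ 1) : ‖aeval x g‖ ≤ ‖x‖ ^ M := by
  obtain ⟨s, rfl⟩ := h
  rw [map_mul, map_pow, aeval_X, norm_mul, norm_pow]
  exact mul_le_of_le_one_right (by positivity) (aeval_le s hx)

lemma aeval_ltp {K : IntermediateField ℚ_[p] Ω} {π : Ω} (h : IsU K π) (q : ℕ) (x : Ω) :
    aeval x (ltp (pK h) q) = ft π q x := by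
  rw [ltp, map_add, map_mul, map_pow, aeval_C, aeval_X]; rfl

lemma Cm_one {K : IntermediateField ℚ_[p] Ω} {π : Ω} (h : IsU K π) {q M : ℕ} {g : Polynomial (OK K)}
    (hg : Cm (pK h) q M g) {x : Ω} (hx : ‖x‖ ≤ 1) :
    ‖ft π q (aeval x g) - aeval (ft π q x) g‖ ≤ ‖x‖ ^ M := by
  have := aeval_dvd_le hg.2 hx
  rwa [map_sub, aeval_comp, aeval_comp, aeval_ltp, aeval_ltp] at this

lemma Cm_it {K : IntermediateField ℚ_[p] Ω} [FiniteDimensional ℚ_[p] K] {π : Ω} (h : IsU K π) {M : ℕ}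
    {g : Polynomial (OK K)} (hg : Cm (pK h) (qK K) M g) {x : Ω} (hx : ‖x‖ ≤ 1) (i : ℕ) :
    ‖(ft π (qK K))^[i] (aeval x g) - aeval ((ft π (qK K))^[i] x) g‖ ≤ ‖x‖ ^ M := by
  have H := h.hyp
  induction i with
  | zero => simp
  | succ i ih =>
    rw [Function.iterate_succ_apply', Function.iterate_succ_apply']
    have h1 := (ft_it_le H hx i)
    have h2 := Cm_one h hg (h1.trans hx)
    refine u_trans ?_ (h2.trans (pow_le_pow_left₀ (norm_nonneg _) h1 M))
    exact (ft_sub H ((ft_it_le H (aeval_le g hx) i).trans (aeval_le g hx)) (aeval_le g (h1.trans hx))).trans ih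

lemma Cm_norm {K : IntermediateField ℚ_[p] Ω} {g : Polynomial (OK K)} (hg : X ∣ g)
    (hu : ‖(g.coeff 1 : Ω)‖ = 1) {x : Ω} (hx : ‖x‖ < 1) : ‖aeval x g‖ = ‖x‖ := by
  obtain ⟨s, rfl⟩ := hg
  rw [coeff_X_mul] at hu
  rw [map_mul, aeval_X, norm_mul]
  suffices h : ‖aeval x s‖ = 1 by rw [h, mul_one]
  obtain ⟨t, ht⟩ : X ∣ s - C (s.coeff 0) := by rw [X_dvd_iff]; simp
  have h1 : aeval x s - (s.coeff 0 : Ω) = x * aeval x t := by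
    have := congrArg (aeval x) ht
    rw [map_sub, map_mul, aeval_X, aeval_C] at this
    exact this
  rw [← hu]
  refine u_eq ?_
  rw [norm_sub_rev, h1, hu, norm_mul]
  exact (mul_le_of_le_one_right (norm_nonneg _) (aeval_le t hx.le)).trans_lt hx

lemma Lp_ne {π : Ω} {q n : ℕ} (h : Hyp π q) {x : Ω} (hx : x ∈ Lp π q n) : (ft π q)^[n] x ≠ 0 := by
  intro h3
  have hx' := (mem_Lp h.two).1 hx
  rw [h3, zero_pow (by have := h.two; omega), zero_add] at hx'
  have := h.pos
  rw [hx', norm_zero] at this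
  exact lt_irrefl _ this

lemma ft_succ {π : Ω} {q : ℕ} (h : Hyp π q) (n : ℕ) (x : Ω) :
    (ft π q)^[n + 1] x = (ft π q)^[n] x * (((ft π q)^[n] x) ^ (q - 1) + π) := by
  rw [Function.iterate_succ_apply', ft]
  set y := (ft π q)^[n] x
  have : y ^ q = y ^ (q - 1) * y := by rw [← pow_succ]; congr 1; have := h.two; omega
  rw [this]; ring

lemma near_root {K : IntermediateField ℚ_[p] Ω} [FiniteDimensional ℚ_[p] K] {π : Ω} (h : IsU K π) {n M : ℕ}
    {g : Polynomial (OK K)} (hg : Cm (pK h) (qK K) M g) (hu : ‖(g.coeff 1 : Ω)‖ = 1) {x : Ω}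
    (hx : x ∈ Lp π (qK K) n) {η : ℝ} (hη : 0 < η) (h1 : ‖x‖ ^ M < ‖(ft π (qK K))^[n] x‖)
    (h2 : ‖x‖ ^ M < η ^ (Lp π (qK K) n).card * ‖(ft π (qK K))^[n] x‖) :
    ∃ y ∈ Lp π (qK K) n, ‖aeval x g - y‖ ≤ η := by
  have H := h.hyp
  have hx1 := Lp_lt H hx
  set q := qK K
  have e0 : (ft π q)^[n + 1] x = 0 := by rw [ft_succ H, (mem_Lp H.two).1 hx, mul_zero]
  have e1 := Cm_it h hg hx1.le (n + 1)
  have e2 := Cm_it h hg hx1.le n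
  have e3 : aeval (0 : Ω) g = 0 := by
    obtain ⟨s, rfl⟩ := hg.1
    simp
  have e4 : ‖(ft π q)^[n] (aeval x g)‖ = ‖(ft π q)^[n] x‖ := by
    have h3 := Cm_norm hg.1 hu ((ft_it_le H hx1.le n).trans_lt hx1)
    rw [← h3]
    refine u_eq ?_
    rw [norm_sub_rev, h3]
    exact e2.trans_lt h1
  change ‖(ft π q)^[n + 1] (aeval x g) - aeval ((ft π q)^[n + 1] x) g‖ ≤ _ at e1
  rw [e0, e3, sub_zero, ft_succ H, norm_mul, e4, ← Lp_prod H, norm_prod] at e1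
  by_contra! hc
  have h5 : η ^ (Lp π q n).card ≤ ∏ y ∈ Lp π q n, ‖aeval x g - y‖ := by
    rw [← Finset.prod_const]
    exact Finset.prod_le_prod (fun _ _ => hη.le) fun y hy => (hc y hy).le
  have h6 : 0 < ‖(ft π q)^[n] x‖ := norm_pos_iff.2 (Lp_ne H hx)
  have h7 := mul_le_mul_of_nonneg_right h5 h6.le
  rw [mul_comm ‖_‖] at e1
  linarith

lemma Lit_roots {π : Ω} {q : ℕ} (h : Hyp π q) (n : ℕ) :
    ∃ s : Finset Ω, s.card = q ^ n ∧ ∀ x ∈ s, (ft π q)^[n] x = 0 := by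
  classical
  obtain ⟨h1, h2⟩ := Lit_deg π h.two n
  have h0 := h1.ne_zero
  have hr : ∀ x, (Lit π q n).IsRoot x → (ft π q)^[n] x = 0 := fun x hx => by rw [← Lit_eval]; exact hx
  refine ⟨(Lit π q n).roots.toFinset, ?_, fun x hx => ?_⟩
  · rw [Multiset.toFinset_card_of_nodup, ← h2]
    · exact splits_iff_card_roots.1 (IsAlgClosed.splits _)
    · rw [Multiset.nodup_iff_count_le_one]
      intro x
      rw [count_roots]
      by_contra hc
      have h3 := (one_lt_rootMultiplicity_iff_isRoot h0).1 (not_le.1 hc)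
      refine Lit_der h ?_ n h3.2
      by_contra h4
      have := ft_it_ge h (not_lt.1 h4) n
      rw [hr x h3.1, norm_zero] at this
      linarith
  · rw [Multiset.mem_toFinset, mem_roots h0] at hx
    exact hr x hx

lemma Lit_int {K : IntermediateField ℚ_[p] Ω} {π : Ω} (h : IsU K π) {q : ℕ} (hq : 2 ≤ q) (n : ℕ) :
    ∃ P : Polynomial (OK K), P.Monic ∧ P.map (algebraMap (OK K) Ω) = Lit π q n ∧ P.coeff 0 = 0 ∧
      P.coeff 1 = pK h ^ n := by
  suffices hs : ∃ P : Polynomial (OK K), P.map (algebraMap (OK K) Ω) = Lit π q n ∧ P.coeff 0 = 0 ∧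
      P.coeff 1 = pK h ^ n by
    obtain ⟨P, h1, h2⟩ := hs
    refine ⟨P, ?_, h1, h2⟩
    have hi : Function.Injective (algebraMap (OK K) Ω) := Subtype.val_injective
    apply Polynomial.monic_of_injective hi
    rw [h1]; exact (Lit_deg π hq n).1
  induction n with
  | zero => exact ⟨X, by simp [Lit], by simp, by simp⟩
  | succ n ih =>
    obtain ⟨P, h1, h2, h3⟩ := ih
    obtain ⟨Q, hQ⟩ : X ∣ P := X_dvd_iff.2 h2
    have h4 : X ^ 2 ∣ P ^ q := by
      rw [hQ, mul_pow]; exact Dvd.dvd.mul_right (pow_dvd_pow _ hq) _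
    rw [X_pow_dvd_iff] at h4
    refine ⟨C (pK h) * P + P ^ q, ?_, ?_, ?_⟩
    · rw [Polynomial.map_add, Polynomial.map_mul, Polynomial.map_pow, h1, map_C, Lit]; rfl
    · rw [coeff_add, coeff_C_mul, h2, h4 0 (by norm_num)]; simp
    · rw [coeff_add, coeff_C_mul, h3, h4 1 (by norm_num), add_zero, pow_succ']

/-- injectivity constant -/
lemma inj_const {K : IntermediateField ℚ_[p] Ω} [FiniteDimensional ℚ_[p] K] {π : Ω} (h : IsU K π) (n : ℕ) :
    ∃ B : ℝ, 0 ≤ B ∧ ∀ η : ℝ, 0 ≤ η → B * η ≤ ‖π‖ ^ (n + 1) → ∀ G : Polynomial (OK K),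
      (∀ z, (ft π (qK K))^[n + 1] z = 0 → ‖aeval z G‖ ≤ η) → ‖(G.coeff 1 : Ω)‖ ≤ ‖π‖ ^ (n + 1) := by
  have H := h.hyp
  obtain ⟨s, hs1, hs2⟩ := Lit_roots H (n + 1)
  obtain ⟨B, hB, hb⟩ := coeff_bound s 1
  refine ⟨B, hB, fun η hη hBη G hG => ?_⟩
  obtain ⟨P, hm, hP, hP0, hP1⟩ := Lit_int h H.two (n + 1)
  have hPd : P.natDegree = qK K ^ (n + 1) := by
    rw [← hm.natDegree_map (algebraMap (OK K) Ω), hP, (Lit_deg π H.two _).2]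
  have hdm := modByMonic_add_div G P
  set Q := G /ₘ P
  set R := G %ₘ P with hR
  have hRd : (R.map (algebraMap (OK K) Ω)).degree < s.card := by
    refine degree_map_le.trans_lt ?_
    rw [hs1, ← hPd, ← degree_eq_natDegree hm.ne_zero]
    exact degree_modByMonic_lt G hm
  have h1 := hb _ hRd η hη (fun x hx => by
    rw [eval_map_algebraMap]
    have e : aeval x R = aeval x G := by
      rw [← hdm, map_add, map_mul]
      have : aeval x P = 0 := by
        rw [← eval_map_algebraMap, hP, Lit_eval]; exact hs2 x hx
      rw [this, zero_mul, add_zero]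
    rw [e]
    exact hG x (hs2 x hx))
  rw [coeff_map] at h1
  have e : (G.coeff 1 : Ω) = R.coeff 1 + π ^ (n + 1) * Q.coeff 0 := by
    have h2 : G.coeff 1 = R.coeff 1 + pK h ^ (n + 1) * Q.coeff 0 := by
      conv_lhs => rw [← hdm]
      obtain ⟨S, hS⟩ : X ∣ P := X_dvd_iff.2 hP0
      rw [hS, coeff_X_mul] at hP1
      rw [coeff_add, hS, mul_assoc, coeff_X_mul, mul_coeff_zero, hP1]
    rw [h2]; rfl
  rw [e]
  refine u_add (h1.trans hBη) ?_
  rw [norm_mul, norm_pow]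
  exact mul_le_of_le_one_right (by positivity) (mem_OK.1 (Q.coeff 0).2).1

lemma unit_set {K : IntermediateField ℚ_[p] Ω} [FiniteDimensional ℚ_[p] K] {π : Ω} (h : IsU K π) (n : ℕ) :
    ∃ U : Finset Ω, U.card = qK K ^ n * (qK K - 1) ∧ (∀ u ∈ U, u ∈ K ∧ ‖u‖ = 1) ∧
      ∀ u ∈ U, ∀ v ∈ U, ‖u - v‖ ≤ ‖π‖ ^ (n + 1) → u = v := by
  classical
  have hT : ((TK_finite K).toFinset).card = qK K := by
    rw [qK, Nat.card_coe_set_eq, Set.ncard_eq_toFinset_card _ (TK_finite K)]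
  have hmT : ∀ t, t ∈ (TK_finite K).toFinset ↔ t ∈ TK K := fun t => by simp
  induction n with
  | zero =>
    have h0 : (0 : Ω) ∈ (TK_finite K).toFinset := (hmT 0).2 ⟨zero_mem K, Or.inl rfl⟩
    refine ⟨(TK_finite K).toFinset.erase 0, ?_, ?_, ?_⟩
    · rw [Finset.card_erase_of_mem h0, hT]; simp
    · intro u hu
      rw [Finset.mem_erase, hmT] at hu
      refine ⟨hu.2.1, ?_⟩
      rcases hu.2.2 with h1 | ⟨m, hm, _, hz⟩
      · exact absurd h1 hu.1
      · exact norm_rootOne hm.ne' hz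
    · intro u hu v hv huv
      rw [Finset.mem_erase, hmT] at hu hv
      refine IsT.eq_of_lt hu.2.2 hv.2.2 (huv.trans_lt ?_)
      simpa using h.lt
  | succ n ih =>
    obtain ⟨U, hc, h1, h2⟩ := ih
    have key : ∀ u ∈ U, ∀ v ∈ U, ∀ t ∈ TK K, ∀ s ∈ TK K,
        ‖(u + π ^ (n + 1) * t) - (v + π ^ (n + 1) * s)‖ ≤ ‖π‖ ^ (n + 2) → u = v ∧ t = s := by
      intro u hu v hv t ht s hs hh
      have hts : ‖t - s‖ ≤ 1 := u_sub ht.2.norm_le hs.2.norm_le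
      have huv : u = v := by
        refine h2 u hu v hv ?_
        have e : u - v = ((u + π ^ (n + 1) * t) - (v + π ^ (n + 1) * s)) - π ^ (n + 1) * (t - s) := by ring
        rw [e]
        refine u_sub (hh.trans (pow_le_pow_of_le_one (norm_nonneg _) h.lt.le (by omega))) ?_
        rw [norm_mul, norm_pow]
        exact mul_le_of_le_one_right (by positivity) hts
      refine ⟨huv, IsT.eq_of_lt ht.2 hs.2 ?_⟩
      have e : (u + π ^ (n + 1) * t) - (v + π ^ (n + 1) * s) = π ^ (n + 1) * (t - s) := by rw [huv]; ring
      rw [e, norm_mul, norm_pow, pow_succ ‖π‖ (n + 1)] at hh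
      exact (le_of_mul_le_mul_left hh (pow_pos h.pos _)).trans_lt h.lt
    refine ⟨(U ×ˢ (TK_finite K).toFinset).image fun z => z.1 + π ^ (n + 1) * z.2, ?_, ?_, ?_⟩
    · rw [Finset.card_image_of_injOn, Finset.card_product, hc, hT, pow_succ]
      · ring
      · rintro ⟨u, t⟩ hz ⟨v, s⟩ hw hh
        rw [Finset.mem_coe, Finset.mem_product, hmT] at hz hw
        obtain ⟨g1, g2⟩ := key u hz.1 v hw.1 t hz.2 s hw.2 (by
          simp only at hh
          rw [hh, sub_self, norm_zero]; positivity)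
        rw [g1, g2]
    · intro w hw
      obtain ⟨⟨u, t⟩, hz, rfl⟩ := Finset.mem_image.1 hw
      rw [Finset.mem_product, hmT] at hz
      obtain ⟨g1, g2⟩ := h1 u hz.1
      refine ⟨add_mem g1 (mul_mem (pow_mem h.mem _) hz.2.1), ?_⟩
      rw [← g2]
      refine u_eq ?_
      rw [g2]
      simp only [sub_add_cancel_left, norm_neg, norm_mul, norm_pow]
      calc ‖π‖ ^ (n + 1) * ‖t‖ ≤ ‖π‖ ^ (n + 1) * 1 := by
            have := hz.2.2.norm_le
            gcongr
        _ < 1 := by rw [mul_one]; exact pow_lt_one₀ (norm_nonneg _) h.lt (by omega)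
    · intro w hw w' hw' hh
      obtain ⟨⟨u, t⟩, hz, rfl⟩ := Finset.mem_image.1 hw
      obtain ⟨⟨v, s⟩, hz', rfl⟩ := Finset.mem_image.1 hw'
      rw [Finset.mem_product, hmT] at hz hz'
      obtain ⟨g1, g2⟩ := key u hz.1 v hz'.1 t hz.2 s hz'.2 hh
      rw [g1, g2]

end abel
end LT

namespace LT

set_option linter.unusedSectionVars false

section abel2
open Polynomial

variable {p : ℕ} [hp : Fact p.Prime] {Ω : Type*} [NormedField Ω] [NormedAlgebra ℚ_[p] Ω]
  [IsUltrametricDist Ω] [IsAlgClosed Ω] [CharZero Ω] [Algebra.IsAlgebraic ℚ_[p] Ω]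
  [TeichP p Ω] [NInv (Ω ≃ₐ[ℚ_[p]] Ω) Ω]

lemma exists_sep (s : Finset Ω) : ∃ D : ℝ, 0 < D ∧ ∀ x ∈ s, ∀ y ∈ s, ‖x - y‖ < D → x = y := by
  classical
  set t := (s ×ˢ s).filter fun z => z.1 ≠ z.2
  by_cases ht : t.Nonempty
  · obtain ⟨z, hz, hmin⟩ := Finset.exists_min_image t (fun z => ‖z.1 - z.2‖) ht
    refine ⟨‖z.1 - z.2‖, norm_pos_iff.2 (sub_ne_zero.2 (Finset.mem_filter.1 hz).2), ?_⟩
    intro x hx y hy hxy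
    by_contra hne
    have := hmin (x, y) (Finset.mem_filter.2 ⟨Finset.mem_product.2 ⟨hx, hy⟩, hne⟩)
    exact absurd hxy (not_lt.2 this)
  · refine ⟨1, one_pos, fun x hx y hy _ => ?_⟩
    by_contra hne
    exact ht ⟨(x, y), Finset.mem_filter.2 ⟨Finset.mem_product.2 ⟨hx, hy⟩, hne⟩⟩

theorem lt_comm {K : IntermediateField ℚ_[p] Ω} [FiniteDimensional ℚ_[p] K] {π : Ω} (h : IsU K π) {n : ℕ}
    {x : Ω} (hx : x ∈ Lp π (qK K) n) {σ τ : Ω ≃ₐ[ℚ_[p]] Ω} (hσ : σ ∈ K.fixingSubgroup)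
    (hτ : τ ∈ K.fixingSubgroup) : σ • τ • x = τ • σ • x := by
  classical
  have H := h.hyp
  have hx1 := Lp_lt H hx
  have hne := Lp_ne H hx
  obtain ⟨D, hD, hsep⟩ := exists_sep (Lp π (qK K) n)
  obtain ⟨B, hB, hinj⟩ := inj_const h n
  obtain ⟨U, hUc, hU1, hU2⟩ := unit_set h n
  have hρ : 0 < ‖(ft π (qK K))^[n] x‖ := norm_pos_iff.2 hne
  obtain ⟨η, hη, hηD, hηB⟩ : ∃ η : ℝ, 0 < η ∧ η < D ∧ B * η ≤ ‖π‖ ^ (n + 1) := by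
    have hp1 : 0 < ‖π‖ ^ (n + 1) := pow_pos h.pos _
    refine ⟨min (D / 2) (‖π‖ ^ (n + 1) / (B + 1)), lt_min (by linarith) (by positivity),
      (min_le_left _ _).trans_lt (by linarith), ?_⟩
    calc B * min (D / 2) (‖π‖ ^ (n + 1) / (B + 1)) ≤ B * (‖π‖ ^ (n + 1) / (B + 1)) :=
          mul_le_mul_of_nonneg_left (min_le_right _ _) hB
      _ = ‖π‖ ^ (n + 1) * (B / (B + 1)) := by ring
      _ ≤ ‖π‖ ^ (n + 1) * 1 := by
          refine mul_le_mul_of_nonneg_left ?_ hp1.le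
          exact div_le_one_of_le₀ (by linarith) (by linarith)
      _ = _ := mul_one _
  obtain ⟨M, hM⟩ := exists_pow_lt_of_lt_one (show 0 < min η (min ‖(ft π (qK K))^[n] x‖
    (η ^ (Lp π (qK K) n).card * ‖(ft π (qK K))^[n] x‖)) from
      lt_min hη (lt_min hρ (mul_pos (pow_pos hη _) hρ))) hx1
  rw [lt_min_iff, lt_min_iff] at hM
  obtain ⟨hM1, hM2, hM3⟩ := hM
  have hpn : ∀ m, ((pK h ^ m : OK K) : Ω) = π ^ m := fun m => rfl
  have hun : ∀ m, 1 ≤ m → IsUnit (1 - pK h ^ m) := by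
    intro m hm
    rw [OK_isUnit]
    change ‖1 - π ^ m‖ = 1
    conv_rhs => rw [← norm_one (α := Ω)]
    refine u_eq ?_
    rw [sub_sub_cancel, norm_pow, norm_one]
    exact pow_lt_one₀ (norm_nonneg _) h.lt (by omega)
  have hpp : ∀ m, 2 ≤ m → pK h - pK h ^ m ≠ 0 := by
    intro m hm h0
    have h1 : π = π ^ m := congrArg Subtype.val (sub_eq_zero.1 h0)
    have h2 := congrArg norm h1
    rw [norm_pow] at h2
    have h3 : ‖π‖ ^ m < ‖π‖ := pow_lt_self_of_lt_one₀ h.pos h.lt (by omega)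
    linarith
  have hex : ∀ u : U, ∃ g : Polynomial (OK K), Cm (pK h) (qK K) M g ∧ (g.coeff 1 : Ω) = u := by
    intro u
    obtain ⟨g, hg, hgu⟩ := exists_Cm H.two hun (res_card K) (IsLocalRing.residue (OK K)) (pK_res h)
      ⟨u.1, mem_OK.2 ⟨(hU1 u.1 u.2).2.le, (hU1 u.1 u.2).1⟩⟩ M
    exact ⟨g, hg, by rw [hgu]⟩
  choose g hg hgu using hex
  have hnear : ∀ u : U, ∃ y : Lp π (qK K) n, ‖aeval x (g u) - y‖ ≤ η := by
    intro u
    obtain ⟨y, hy, hyn⟩ := near_root h (hg u) (by rw [hgu]; exact (hU1 u.1 u.2).2) hx hη hM2 hM3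
    exact ⟨⟨y, hy⟩, hyn⟩
  choose Y hY using hnear
  have hYinj : Function.Injective Y := by
    intro u v huv
    apply Subtype.ext
    apply hU2 u.1 u.2 v.1 v.2
    have h1 := hinj η hη.le hηB (g u - g v) ?_
    · have e : (((g u - g v).coeff 1 : OK K) : Ω) = u.1 - v.1 := by
        rw [coeff_sub, ← hgu u, ← hgu v]; rfl
      rwa [e] at h1
    have hx0 : ‖aeval x (g u) - aeval x (g v)‖ ≤ η := by
      refine u_trans (hY u) ?_
      rw [huv, norm_sub_rev]; exact hY v
    intro z hz
    rcases Lam_cases H.two hz with rfl | ⟨i, y, hy, rfl⟩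
    · have e3 : ∀ u, aeval (0 : Ω) (g u) = 0 := by
        intro u
        obtain ⟨s, hs⟩ := (hg u).1
        rw [hs]; simp
      rw [map_sub, e3, e3, sub_zero, norm_zero]; exact hη.le
    · obtain ⟨γ, hγ, hγy⟩ := (lt_main h hx).1 y hy
      have hyn : ‖y‖ = ‖x‖ := by rw [← hγy, norm_act]
      have hy1 : ‖y‖ ≤ 1 := by rw [hyn]; exact hx1.le
      have h2 : ‖aeval y (g u) - aeval y (g v)‖ ≤ η := by
        rw [← hγy, ← act_aeval hγ, ← act_aeval hγ, ← smul_sub, norm_act]; exact hx0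
      have h3 : ∀ w, ‖(ft π (qK K))^[i] (aeval y (g w)) - aeval ((ft π (qK K))^[i] y) (g w)‖ ≤ η := fun w =>
        (Cm_it h (hg w) hy1 i).trans (by rw [hyn]; exact hM1.le)
      rw [map_sub]
      refine u_trans (b := (ft π (qK K))^[i] (aeval y (g u))) (by rw [norm_sub_rev]; exact h3 u) ?_
      refine u_trans (b := (ft π (qK K))^[i] (aeval y (g v))) ?_ (h3 v)
      exact (ft_it_sub H (aeval_le _ hy1) (aeval_le _ hy1) i).trans h2
  have hYsur : Function.Surjective Y := by
    refine ((Fintype.bijective_iff_injective_and_card Y).2 ⟨hYinj, ?_⟩).2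
    rw [Fintype.card_coe, Fintype.card_coe, hUc, Lp_card H]
  obtain ⟨u, hu⟩ := hYsur ⟨σ • x, act_Lp h.mem hσ H.two hx⟩
  obtain ⟨v, hv⟩ := hYsur ⟨τ • x, act_Lp h.mem hτ H.two hx⟩
  have hu' : ‖aeval x (g u) - σ • x‖ ≤ η := by have := hY u; rwa [hu] at this
  have hv' : ‖aeval x (g v) - τ • x‖ ≤ η := by have := hY v; rwa [hv] at this
  have hgen : ∀ (ρ₁ ρ₂ : Ω ≃ₐ[ℚ_[p]] Ω), ρ₁ ∈ K.fixingSubgroup → ∀ a b : U, ‖aeval x (g a) - ρ₁ • x‖ ≤ η →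
      ‖aeval x (g b) - ρ₂ • x‖ ≤ η → ‖aeval x ((g b).comp (g a)) - ρ₁ • ρ₂ • x‖ ≤ η := by
    intro ρ₁ ρ₂ h1 a b ha hb
    rw [aeval_comp]
    refine u_trans (b := aeval (ρ₁ • x) (g b)) ?_ ?_
    · exact (aeval_sub_le _ (aeval_le _ hx1.le) (by rw [norm_act]; exact hx1.le)).trans ha
    · rw [← act_aeval h1, ← smul_sub, norm_act]; exact hb
  have h1 := hgen σ τ hσ u v hu' hv'
  have h2 := hgen τ σ hτ v u hv' hu'
  have h3 := aeval_dvd_le (Cm.comm H.two hpp (hg v) (hg u)) hx1.le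
  rw [map_sub] at h3
  refine hsep _ (act_Lp h.mem hσ H.two (act_Lp h.mem hτ H.two hx)) _
    (act_Lp h.mem hτ H.two (act_Lp h.mem hσ H.two hx)) (lt_of_le_of_lt ?_ hηD)
  refine u_trans (by rw [norm_sub_rev]; exact h1) (u_trans (h3.trans hM1.le) h2)

theorem lt_ab {K : IntermediateField ℚ_[p] Ω} [FiniteDimensional ℚ_[p] K] {π : Ω} (h : IsU K π) {n : ℕ}
    {x : Ω} (hx : x ∈ Lp π (qK K) n) : Ab K.fixingSubgroup (LF K x).fixingSubgroup := by
  intro a ha b hb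
  rw [LF_fix]
  refine ⟨Subgroup.mul_mem _ (Subgroup.mul_mem _ (Subgroup.mul_mem _ ha hb) (Subgroup.inv_mem _ ha))
    (Subgroup.inv_mem _ hb), ?_⟩
  have hy : (a⁻¹ * b⁻¹) • x ∈ Lp π (qK K) n :=
    act_Lp h.mem (Subgroup.mul_mem _ (Subgroup.inv_mem _ ha) (Subgroup.inv_mem _ hb)) h.hyp.two hx
  have := lt_comm h hy ha hb
  rw [mul_assoc, mul_smul, mul_smul, this, ← mul_smul, ← mul_smul]
  simp

theorem lt_good {K : IntermediateField ℚ_[p] Ω} [FiniteDimensional ℚ_[p] K] {π : Ω} (h : IsU K π) (n : ℕ) :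
    ∃ L, Good K L π ∧ ∀ u ∈ L, ‖u‖ = 1 → ‖rN K.fixingSubgroup L.fixingSubgroup u - 1‖ ≤ ‖π‖ ^ (n + 1) := by
  have H := h.hyp
  have hc := Lp_card H n
  have hpos : 0 < (Lp π (qK K) n).card := by
    rw [hc]; exact Nat.mul_pos (pow_pos (by have := H.two; omega) _) (by have := H.two; omega)
  obtain ⟨x, hx⟩ := Finset.card_pos.1 hpos
  exact ⟨LF K x, ⟨LF_le K x, LF_fin K x, lt_ab h hx, -x, neg_mem (LF_mem K x), lt_unif h hx⟩,
    fun u hu hu1 => lt_norm h hx hu hu1⟩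

end abel2
end LT

namespace LT

set_option linter.unusedSectionVars false

section bwd

variable {p : ℕ} [hp : Fact p.Prime] {Ω : Type*} [NormedField Ω] [NormedAlgebra ℚ_[p] Ω]
  [IsUltrametricDist Ω] [IsAlgClosed Ω] [CharZero Ω] [Algebra.IsAlgebraic ℚ_[p] Ω]
  [TeichP p Ω] [NInv (Ω ≃ₐ[ℚ_[p]] Ω) Ω]

theorem good_bwd {K₁ K₂ : IntermediateField ℚ_[p] Ω} [FiniteDimensional ℚ_[p] K₁]
    [FiniteDimensional ℚ_[p] K₂] (h12 : K₁ ≤ K₂)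
    {π₁ π₂ : Ω} (hπ₁ : IsU K₁ π₁) (hπ₂ : IsU K₂ π₂) {f : ℕ} (hq : qK K₂ = qK K₁ ^ f)
    (hs : ∀ L, Good K₁ L π₁ → ∃ M, Good K₂ M π₂ ∧ L ≤ M) :
    rN K₁.fixingSubgroup K₂.fixingSubgroup π₂ = π₁ ^ f := by
  have hnorm : ‖rN K₁.fixingSubgroup K₂.fixingSubgroup π₂‖ = ‖π₁‖ ^ f := by
    obtain ⟨φ, hφ1, hφ⟩ := exists_frob K₁
    have hF : π₂ ∈ FF Ω (IK K₂) := FF_anti (IK_le K₂) (mem_K_iff.1 hπ₂.mem)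
    rw [(rN_unr h12 hq hφ1 hφ hπ₂.mem).2, norm_prod, (ram h12 hπ₁ hπ₂).1]
    rw [Finset.prod_congr rfl fun i _ => (norm_act (φ ^ i) _).trans (norm_rN (rel_IK_ne h12) hF),
      Finset.prod_const, Finset.card_range]
  have h10 : π₁ ≠ 0 := norm_pos_iff.1 hπ₁.pos
  have key : ∀ n : ℕ, ‖rN K₁.fixingSubgroup K₂.fixingSubgroup π₂ / π₁ ^ f - 1‖ ≤ ‖π₁‖ ^ (n + 1) := by
    intro n
    obtain ⟨L, hL, hLu⟩ := lt_good hπ₁ n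
    obtain ⟨M, hM, hLM⟩ := hs L hL
    obtain ⟨h1L, hLf, -, x₁, hx₁, hNx₁⟩ := hL
    obtain ⟨h2M, hMf, -, x', hx', hNx'⟩ := hM
    set y := rN L.fixingSubgroup M.fixingSubgroup x' with hy
    have hx'F := mem_K_iff.1 hx'
    have hyF : y ∈ FF Ω L.fixingSubgroup := rN_mem (rel_fix_ne M _) hx'F
    have anti : ∀ {K L : IntermediateField ℚ_[p] Ω}, K ≤ L → L.fixingSubgroup ≤ K.fixingSubgroup :=
      fun h => IntermediateField.fixingSubgroup_antitone h
    have e1 : rN K₁.fixingSubgroup L.fixingSubgroup y = rN K₁.fixingSubgroup K₂.fixingSubgroup π₂ := by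
      rw [hy, ← rN_tower' (anti h1L) (anti hLM) (rel_fix_ne L _) (rel_fix_ne M _) hx'F,
        rN_tower' (anti h12) (anti h2M) (rel_fix_ne K₂ _) (rel_fix_ne M _) hx'F, hNx']
    have hd := rel_fix_ne L K₁.fixingSubgroup
    have hx₁F := mem_K_iff.1 hx₁
    have hx10 : x₁ ≠ 0 := by
      rintro rfl
      have := norm_rN hd hx₁F
      rw [hNx₁, norm_zero, zero_pow hd] at this
      exact hπ₁.pos.ne' this
    have hyn : ‖y‖ = ‖x₁‖ ^ f := by
      have h1 := norm_rN hd hyF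
      have h2 := norm_rN hd hx₁F
      rw [hNx₁] at h2
      rw [e1, hnorm, h2, ← pow_mul, mul_comm, pow_mul] at h1
      exact ((pow_left_inj₀ (by positivity) (norm_nonneg _) hd).1 h1).symm
    have hu : ‖y / x₁ ^ f‖ = 1 := by
      rw [norm_div, norm_pow, hyn, div_self (pow_ne_zero _ (norm_ne_zero_iff.2 hx10))]
    have h3 := hLu (y / x₁ ^ f) (div_mem (mem_K_iff.2 hyF) (pow_mem hx₁ f)) hu
    have e2 : rN K₁.fixingSubgroup L.fixingSubgroup (x₁ ^ f) = π₁ ^ f := by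
      have := rN_zpow hd hx₁F (f : ℤ)
      rwa [zpow_natCast, zpow_natCast, hNx₁] at this
    rwa [rN_div hd hyF (pow_mem hx₁F f), e1, e2] at h3
  have h0 : ‖rN K₁.fixingSubgroup K₂.fixingSubgroup π₂ / π₁ ^ f - 1‖ = 0 := by
    by_contra hne
    obtain ⟨m, hm⟩ := exists_pow_lt_of_lt_one (lt_of_le_of_ne (norm_nonneg _) (Ne.symm hne)) hπ₁.lt
    have h1 := key m
    have h2 : ‖π₁‖ ^ (m + 1) ≤ ‖π₁‖ ^ m := pow_le_pow_of_le_one (norm_nonneg _) hπ₁.lt.le (by omega)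
    linarith
  rw [norm_eq_zero, sub_eq_zero, div_eq_one_iff_eq (pow_ne_zero _ h10)] at h0
  exact h0

theorem conc_main {K₁ K₂ : IntermediateField ℚ_[p] Ω} [FiniteDimensional ℚ_[p] K₁]
    [FiniteDimensional ℚ_[p] K₂] (h12 : K₁ ≤ K₂)
    {π₁ π₂ : Ω} (hπ₁ : IsU K₁ π₁) (hπ₂ : IsU K₂ π₂) {f : ℕ} (hq : qK K₂ = qK K₁ ^ f) :
    rN K₁.fixingSubgroup K₂.fixingSubgroup π₂ = π₁ ^ f ↔
      ∀ L, Good K₁ L π₁ → ∃ M, Good K₂ M π₂ ∧ L ≤ M :=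
  ⟨fun hN _ hL => good_fwd h12 hπ₁ hπ₂ hq hN hL, good_bwd h12 hπ₁ hπ₂ hq⟩

lemma good_self {K : IntermediateField ℚ_[p] Ω} [FiniteDimensional ℚ_[p] K] {π : Ω} (h : π ∈ K) :
    Good K K π :=
  ⟨le_rfl, inferInstance, fun _ ha _ hb => Subgroup.mul_mem _ (Subgroup.mul_mem _ (Subgroup.mul_mem _ ha hb)
    (Subgroup.inv_mem _ ha)) (Subgroup.inv_mem _ hb), π, h, rN_self (mem_K_iff.1 h)⟩

/-- finite families -/
lemma good_fin {K : IntermediateField ℚ_[p] Ω} [FiniteDimensional ℚ_[p] K] {π : Ω} (h : IsU K π)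
    (s : Finset Ω) (hs : ∀ x ∈ s, ∃ M, Good K M π ∧ x ∈ M) : ∃ M, Good K M π ∧ ∀ x ∈ s, x ∈ M := by
  classical
  induction s using Finset.induction_on with
  | empty => exact ⟨K, good_self h.mem, by simp⟩
  | insert a s ha ih =>
    obtain ⟨M, hM, hMs⟩ := ih fun x hx => hs x (Finset.mem_insert_of_mem hx)
    obtain ⟨M', hM', hMa⟩ := hs a (Finset.mem_insert_self _ _)
    refine ⟨M ⊔ M', good_dir h hM hM', fun x hx => ?_⟩
    rcases Finset.mem_insert.1 hx with rfl | hx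
    · exact (le_sup_right : M' ≤ M ⊔ M') hMa
    · exact (le_sup_left : M ≤ M ⊔ M') (hMs x hx)

lemma good_le {K L : IntermediateField ℚ_[p] Ω} [FiniteDimensional ℚ_[p] K] [FiniteDimensional ℚ_[p] L]
    {π : Ω} (h : IsU K π) (hs : ∀ x ∈ L, ∃ M, Good K M π ∧ x ∈ M) : ∃ M, Good K M π ∧ L ≤ M := by
  classical
  let b := Module.finBasis ℚ_[p] L
  obtain ⟨M, hM, hMs⟩ := good_fin h (Finset.univ.image fun i => (b i : Ω)) (by
    intro x hx
    obtain ⟨i, -, rfl⟩ := Finset.mem_image.1 hx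
    exact hs _ (b i).2)
  refine ⟨M, hM, fun x hx => ?_⟩
  have e := congrArg Subtype.val (b.sum_repr ⟨x, hx⟩)
  simp only at e
  have e2 : L.val (∑ i, b.repr ⟨x, hx⟩ i • b i) = x := e
  rw [← e2, map_sum]
  refine sum_mem fun i _ => ?_
  change (b.repr ⟨x, hx⟩ i) • (b i : Ω) ∈ M
  exact IntermediateField.smul_mem _ (hMs _ (Finset.mem_image.2 ⟨i, Finset.mem_univ _, rfl⟩))

end bwd
end LT

namespace LT

set_option linter.unusedSectionVars false

section dict

variable {p : ℕ} [hp : Fact p.Prime] {Ω : Type*} [NormedField Ω] [NormedAlgebra ℚ_[p] Ω]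
  [IsUltrametricDist Ω] [IsAlgClosed Ω] [CharZero Ω] [Algebra.IsAlgebraic ℚ_[p] Ω]
  [TeichP p Ω] [NInv (Ω ≃ₐ[ℚ_[p]] Ω) Ω]

/-- the image of a field in the algebraic closure -/
noncomputable def im (p : ℕ) [hp : Fact p.Prime] (Ω : Type*) [NormedField Ω] [NormedAlgebra ℚ_[p] Ω]
    (k : Type*) [Field k] [Algebra ℚ_[p] k] [Algebra k Ω]
    [IsScalarTower ℚ_[p] k Ω] : IntermediateField ℚ_[p] Ω :=
  (IsScalarTower.toAlgHom ℚ_[p] k Ω).fieldRange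

variable {k E : Type*} [Field k] [Field E] [Algebra ℚ_[p] k] [Algebra ℚ_[p] E] [Algebra k Ω]
  [Algebra E Ω] [IsScalarTower ℚ_[p] k Ω] [IsScalarTower ℚ_[p] E Ω] [Algebra k E] [IsScalarTower k E Ω]

lemma mem_im {x : Ω} : x ∈ im p Ω k ↔ ∃ a : k, algebraMap k Ω a = x := Iff.rfl

lemma im_fin [FiniteDimensional ℚ_[p] k] : FiniteDimensional ℚ_[p] (im p Ω k) :=
  (AlgEquiv.ofInjectiveField (IsScalarTower.toAlgHom ℚ_[p] k Ω)).toLinearEquiv.finiteDimensional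

lemma alg_k (p : ℕ) [hp : Fact p.Prime] (Ω : Type*) [NormedField Ω] [NormedAlgebra ℚ_[p] Ω]
    [Algebra.IsAlgebraic ℚ_[p] Ω] (k : Type*) [Field k] [Algebra ℚ_[p] k] [Algebra k Ω]
    [IsScalarTower ℚ_[p] k Ω] : Algebra.IsAlgebraic k Ω :=
  Algebra.IsAlgebraic.tower_top (K := ℚ_[p]) k

lemma mem_fix_im {γ : Ω ≃ₐ[ℚ_[p]] Ω} :
    γ ∈ (im p Ω k).fixingSubgroup ↔ ∀ a : k, γ (algebraMap k Ω a) = algebraMap k Ω a := by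
  rw [mem_fix]
  constructor
  · intro h a
    exact h _ ⟨a, rfl⟩
  · rintro h _ ⟨a, rfl⟩
    exact h a

/-- an automorphism fixing the image of `k` is `k`-linear -/
noncomputable def toK (γ : Ω ≃ₐ[ℚ_[p]] Ω) (h : γ ∈ (im p Ω k).fixingSubgroup) : Ω ≃ₐ[k] Ω :=
  AlgEquiv.ofRingEquiv (f := γ.toRingEquiv) (fun a => mem_fix_im.1 h a)

lemma toK_apply (γ : Ω ≃ₐ[ℚ_[p]] Ω) (h : γ ∈ (im p Ω k).fixingSubgroup) (x : Ω) : toK γ h x = γ x := rfl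

lemma ofK_mem (σ : Ω ≃ₐ[k] Ω) : σ.restrictScalars ℚ_[p] ∈ (im p Ω k).fixingSubgroup :=
  mem_fix_im.2 fun a => σ.commutes a

lemma im_le : im p Ω k ≤ im p Ω E := by
  rintro _ ⟨a, rfl⟩
  exact ⟨algebraMap k E a, (IsScalarTower.algebraMap_apply k E Ω a).symm⟩

theorem rN_im [FiniteDimensional ℚ_[p] E] [FiniteDimensional k E] (x : E) :
    rN (im p Ω k).fixingSubgroup (im p Ω E).fixingSubgroup (algebraMap E Ω x) =
      algebraMap k Ω (Algebra.norm k x) := by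
  classical
  have := im_fin (p := p) (Ω := Ω) (k := E)
  obtain ⟨f, hf⟩ := exists_Trv_fin (rel_fix_ne (im p Ω E) (im p Ω k).fixingSubgroup)
  have hx0 : algebraMap E Ω x ∈ im p Ω E := ⟨x, rfl⟩
  rw [rN_eq_prod hf (mem_K_iff.1 hx0)]
  have hsep : Algebra.IsSeparable k E := by
    have : CharZero k := (algebraMap k Ω).charZero_iff (algebraMap k Ω).injective |>.2 inferInstance
    infer_instance
  rw [Algebra.norm_eq_prod_embeddings k Ω x]
  refine Fintype.prod_bijective
    (fun i => ((toK (f i) (hf.1 i)).toAlgHom.comp (IsScalarTower.toAlgHom k E Ω))) ⟨?_, ?_⟩ _ _ ?_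
  · intro i j hij
    have h1 : (f i)⁻¹ * f j ∈ (im p Ω E).fixingSubgroup := by
      rw [mem_fix_im]
      intro a
      have := DFunLike.congr_fun hij a
      have h2 : f i (algebraMap E Ω a) = f j (algebraMap E Ω a) := this
      rw [AlgEquiv.mul_apply, ← h2]
      exact (f i).symm_apply_apply _
    exact (hf.2 (f j) (hf.1 j)).unique h1 (by simp)
  · intro φ
    have := alg_k p Ω k
    have := alg_k p Ω E
    obtain ⟨ψ, hψ⟩ := IsAlgClosed.surjective_domRestrict_of_isAlgebraic (K := k) (L := E) (M := Ω) (E := Ω) φ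
    let σ : Ω ≃ₐ[k] Ω := AlgEquiv.ofBijective ψ (Algebra.IsAlgebraic.algHom_bijective ψ)
    obtain ⟨i, hi, -⟩ := hf.2 (σ.restrictScalars ℚ_[p]) (ofK_mem σ)
    refine ⟨i, ?_⟩
    ext a
    have h1 := mem_fix_im.1 hi a
    have h2 : f i (algebraMap E Ω a) = σ (algebraMap E Ω a) := by
      conv_lhs => rw [← h1]
      rw [AlgEquiv.mul_apply]
      exact (f i).apply_symm_apply _
    exact h2.trans (DFunLike.congr_fun hψ a)
  · intro i
    rfl

instance towerIF (L : IntermediateField k Ω) : IsScalarTower ℚ_[p] L Ω :=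
  ⟨fun a b c => smul_mul_assoc a (b : Ω) c⟩

lemma im_IF (L : IntermediateField k Ω) : im p Ω L = L.restrictScalars ℚ_[p] := by
  ext x
  constructor
  · rintro ⟨a, rfl⟩
    exact a.2
  · intro h
    exact ⟨⟨x, h⟩, rfl⟩

/-- the property defining the constituents of the Lubin-Tate extension -/
def LTP {k Ω : Type*} [Field k] [Field Ω] [Algebra k Ω] (π : k) (L : IntermediateField k Ω) : Prop :=
  FiniteDimensional k L ∧ IsGalois k L ∧
      (∀ σ τ : L ≃ₐ[k] L, σ * τ = τ * σ) ∧ ∃ x : L, Algebra.norm k x = π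

theorem LTP_good [FiniteDimensional ℚ_[p] k] {π : k} {L : IntermediateField k Ω} (h : LTP π L) :
    Good (im p Ω k) (L.restrictScalars ℚ_[p]) (algebraMap k Ω π) := by
  obtain ⟨hf, hg, hc, x, hx⟩ := h
  have hfL : FiniteDimensional ℚ_[p] L := Module.Finite.trans k L
  have := im_fin (p := p) (Ω := Ω) (k := k)
  rw [← im_IF (p := p) L]
  refine ⟨im_le, im_fin, ?_, x, ⟨x, rfl⟩, ?_⟩
  · intro a ha b hb
    rw [mem_fix_im]
    intro y
    have h1 : AlgEquiv.restrictNormalHom L (toK a ha * toK b hb * (toK a ha)⁻¹ * (toK b hb)⁻¹) = 1 := by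
      rw [map_mul, map_mul, map_mul, hc (AlgEquiv.restrictNormalHom L (toK a ha)), map_inv, map_inv]
      group
    have h2 := AlgEquiv.restrictNormal_commutes (toK a ha * toK b hb * (toK a ha)⁻¹ * (toK b hb)⁻¹) L y
    change algebraMap L Ω (AlgEquiv.restrictNormalHom L _ y) = _ at h2
    rw [h1] at h2
    exact h2.symm
  · have := rN_im (p := p) (Ω := Ω) (k := k) x
    rw [hx] at this
    exact this

theorem good_LTP [FiniteDimensional ℚ_[p] k] {π : k} {L : IntermediateField k Ω}
    (h : Good (im p Ω k) (L.restrictScalars ℚ_[p]) (algebraMap k Ω π)) : LTP π L := by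
  obtain ⟨hle, hf, hab, x, hx, hN⟩ := h
  have hfL : FiniteDimensional ℚ_[p] L := hf
  have hfk : FiniteDimensional k L := Module.Finite.of_restrictScalars_finite ℚ_[p] k L
  have hck : CharZero k := (algebraMap k Ω).charZero_iff (algebraMap k Ω).injective |>.2 inferInstance
  have := alg_k p Ω k
  have hac : IsAlgClosure k Ω := ⟨inferInstance, inferInstance⟩
  have hnO : Normal k Ω := IsAlgClosure.normal k Ω
  have hmem : ∀ y, y ∈ L ↔ y ∈ L.restrictScalars ℚ_[p] := fun y => Iff.rfl
  have hnorm : Normal k L := by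
    rw [IntermediateField.normal_iff_forall_map_le']
    rintro σ _ ⟨y, hy, rfl⟩
    rw [hmem, mem_K_iff, mem_FF]
    intro γ hγ
    have hγK := IntermediateField.fixingSubgroup_antitone hle hγ
    have h1 := hab _ (inv_mem (ofK_mem (p := p) σ)) γ hγK
    have h2 := mem_fix.1 h1 y hy
    have h3 := mem_fix.1 (inv_mem hγ) y hy
    rw [mul_smul, h3, inv_inv, mul_smul, mul_smul, inv_smul_eq_iff] at h2
    exact h2
  have hfinal : ∃ x : L, Algebra.norm k x = π := by
    refine ⟨⟨x, hx⟩, (algebraMap k Ω).injective ?_⟩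
    have h1 := rN_im (p := p) (Ω := Ω) (k := k) (⟨x, hx⟩ : L)
    rw [im_IF] at h1
    exact h1.symm.trans hN
  refine ⟨hfk, ⟨⟩, fun σ τ => ?_, hfinal⟩
  have hs : ∀ (ρ : L ≃ₐ[k] L) (y : L), ρ.liftNormal Ω (y : Ω) = (ρ y : Ω) := fun ρ y =>
    AlgEquiv.liftNormal_commutes ρ Ω y
  ext y
  have h1 := hab _ (ofK_mem (p := p) (σ.liftNormal Ω)) _ (ofK_mem (p := p) (τ.liftNormal Ω))
  have h2 := mem_fix.1 h1 ((τ * σ) y : L) ((τ * σ) y).2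
  have e1 : (τ.liftNormal Ω).restrictScalars ℚ_[p] • (σ.liftNormal Ω).restrictScalars ℚ_[p] • (y : Ω)
      = ((τ * σ) y : L) := by
    change τ.liftNormal Ω (σ.liftNormal Ω (y : Ω)) = _
    rw [hs, hs]; rfl
  have e2 : (σ.liftNormal Ω).restrictScalars ℚ_[p] • (τ.liftNormal Ω).restrictScalars ℚ_[p] • (y : Ω)
      = ((σ * τ) y : L) := by
    change σ.liftNormal Ω (τ.liftNormal Ω (y : Ω)) = _
    rw [hs, hs]; rfl
  rw [← e1, mul_smul, mul_smul, mul_smul, inv_smul_smul, inv_smul_smul, e1, e2] at h2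
  exact h2

theorem mem_LT [FiniteDimensional ℚ_[p] k] {π : k} (hU : IsU (im p Ω k) (algebraMap k Ω π)) {x : Ω} :
    x ∈ lubinTateExt k Ω π ↔ ∃ M, Good (im p Ω k) M (algebraMap k Ω π) ∧ x ∈ M := by
  have := im_fin (p := p) (Ω := Ω) (k := k)
  constructor
  · intro hx
    have e : lubinTateExt k Ω π = ⨆ L : {L : IntermediateField k Ω // LTP π L}, (L : IntermediateField k Ω) := by
      rw [iSup_subtype]; rfl
    have hsup : ∀ L L' : IntermediateField k Ω, (L ⊔ L').restrictScalars ℚ_[p] =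
        L.restrictScalars ℚ_[p] ⊔ L'.restrictScalars ℚ_[p] := by
      intro L L'
      apply le_antisymm
      · intro y hy
        have hle : im p Ω k ≤ L.restrictScalars ℚ_[p] ⊔ L'.restrictScalars ℚ_[p] := by
          rintro _ ⟨a, rfl⟩
          exact (le_sup_left : L.restrictScalars ℚ_[p] ≤ _) (L.algebraMap_mem a)
        let N : IntermediateField k Ω :=
          (L.restrictScalars ℚ_[p] ⊔ L'.restrictScalars ℚ_[p]).toSubfield.toIntermediateField
            (fun a => hle ⟨a, rfl⟩)
        have h1 : L ⊔ L' ≤ N := sup_le (fun z hz => (le_sup_left : L.restrictScalars ℚ_[p] ≤ _) hz)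
          (fun z hz => (le_sup_right : L'.restrictScalars ℚ_[p] ≤ _) hz)
        exact h1 hy
      · exact sup_le (fun z hz => (le_sup_left : L ≤ L ⊔ L') hz) (fun z hz => (le_sup_right : L' ≤ L ⊔ L') hz)
    have hself : LTP π (⊥ : IntermediateField k Ω) := by
      apply good_LTP (p := p)
      have e2 : (⊥ : IntermediateField k Ω).restrictScalars ℚ_[p] = im p Ω k := by
        ext y
        exact IntermediateField.mem_bot
      rw [e2]
      exact good_self hU.mem
    have : Nonempty {L : IntermediateField k Ω // LTP π L} := ⟨⟨⊥, hself⟩⟩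
    have hdir : Directed (· ≤ ·) (fun L : {L : IntermediateField k Ω // LTP π L} => (L : IntermediateField k Ω)) := by
      intro L L'
      refine ⟨⟨L.1 ⊔ L'.1, good_LTP (p := p) ?_⟩, le_sup_left, le_sup_right⟩
      rw [hsup]
      exact good_dir hU (LTP_good L.2) (LTP_good L'.2)
    rw [e, ← SetLike.mem_coe, IntermediateField.coe_iSup_of_directed hdir, Set.mem_iUnion] at hx
    obtain ⟨L, hL⟩ := hx
    exact ⟨_, LTP_good L.2, hL⟩
  · rintro ⟨M, hM, hx⟩
    let N : IntermediateField k Ω := M.toSubfield.toIntermediateField (fun a => hM.le ⟨a, rfl⟩)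
    have hN : N.restrictScalars ℚ_[p] = M := by
      ext y; exact Iff.rfl
    have hP : LTP π N := good_LTP (p := p) (by rw [hN]; exact hM)
    exact (le_iSup₂_of_le N hP le_rfl : N ≤ lubinTateExt k Ω π) hx

theorem main_dict [FiniteDimensional ℚ_[p] k] [FiniteDimensional ℚ_[p] E] [FiniteDimensional k E]
    {π₁ : k} {π₂ : E} (h1 : IsU (im p Ω k) (algebraMap k Ω π₁)) (h2 : IsU (im p Ω E) (algebraMap E Ω π₂))
    {f : ℕ} (hq : qK (im p Ω E) = qK (im p Ω k) ^ f) :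
    Algebra.norm k π₂ = π₁ ^ f ↔ (lubinTateExt k Ω π₁ : Set Ω) ⊆ lubinTateExt E Ω π₂ := by
  have := im_fin (p := p) (Ω := Ω) (k := k)
  have := im_fin (p := p) (Ω := Ω) (k := E)
  have key := conc_main im_le h1 h2 hq
  rw [rN_im, ← map_pow, (algebraMap k Ω).injective.eq_iff] at key
  rw [key]
  constructor
  · intro h x hx
    obtain ⟨L, hL, hxL⟩ := (mem_LT h1).1 hx
    obtain ⟨M, hM, hLM⟩ := h L hL
    exact (mem_LT h2).2 ⟨M, hM, hLM hxL⟩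
  · intro h L hL
    have := hL.fin
    exact good_le h2 fun x hx => (mem_LT h2).1 (h ((mem_LT h1).2 ⟨L, hL, hx⟩))

end dict

end LT

namespace LT

set_option linter.unusedSectionVars false

section res

variable {p : ℕ} [hp : Fact p.Prime] {Ω : Type*} [NormedField Ω] [NormedAlgebra ℚ_[p] Ω]
  [IsUltrametricDist Ω] [IsAlgClosed Ω] [CharZero Ω] [Algebra.IsAlgebraic ℚ_[p] Ω]
  [TeichP p Ω] [NInv (Ω ≃ₐ[ℚ_[p]] Ω) Ω]

variable {k : Type*} [Field k] [Algebra ℚ_[p] k] [Algebra k Ω] [IsScalarTower ℚ_[p] k Ω]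
  [Algebra ℤ_[p] k] [IsScalarTower ℤ_[p] ℚ_[p] k]

lemma phi_eq : (algebraMap k Ω).comp (algebraMap ℤ_[p] k) =
    (algebraMap ℚ_[p] Ω).comp (algebraMap ℤ_[p] ℚ_[p]) := by
  ext c
  rw [RingHom.comp_apply, RingHom.comp_apply, IsScalarTower.algebraMap_apply ℤ_[p] ℚ_[p] k,
    ← IsScalarTower.algebraMap_apply ℚ_[p] k Ω]

lemma norm_phi (c : ℤ_[p]) : ‖(algebraMap k Ω).comp (algebraMap ℤ_[p] k) c‖ ≤ 1 := by
  rw [phi_eq, RingHom.comp_apply, norm_algebraMap']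
  exact c.2

lemma int_iff {x : k} : IsIntegral ℤ_[p] x ↔ ‖algebraMap k Ω x‖ ≤ 1 := by
  set y := algebraMap k Ω x with hy
  constructor
  · rintro ⟨P, hP, h0⟩
    have h1 := congrArg (algebraMap k Ω) h0
    rw [Polynomial.hom_eval₂, map_zero, ← hy, Polynomial.eval₂_eq_sum_range, Finset.sum_range_succ,
      hP.coeff_natDegree, map_one, one_mul] at h1
    by_contra! hlt
    rcases Nat.eq_zero_or_pos P.natDegree with hn | hn
    · simp [hn] at h1
    · obtain ⟨m, hm⟩ := Nat.exists_eq_succ_of_ne_zero hn.ne'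
      rw [hm] at h1
      have h2 : y ^ (m + 1) = -∑ i ∈ Finset.range (m + 1),
          ((algebraMap k Ω).comp (algebraMap ℤ_[p] k)) (P.coeff i) * y ^ i :=
        eq_neg_of_add_eq_zero_right h1
      have h3 : ‖y‖ ^ (m + 1) ≤ ‖y‖ ^ m := by
        rw [← norm_pow, h2, norm_neg]
        refine IsUltrametricDist.norm_sum_le_of_forall_le_of_nonneg (by positivity) fun i hi => ?_
        rw [norm_mul, norm_pow]
        calc _ ≤ 1 * ‖y‖ ^ i := by gcongr; exact norm_phi _
          _ ≤ ‖y‖ ^ m := by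
            rw [one_mul]
            exact pow_le_pow_right₀ hlt.le (by have := Finset.mem_range.1 hi; omega)
      exact absurd h3 (not_le.2 (pow_lt_pow_right₀ hlt (Nat.lt_succ_self m)))
  · intro h
    have hmon : (PP (⊤ : Subgroup (Ω ≃ₐ[ℚ_[p]] Ω)) y).Monic :=
      Polynomial.monic_prod_of_monic _ _ fun z _ => Polynomial.monic_X_sub_C z
    have hl : PP (⊤ : Subgroup (Ω ≃ₐ[ℚ_[p]] Ω)) y ∈
        Polynomial.lifts ((algebraMap k Ω).comp (algebraMap ℤ_[p] k)) := by
      rw [Polynomial.lifts_iff_coeff_lifts]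
      intro i
      have h1 : (PP (⊤ : Subgroup (Ω ≃ₐ[ℚ_[p]] Ω)) y).coeff i ∈ (⊥ : IntermediateField ℚ_[p] Ω) :=
        mem_K_iff.2 (mem_FF.2 fun γ _ => PP_coeff_act (Subgroup.mem_top γ) i)
      obtain ⟨c, hc⟩ := IntermediateField.mem_bot.1 h1
      have h2 := PP_coeff_le (H := (⊤ : Subgroup (Ω ≃ₐ[ℚ_[p]] Ω))) h i
      rw [← hc, norm_algebraMap'] at h2
      refine ⟨⟨c, h2⟩, ?_⟩
      rw [phi_eq, ← hc]
      rfl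
    obtain ⟨q, hq, -, hqm⟩ := Polynomial.lifts_and_natDegree_eq_and_monic hl hmon
    refine ⟨q, hqm, (algebraMap k Ω).injective ?_⟩
    rw [Polynomial.hom_eval₂, map_zero, ← hy, ← Polynomial.eval_map, hq]
    exact PP_self _ _

/-- the ring of integers, compared with the unit ball -/
noncomputable def intHom (p : ℕ) [hp : Fact p.Prime] (Ω : Type*) [NormedField Ω] [NormedAlgebra ℚ_[p] Ω]
    [IsUltrametricDist Ω] [IsAlgClosed Ω] [CharZero Ω] [Algebra.IsAlgebraic ℚ_[p] Ω]
    [TeichP p Ω] [NInv (Ω ≃ₐ[ℚ_[p]] Ω) Ω] (k : Type*) [Field k] [Algebra ℚ_[p] k] [Algebra k Ω]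
    [IsScalarTower ℚ_[p] k Ω] [Algebra ℤ_[p] k] [IsScalarTower ℤ_[p] ℚ_[p] k] :
    integralClosure ℤ_[p] k →+* OK (im p Ω k) :=
  ((algebraMap k Ω).comp (integralClosure ℤ_[p] k).toSubring.subtype).codRestrict (OK (im p Ω k))
    fun x => ⟨int_iff.1 x.2, ⟨x, rfl⟩⟩

lemma intHom_bij : Function.Bijective (intHom p Ω k) := by
  constructor
  · intro x y h
    exact Subtype.ext ((algebraMap k Ω).injective (congrArg Subtype.val h))
  · rintro ⟨y, hy, x, rfl⟩
    exact ⟨⟨x, int_iff.2 hy⟩, rfl⟩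

/-- the ring of integers is the unit ball -/
noncomputable def intEquiv (p : ℕ) [hp : Fact p.Prime] (Ω : Type*) [NormedField Ω] [NormedAlgebra ℚ_[p] Ω]
    [IsUltrametricDist Ω] [IsAlgClosed Ω] [CharZero Ω] [Algebra.IsAlgebraic ℚ_[p] Ω]
    [TeichP p Ω] [NInv (Ω ≃ₐ[ℚ_[p]] Ω) Ω] (k : Type*) [Field k] [Algebra ℚ_[p] k] [Algebra k Ω]
    [IsScalarTower ℚ_[p] k Ω] [Algebra ℤ_[p] k] [IsScalarTower ℤ_[p] ℚ_[p] k] :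
    integralClosure ℤ_[p] k ≃+* OK (im p Ω k) := RingEquiv.ofBijective (intHom p Ω k) intHom_bij

theorem resCard_eq : resCard p k = qK (im p Ω k) := by
  have hloc : IsLocalRing (integralClosure ℤ_[p] k) := (intEquiv p Ω k).symm.isLocalRing
  rw [qK_eq, resCard, IsLocalRing.jacobson_eq_maximalIdeal _ bot_ne_top]
  exact Nat.card_congr (IsLocalRing.ResidueField.mapEquiv (intEquiv p Ω k)).toEquiv

theorem unif_U {π : k} (h : IsUniformizer p k π) : IsU (im p Ω k) (algebraMap k Ω π) := by
  obtain ⟨hintg, hirr⟩ := h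
  have hirr' : Irreducible (intEquiv p Ω k ⟨π, hintg⟩) := (MulEquiv.irreducible_iff (intEquiv p Ω k)).2 hirr
  set w := intEquiv p Ω k ⟨π, hintg⟩ with hw
  have hwv : (w : Ω) = algebraMap k Ω π := rfl
  rw [← hwv]
  have hlt : ‖(w : Ω)‖ < 1 := OK_nonunit.1 hirr'.not_isUnit
  have h0 : (w : Ω) ≠ 0 := fun h => hirr'.ne_zero (Subtype.ext h)
  refine IsU.of_max w.2.2 (norm_pos_iff.2 h0) hlt fun y hy hy1 => ?_
  by_contra! hlt2
  have hy0 : y ≠ 0 := by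
    rintro rfl
    rw [norm_zero] at hlt2
    exact absurd hlt2 (not_lt.2 (norm_nonneg _))
  have hq : ‖(w : Ω) / y‖ < 1 := by
    rw [norm_div, div_lt_one (norm_pos_iff.2 hy0)]; exact hlt2
  have hdiv : (w : Ω) / y ∈ im p Ω k := div_mem (mem_OK.1 w.2).2 hy
  have := hirr'.isUnit_or_isUnit (a := ⟨y, hy1.le, hy⟩) (b := ⟨(w : Ω) / y, hq.le, hdiv⟩)
    (Subtype.ext (mul_div_cancel₀ _ hy0).symm)
  rcases this with h | h
  · rw [OK_isUnit] at h; exact hy1.ne h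
  · rw [OK_isUnit] at h; exact hq.ne h

end res

end LT

namespace LT

set_option linter.unusedSectionVars false

section transfer

lemma LTP_equiv {k A B : Type*} [Field k] [Field A] [Field B] [Algebra k A] [Algebra k B] {π : k}
    {L : IntermediateField k A} {M : IntermediateField k B} (e : L ≃ₐ[k] M) (h : LTP π L) : LTP π M := by
  obtain ⟨hf, hg, hc, x, hx⟩ := h
  refine ⟨e.toLinearEquiv.finiteDimensional, IsGalois.of_algEquiv e, fun σ τ => ?_, e x, ?_⟩
  · have h1 := hc (e.autCongr.symm σ) (e.autCongr.symm τ)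
    rw [← map_mul, ← map_mul] at h1
    exact e.autCongr.symm.injective h1
  · rw [← hx]
    exact Algebra.norm_eq_of_algEquiv e x

lemma alg_mem {B A : Type*} [Field B] [Field A] [IsAlgClosed B] [Algebra B A] {x : A}
    (h : IsIntegral B x) : x ∈ (algebraMap B A).range :=
  minpoly.mem_range_of_degree_eq_one B x (IsAlgClosed.degree_eq_one_of_irreducible B (minpoly.irreducible h))

lemma alg_mem_hom {k B A : Type*} [Field k] [Field B] [Field A] [IsAlgClosed B] [Algebra k B] [Algebra k A]
    (Φ : B →ₐ[k] A) {x : A} (h : IsIntegral k x) : ∃ y, Φ y = x := by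
  let : Algebra B A := Φ.toRingHom.toAlgebra
  have : IsScalarTower k B A := IsScalarTower.of_algebraMap_eq fun a => (Φ.commutes a).symm
  exact alg_mem (h.tower_top (A := B))

theorem lub_map {k B A : Type*} [Field k] [Field B] [Field A] [IsAlgClosed B] [Algebra k B] [Algebra k A]
    (Φ : B →ₐ[k] A) (π : k) : (lubinTateExt k A π : Set A) = Φ '' (lubinTateExt k B π : Set B) := by
  have h : lubinTateExt k A π = (lubinTateExt k B π).map Φ := by
    apply le_antisymm
    · refine iSup₂_le fun L hL => ?_
      have hL' : LTP π L := hL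
      have hfin := hL'.1
      have e : (L.comap Φ).map Φ = L := by
        ext x
        constructor
        · rintro ⟨y, hy, rfl⟩
          exact hy
        · intro hx
          have hi : IsIntegral k x := by
            have := (IsIntegral.of_finite k (⟨x, hx⟩ : L)).map L.val
            exact this
          obtain ⟨y, rfl⟩ := alg_mem_hom Φ hi
          exact ⟨y, hx, rfl⟩
      have hM : LTP π (L.comap Φ) := by
        refine LTP_equiv ((L.comap Φ).equivMap Φ).symm ?_
        rw [e]; exact hL'
      conv_lhs => rw [← e]
      exact IntermediateField.map_mono Φ (le_iSup₂_of_le (L.comap Φ) hM le_rfl)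
    · rw [IntermediateField.map_le_iff_le_comap]
      refine iSup₂_le fun L hL => ?_
      rw [← IntermediateField.map_le_iff_le_comap]
      exact le_iSup₂_of_le (L.map Φ) (LTP_equiv (L.equivMap Φ) hL) le_rfl
  rw [h, IntermediateField.coe_map]

end transfer

section fin

theorem main_B {p : ℕ} [hp : Fact p.Prime] {Ω : Type*} [NormedField Ω] [NormedAlgebra ℚ_[p] Ω]
    [IsUltrametricDist Ω] [IsAlgClosed Ω] [CharZero Ω] [Algebra.IsAlgebraic ℚ_[p] Ω]
    [TeichP p Ω] [NInv (Ω ≃ₐ[ℚ_[p]] Ω) Ω]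
    {k₁ k₂ A : Type*} [Field k₁] [Field k₂] [Field A] [IsAlgClosed A]
    [Algebra ℚ_[p] k₁] [Algebra ℚ_[p] k₂] [Algebra k₁ k₂] [IsScalarTower ℚ_[p] k₁ k₂]
    [FiniteDimensional ℚ_[p] k₂]
    [Algebra ℤ_[p] k₁] [IsScalarTower ℤ_[p] ℚ_[p] k₁]
    [Algebra ℤ_[p] k₂] [IsScalarTower ℤ_[p] ℚ_[p] k₂]
    [Algebra k₁ A] [Algebra k₂ A] [IsScalarTower k₁ k₂ A]
    [Algebra k₁ Ω] [Algebra k₂ Ω] [IsScalarTower k₁ k₂ Ω] [IsScalarTower ℚ_[p] k₁ Ω]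
    [IsScalarTower ℚ_[p] k₂ Ω]
    (π₁ : k₁) (π₂ : k₂)
    (hπ₁ : IsUniformizer p k₁ π₁) (hπ₂ : IsUniformizer p k₂ π₂)
    (f : ℕ) (hf : resCard p k₂ = (resCard p k₁) ^ f) :
    Algebra.norm k₁ π₂ = π₁ ^ f ↔
      (lubinTateExt k₁ A π₁ : Set A) ⊆ (lubinTateExt k₂ A π₂ : Set A) := by
  have h1 : FiniteDimensional ℚ_[p] k₁ := FiniteDimensional.left ℚ_[p] k₁ k₂
  have h2 : FiniteDimensional k₁ k₂ := FiniteDimensional.right ℚ_[p] k₁ k₂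
  have h3 := alg_k p Ω k₂
  let Φ : Ω →ₐ[k₂] A := IsAlgClosed.lift
  rw [lub_map Φ, lub_map (Φ.restrictScalars k₁)]
  rw [main_dict (Ω := Ω) (unif_U hπ₁) (unif_U hπ₂) (by rw [← resCard_eq, ← resCard_eq, hf])]
  exact (Set.image_subset_image_iff Φ.injective).symm

theorem main_A {p : ℕ} [hp : Fact p.Prime]
    {k₁ k₂ A : Type*} [Field k₁] [Field k₂] [Field A] [IsAlgClosed A]
    [Algebra ℚ_[p] k₁] [Algebra ℚ_[p] k₂] [Algebra k₁ k₂] [IsScalarTower ℚ_[p] k₁ k₂]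
    [FiniteDimensional ℚ_[p] k₂]
    [Algebra ℤ_[p] k₁] [IsScalarTower ℤ_[p] ℚ_[p] k₁]
    [Algebra ℤ_[p] k₂] [IsScalarTower ℤ_[p] ℚ_[p] k₂]
    [Algebra k₁ A] [Algebra k₂ A] [IsScalarTower k₁ k₂ A]
    (π₁ : k₁) (π₂ : k₂)
    (hπ₁ : IsUniformizer p k₁ π₁) (hπ₂ : IsUniformizer p k₂ π₂)
    (f : ℕ) (hf : resCard p k₂ = (resCard p k₁) ^ f) :
    Algebra.norm k₁ π₂ = π₁ ^ f ↔
      (lubinTateExt k₁ A π₁ : Set A) ⊆ (lubinTateExt k₂ A π₂ : Set A) := by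
  let j : k₂ →ₐ[ℚ_[p]] PadicAlgCl p := IsAlgClosed.lift
  let a2 : Algebra k₂ (PadicAlgCl p) := j.toRingHom.toAlgebra
  let a1 : Algebra k₁ (PadicAlgCl p) := (j.toRingHom.comp (algebraMap k₁ k₂)).toAlgebra
  have t12 : IsScalarTower k₁ k₂ (PadicAlgCl p) := IsScalarTower.of_algebraMap_eq fun a => rfl
  have t2 : IsScalarTower ℚ_[p] k₂ (PadicAlgCl p) :=
    IsScalarTower.of_algebraMap_eq fun a => (j.commutes a).symm
  have t1 : IsScalarTower ℚ_[p] k₁ (PadicAlgCl p) :=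
    IsScalarTower.of_algebraMap_eq fun a => by
      change _ = j (algebraMap k₁ k₂ (algebraMap ℚ_[p] k₁ a))
      rw [← IsScalarTower.algebraMap_apply ℚ_[p] k₁ k₂]
      exact (j.commutes a).symm
  have : TeichP p (PadicAlgCl p) := mkTeichP p (PadicAlgCl p)
  have : NInv (PadicAlgCl p ≃ₐ[ℚ_[p]] PadicAlgCl p) (PadicAlgCl p) :=
    ⟨fun γ x => (spectralNorm_eq_of_equiv γ x).symm⟩
  exact main_B (Ω := PadicAlgCl p) π₁ π₂ hπ₁ hπ₂ f hf

end fin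

end LT

/-- Let `k₂/k₁` be a finite extension of `p`-adic fields with residual degree
`f`, with uniformizers `π₂` of `k₂` and `π₁` of `k₁`.  Then `Nr_{k₂/k₁}(π₂) = π₁^f` if and
only if the Lubin-Tate extension `k_{1,π₁}` is contained in `k_{2,π₂}` (inside a fixed
algebraic closure `Ω` of `ℚ_p`). -/
theorem stmt_7 (p : ℕ) [Fact p.Prime] (k₁ k₂ : Type) [Field k₁] [Field k₂]
    [Algebra ℚ_[p] k₁] [Algebra ℚ_[p] k₂] [Algebra k₁ k₂] [IsScalarTower ℚ_[p] k₁ k₂]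
    [FiniteDimensional ℚ_[p] k₂]
    [Algebra ℤ_[p] k₁] [IsScalarTower ℤ_[p] ℚ_[p] k₁]
    [Algebra ℤ_[p] k₂] [IsScalarTower ℤ_[p] ℚ_[p] k₂]
    [Algebra k₁ (AlgebraicClosure ℚ_[p])] [Algebra k₂ (AlgebraicClosure ℚ_[p])]
    [IsScalarTower k₁ k₂ (AlgebraicClosure ℚ_[p])]
    (π₁ : k₁) (π₂ : k₂)
    (hπ₁ : IsUniformizer p k₁ π₁) (hπ₂ : IsUniformizer p k₂ π₂)
    (f : ℕ) (hf : resCard p k₂ = (resCard p k₁) ^ f) :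
    Algebra.norm k₁ π₂ = π₁ ^ f ↔
      (lubinTateExt k₁ (AlgebraicClosure ℚ_[p]) π₁ : Set (AlgebraicClosure ℚ_[p])) ⊆
        (lubinTateExt k₂ (AlgebraicClosure ℚ_[p]) π₂ : Set (AlgebraicClosure ℚ_[p])) := by
  exact LT.main_A π₁ π₂ hπ₁ hπ₂ f hf
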